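/- There is an absolute constant C > 0 with the following property. Let K be an isotropic convex body in ℝ^n (n ≥ 2) and let 1 ≤ k ≤ n−1. Let ν_{n,k} denote the rotation-invariant Haar probability measure on the Grassmannian G_{n,k} of k-dimensional linear subspaces of ℝ^n (the pushforward of Haar measure on the orthogonal group O(n) acting on a fixed k-dimensional subspace). Then the ν_{n,k}-measure of the set of H ∈ G_{n,k} satisfying vrad(K_out ∩ H) ≤ C·(log n) · vrad(K_in ∩ H) is greater than 1 − e^{−k}. -/

import Mathlib

open MeasureTheory Metric Set
open scoped ENNReal RealInnerProductSpace Pointwise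

noncomputable section

/-- `K` is isotropic: volume one, barycenter at the origin, and the quadratic form
`ξ ↦ ∫_K ⟨x, ξ⟩² dx` is constant (`= L_K²`) on the unit sphere. -/
def IsIsotropic {n : ℕ} (K : Set (EuclideanSpace ℝ (Fin n))) : Prop :=
  volume K = 1 ∧ (∫ x in K, x) = (0 : EuclideanSpace ℝ (Fin n)) ∧
    ∃ L : ℝ, 0 < L ∧ ∀ ξ : EuclideanSpace ℝ (Fin n), ‖ξ‖ = 1 →
      (∫ x in K, (⟪x, ξ⟫) ^ 2) = L ^ 2

/-- The volume radius of a subset of a `k`-dimensional subspace `H`: the `k`-th root of the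
ratio of its `k`-dimensional (Hausdorff) volume to that of the unit ball of `H`. -/
def vrad {n : ℕ} (k : ℕ) (H : Submodule ℝ (EuclideanSpace ℝ (Fin n)))
    (A : Set (EuclideanSpace ℝ (Fin n))) : ℝ≥0∞ :=
  (μH[(k : ℝ)] A / μH[(k : ℝ)] (closedBall (0 : EuclideanSpace ℝ (Fin n)) 1 ∩ (H : Set _)))
    ^ ((k : ℝ)⁻¹)

instance matrixMeasurableSpace (n : ℕ) : MeasurableSpace (Matrix (Fin n) (Fin n) ℝ) :=
  MeasurableSpace.pi

/-- The image of a subspace `H` under (the Euclidean linear map of) a matrix `g`. -/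
def rotate {n : ℕ} (g : Matrix (Fin n) (Fin n) ℝ)
    (H : Submodule ℝ (EuclideanSpace ℝ (Fin n))) : Submodule ℝ (EuclideanSpace ℝ (Fin n)) :=
  H.map (Matrix.toEuclideanLin g)

set_option linter.all false
namespace ISO
open ProbabilityTheory Real

section
section Gauss
variable {E : Type*} [NormedAddCommGroup E] [InnerProductSpace ℝ E] [FiniteDimensional ℝ E]
  [MeasurableSpace E] [BorelSpace E]
lemma intble_gauss {b : ℝ} (hb : 0 < b) : Integrable (fun x : E => rexp (-b * ‖x‖ ^ 2)) := by
  have := (GaussianFourier.integrable_cexp_neg_mul_sq_norm_add (V := E) (b := (b : ℂ))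
    (by simpa using hb) 0 0).norm
  refine this.congr (Filter.Eventually.of_forall fun x => ?_)
  simp only [Complex.norm_exp]
  congr 1
  have : (-(b : ℂ) * (‖x‖ : ℂ) ^ 2 + 0 * ((⟪(0 : E), x⟫ : ℝ) : ℂ)) = ((-b * ‖x‖ ^ 2 : ℝ) : ℂ) := by
    push_cast; ring
  rw [this, Complex.ofReal_re]
def gc (E : Type*) [NormedAddCommGroup E] [InnerProductSpace ℝ E] : ℝ :=
  ((2 * π) ^ ((Module.finrank ℝ E : ℝ) / 2))⁻¹
lemma gc_pos : 0 < gc E := by unfold gc; positivity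
lemma std_eq : stdGaussian E =
    (volume : Measure E).withDensity (fun x => ENNReal.ofReal (gc E * rexp (-‖x‖ ^ 2 / 2))) := by
  have hi : Integrable (fun x : E => gc E * rexp (-‖x‖ ^ 2 / 2)) := by
    refine ((intble_gauss (E := E) (b := 1/2) (by norm_num)).const_mul (gc E)).congr
      (Filter.Eventually.of_forall fun x => ?_)
    simp only; congr 2; ring
  have : IsFiniteMeasure ((volume : Measure E).withDensity
      (fun x => ENNReal.ofReal (gc E * rexp (-‖x‖ ^ 2 / 2)))) :=
    isFiniteMeasure_withDensity_ofReal hi.2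
  refine Measure.ext_of_charFun ?_
  ext t
  rw [charFun_stdGaussian, charFun_apply]
  have hm : Measurable (fun x : E => (gc E * rexp (-‖x‖ ^ 2 / 2)).toNNReal) := by fun_prop
  have := integral_withDensity_eq_integral_smul (μ := (volume : Measure E)) hm
    (fun x : E => Complex.exp ((⟪x, t⟫ : ℝ) * Complex.I))
  simp only [ENNReal.ofReal] at *
  rw [this]
  have h2 := GaussianFourier.integral_cexp_neg_mul_sq_norm_add (V := E) (b := (1/2 : ℂ))
    (by norm_num) Complex.I t
  have h3 : ∀ x : E, ((gc E * rexp (-‖x‖ ^ 2 / 2)).toNNReal • Complex.exp ((⟪x, t⟫ : ℝ) * Complex.I))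
      = (gc E : ℂ) * Complex.exp (-(1/2 : ℂ) * ‖x‖ ^ 2 + Complex.I * (⟪t, x⟫ : ℝ)) := by
    intro x
    rw [NNReal.smul_def, Real.coe_toNNReal _ (mul_nonneg gc_pos.le (exp_pos _).le), Complex.exp_add,
      Complex.real_smul, real_inner_comm]
    push_cast
    ring_nf
  simp_rw [h3]
  rw [integral_const_mul, h2]
  have h4 : (π / (1/2 : ℂ)) ^ ((Module.finrank ℝ E : ℂ) / 2) = (((gc E)⁻¹ : ℝ) : ℂ) := by
    unfold gc
    rw [inv_inv, Complex.ofReal_cpow (by positivity)]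
    push_cast; congr 1; ring
  rw [h4, ← mul_assoc, ← Complex.ofReal_mul, mul_inv_cancel₀ gc_pos.ne']
  simp only [Complex.I_sq]
  push_cast; ring_nf
lemma integral_std {F : Type*} [NormedAddCommGroup F] [NormedSpace ℝ F] (f : E → F) :
    ∫ x, f x ∂(stdGaussian E) = ∫ x, (gc E * rexp (-‖x‖ ^ 2 / 2)) • f x := by
  rw [std_eq]
  have hm : Measurable (fun x : E => (gc E * rexp (-‖x‖ ^ 2 / 2)).toNNReal) := by fun_prop
  have := integral_withDensity_eq_integral_smul (μ := (volume : Measure E)) hm f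
  simp only [ENNReal.ofReal] at *
  rw [this]
  refine integral_congr_ae (Filter.Eventually.of_forall fun x => ?_)
  simp only [NNReal.smul_def]
  rw [Real.coe_toNNReal _ (mul_nonneg gc_pos.le (exp_pos _).le)]
lemma intble_std {F : Type*} [NormedAddCommGroup F] [NormedSpace ℝ F] (f : E → F) :
    Integrable f (stdGaussian E) ↔ Integrable (fun x => rexp (-‖x‖ ^ 2 / 2) • f x) := by
  rw [std_eq]
  have hm : Measurable (fun x : E => (gc E * rexp (-‖x‖ ^ 2 / 2)).toNNReal) := by fun_prop
  have := integrable_withDensity_iff_integrable_smul (μ := (volume : Measure E)) hm (g := f)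
  simp only [ENNReal.ofReal] at *
  rw [this]
  have h3 : ∀ x : E, ((gc E * rexp (-‖x‖ ^ 2 / 2)).toNNReal • f x) =
      gc E • (rexp (-‖x‖ ^ 2 / 2) • f x) := by
    intro x
    rw [NNReal.smul_def, Real.coe_toNNReal _ (mul_nonneg gc_pos.le (exp_pos _).le), mul_smul]
  simp_rw [h3]
  exact integrable_smul_iff gc_pos.ne' _
lemma vol_ac_std : (volume : Measure E) ≪ stdGaussian E := by
  rw [std_eq]
  refine withDensity_absolutelyContinuous' (by fun_prop) (Filter.Eventually.of_forall fun x => ?_)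
  have := gc_pos (E := E)
  simp only [ne_eq, ENNReal.ofReal_eq_zero, not_le]; positivity
lemma std_ac_vol : stdGaussian E ≪ (volume : Measure E) := by
  rw [std_eq]; exact withDensity_absolutelyContinuous _ _
lemma intble_exp_std (a : ℝ) : Integrable (fun x : E => rexp (a * ‖x‖)) (stdGaussian E) := by
  rw [intble_std]
  refine ((intble_gauss (E := E) (b := 1/4) (by norm_num)).const_mul (rexp (a^2))).mono'
    (by fun_prop) (Filter.Eventually.of_forall fun x => ?_)
  simp only [smul_eq_mul]
  rw [Real.norm_of_nonneg (by positivity), ← Real.exp_add, ← Real.exp_add]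
  apply Real.exp_le_exp.2
  nlinarith [sq_nonneg (a - ‖x‖/2)]
lemma std_shift {F : Type*} [NormedAddCommGroup F] [NormedSpace ℝ F] (f : E → F) (v : E) :
    ∫ x, f (x + v) ∂(stdGaussian E) =
      ∫ x, rexp (⟪v, x⟫ - ‖v‖ ^ 2 / 2) • f x ∂(stdGaussian E) := by
  rw [integral_std, integral_std, ← integral_add_right_eq_self _ (-v)]
  refine integral_congr_ae (Filter.Eventually.of_forall fun x => ?_)
  simp only [neg_add_cancel_right, smul_smul]
  congr 1
  rw [mul_assoc, ← Real.exp_add]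
  congr 2
  rw [← sub_eq_add_neg, norm_sub_sq_real, real_inner_comm]; ring
end Gauss
end

section
abbrev EE (n : ℕ) := EuclideanSpace ℝ (Fin n)
abbrev bs {n : ℕ} (i : Fin n) : EE n := EuclideanSpace.single i 1
def PG {E : Type*} [NormedAddCommGroup E] (f : E → ℝ) : Prop :=
  Continuous f ∧ ∃ C : ℝ, ∃ k : ℕ, 0 ≤ C ∧ ∀ x, |f x| ≤ C * (1 + ‖x‖) ^ k
section PG
variable {E : Type*} [NormedAddCommGroup E] {f g : E → ℝ}
lemma PG.cont (h : PG f) : Continuous f := h.1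
lemma PG.mul (hf : PG f) (hg : PG g) : PG (fun x => f x * g x) := by
  obtain ⟨cf, C, k, hC, h⟩ := hf
  obtain ⟨cg, D, l, hD, h'⟩ := hg
  refine ⟨cf.mul cg, C * D, k + l, by positivity, fun x => ?_⟩
  rw [abs_mul, pow_add]
  calc |f x| * |g x| ≤ (C * (1 + ‖x‖) ^ k) * (D * (1 + ‖x‖) ^ l) :=
        mul_le_mul (h x) (h' x) (abs_nonneg _) (by positivity)
    _ = _ := by ring
lemma PG.add (hf : PG f) (hg : PG g) : PG (fun x => f x + g x) := by
  obtain ⟨cf, C, k, hC, h⟩ := hf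
  obtain ⟨cg, D, l, hD, h'⟩ := hg
  refine ⟨cf.add cg, C + D, k + l, by positivity, fun x => (abs_add_le _ _).trans ?_⟩
  have h1 : (1:ℝ) ≤ 1 + ‖x‖ := by linarith [norm_nonneg x]
  have := pow_le_pow_right₀ h1 (Nat.le_add_right k l)
  have := pow_le_pow_right₀ h1 (Nat.le_add_left l k)
  nlinarith [h x, h' x, mul_le_mul_of_nonneg_left (pow_le_pow_right₀ h1 (Nat.le_add_right k l)) hC,
    mul_le_mul_of_nonneg_left (pow_le_pow_right₀ h1 (Nat.le_add_left l k)) hD]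
lemma PG.const (c : ℝ) : PG (fun _ : E => c) :=
  ⟨continuous_const, |c|, 0, abs_nonneg _, fun x => by simp⟩
lemma PG.const_mul (c : ℝ) (hf : PG f) : PG (fun x => c * f x) := (PG.const c).mul hf
lemma PG.neg (hf : PG f) : PG (fun x => - f x) := by simpa using hf.const_mul (-1)
lemma PG.sub (hf : PG f) (hg : PG g) : PG (fun x => f x - g x) := by
  simpa [sub_eq_add_neg] using hf.add hg.neg
lemma PG.pow (hf : PG f) (k : ℕ) : PG (fun x => f x ^ k) := by
  induction k with
  | zero => simpa using PG.const (E := E) 1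
  | succ k ih => simpa [pow_succ] using ih.mul hf
lemma PG.sum {ι : Type*} (s : Finset ι) {F : ι → E → ℝ} (h : ∀ i ∈ s, PG (F i)) :
    PG (fun x => ∑ i ∈ s, F i x) := by
  classical
  induction s using Finset.induction_on with
  | empty => simpa using PG.const (E := E) 0
  | insert a s ha ih =>
    simp_rw [Finset.sum_insert ha]
    exact (h a (Finset.mem_insert_self _ _)).add (ih fun i hi => h i (Finset.mem_insert_of_mem hi))
lemma PG.of_bdd (hc : Continuous f) (M : ℝ) (h : ∀ x, |f x| ≤ M) : PG f :=
  ⟨hc, |M|, 0, abs_nonneg _, fun x => by simpa using (h x).trans (le_abs_self _)⟩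
lemma PG.norm' : PG (fun x : E => ‖x‖) :=
  ⟨continuous_norm, 1, 1, zero_le_one, fun x => by simp⟩
lemma PG.coord {n : ℕ} (i : Fin n) : PG (fun x : EE n => x i) :=
  ⟨by fun_prop, 1, 1, zero_le_one, fun x => by
    have : ‖x i‖ ≤ ‖x‖ := PiLp.norm_apply_le x i
    rw [Real.norm_eq_abs] at this; linarith⟩
lemma PG.le_exp (h : PG f) : ∃ C k : ℝ, 0 ≤ C ∧ ∀ x, |f x| ≤ C * rexp (k * ‖x‖) := by
  obtain ⟨_, C, k, hC, h⟩ := h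
  refine ⟨C, k, hC, fun x => (h x).trans ?_⟩
  gcongr
  rw [Real.exp_nat_mul]
  gcongr
  linarith [Real.add_one_le_exp ‖x‖]
end PG
lemma PG.intble {E : Type*} [NormedAddCommGroup E] [InnerProductSpace ℝ E] [FiniteDimensional ℝ E]
    [MeasurableSpace E] [BorelSpace E] {f : E → ℝ} (h : PG f) : Integrable f (stdGaussian E) := by
  obtain ⟨C, k, hC, hb⟩ := h.le_exp
  exact ((intble_exp_std k).const_mul C).mono' h.cont.aestronglyMeasurable
    (Filter.Eventually.of_forall hb)
def HL {n : ℕ} (f : EE n → ℝ) (f' : ℝ) (x : EE n) (i : Fin n) : Prop :=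
  HasDerivAt (fun t : ℝ => f (x + t • bs i)) f' 0
section HL
variable {n : ℕ} {f g : EE n → ℝ} {f' g' : ℝ} {x : EE n} {i : Fin n}
lemma HL.add (hf : HL f f' x i) (hg : HL g g' x i) : HL (fun x => f x + g x) (f' + g') x i :=
  HasDerivAt.fun_add hf hg
lemma HL.sub (hf : HL f f' x i) (hg : HL g g' x i) : HL (fun x => f x - g x) (f' - g') x i :=
  HasDerivAt.fun_sub hf hg
lemma HL.mul (hf : HL f f' x i) (hg : HL g g' x i) :
    HL (fun x => f x * g x) (f' * g x + f x * g') x i := by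
  have := HasDerivAt.fun_mul hf hg
  simpa only [HL, zero_smul, add_zero] using this
lemma HL.const (c : ℝ) : HL (fun _ => c) 0 x i := hasDerivAt_const _ _
lemma HL.neg (hf : HL f f' x i) : HL (fun x => - f x) (- f') x i := HasDerivAt.fun_neg hf
lemma HL.const_mul (c : ℝ) (hf : HL f f' x i) : HL (fun x => c * f x) (c * f') x i :=
  HasDerivAt.const_mul c hf
lemma HL.sum {ι : Type*} (s : Finset ι) {F : ι → EE n → ℝ} {F' : ι → ℝ}
    (h : ∀ j ∈ s, HL (F j) (F' j) x i) :
    HL (fun x => ∑ j ∈ s, F j x) (∑ j ∈ s, F' j) x i := HasDerivAt.fun_sum h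
lemma HL.congr (hf : HL f f' x i) (h : f' = g') : HL f g' x i := h ▸ hf
lemma HL.of_fderiv {L : EE n →L[ℝ] ℝ} (h : HasFDerivAt f L x) : HL f (L (bs i)) x i := by
  have h1 : HasDerivAt (fun t : ℝ => x + t • bs i) (bs i) 0 := by
    simpa using ((hasDerivAt_id (0:ℝ)).smul_const (bs i)).const_add x
  have h2 : HasFDerivAt f L (x + (0:ℝ) • bs i) := by simpa using h
  exact h2.comp_hasDerivAt (0:ℝ) h1
lemma HL.coord (j : Fin n) : HL (fun x => x j) (if j = i then 1 else 0) x i := by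
  have h : HasFDerivAt (fun x : EE n => x j) (EuclideanSpace.proj j : EE n →L[ℝ] ℝ) x :=
    (EuclideanSpace.proj j : EE n →L[ℝ] ℝ).hasFDerivAt
  refine (HL.of_fderiv (i := i) h).congr ?_
  simp [Pi.single_apply]
lemma HL.exp (hf : HL f f' x i) : HL (fun x => rexp (f x)) (rexp (f x) * f') x i := by
  have := HasDerivAt.exp hf
  simpa only [HL, zero_smul, add_zero] using this
lemma HL.normsq : HL (fun x : EE n => ‖x‖ ^ 2 / 2) (x i) x i := by
  have h : HasFDerivAt (fun x : EE n => ‖x‖ ^ 2) (2 • (innerSL ℝ x)) x :=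
    (hasStrictFDerivAt_norm_sq x).hasFDerivAt
  have := (HL.of_fderiv (i := i) h).const_mul (1/2)
  have h2 : (1 / 2 * (2 • (innerSL ℝ) x) (bs i)) = x i := by
    simp [EuclideanSpace.inner_single_right]
  rw [h2] at this
  convert this using 2; ring
end HL
structure Pot (n : ℕ) where
  ψ : EE n → ℝ
  d : Fin n → EE n → ℝ
  dd : Fin n → Fin n → EE n → ℝ
  M : ℝ
  δ : ℝ
  cψ : Continuous ψ
  cd : ∀ i, Continuous (d i)
  cdd : ∀ i j, Continuous (dd i j)
  bψ : ∀ x, |ψ x| ≤ M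
  bd : ∀ i x, |d i x| ≤ M
  bdd : ∀ i j x, |dd i j x| ≤ M
  hd : ∀ i x, HL ψ (d i x) x i
  hdd : ∀ i j x, HL (d i) (dd i j x) x j
  conv : ∀ x (v : Fin n → ℝ), -δ * ∑ i, v i ^ 2 ≤ ∑ i, ∑ j, dd i j x * v i * v j
  hδ : δ < 1
namespace Pot
variable {n : ℕ} (Q : Pot n)
def m : Measure (EE n) := (stdGaussian (EE n)).tilted (fun x => - Q.ψ x)
lemma hM : 0 ≤ Q.M := (abs_nonneg _).trans (Q.bψ 0)
lemma cexp : Continuous fun x => rexp (- Q.ψ x) := by have := Q.cψ; fun_prop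
lemma iexp : Integrable (fun x => rexp (- Q.ψ x)) (stdGaussian (EE n)) :=
  PG.intble (PG.of_bdd (Q.cexp) (rexp Q.M) fun x => by
    rw [abs_of_pos (exp_pos _)]
    exact Real.exp_le_exp.2 (by linarith [neg_abs_le (Q.ψ x), Q.bψ x]))
instance : IsProbabilityMeasure Q.m := isProbabilityMeasure_tilted Q.iexp
def Z : ℝ := ∫ x, rexp (- Q.ψ x) ∂(stdGaussian (EE n))
lemma Z_pos : 0 < Q.Z := integral_exp_pos Q.iexp
lemma integral_m (f : EE n → ℝ) :
    ∫ x, f x ∂Q.m = gc (EE n) * Q.Z⁻¹ * ∫ x, f x * rexp (-‖x‖ ^ 2 / 2 - Q.ψ x) := by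
  unfold m
  rw [integral_tilted, integral_std, ← integral_const_mul]
  refine integral_congr_ae (Filter.Eventually.of_forall fun x => ?_)
  simp only [smul_eq_mul]
  rw [sub_eq_add_neg, Real.exp_add]
  change _ * (_ / Q.Z * _) = _
  ring
lemma intble {f : EE n → ℝ} (h : PG f) : Integrable f Q.m := by
  unfold m
  rw [integrable_tilted_iff Q.iexp]
  refine PG.intble (PG.mul (PG.of_bdd (Q.cexp) (rexp Q.M) fun x => ?_) h)
  rw [abs_of_pos (exp_pos _)]
  exact Real.exp_le_exp.2 (by linarith [neg_abs_le (Q.ψ x), Q.bψ x])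
lemma intble' {f : EE n → ℝ} (h : PG f) :
    Integrable (fun x => f x * rexp (-‖x‖ ^ 2 / 2 - Q.ψ x)) := by
  have := (intble_std _).1 (PG.intble (PG.mul (PG.of_bdd (Q.cexp) (rexp Q.M) fun x => by
    rw [abs_of_pos (exp_pos _)]
    exact Real.exp_le_exp.2 (by linarith [neg_abs_le (Q.ψ x), Q.bψ x])) h))
  refine this.congr (Filter.Eventually.of_forall fun x => ?_)
  simp only [smul_eq_mul]
  rw [sub_eq_add_neg, Real.exp_add]; ring
lemma pgd (i) : PG (Q.d i) := PG.of_bdd (Q.cd i) Q.M (Q.bd i)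
lemma pgdd (i j) : PG (Q.dd i j) := PG.of_bdd (Q.cdd i j) Q.M (Q.bdd i j)
lemma ibp {F F' : EE n → ℝ} (i : Fin n) (hF : PG F) (hF' : PG F')
    (h : ∀ x, HL F (F' x) x i) :
    ∫ x, F' x ∂Q.m = ∫ x, F x * (x i + Q.d i x) ∂Q.m := by
  rw [integral_m, integral_m]
  congr 1
  have hw : ∀ x, HL (fun x => rexp (-‖x‖ ^ 2 / 2 - Q.ψ x))
      (-((x i + Q.d i x) * rexp (-‖x‖ ^ 2 / 2 - Q.ψ x))) x i := fun x => by
    have h2 := ((HL.normsq.neg).sub (Q.hd i x)).exp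
    simp only [← neg_div] at h2
    exact h2.congr (by ring)
  have := integral_bilinear_hasLineDerivAt_right_eq_neg_left_of_integrable
    (μ := (volume : Measure (EE n))) (f := F) (f' := F')
    (g := fun x => rexp (-‖x‖ ^ 2 / 2 - Q.ψ x))
    (g' := fun x => -((x i + Q.d i x) * rexp (-‖x‖ ^ 2 / 2 - Q.ψ x))) (v := bs i)
    (B := ContinuousLinearMap.mul ℝ ℝ) (Q.intble' hF') ?_ (Q.intble' hF) (fun x _ => h x) (fun x _ => hw x)
  · simp only [ContinuousLinearMap.mul_apply'] at this
    rw [← neg_inj, ← this, ← integral_neg]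
    congr 1; ext x; ring
  · refine (Q.intble' (hF.mul ((PG.coord i).add (Q.pgd i)))).neg.congr
      (Filter.Eventually.of_forall fun x => ?_)
    simp only [ContinuousLinearMap.mul_apply', Pi.neg_apply]; ring
end Pot
end

section
abbrev PP (n : ℕ) := MvPolynomial (Fin n) ℝ
def ev {n : ℕ} (p : PP n) (x : EE n) : ℝ := MvPolynomial.eval (fun i => x i) p
abbrev pd {n : ℕ} (i : Fin n) (p : PP n) : PP n := MvPolynomial.pderiv i p
section ev
variable {n : ℕ}
lemma ev_add (p q : PP n) (x) : ev (p + q) x = ev p x + ev q x := by simp [ev]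
lemma ev_sub (p q : PP n) (x) : ev (p - q) x = ev p x - ev q x := by simp [ev]
lemma ev_mul (p q : PP n) (x) : ev (p * q) x = ev p x * ev q x := by simp [ev]
lemma ev_smul (c : ℝ) (p : PP n) (x) : ev (c • p) x = c * ev p x := by simp [ev, MvPolynomial.smul_eval]
lemma ev_C (c : ℝ) (x : EE n) : ev (MvPolynomial.C c) x = c := by simp [ev]
lemma ev_X (i : Fin n) (x : EE n) : ev (MvPolynomial.X i) x = x i := by simp [ev]
lemma ev_sum {ι : Type*} (s : Finset ι) (p : ι → PP n) (x) : ev (∑ i ∈ s, p i) x = ∑ i ∈ s, ev (p i) x := by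
  simp [ev]
lemma ev_pow (p : PP n) (k : ℕ) (x) : ev (p ^ k) x = ev p x ^ k := by simp [ev]
lemma ev_pg (p : PP n) : PG (ev p) := by
  induction p using MvPolynomial.induction_on with
  | C a => simpa [funext (ev_C a)] using PG.const a
  | add p q hp hq => simpa [funext (ev_add p q)] using hp.add hq
  | mul_X p i hp =>
    have : ev (p * MvPolynomial.X i) = fun x => ev p x * x i := by ext x; rw [ev_mul, ev_X]
    rw [this]; exact hp.mul (PG.coord i)
lemma ev_hl (p : PP n) (i : Fin n) (x : EE n) : HL (ev p) (ev (pd i p) x) x i := by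
  induction p using MvPolynomial.induction_on with
  | C a => simpa [funext (ev_C a), ev, pd] using HL.const a
  | add p q hp hq => simpa [funext (ev_add p q), pd, ev_add] using hp.add hq
  | mul_X p j hp =>
    have : ev (p * MvPolynomial.X j) = fun x => ev p x * x j := by ext x; rw [ev_mul, ev_X]
    rw [this]
    refine (hp.mul (HL.coord j)).congr ?_
    simp only [pd, Derivation.leibniz, smul_eq_mul, ev_add, ev_mul, ev_X, MvPolynomial.pderiv_X]
    by_cases h : j = i
    · subst h; simp [ev]; ring
    · simp [ev, h, Pi.single_apply, Ne.symm h]; ring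
lemma pd_comm (i j : Fin n) (p : PP n) : pd i (pd j p) = pd j (pd i p) := by
  have h : ⁅(MvPolynomial.pderiv i : Derivation ℝ (PP n) (PP n)),
      (MvPolynomial.pderiv j : Derivation ℝ (PP n) (PP n))⁆ = 0 := by
    apply MvPolynomial.derivation_ext
    intro k
    rw [Derivation.commutator_apply]
    simp [MvPolynomial.pderiv_X, Pi.single_apply, apply_ite]
  have := congrArg (fun D : Derivation ℝ (PP n) (PP n) => D p) h
  rw [Derivation.commutator_apply] at this
  simpa [sub_eq_zero] using this
def LO : PP n →ₗ[ℝ] PP n :=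
  ∑ i, ((MvPolynomial.pderiv i).toLinearMap ∘ₗ (MvPolynomial.pderiv i).toLinearMap
    - LinearMap.mulLeft ℝ (MvPolynomial.X i) ∘ₗ (MvPolynomial.pderiv i).toLinearMap)
lemma LO_apply (p : PP n) : LO p = ∑ i, (pd i (pd i p) - MvPolynomial.X i * pd i p) := by
  simp [LO, LinearMap.sum_apply]
lemma LO_monomial (s : Fin n →₀ ℕ) (a : ℝ) : LO (MvPolynomial.monomial s a) =
    ∑ i, MvPolynomial.monomial (s - Finsupp.single i 1 - Finsupp.single i 1) (a * s i * (s i - 1 : ℕ))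
     - (s.degree : ℝ) • MvPolynomial.monomial s a := by
  rw [LO_apply, Finset.sum_sub_distrib]
  congr 1
  · refine Finset.sum_congr rfl fun i _ => ?_
    simp [pd, MvPolynomial.pderiv_monomial]
  · rw [Finsupp.degree_eq_sum, Nat.cast_sum, Finset.sum_smul]
    refine Finset.sum_congr rfl fun i _ => ?_
    rw [MvPolynomial.X_mul_pderiv_monomial]
    simp [Nat.cast_smul_eq_nsmul]
lemma solve_mono (c : ℝ) (hc : 0 ≤ c) (W : Submodule ℝ (PP n))
    (hW : ∀ p, c • p - LO p ∈ W) (h0 : ∀ a, MvPolynomial.C a ∈ W) :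
    ∀ (d : ℕ) (s : Fin n →₀ ℕ), s.degree = d → ∀ a : ℝ, MvPolynomial.monomial s a ∈ W := by
  intro d
  induction d using Nat.strong_induction_on with
  | _ d ih =>
    intro s hs a
    rcases Nat.eq_zero_or_pos d with h | h
    · have : s = 0 := by rw [← Finsupp.degree_eq_zero_iff]; omega
      subst this; exact h0 a
    have h1 := hW (MvPolynomial.monomial s a)
    rw [LO_monomial, sub_sub_eq_add_sub, ← add_smul] at h1
    have h2 : ∑ i, MvPolynomial.monomial (s - Finsupp.single i 1 - Finsupp.single i 1)
        (a * s i * (s i - 1 : ℕ)) ∈ W := by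
      refine Submodule.sum_mem _ fun i _ => ?_
      by_cases hi : s i = 0
      · simp [hi]
      refine ih _ ?_ _ rfl _
      have h3 : (s - Finsupp.single i 1 - Finsupp.single i 1).degree ≤ (s - Finsupp.single i 1).degree :=
        Finsupp.degree_mono tsub_le_self
      have h4 : (s - Finsupp.single i 1).degree + 1 = s.degree := by
        have h5 : s - Finsupp.single i 1 + Finsupp.single i 1 = s :=
          tsub_add_cancel_of_le (by simpa [Finsupp.single_le_iff] using Nat.one_le_iff_ne_zero.2 hi)
        calc _ = (s - Finsupp.single i 1 + Finsupp.single i 1).degree := by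
                rw [map_add, Finsupp.degree_single]
          _ = _ := by rw [h5]
      omega
    have h5 := W.add_mem h1 h2
    rw [sub_add_cancel] at h5
    have h6 : (c + s.degree : ℝ) ≠ 0 := by
      have : (0:ℝ) < s.degree := by rw [hs]; exact_mod_cast h
      positivity
    simpa [smul_smul, inv_mul_cancel₀ h6] using W.smul_mem (c + s.degree : ℝ)⁻¹ h5
lemma solve_all (c : ℝ) (hc : 0 ≤ c) (W : Submodule ℝ (PP n))
    (hW : ∀ p, c • p - LO p ∈ W) (h0 : ∀ a, MvPolynomial.C a ∈ W) (p : PP n) : p ∈ W := by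
  rw [p.as_sum]
  exact Submodule.sum_mem _ fun s _ => solve_mono c hc W hW h0 _ s rfl _
lemma solve_pos (c : ℝ) (hc : 0 < c) (p : PP n) : ∃ u, c • u - LO u = p := by
  refine solve_all c hc.le (LinearMap.range (c • LinearMap.id - LO)) (fun p => ⟨p, by simp⟩) (fun a => ?_) p
  refine ⟨MvPolynomial.C (c⁻¹ * a), ?_⟩
  have : LO (MvPolynomial.C (c⁻¹ * a) : PP n) = 0 := by simp [LO_apply]
  simp only [LinearMap.sub_apply, LinearMap.smul_apply, LinearMap.id_apply, this, sub_zero]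
  rw [MvPolynomial.smul_eq_C_mul, ← MvPolynomial.C_mul]; congr 1; field_simp
lemma solve_zero (p : PP n) : ∃ u a, - LO u + MvPolynomial.C a = p := by
  have h := solve_all 0 le_rfl (LinearMap.range (-LO (n := n)) ⊔
    LinearMap.range (Algebra.linearMap ℝ (PP n)))
    (fun p => Submodule.mem_sup_left ⟨p, by simp⟩) (fun a => Submodule.mem_sup_right ⟨a, rfl⟩) p
  obtain ⟨y, ⟨u, rfl⟩, z, ⟨a, rfl⟩, h⟩ := Submodule.mem_sup.1 h
  exact ⟨u, a, h⟩
end ev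
namespace Pot
variable {n : ℕ} (Q : Pot n)
def L (p : PP n) (x : EE n) : ℝ :=
  ∑ i, (ev (pd i (pd i p)) x - (x i + Q.d i x) * ev (pd i p) x)
lemma L_pg (p : PP n) : PG (Q.L p) :=
  PG.sum _ fun i _ => (ev_pg _).sub (((PG.coord i).add (Q.pgd i)).mul (ev_pg _))
lemma ibpL (p : PP n) (q : EE n → ℝ) (q' : Fin n → EE n → ℝ) (hq : PG q) (hq' : ∀ i, PG (q' i))
    (h : ∀ i x, HL q (q' i x) x i) :
    ∫ x, Q.L p x * q x ∂Q.m = - ∫ x, ∑ i, ev (pd i p) x * q' i x ∂Q.m := by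
  have key : ∀ i, ∫ x, (ev (pd i (pd i p)) x - (x i + Q.d i x) * ev (pd i p) x) * q x ∂Q.m
      = - ∫ x, ev (pd i p) x * q' i x ∂Q.m := fun i => by
    have h1 := Q.ibp i ((ev_pg (pd i p)).mul hq)
      (((ev_pg (pd i (pd i p))).mul hq).add ((ev_pg (pd i p)).mul (hq' i)))
      (fun x => (ev_hl (pd i p) i x).mul (h i x))
    rw [integral_add (Q.intble ((ev_pg _).mul hq)) (Q.intble ((ev_pg _).mul (hq' i)))] at h1
    have h2 : ∫ x, (ev (pd i (pd i p)) x - (x i + Q.d i x) * ev (pd i p) x) * q x ∂Q.m =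
        ∫ x, ev (pd i (pd i p)) x * q x ∂Q.m - ∫ x, ev (pd i p) x * q x * (x i + Q.d i x) ∂Q.m := by
      rw [← integral_sub (Q.intble ((ev_pg _).mul hq))
        (Q.intble (((ev_pg _).mul hq).mul ((PG.coord i).add (Q.pgd i))))]
      congr 1; ext x; ring
    rw [h2]; linarith
  rw [integral_finsetSum _ fun i _ => Q.intble ((ev_pg _).mul (hq' i)), ← Finset.sum_neg_distrib]
  simp_rw [← key]
  rw [← integral_finsetSum _ fun i _ =>
    Q.intble (((ev_pg _).sub (((PG.coord i).add (Q.pgd i)).mul (ev_pg _))).mul hq)]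
  simp_rw [L, Finset.sum_mul]
lemma ibpLev (p q : PP n) :
    ∫ x, Q.L p x * ev q x ∂Q.m = - ∫ x, ∑ i, ev (pd i p) x * ev (pd i q) x ∂Q.m :=
  Q.ibpL p _ (fun i => ev (pd i q)) (ev_pg q) (fun i => ev_pg _) fun i x => ev_hl q i x
lemma L_hl (p : PP n) (i : Fin n) (x : EE n) : HL (Q.L p)
    (Q.L (pd i p) x - ev (pd i p) x - ∑ j, Q.dd j i x * ev (pd j p) x) x i := by
  have h := HL.sum (x := x) (i := i) Finset.univ
    (F := fun j x => ev (pd j (pd j p)) x - (x j + Q.d j x) * ev (pd j p) x)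
    fun j _ => (ev_hl (pd j (pd j p)) i x).sub
      (((HL.coord j).add (Q.hdd j i x)).mul (ev_hl (pd j p) i x))
  refine h.congr ?_
  unfold L
  have : ev (pd i p) x = ∑ j, (if j = i then 1 else 0) * ev (pd j p) x := by simp
  rw [this, ← Finset.sum_sub_distrib, ← Finset.sum_sub_distrib]
  refine Finset.sum_congr rfl fun j _ => ?_
  rw [pd_comm i j (pd j p), pd_comm i j p]
  ring
def G (p : PP n) : ℝ := ∫ x, ∑ i, ev (pd i p) x ^ 2 ∂Q.m
def Hs (p : PP n) : ℝ := ∑ i, Q.G (pd i p)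
lemma bochner (p : PP n) : Q.Hs p + (1 - Q.δ) * Q.G p ≤ ∫ x, Q.L p x ^ 2 ∂Q.m := by
  have h1 := Q.ibpL p _ _ (Q.L_pg p) (fun i => ((Q.L_pg (pd i p)).sub (ev_pg (pd i p))).sub
    (PG.sum Finset.univ fun j _ => (Q.pgdd j i).mul (ev_pg (pd j p)))) (fun i x => Q.L_hl p i x)
  have h2 : ∀ i, ∫ x, Q.L (pd i p) x * ev (pd i p) x ∂Q.m = - Q.G (pd i p) := fun i => by
    rw [ibpLev]; simp_rw [← sq]; rfl
  have e1 : ∫ x, Q.L p x ^ 2 ∂Q.m = ∫ x, Q.L p x * Q.L p x ∂Q.m := by simp_rw [sq]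
  rw [e1, h1]
  have i1 : Integrable (fun x => ∑ i, Q.L (pd i p) x * ev (pd i p) x) Q.m :=
    Q.intble (PG.sum _ fun i _ => (Q.L_pg _).mul (ev_pg _))
  have i2 : Integrable (fun x => ∑ i, ev (pd i p) x ^ 2) Q.m :=
    Q.intble (PG.sum _ fun i _ => (ev_pg _).pow 2)
  have h3 : ∫ x, ∑ i, Q.L (pd i p) x * ev (pd i p) x ∂Q.m = - Q.Hs p := by
    rw [integral_finsetSum _ fun i _ => Q.intble ((Q.L_pg _).mul (ev_pg _))]
    simp_rw [h2]; simp [Hs]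
  have h4 : ∫ x, ∑ i, ev (pd i p) x * (Q.L (pd i p) x - ev (pd i p) x
        - ∑ j, Q.dd j i x * ev (pd j p) x) ∂Q.m ≤
      ∫ x, (∑ i, Q.L (pd i p) x * ev (pd i p) x) - (1 - Q.δ) * ∑ i, ev (pd i p) x ^ 2 ∂Q.m := by
    refine integral_mono (Q.intble (PG.sum _ fun i _ => (ev_pg _).mul (((Q.L_pg (pd i p)).sub (ev_pg (pd i p))).sub
      (PG.sum Finset.univ fun j _ => (Q.pgdd j i).mul (ev_pg (pd j p))))))
      (i1.sub (i2.const_mul _)) fun x => ?_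
    simp only
    have hc := Q.conv x (fun i => ev (pd i p) x)
    have e : ∑ i, ev (pd i p) x * (Q.L (pd i p) x - ev (pd i p) x
        - ∑ j, Q.dd j i x * ev (pd j p) x) = (∑ i, Q.L (pd i p) x * ev (pd i p) x)
        - ∑ i, ev (pd i p) x ^ 2 - ∑ i, ∑ j, Q.dd i j x * ev (pd i p) x * ev (pd j p) x := by
      rw [Finset.sum_comm (f := fun i j => Q.dd i j x * ev (pd i p) x * ev (pd j p) x),
        ← Finset.sum_sub_distrib, ← Finset.sum_sub_distrib]
      refine Finset.sum_congr rfl fun i _ => ?_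
      rw [mul_sub, mul_sub, Finset.mul_sum]
      congr 1
      · ring
      · exact Finset.sum_congr rfl fun j _ => by ring
    rw [e]; linarith
  rw [integral_sub i1 (i2.const_mul _), integral_const_mul, h3] at h4
  change _ ≤ _ - (1 - Q.δ) * Q.G p at h4
  linarith
end Pot
end

section
lemma dense_pert {V H : Type*} [AddCommGroup V] [Module ℝ V] [NormedAddCommGroup H]
    [InnerProductSpace ℝ H] [CompleteSpace H] (S R : V →ₗ[ℝ] H) (hS : DenseRange S) (c : ℝ)
    (hc : c < 1) (h : ∀ u, ‖R u‖ ≤ c * ‖S u‖) : DenseRange (S + R) := by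
  have : (LinearMap.range (S + R)).topologicalClosure = ⊤ := by
    rw [Submodule.topologicalClosure_eq_top_iff, Submodule.eq_bot_iff]
    intro w hw
    rw [Submodule.mem_orthogonal] at hw
    have h1 : ∀ v, ⟪v, w⟫ ≤ c * (‖w‖ * ‖v‖) := by
      intro v
      refine hS.induction_on (p := fun v => ⟪v, w⟫ ≤ c * (‖w‖ * ‖v‖)) v
        (isClosed_le (by fun_prop) (by fun_prop)) fun u => ?_
      have h2 := hw ((S + R) u) ⟨u, rfl⟩
      rw [LinearMap.add_apply, inner_add_left] at h2
      have h3 := abs_real_inner_le_norm (R u) w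
      have h4 := neg_abs_le ⟪R u, w⟫
      have h5 := mul_le_mul_of_nonneg_right (h u) (norm_nonneg w)
      nlinarith
    have h2 := h1 w
    rw [real_inner_self_eq_norm_sq] at h2
    have : ‖w‖ ^ 2 ≤ 0 := by nlinarith [sq_nonneg ‖w‖]
    simpa using this
  rw [DenseRange, dense_iff_closure_eq]
  have h2 := congrArg (fun s : Submodule ℝ H => (s : Set H)) this
  simpa only [Submodule.topologicalClosure_coe, LinearMap.coe_range, Submodule.top_coe] using h2
namespace Pot
variable {n : ℕ} (Q : Pot n)
lemma memLp {f : EE n → ℝ} (h : PG f) : MemLp f 2 Q.m :=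
  (memLp_two_iff_integrable_sq h.cont.aestronglyMeasurable).2 (Q.intble (h.pow 2))
def toL2 (T : PP n →ₗ[ℝ] (EE n → ℝ)) (hT : ∀ p, PG (T p)) : PP n →ₗ[ℝ] Lp ℝ 2 Q.m where
  toFun p := (Q.memLp (hT p)).toLp _
  map_add' p q := by
    rw [← MemLp.toLp_add]; congr 1; rw [map_add]
  map_smul' c p := by
    simp only [RingHom.id_apply]
    rw [← MemLp.toLp_const_smul]; congr 1; rw [map_smul]
lemma toLp_normsq {f : EE n → ℝ} (hf : MemLp f 2 Q.m) : ‖hf.toLp f‖ ^ 2 = ∫ x, f x ^ 2 ∂Q.m := by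
  rw [← real_inner_self_eq_norm_sq, L2.inner_def]
  refine integral_congr_ae ?_
  filter_upwards [hf.coeFn_toLp] with x hx
  rw [hx]; simp [sq]
def zero (n : ℕ) : Pot n where
  ψ := 0
  d := 0
  dd := 0
  M := 0
  δ := 0
  cψ := continuous_const
  cd _ := continuous_const
  cdd _ _ := continuous_const
  bψ _ := by simp
  bd _ _ := by simp
  bdd _ _ _ := by simp
  hd _ _ := HL.const 0
  hdd _ _ _ := HL.const 0
  conv _ _ := by simp
  hδ := zero_lt_one
lemma zero_m : (zero n).m = stdGaussian (EE n) := by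
  simp [zero, m]
lemma zero_L (p : PP n) : (zero n).L p = ev (LO p) := by
  ext x
  rw [LO_apply, ev_sum]
  simp [L, zero, ev_sub, ev_mul, ev_X]
end Pot
lemma poly_orth {n : ℕ} (w : EE n → ℝ) (hw : MemLp w 2 (stdGaussian (EE n)))
    (h : ∀ p : PP n, ∫ x, ev p x * w x ∂(stdGaussian (EE n)) = 0) : w =ᵐ[stdGaussian (EE n)] 0 := by
  set γ := stdGaussian (EE n)
  have hPG : ∀ f : EE n → ℝ, PG f → MemLp f 2 γ := fun f hf =>
    (memLp_two_iff_integrable_sq hf.cont.aestronglyMeasurable).2 ((hf.pow 2).intble)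
  have hwi : Integrable w γ := hw.integrable (by norm_num)
  have hexp : ∀ a : ℝ, Integrable (fun x => rexp (a * ‖x‖) * |w x|) γ := fun a => by
    have : MemLp (fun x : EE n => rexp (a * ‖x‖)) 2 γ := by
      rw [memLp_two_iff_integrable_sq (by fun_prop)]
      refine (intble_exp_std (2 * a)).congr (Filter.Eventually.of_forall fun x => ?_)
      simp only; rw [sq, ← Real.exp_add]; ring_nf
    exact this.integrable_mul hw.abs
  have key : ∀ t : EE n, ∫ x, Complex.exp ((⟪x, t⟫ : ℝ) * Complex.I) * (w x : ℂ) ∂γ = 0 := by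
    intro t
    have hs : HasSum (fun k : ℕ => ∫ x, ((((⟪x, t⟫ : ℝ) * Complex.I) ^ k / (k.factorial : ℂ)) * (w x : ℂ)) ∂γ)
        (∫ x, Complex.exp ((⟪x, t⟫ : ℝ) * Complex.I) * (w x : ℂ) ∂γ) := by
      refine hasSum_integral_of_dominated_convergence
        (fun k x => ((‖t‖ * ‖x‖) ^ k / k.factorial) * |w x|) ?_ ?_ ?_ ?_ ?_
      · intro k
        refine AEStronglyMeasurable.mul (by fun_prop) ?_
        exact Complex.continuous_ofReal.comp_aestronglyMeasurable hw.1
      · intro k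
        refine Filter.Eventually.of_forall fun x => ?_
        rw [norm_mul, norm_div, norm_pow, norm_mul, Complex.norm_I, mul_one, Complex.norm_real,
          Complex.norm_real, Complex.norm_natCast, Real.norm_eq_abs, Real.norm_eq_abs]
        gcongr
        rw [mul_comm]; exact abs_real_inner_le_norm x t
      · exact Filter.Eventually.of_forall fun x => (Real.summable_pow_div_factorial _).mul_right _
      · refine (hexp ‖t‖).congr (Filter.Eventually.of_forall fun x => ?_)
        simp only
        rw [tsum_mul_right, Real.exp_eq_exp_ℝ, NormedSpace.exp_eq_tsum_div]
      · refine Filter.Eventually.of_forall fun x => ?_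
        refine HasSum.mul_right _ ?_
        rw [Complex.exp_eq_exp_ℂ]
        exact NormedSpace.expSeries_div_hasSum_exp _
    have h0 : ∀ k : ℕ, ∫ x, ((((⟪x, t⟫ : ℝ) * Complex.I) ^ k / (k.factorial : ℂ)) * (w x : ℂ)) ∂γ = 0 := by
      intro k
      have h1 := h ((∑ i, MvPolynomial.C (t i) * MvPolynomial.X i) ^ k)
      have h2 : ∀ x : EE n, ev ((∑ i, MvPolynomial.C (t i) * MvPolynomial.X i) ^ k) x = ⟪x, t⟫ ^ k := by
        intro x; rw [ev_pow, ev_sum]; simp [ev_mul, ev_C, ev_X, PiLp.inner_apply]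
      simp_rw [h2] at h1
      have h3 : ∀ x : EE n, ((((⟪x, t⟫ : ℝ) * Complex.I) ^ k / (k.factorial : ℂ)) * (w x : ℂ)) =
          (Complex.I ^ k / (k.factorial : ℂ)) * ((⟪x, t⟫ ^ k * w x : ℝ) : ℂ) := by
        intro x; push_cast; rw [mul_pow]; ring
      simp_rw [h3]
      rw [integral_const_mul, integral_complex_ofReal, h1]; simp
    simp_rw [h0] at hs
    exact hs.unique hasSum_zero
  obtain ⟨v, hv, hvw⟩ := hw.1.aemeasurable
  have hvi : Integrable v γ := hwi.congr hvw
  have fin1 : IsFiniteMeasure (γ.withDensity fun x => ENNReal.ofReal (v x)) :=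
    isFiniteMeasure_withDensity_ofReal hvi.2
  have fin2 : IsFiniteMeasure (γ.withDensity fun x => ENNReal.ofReal (-v x)) :=
    isFiniteMeasure_withDensity_ofReal hvi.neg.2
  have heq : (γ.withDensity fun x => ENNReal.ofReal (v x)) =
      γ.withDensity fun x => ENNReal.ofReal (-v x) := by
    refine Measure.ext_of_charFun ?_
    ext t
    have hm1 : Measurable (fun x => (v x).toNNReal) := by fun_prop
    have hm2 : Measurable (fun x => (-v x).toNNReal) := by fun_prop
    rw [charFun_apply, charFun_apply]
    have e1 := integral_withDensity_eq_integral_smul (μ := γ) hm1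
      (fun x : EE n => Complex.exp ((⟪x, t⟫ : ℝ) * Complex.I))
    have e2 := integral_withDensity_eq_integral_smul (μ := γ) hm2
      (fun x : EE n => Complex.exp ((⟪x, t⟫ : ℝ) * Complex.I))
    simp only [ENNReal.ofReal] at *
    rw [e1, e2, ← sub_eq_zero, ← integral_sub]
    · rw [← key t]
      refine integral_congr_ae ?_
      filter_upwards [hvw] with x hx
      rw [hx, NNReal.smul_def, NNReal.smul_def, ← sub_smul, Complex.real_smul, mul_comm]
      congr 2
      rw [Real.coe_toNNReal', Real.coe_toNNReal']
      rcases le_total (v x) 0 with h | h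
      · rw [max_eq_right h, max_eq_left (by linarith)]; ring
      · rw [max_eq_left h, max_eq_right (by linarith)]; ring
    all_goals
      refine (hvi.norm).mono' (AEStronglyMeasurable.smul (by fun_prop) (by fun_prop)) ?_
      refine Filter.Eventually.of_forall fun x => ?_
      rw [NNReal.smul_def, norm_smul, Complex.norm_exp_ofReal_mul_I, mul_one, Real.norm_eq_abs,
        Real.coe_toNNReal', Real.norm_eq_abs, abs_of_nonneg (le_max_right _ _)]
      rcases abs_cases (v x) with h | h <;> simp [h.1] <;> linarith [h.2]
  have h3 := (withDensity_eq_iff (by fun_prop) (by fun_prop) hvi.lintegral_lt_top.ne).1 heq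
  filter_upwards [h3, hvw] with x hx hx2
  rw [hx2]
  rcases le_total (v x) 0 with h | h
  · rw [ENNReal.ofReal_of_nonpos h, eq_comm, ENNReal.ofReal_eq_zero] at hx
    simp; linarith
  · rw [ENNReal.ofReal_of_nonpos (by linarith : -v x ≤ 0), ENNReal.ofReal_eq_zero] at hx
    simp; linarith
end

section
def evL (n : ℕ) : PP n →ₗ[ℝ] (EE n → ℝ) where
  toFun := ev
  map_add' p q := funext (ev_add p q)
  map_smul' c p := funext (ev_smul c p)
namespace Pot
variable {n : ℕ} (Q : Pot n)
def LL : PP n →ₗ[ℝ] (EE n → ℝ) where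
  toFun := Q.L
  map_add' p q := by
    ext x; simp only [L, pd, map_add, ev_add, Pi.add_apply, ← Finset.sum_add_distrib]
    exact Finset.sum_congr rfl fun i _ => by ring
  map_smul' c p := by
    ext x; simp only [L, pd, Derivation.map_smul, ev_smul, Pi.smul_apply, smul_eq_mul, Finset.mul_sum,
      RingHom.id_apply]
    exact Finset.sum_congr rfl fun i _ => by ring
def RR : PP n →ₗ[ℝ] (EE n → ℝ) where
  toFun p x := ∑ i, Q.d i x * ev (pd i p) x
  map_add' p q := by
    ext x; simp only [pd, map_add, ev_add, Pi.add_apply, ← Finset.sum_add_distrib]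
    exact Finset.sum_congr rfl fun i _ => by ring
  map_smul' c p := by
    ext x; simp only [pd, Derivation.map_smul, ev_smul, Pi.smul_apply, smul_eq_mul, Finset.mul_sum,
      RingHom.id_apply]
    exact Finset.sum_congr rfl fun i _ => by ring
lemma RR_pg (p : PP n) : PG (Q.RR p) := PG.sum Finset.univ fun i _ => (Q.pgd i).mul (ev_pg (pd i p))
lemma evL_pg (p : PP n) : PG (evL n p) := ev_pg p
def Sl (l : ℝ) : PP n →ₗ[ℝ] (EE n → ℝ) := l • evL n - Q.LL
lemma Sl_apply (l : ℝ) (p : PP n) (x : EE n) : Q.Sl l p x = l * ev p x - Q.L p x := rfl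
lemma Sl_pg (l : ℝ) (p : PP n) : PG (Q.Sl l p) := ((ev_pg p).const_mul l).sub (Q.L_pg p)
lemma Sl_split (l : ℝ) : Q.Sl l = (zero n).Sl l + Q.RR := by
  refine LinearMap.ext fun p => funext fun x => ?_
  simp only [Sl_apply, LinearMap.add_apply, Pi.add_apply]
  have : Q.L p x = (zero n).L p x - Q.RR p x := by
    simp only [L, RR, LinearMap.coe_mk, AddHom.coe_mk, ← Finset.sum_sub_distrib, zero]
    exact Finset.sum_congr rfl fun i _ => by simp; ring
  rw [this]; ring
lemma orth_of_dense {T : PP n →ₗ[ℝ] (EE n → ℝ)} {hT : ∀ p, PG (T p)} (h : DenseRange (Q.toL2 T hT))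
    (w : EE n → ℝ) (hw : MemLp w 2 Q.m) (ho : ∀ p, ∫ x, T p x * w x ∂Q.m = 0) : w =ᵐ[Q.m] 0 := by
  have h1 : ∀ v : Lp ℝ 2 Q.m, ⟪v, hw.toLp w⟫ = 0 := fun v => by
    refine h.induction_on (p := fun v => ⟪v, hw.toLp w⟫ = 0) v
      (isClosed_eq (by fun_prop) continuous_const) fun p => ?_
    rw [L2.inner_def, ← ho p]
    refine integral_congr_ae ?_
    filter_upwards [hw.coeFn_toLp, (Q.memLp (hT p)).coeFn_toLp] with x h1 h2
    simp only [toL2, LinearMap.coe_mk, AddHom.coe_mk]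
    rw [h1, h2]; simp [mul_comm]
  have h2 := h1 (hw.toLp w)
  rw [inner_self_eq_zero] at h2
  have h3 := hw.coeFn_toLp
  rw [h2] at h3
  filter_upwards [h3, Lp.coeFn_zero ℝ 2 Q.m] with x h4 h5
  rw [← h4, h5]
lemma dense_of_orth {T : PP n →ₗ[ℝ] (EE n → ℝ)} (hT : ∀ p, PG (T p))
    (h : ∀ w : EE n → ℝ, MemLp w 2 Q.m → (∀ p, ∫ x, T p x * w x ∂Q.m = 0) → w =ᵐ[Q.m] 0) :
    DenseRange (Q.toL2 T hT) := by
  have : (LinearMap.range (Q.toL2 T hT)).topologicalClosure = ⊤ := by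
    rw [Submodule.topologicalClosure_eq_top_iff, Submodule.eq_bot_iff]
    intro w hw
    rw [Submodule.mem_orthogonal] at hw
    have h1 := h w (Lp.memLp w) fun p => by
      rw [← hw _ ⟨p, rfl⟩, L2.inner_def]
      refine integral_congr_ae ?_
      filter_upwards [(Q.memLp (hT p)).coeFn_toLp] with x h2
      simp only [toL2, LinearMap.coe_mk, AddHom.coe_mk]
      rw [h2]; simp [mul_comm]
    exact (Lp.eq_zero_iff_ae_eq_zero).2 h1
  rw [DenseRange, dense_iff_closure_eq]
  have h2 := congrArg (fun s : Submodule ℝ (Lp ℝ 2 Q.m) => (s : Set (Lp ℝ 2 Q.m))) this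
  simpa only [Submodule.topologicalClosure_coe, LinearMap.coe_range, Submodule.top_coe] using h2
lemma G_nonneg (p : PP n) : 0 ≤ Q.G p :=
  integral_nonneg fun x => Finset.sum_nonneg fun i _ => sq_nonneg _
lemma Sl_sq (l : ℝ) (p : PP n) : ∫ x, Q.Sl l p x ^ 2 ∂Q.m =
    l ^ 2 * ∫ x, ev p x ^ 2 ∂Q.m + 2 * l * Q.G p + ∫ x, Q.L p x ^ 2 ∂Q.m := by
  have h1 : ∫ x, Q.L p x * ev p x ∂Q.m = - Q.G p := by
    rw [ibpLev]; simp_rw [← sq]; rfl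
  have i1 := (Q.intble ((ev_pg p).pow 2)).const_mul (l ^ 2)
  have i2 := (Q.intble ((Q.L_pg p).mul (ev_pg p))).const_mul (2 * l)
  have i3 := Q.intble ((Q.L_pg p).pow 2)
  have e1 : ∫ x, Q.Sl l p x ^ 2 ∂Q.m =
      ∫ x, (l ^ 2 * ev p x ^ 2 - 2 * l * (Q.L p x * ev p x) + Q.L p x ^ 2) ∂Q.m :=
    integral_congr_ae (Filter.Eventually.of_forall fun x => by simp only [Sl_apply]; ring)
  have e2 := integral_add (i1.sub i2) i3
  have e3 := integral_sub i1 i2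
  have e4 := integral_const_mul (μ := Q.m) (l ^ 2) fun x => ev p x ^ 2
  have e5 := integral_const_mul (μ := Q.m) (2 * l) fun x => (Q.L p x * ev p x)
  simp only [Pi.sub_apply] at e2
  rw [e1, e2, e3, e4, e5, h1]
  generalize ∫ x, ev p x ^ 2 ∂Q.m = A
  generalize ∫ x, Q.L p x ^ 2 ∂Q.m = B
  ring
lemma norm_toL2 {T : PP n →ₗ[ℝ] (EE n → ℝ)} (hT : ∀ p, PG (T p)) (p : PP n) :
    ‖Q.toL2 T hT p‖ ^ 2 = ∫ x, T p x ^ 2 ∂Q.m := Q.toLp_normsq (Q.memLp (hT p))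
def l0 : ℝ := 2 * n * Q.M ^ 2 + 1
lemma l0_pos : 0 < Q.l0 := by unfold l0; positivity
lemma dense0 (l : ℝ) (hl : 0 < l) : DenseRange ((zero n).toL2 ((zero n).Sl l) ((zero n).Sl_pg l)) := by
  refine (zero n).dense_of_orth _ fun w hw ho => ?_
  rw [zero_m] at *
  refine poly_orth w hw fun p => ?_
  obtain ⟨u, hu⟩ := solve_pos l hl p
  rw [← ho u]
  congr 1; ext x
  rw [Sl_apply, zero_L, ← hu, ev_sub, ev_smul]
lemma sq_le_of {a b c : ℝ} (hb : 0 ≤ b) (hc : 0 ≤ c) (h : a ^ 2 ≤ c ^ 2 * b ^ 2) : a ≤ c * b :=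
  le_of_sq_le_sq (by rw [mul_pow]; exact h) (by positivity)
where le_of_sq_le_sq {x y : ℝ} (h : x ^ 2 ≤ y ^ 2) (hy : 0 ≤ y) : x ≤ y := by
        exact le_trans (le_abs_self x) (by rw [← abs_of_nonneg hy]; exact sq_le_sq.1 h)
lemma dense1 : DenseRange ((zero n).toL2 (Q.Sl Q.l0) (Q.Sl_pg Q.l0)) := by
  have h := dense_pert _ ((zero n).toL2 Q.RR Q.RR_pg) (dense0 Q.l0 Q.l0_pos) (1/2) (by norm_num) ?_
  · convert h using 1
    ext1 p
    rw [LinearMap.add_apply]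
    simp only [toL2, LinearMap.coe_mk, AddHom.coe_mk]
    rw [← MemLp.toLp_add]
    congr 1
    rw [Sl_split]; rfl
  · intro u
    refine sq_le_of (norm_nonneg _) (by norm_num) ?_
    rw [norm_toL2, norm_toL2, Sl_sq]
    have h1 : ∫ x, Q.RR u x ^ 2 ∂(zero n).m ≤ n * Q.M ^ 2 * (zero n).G u := by
      rw [G, ← integral_const_mul]
      refine integral_mono ((zero n).intble ((Q.RR_pg u).pow 2))
        (((zero n).intble (PG.sum _ fun i _ => (ev_pg (pd i u)).pow 2)).const_mul _) fun x => ?_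
      simp only [RR, LinearMap.coe_mk, AddHom.coe_mk]
      refine (Finset.sum_mul_sq_le_sq_mul_sq _ _ _).trans ?_
      refine mul_le_mul_of_nonneg_right ?_ (Finset.sum_nonneg fun i _ => sq_nonneg _)
      have : ∑ i, Q.d i x ^ 2 ≤ ∑ i : Fin n, Q.M ^ 2 :=
        Finset.sum_le_sum fun i _ => sq_le_sq' (by linarith [neg_abs_le (Q.d i x), Q.bd i x])
          ((le_abs_self _).trans (Q.bd i x))
      simpa using this
    have h2 : 0 ≤ ∫ x, ev u x ^ 2 ∂(zero n).m := integral_nonneg fun x => sq_nonneg _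
    have h3 : 0 ≤ ∫ x, (zero n).L u x ^ 2 ∂(zero n).m := integral_nonneg fun x => sq_nonneg _
    have h4 := (zero n).G_nonneg u
    have h5 : 0 ≤ Q.l0 ^ 2 * ∫ x, ev u x ^ 2 ∂(zero n).m := by positivity
    have h6 : 2 * n * Q.M ^ 2 * (zero n).G u ≤ Q.l0 * (zero n).G u := by
      unfold l0; nlinarith
    nlinarith
lemma integral_m' (f : EE n → ℝ) :
    ∫ x, f x ∂Q.m = Q.Z⁻¹ * ∫ x, rexp (- Q.ψ x) * f x ∂(stdGaussian (EE n)) := by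
  unfold m
  rw [integral_tilted, ← integral_const_mul]
  refine integral_congr_ae (Filter.Eventually.of_forall fun x => ?_)
  simp only [smul_eq_mul]
  change (_ / Q.Z * _) = _
  ring
lemma dense2 : DenseRange (Q.toL2 (Q.Sl Q.l0) (Q.Sl_pg Q.l0)) := by
  refine Q.dense_of_orth _ fun w hw ho => ?_
  have hac : Q.m ≪ stdGaussian (EE n) := tilted_absolutelyContinuous _ _
  have hac' : stdGaussian (EE n) ≪ Q.m := absolutelyContinuous_tilted Q.iexp
  have hM := Q.hM
  have hwm : AEStronglyMeasurable w (stdGaussian (EE n)) := hw.1.mono_ac hac'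
  have h1 : MemLp (fun x => rexp (- Q.ψ x) * w x) 2 (zero n).m := by
    rw [zero_m, memLp_two_iff_integrable_sq (f := fun x => rexp (- Q.ψ x) * w x) (Q.cexp.aestronglyMeasurable.mul hwm)]
    have h2 := (memLp_two_iff_integrable_sq hw.1).1 hw
    unfold m at h2
    rw [integrable_tilted_iff Q.iexp] at h2
    refine (h2.const_mul (rexp Q.M)).mono' ((Q.cexp.aestronglyMeasurable.mul hwm).pow 2)
      (Filter.Eventually.of_forall fun x => ?_)
    simp only [smul_eq_mul]
    rw [Real.norm_of_nonneg (sq_nonneg _)]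
    have : rexp (-Q.ψ x) ≤ rexp Q.M := Real.exp_le_exp.2 (by linarith [neg_abs_le (Q.ψ x), Q.bψ x])
    have h3 := exp_pos (-Q.ψ x)
    calc (rexp (-Q.ψ x) * w x) ^ 2 = rexp (-Q.ψ x) * (rexp (-Q.ψ x) * w x ^ 2) := by ring
      _ ≤ _ := mul_le_mul_of_nonneg_right this (by positivity)
  have h2 := (zero n).orth_of_dense Q.dense1 _ h1 fun p => by
    have := ho p
    rw [integral_m', mul_eq_zero] at this
    rw [zero_m, ← this.resolve_left (inv_pos.2 Q.Z_pos).ne']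
    congr 1; ext x; ring
  rw [zero_m] at h2
  refine hac.ae_eq ?_
  filter_upwards [h2] with x hx
  have := exp_pos (- Q.ψ x)
  simpa [this.ne'] using hx
lemma dense3 (l : ℝ) (hl : 0 < l) (hl' : l ≤ Q.l0) : DenseRange (Q.toL2 (Q.Sl l) (Q.Sl_pg l)) := by
  have hp := Q.l0_pos
  have h := dense_pert _ ((l - Q.l0) • Q.toL2 (evL n) evL_pg) Q.dense2 ((Q.l0 - l) / Q.l0)
    (by rw [div_lt_one hp]; linarith) ?_
  · convert h using 1
    ext1 p
    rw [LinearMap.add_apply]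
    simp only [toL2, LinearMap.coe_mk, AddHom.coe_mk, LinearMap.smul_apply]
    rw [← MemLp.toLp_const_smul, ← MemLp.toLp_add]
    congr 1
    ext x
    simp only [Sl_apply, Pi.add_apply, Pi.smul_apply, smul_eq_mul, evL, LinearMap.coe_mk, AddHom.coe_mk]
    ring
  · intro u
    rw [LinearMap.smul_apply, norm_smul, Real.norm_eq_abs, abs_of_nonpos (by linarith), neg_sub, div_mul_eq_mul_div,
      mul_div_assoc]
    refine mul_le_mul_of_nonneg_left ?_ (by linarith)
    rw [le_div_iff₀ hp, mul_comm]
    refine abs_le_abs_of_sq_le_sq ?_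
    rw [mul_pow, norm_toL2, norm_toL2, Sl_sq]
    have h3 : 0 ≤ ∫ x, Q.L u x ^ 2 ∂Q.m := integral_nonneg fun x => sq_nonneg _
    have h4 := Q.G_nonneg u
    change _ * ∫ x, ev u x ^ 2 ∂Q.m ≤ _
    nlinarith
where abs_le_abs_of_sq_le_sq {a b : ℝ} {x : PP n} (h : (a * b) ^ 2 ≤ (‖Q.toL2 (Q.Sl Q.l0) (Q.Sl_pg Q.l0) x‖) ^ 2) :
      a * b ≤ ‖Q.toL2 (Q.Sl Q.l0) (Q.Sl_pg Q.l0) x‖ :=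
        le_trans (le_abs_self _) (abs_le_of_sq_le_sq h (norm_nonneg _))
lemma approx (l : ℝ) (hl : 0 < l) (hl' : l ≤ Q.l0) (f : PP n) (ε : ℝ) (hε : 0 < ε) :
    ∃ u, ∫ x, (Q.Sl l u x - ev f x) ^ 2 ∂Q.m ≤ ε ^ 2 := by
  obtain ⟨u, hu⟩ := (Q.dense3 l hl hl').exists_dist_lt (Q.toL2 (evL n) evL_pg f) hε
  refine ⟨u, ?_⟩
  rw [dist_comm, dist_eq_norm] at hu
  have h1 : Q.toL2 (Q.Sl l) (Q.Sl_pg l) u - Q.toL2 (evL n) evL_pg f =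
    ((Q.memLp (Q.Sl_pg l u)).sub (Q.memLp (ev_pg f))).toLp _ := by
      rw [MemLp.toLp_sub (Q.memLp (Q.Sl_pg l u)) (Q.memLp (ev_pg f))]; rfl
  have h2 := Q.toLp_normsq ((Q.memLp (Q.Sl_pg l u)).sub (Q.memLp (ev_pg f)))
  rw [← h1] at h2
  change _ = ∫ x, (Q.Sl l u x - ev f x) ^ 2 ∂Q.m at h2
  rw [← h2]
  exact pow_le_pow_left₀ (norm_nonneg _) hu.le 2
end Pot
end

section
lemma quad_cs {A B C : ℝ} (h : ∀ s : ℝ, 0 ≤ A * s ^ 2 + 2 * B * s + C) : B ^ 2 ≤ A * C := by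
  have := discrim_le_zero (a := A) (b := 2 * B) (c := C) fun s => by
    have := h s; nlinarith
  unfold discrim at this; nlinarith
namespace Pot
variable {n : ℕ} (Q : Pot n)
lemma cs {f g : EE n → ℝ} (hf : PG f) (hg : PG g) :
    (∫ x, f x * g x ∂Q.m) ^ 2 ≤ (∫ x, f x ^ 2 ∂Q.m) * ∫ x, g x ^ 2 ∂Q.m := by
  refine quad_cs fun s => ?_
  have i1 := (Q.intble (hf.pow 2)).mul_const (s ^ 2)
  have i2 := ((Q.intble (hf.mul hg)).const_mul 2).mul_const s
  have i3 := Q.intble (hg.pow 2)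
  rw [← integral_mul_const, ← integral_const_mul, ← integral_mul_const, ← integral_add i1 i2,
    ← integral_add (i1.fun_add i2) i3]
  refine integral_nonneg fun x => ?_
  have : 0 ≤ (f x * s + g x) ^ 2 := sq_nonneg _
  simp only [Pi.zero_apply]; nlinarith
def cr (p q : PP n) : ℝ := ∫ x, ∑ i, ev (pd i p) x * ev (pd i q) x ∂Q.m
lemma cs_cr (p q : PP n) : (Q.cr p q) ^ 2 ≤ Q.G p * Q.G q := by
  unfold cr G
  refine quad_cs fun s => ?_
  have i1 := (Q.intble (PG.sum Finset.univ fun i _ => (ev_pg (pd i p)).pow 2)).mul_const (s ^ 2)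
  have i2 := ((Q.intble (PG.sum Finset.univ fun i _ => (ev_pg (pd i p)).mul (ev_pg (pd i q)))).const_mul 2).mul_const s
  have i3 := Q.intble (PG.sum Finset.univ fun i _ => (ev_pg (pd i q)).pow 2)
  rw [← integral_mul_const, ← integral_const_mul, ← integral_mul_const, ← integral_add i1 i2,
    ← integral_add (i1.fun_add i2) i3]
  refine integral_nonneg fun x => ?_
  simp only [Pi.zero_apply]
  rw [Finset.sum_mul, Finset.mul_sum, Finset.sum_mul, ← Finset.sum_add_distrib, ← Finset.sum_add_distrib]
  refine Finset.sum_nonneg fun i _ => ?_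
  have : 0 ≤ (ev (pd i p) x * s + ev (pd i q) x) ^ 2 := sq_nonneg _
  nlinarith
def V (p : PP n) : ℝ := ∫ x, ev p x ^ 2 ∂Q.m - (∫ x, ev p x ∂Q.m) ^ 2
lemma V_shift (p : PP n) (c : ℝ) :
    ∫ x, ev (p - MvPolynomial.C c) x ^ 2 ∂Q.m = Q.V p + (∫ x, ev p x ∂Q.m - c) ^ 2 := by
  unfold V
  have i1 := Q.intble ((ev_pg p).pow 2)
  have i2 := (Q.intble (ev_pg p)).const_mul (2 * c)
  have e : ∀ x, ev (p - MvPolynomial.C c) x ^ 2 = ev p x ^ 2 - 2 * c * ev p x + c ^ 2 := fun x => by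
    rw [ev_sub, ev_C]; ring
  simp_rw [e]
  have e2 := integral_add (i1.sub i2) (integrable_const (c ^ 2))
  have e3 := integral_sub i1 i2
  have e5 := integral_const_mul (μ := Q.m) (2 * c) fun x => ev p x
  simp only [Pi.sub_apply] at e2
  rw [e2, e3, e5]
  simp only [integral_const, probReal_univ, one_smul]
  generalize ∫ x, ev p x ∂Q.m = A
  generalize ∫ x, ev p x ^ 2 ∂Q.m = B
  ring
lemma G_shift (p : PP n) (c : ℝ) : Q.G (p - MvPolynomial.C c) = Q.G p := by
  simp [G, pd]
lemma gaussPoincare (p : PP n) : ∃ a : ℝ,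
    ∫ x, ev (p - MvPolynomial.C a) x ^ 2 ∂(zero n).m ≤ (zero n).G p := by
  obtain ⟨u, a, h⟩ := solve_zero p
  refine ⟨a, ?_⟩
  have e : ∀ x, ev (p - MvPolynomial.C a) x = - (zero n).L u x := fun x => by
    rw [zero_L, ← h]; simp [ev]
  have h1 := (zero n).ibpLev u (p - MvPolynomial.C a)
  have h2 := (zero n).cs_cr u (p - MvPolynomial.C a)
  have h3 := (zero n).bochner u
  have h4 : (zero n).δ = 0 := rfl
  have h5 : 0 ≤ (zero n).Hs u := Finset.sum_nonneg fun i _ => G_nonneg _ _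
  rw [G_shift] at h2
  change _ = - (zero n).cr _ _ at h1
  simp_rw [e] at h1 ⊢
  simp only [mul_neg, integral_neg, neg_sq, ← sq] at h1 ⊢
  rw [neg_inj] at h1
  rw [← h1] at h2
  have h6 := (zero n).G_nonneg p
  have h7 : 0 ≤ ∫ x, (zero n).L u x ^ 2 ∂(zero n).m := integral_nonneg fun x => sq_nonneg _
  have h8 := (zero n).G_nonneg u
  generalize ∫ x, (zero n).L u x ^ 2 ∂(zero n).m = I at *
  rw [h4] at h3
  have h9 : I ^ 2 ≤ I * (zero n).G p := h2.trans (mul_le_mul_of_nonneg_right (by linarith) h6)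
  rcases h7.eq_or_lt with h | h
  · rw [← h]; exact h6
  · nlinarith
lemma crude (p : PP n) : Q.V p ≤ rexp (2 * Q.M) * Q.G p := by
  obtain ⟨a, h⟩ := gaussPoincare p
  rw [zero_m] at h
  have h1 := Q.V_shift p a
  have hZ := Q.Z_pos
  have h2 : ∫ x, ev (p - MvPolynomial.C a) x ^ 2 ∂Q.m ≤ Q.Z⁻¹ * (rexp Q.M *
      ∫ x, ev (p - MvPolynomial.C a) x ^ 2 ∂(stdGaussian (EE n))) := by
    rw [integral_m', ← integral_const_mul (rexp Q.M)]
    refine mul_le_mul_of_nonneg_left (integral_mono ?_ ?_ fun x => ?_) (by positivity)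
    · exact PG.intble ((PG.of_bdd Q.cexp (rexp Q.M) fun x => by
        rw [abs_of_pos (exp_pos _)]
        exact Real.exp_le_exp.2 (by linarith [neg_abs_le (Q.ψ x), Q.bψ x])).mul ((ev_pg _).pow 2))
    · exact (PG.intble ((ev_pg _).pow 2)).const_mul _
    · exact mul_le_mul_of_nonneg_right (Real.exp_le_exp.2 (by linarith [neg_abs_le (Q.ψ x), Q.bψ x]))
        (sq_nonneg _)
  have h3 : (zero n).G p ≤ rexp Q.M * (Q.Z * Q.G p) := by
    have : Q.Z * Q.G p = ∫ x, rexp (- Q.ψ x) * ∑ i, ev (pd i p) x ^ 2 ∂(stdGaussian (EE n)) := by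
      rw [G, integral_m', ← mul_assoc, mul_inv_cancel₀ hZ.ne', one_mul]
    rw [this, G, zero_m, ← integral_const_mul (rexp Q.M)]
    have pg := (PG.sum Finset.univ fun i _ => (ev_pg (pd i p)).pow 2)
    refine integral_mono (PG.intble pg) ?_ fun x => ?_
    · exact (PG.intble ((PG.of_bdd Q.cexp (rexp Q.M) fun x => by
        rw [abs_of_pos (exp_pos _)]
        exact Real.exp_le_exp.2 (by linarith [neg_abs_le (Q.ψ x), Q.bψ x])).mul pg)).const_mul _
    · have : 1 ≤ rexp Q.M * rexp (- Q.ψ x) := by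
        rw [← Real.exp_add]; exact Real.one_le_exp (by linarith [le_abs_self (Q.ψ x), Q.bψ x])
      simp only
      rw [← mul_assoc]
      exact le_mul_of_one_le_left (Finset.sum_nonneg fun i _ => sq_nonneg _) this
  have h4 : 0 ≤ (∫ x, ev p x ∂Q.m - a) ^ 2 := sq_nonneg _
  have he : rexp (2 * Q.M) = rexp Q.M * rexp Q.M := by rw [← Real.exp_add]; ring_nf
  calc Q.V p ≤ _ := by linarith
    _ ≤ _ := h2
    _ ≤ Q.Z⁻¹ * (rexp Q.M * (rexp Q.M * (Q.Z * Q.G p))) := by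
        have := h.trans h3
        gcongr
    _ = _ := by rw [he]; field_simp
def lin (θ : Fin n → ℝ) : PP n := ∑ i, θ i • MvPolynomial.X i
lemma ev_lin (θ : Fin n → ℝ) (x) : ev (lin θ) x = ∑ i, θ i * x i := by
  simp [lin, ev_sum, ev_smul, ev_X]
lemma pd_lin (θ : Fin n → ℝ) (i) : pd i (lin θ) = MvPolynomial.C (θ i) := by
  simp [lin, pd, MvPolynomial.pderiv_X, Pi.single_apply, MvPolynomial.smul_eq_C_mul, eq_comm]
def Val (C : ℝ) : Prop := ∀ p, Q.V p ≤ C * Q.G p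
lemma mean_grad {a : ℝ} (ha0 : 0 ≤ a) (ha : ∀ θ, Q.V (lin θ) ≤ a * ∑ i, θ i ^ 2) (u : PP n) :
    ∑ i, (∫ x, ev (pd i u) x ∂Q.m) ^ 2 ≤ a * ∫ x, Q.L u x ^ 2 ∂Q.m := by
  set θ : Fin n → ℝ := fun i => ∫ x, ev (pd i u) x ∂Q.m with hθ
  set q := lin θ - MvPolynomial.C (∫ x, ev (lin θ) x ∂Q.m) with hq
  have h1 := Q.ibpLev u q
  have h2 : ∀ i, pd i q = MvPolynomial.C (θ i) := fun i => by
    rw [hq, ← pd_lin θ i]; simp [pd]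
  simp_rw [h2, ev_C] at h1
  rw [integral_finset_sum _ fun i _ => (Q.intble (ev_pg _)).mul_const _] at h1
  simp_rw [integral_mul_const] at h1
  have h3 := Q.cs (Q.L_pg u) (ev_pg q)
  rw [h1, hq, V_shift, sub_self] at h3
  have h4 := ha θ
  have h5 : ∑ i, (∫ x, ev (pd i u) x ∂Q.m) * θ i = ∑ i, θ i ^ 2 := by simp [hθ, sq]
  rw [h5] at h3
  have h6 : 0 ≤ ∑ i, θ i ^ 2 := Finset.sum_nonneg fun i _ => sq_nonneg _
  have h7 : 0 ≤ ∫ x, Q.L u x ^ 2 ∂Q.m := integral_nonneg fun x => sq_nonneg _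
  change ∑ i, θ i ^ 2 ≤ _
  generalize ∫ x, Q.L u x ^ 2 ∂Q.m = I at *
  generalize ∑ i, θ i ^ 2 = S at *
  have h8 : S ^ 2 ≤ I * (a * S) := by
    have := mul_le_mul_of_nonneg_left h4 h7; nlinarith
  rcases h6.eq_or_lt with h | h
  · rw [← h]; positivity
  · nlinarith
lemma G_step {a C : ℝ} (ha0 : 0 ≤ a) (hC : 0 ≤ C) (hV : Q.Val C) (ha : ∀ θ, Q.V (lin θ) ≤ a * ∑ i, θ i ^ 2) (u : PP n) :
    (1 + (1 - Q.δ) * C) * Q.G u ≤ (a + C) * ∫ x, Q.L u x ^ 2 ∂Q.m := by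
  have h1 : Q.G u ≤ ∑ i, (∫ x, ev (pd i u) x ∂Q.m) ^ 2 + C * Q.Hs u := by
    have : Q.G u = ∑ i, (Q.V (pd i u) + (∫ x, ev (pd i u) x ∂Q.m) ^ 2) := by
      rw [G, integral_finset_sum _ fun i _ => Q.intble ((ev_pg _).pow 2)]
      simp [V]
    rw [this, Finset.sum_add_distrib, Hs, Finset.mul_sum, add_comm]
    gcongr with i
    exact hV _
  have h2 := Q.mean_grad ha0 ha u
  have h3 := mul_le_mul_of_nonneg_left (Q.bochner u) hC
  nlinarith
lemma lim_arg {F Γ C C' b : ℝ} (hb : 0 < b) (hF : 0 ≤ F) (hΓ : 0 ≤ Γ) (hC' : 0 ≤ C')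
    (h : ∀ e, 0 < e → e ≤ b → F ≤ (e * √(C * F) + √Γ) * √C' * (√F + e) + √F * e) : F ≤ C' * Γ := by
  have h1 : F ≤ (0 * √(C * F) + √Γ) * √C' * (√F + 0) + √F * 0 := by
    have ht : Filter.Tendsto (fun e : ℝ => (e * √(C * F) + √Γ) * √C' * (√F + e) + √F * e)
        (nhdsWithin 0 (Ioi 0)) (nhds ((0 * √(C * F) + √Γ) * √C' * (√F + 0) + √F * 0)) :=
      (Continuous.tendsto (by fun_prop) 0).mono_left nhdsWithin_le_nhds
    refine ge_of_tendsto ht ?_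
    filter_upwards [Ioc_mem_nhdsGT hb] with e he using h e he.1 he.2
  simp only [zero_mul, zero_add, add_zero, mul_zero] at h1
  have h2 := Real.sq_sqrt hF
  have h3 := Real.sq_sqrt hΓ
  have h4 := Real.sq_sqrt hC'
  rcases (Real.sqrt_nonneg F).eq_or_lt with h0 | h0
  · rw [← h0] at h2; rw [← h2]; simp; positivity
  · have : √F ≤ √Γ * √C' := by
      by_contra! h'
      nlinarith
    calc F = √F ^ 2 := h2.symm
      _ ≤ (√Γ * √C') ^ 2 := by gcongr
      _ = _ := by rw [mul_pow, h3, h4]; ring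
lemma abs_le_sqrt' {x a b : ℝ} (ha : 0 ≤ a) (h : x ^ 2 ≤ a * b) : x ≤ √a * √b := by
  rw [← Real.sqrt_mul ha]; exact Real.le_sqrt_of_sq_le h
lemma step {a C C' : ℝ} (hC : 0 ≤ C) (hC'0 : 0 ≤ C') (hV : Q.Val C)
    (hG : ∀ u, Q.G u ≤ C' * ∫ x, Q.L u x ^ 2 ∂Q.m) : Q.Val C' := by
  intro p
  set f := p - MvPolynomial.C (∫ x, ev p x ∂Q.m) with hf
  have hf2 : ∫ x, ev f x ^ 2 ∂Q.m = Q.V p := by rw [hf, V_shift]; simp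
  have hfG : Q.G f = Q.G p := by rw [hf, G_shift]
  have hf0 : ∫ x, ev f x ∂Q.m = 0 := by
    simp_rw [hf, ev_sub, ev_C]
    rw [integral_sub (Q.intble (ev_pg p)) (integrable_const _)]
    simp
  rw [← hf2, ← hfG]
  have hF0 : 0 ≤ ∫ x, ev f x ^ 2 ∂Q.m := integral_nonneg fun x => sq_nonneg _
  refine lim_arg (C := C) Q.l0_pos hF0 (Q.G_nonneg f) hC'0 fun e he hel => ?_
  obtain ⟨u, hu⟩ := Q.approx e he hel f e he
  set g := Q.Sl e u with hg
  have hgp : PG g := Q.Sl_pg e u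
  have hg0 : 0 ≤ ∫ x, g x ^ 2 ∂Q.m := integral_nonneg fun x => sq_nonneg _
  have h1 : ∫ x, Q.L u x ^ 2 ∂Q.m ≤ ∫ x, g x ^ 2 ∂Q.m := by
    have := Q.Sl_sq e u
    have h2 : 0 ≤ ∫ x, ev u x ^ 2 ∂Q.m := integral_nonneg fun x => sq_nonneg _
    have h3 := Q.G_nonneg u
    have h4 : 0 ≤ e ^ 2 * ∫ x, ev u x ^ 2 ∂Q.m := by positivity
    have h5 : 0 ≤ 2 * e * Q.G u := by positivity
    linarith
  have hGu : Q.G u ≤ C' * ∫ x, g x ^ 2 ∂Q.m := (hG u).trans (by gcongr)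
  set v := u - MvPolynomial.C (∫ x, ev u x ∂Q.m) with hv
  have e1 : ∫ x, ev f x * ev u x ∂Q.m = ∫ x, ev f x * ev v x ∂Q.m := by
    simp_rw [hv, ev_sub, ev_C, mul_sub]
    rw [integral_sub (Q.intble ((ev_pg f).mul (ev_pg u))) ((Q.intble (ev_pg f)).mul_const _),
      integral_mul_const, hf0]; simp
  have e2 : ∫ x, ev f x * ev u x ∂Q.m ≤ √(∫ x, ev f x ^ 2 ∂Q.m) * √(C * (C' * ∫ x, g x ^ 2 ∂Q.m)) := by
    rw [e1]
    refine abs_le_sqrt' hF0 ((Q.cs (ev_pg f) (ev_pg v)).trans ?_)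
    refine mul_le_mul_of_nonneg_left ?_ hF0
    rw [hv, V_shift]; simp
    exact (hV u).trans (by gcongr)
  have e3 : - ∫ x, ev f x * Q.L u x ∂Q.m ≤ √(Q.G f) * √(C' * ∫ x, g x ^ 2 ∂Q.m) := by
    have h2 := Q.ibpLev u f
    have h3 := Q.cs_cr u f
    have : ∫ x, ev f x * Q.L u x ∂Q.m = - Q.cr u f := by
      rw [cr, ← h2]; congr 1; ext x; ring
    rw [this, neg_neg]
    refine abs_le_sqrt' (Q.G_nonneg f) (h3.trans ?_)
    rw [mul_comm]
    exact mul_le_mul_of_nonneg_left hGu (Q.G_nonneg f)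
  have e4 : ∫ x, ev f x * g x ∂Q.m = e * ∫ x, ev f x * ev u x ∂Q.m - ∫ x, ev f x * Q.L u x ∂Q.m := by
    rw [← integral_const_mul, ← integral_sub ((Q.intble ((ev_pg f).mul (ev_pg u))).const_mul _)
      (Q.intble ((ev_pg f).mul (Q.L_pg u)))]
    congr 1; ext x; rw [hg, Sl_apply]; ring
  have e5 : ∫ x, ev f x ^ 2 ∂Q.m = ∫ x, ev f x * g x ∂Q.m + ∫ x, ev f x * (ev f x - g x) ∂Q.m := by
    rw [← integral_add (Q.intble ((ev_pg f).mul hgp)) (Q.intble ((ev_pg f).mul ((ev_pg f).sub hgp)))]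
    congr 1; ext x; ring
  have hfg : ∫ x, (ev f x - g x) ^ 2 ∂Q.m ≤ e ^ 2 := by
    refine le_trans (le_of_eq ?_) hu
    congr 1; ext x; ring
  have e6 : ∫ x, ev f x * (ev f x - g x) ∂Q.m ≤ √(∫ x, ev f x ^ 2 ∂Q.m) * √(e ^ 2) := by
    refine abs_le_sqrt' hF0 ((Q.cs (ev_pg f) ((ev_pg f).sub hgp)).trans ?_)
    exact mul_le_mul_of_nonneg_left hfg hF0
  have e7 : √(∫ x, g x ^ 2 ∂Q.m) ≤ √(∫ x, ev f x ^ 2 ∂Q.m) + e := by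
    rw [Real.sqrt_le_left (by positivity)]
    have e8 : ∫ x, g x ^ 2 ∂Q.m = ∫ x, ev f x ^ 2 ∂Q.m + 2 * (∫ x, ev f x * (g x - ev f x) ∂Q.m) +
        ∫ x, (ev f x - g x) ^ 2 ∂Q.m := by
      have i2 := (Q.intble ((ev_pg f).mul (hgp.sub (ev_pg f)))).const_mul 2
      have i1 := Q.intble ((ev_pg f).pow 2)
      rw [← integral_const_mul, ← integral_add i1 i2,
        ← integral_add (i1.fun_add i2) (Q.intble (((ev_pg f).sub hgp).pow 2))]
      congr 1; ext x; ring
    have e9 : ∫ x, ev f x * (g x - ev f x) ∂Q.m ≤ √(∫ x, ev f x ^ 2 ∂Q.m) * √(e ^ 2) := by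
      refine abs_le_sqrt' hF0 ((Q.cs (ev_pg f) (hgp.sub (ev_pg f))).trans ?_)
      refine mul_le_mul_of_nonneg_left (le_trans (le_of_eq ?_) hfg) hF0
      congr 1; ext x; ring
    rw [Real.sqrt_sq he.le] at e9
    rw [e8]
    have := Real.sq_sqrt hF0
    nlinarith
  rw [Real.sqrt_sq he.le] at e6
  have s1 : √(C * (C' * ∫ x, g x ^ 2 ∂Q.m)) = √C * (√C' * √(∫ x, g x ^ 2 ∂Q.m)) := by
    rw [Real.sqrt_mul hC, Real.sqrt_mul hC'0]
  rw [s1] at e2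
  rw [Real.sqrt_mul hC'0] at e3
  rw [Real.sqrt_mul hC]
  have e10 := mul_le_mul_of_nonneg_left e2 he.le
  have n1 := Real.sqrt_nonneg C
  have n2 := Real.sqrt_nonneg C'
  have n3 := Real.sqrt_nonneg (∫ x, ev f x ^ 2 ∂Q.m)
  have n4 := Real.sqrt_nonneg (Q.G f)
  have n5 := Real.sqrt_nonneg (∫ x, g x ^ 2 ∂Q.m)
  calc ∫ x, ev f x ^ 2 ∂Q.m ≤ (e * (√C * √(∫ x, ev f x ^ 2 ∂Q.m)) + √(Q.G f)) * √C' * √(∫ x, g x ^ 2 ∂Q.m)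
        + √(∫ x, ev f x ^ 2 ∂Q.m) * e := by
        rw [e5, e4] at *
        linarith
    _ ≤ _ := by gcongr
theorem poincare {a : ℝ} (ha0 : 0 ≤ a) (ha : ∀ θ, Q.V (lin θ) ≤ a * ∑ i, θ i ^ 2) (p : PP n) :
    Q.V p ≤ √(a / (1 - Q.δ)) * Q.G p := by
  set S := {C : ℝ | 0 ≤ C ∧ Q.Val C} with hS
  have hne : S.Nonempty := ⟨rexp (2 * Q.M), (exp_pos _).le, Q.crude⟩
  have hbd : BddBelow S := ⟨0, fun C hC => hC.1⟩
  set c := sInf S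
  have hc0 : 0 ≤ c := le_csInf hne fun C hC => hC.1
  have hcV : Q.Val c := fun p => by
    rcases (Q.G_nonneg p).eq_or_lt with h | h
    · obtain ⟨C, hC⟩ := hne
      have := hC.2 p
      rw [← h] at this ⊢; simpa using this
    · rw [← div_le_iff₀ h]
      exact le_csInf hne fun C hC => (div_le_iff₀ h).2 (hC.2 p)
  have ht : 0 < 1 - Q.δ := by linarith [Q.hδ]
  have hpos : 0 < 1 + (1 - Q.δ) * c := by positivity
  have h1 : Q.Val ((a + c) / (1 + (1 - Q.δ) * c)) := Q.step (a := a) hc0 (by positivity) hcV fun u => by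
    rw [div_mul_eq_mul_div, le_div_iff₀ hpos, mul_comm]
    exact Q.G_step ha0 hc0 hcV ha u
  have h2 : c ≤ (a + c) / (1 + (1 - Q.δ) * c) := csInf_le hbd ⟨by positivity, h1⟩
  rw [le_div_iff₀ hpos] at h2
  have h3 : c ≤ √(a / (1 - Q.δ)) := Real.le_sqrt_of_sq_le (by rw [le_div_iff₀ ht]; nlinarith)
  exact (hcV p).trans (mul_le_mul_of_nonneg_right h3 (Q.G_nonneg p))
end Pot
end

section
section Moll
variable {n : ℕ}
lemma ev_line (P : PP n) (c w : EE n) (t : ℝ) :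
    HasDerivAt (fun t : ℝ => ev P (c + t • w)) (∑ i, w i * ev (pd i P) (c + t • w)) t := by
  induction P using MvPolynomial.induction_on with
  | C a => simpa [funext (ev_C a), ev, pd] using hasDerivAt_const t a
  | add p q hp hq =>
    refine (hp.fun_add hq).congr_deriv ?_ |>.congr_of_eventuallyEq ?_
    · simp [pd, ev_add, mul_add, Finset.sum_add_distrib]
    · exact Filter.Eventually.of_forall fun t => by simp [ev_add]
  | mul_X p j hp =>
    have hx : HasDerivAt (fun t : ℝ => (c + t • w) j) (w j) t := by
      have : (fun t : ℝ => (c + t • w) j) = fun t => c j + t * w j := by ext t; simp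
      rw [this]
      simpa using ((hasDerivAt_id t).mul_const (w j)).const_add (c j)
    refine (hp.fun_mul hx).congr_deriv ?_ |>.congr_of_eventuallyEq ?_
    · simp only [pd, Derivation.leibniz, ev_add, smul_eq_mul, ev_mul, MvPolynomial.pderiv_X, ev_X]
      simp only [mul_add, Finset.sum_add_distrib]
      rw [add_comm]
      congr 1
      · rw [Finset.sum_eq_single j]
        · simp [ev]; ring
        · intro i _ hij; simp [Pi.single_apply, hij, ev, Ne.symm hij]
        · simp
      · rw [Finset.sum_mul]; exact Finset.sum_congr rfl fun i _ => by ring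
    · exact Filter.Eventually.of_forall fun t => by simp [ev_mul, ev_X]
def gF (N : EE n → ℝ) (P : PP n) (y : EE n) : ℝ := ∫ z, N (y + z) * ev P z ∂(stdGaussian (EE n))
def DP (v : EE n) (P : PP n) : PP n := Pot.lin (fun i => v i) * P - ∑ i, v i • pd i P
lemma ev_DP (v : EE n) (P : PP n) (x : EE n) :
    ev (DP v P) x = ⟪v, x⟫ * ev P x - ∑ i, v i * ev (pd i P) x := by
  rw [DP, ev_sub, ev_mul, Pot.ev_lin, ev_sum]
  simp only [ev_smul]
  congr 2
  simp [PiLp.inner_apply, mul_comm]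
lemma gF_eq (N : EE n → ℝ) (P : PP n) (y : EE n) :
    gF N P y = ∫ x, rexp (⟪y, x⟫ - ‖y‖ ^ 2 / 2) * (N x * ev P (x - y)) ∂(stdGaussian (EE n)) := by
  have := std_shift (fun x => N x * ev P (x - y)) y
  simp only [add_sub_cancel_right, smul_eq_mul] at this
  rw [← this]
  unfold gF
  congr 1; ext z; rw [add_comm]
lemma gF_bound (N : EE n → ℝ) (hN : PG N) (P : PP n) (r : ℝ) (hr : 0 ≤ r) :
    ∃ B k : ℝ, 0 ≤ B ∧ ∀ y x : EE n, ‖y‖ ≤ r →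
      |rexp (⟪y, x⟫ - ‖y‖ ^ 2 / 2) * (N x * ev P (x - y))| ≤ B * rexp (k * ‖x‖) := by
  obtain ⟨C, k, hC, h1⟩ := hN.le_exp
  obtain ⟨D, l, hD, h2⟩ := (ev_pg P).le_exp
  refine ⟨C * (D * rexp (|l| * r)), r + k + |l|, by positivity, fun y x hy => ?_⟩
  rw [abs_mul, abs_mul, abs_of_pos (exp_pos _)]
  have a1 : rexp (⟪y, x⟫ - ‖y‖ ^ 2 / 2) ≤ rexp (r * ‖x‖) := by
    refine Real.exp_le_exp.2 ?_
    have := (real_inner_le_norm y x).trans (mul_le_mul_of_nonneg_right hy (norm_nonneg x))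
    have := sq_nonneg ‖y‖
    linarith
  have a2 : |ev P (x - y)| ≤ D * (rexp (|l| * r) * rexp (|l| * ‖x‖)) := by
    refine (h2 _).trans (mul_le_mul_of_nonneg_left ?_ hD)
    rw [← Real.exp_add]
    refine Real.exp_le_exp.2 ?_
    have h3 : ‖x - y‖ ≤ ‖x‖ + r := (norm_sub_le _ _).trans (by linarith)
    have h4 : l * ‖x - y‖ ≤ |l| * ‖x - y‖ := mul_le_mul_of_nonneg_right (le_abs_self l) (norm_nonneg _)
    have h5 := mul_le_mul_of_nonneg_left h3 (abs_nonneg l)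
    linarith
  calc _ ≤ rexp (r * ‖x‖) * ((C * rexp (k * ‖x‖)) * (D * (rexp (|l| * r) * rexp (|l| * ‖x‖)))) := by
        have := h1 x
        gcongr
    _ = _ := by
        rw [show (r + k + |l|) * ‖x‖ = r * ‖x‖ + k * ‖x‖ + |l| * ‖x‖ by ring, Real.exp_add, Real.exp_add]
        ring
lemma gF_contx {N : EE n → ℝ} (hN : PG N) (P : PP n) (y : EE n) :
    Continuous fun x => rexp (⟪y, x⟫ - ‖y‖ ^ 2 / 2) * (N x * ev P (x - y)) := by
  have h1 := hN.cont
  have h2 := (ev_pg P).cont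
  fun_prop
lemma gF_cont {N : EE n → ℝ} (hN : PG N) (P : PP n) : Continuous (gF N P) := by
  rw [continuous_iff_continuousAt]
  intro y
  obtain ⟨B, k, hB, h⟩ := gF_bound N hN P (‖y‖ + 1) (by positivity)
  rw [show gF N P = fun y => _ from funext (gF_eq N P)]
  refine continuousAt_of_dominated (bound := fun x => B * rexp (k * ‖x‖))
    (Filter.Eventually.of_forall fun y => (gF_contx hN P y).aestronglyMeasurable) ?_ ?_ ?_
  · filter_upwards [Metric.ball_mem_nhds y one_pos] with y' hy'
    refine Filter.Eventually.of_forall fun x => h y' x ?_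
    have := norm_le_norm_add_norm_sub y y'
    rw [mem_ball, dist_eq_norm] at hy'
    rw [norm_sub_rev] at this
    linarith
  · exact (intble_exp_std k).const_mul B
  · refine Filter.Eventually.of_forall fun x => Continuous.continuousAt ?_
    have h2 := (ev_pg P).cont
    fun_prop
lemma gF_deriv {N : EE n → ℝ} (hN : PG N) (P : PP n) (y v : EE n) (t0 : ℝ) :
    HasDerivAt (fun t : ℝ => gF N P (y + t • v)) (gF N (DP v P) (y + t0 • v)) t0 := by
  suffices H : ∀ y, HasDerivAt (fun t : ℝ => gF N P (y + t • v)) (gF N (DP v P) y) 0 by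
    have := H (y + t0 • v)
    have h1 : HasDerivAt (fun t : ℝ => t - t0) 1 t0 := (hasDerivAt_id t0).sub_const t0
    have h2 := HasDerivAt.comp (h₂ := fun t : ℝ => gF N P ((y + t0 • v) + t • v)) (h := fun t : ℝ => t - t0) t0
      (by simpa using this) h1
    rw [mul_one] at h2
    refine h2.congr_of_eventuallyEq (Filter.Eventually.of_forall fun t => ?_)
    simp [sub_smul, add_assoc]
  intro y
  obtain ⟨B, k, hB, h⟩ := gF_bound N hN (DP v P) (‖y‖ + ‖v‖) (by positivity)
  have h0 := hasDerivAt_integral_of_dominated_loc_of_deriv_le (μ := stdGaussian (EE n)) (𝕜 := ℝ)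
    (F := fun (t : ℝ) x => rexp (⟪y + t • v, x⟫ - ‖y + t • v‖ ^ 2 / 2) * (N x * ev P (x - (y + t • v))))
    (F' := fun (t : ℝ) x => rexp (⟪y + t • v, x⟫ - ‖y + t • v‖ ^ 2 / 2) * (N x * ev (DP v P) (x - (y + t • v))))
    (x₀ := 0) (bound := fun x => B * rexp (k * ‖x‖)) (s := ball 0 1) (ball_mem_nhds _ one_pos)
    (Filter.Eventually.of_forall fun t => (gF_contx hN P _).aestronglyMeasurable)
    ?_ (gF_contx hN _ _).aestronglyMeasurable ?_ ((intble_exp_std k).const_mul B) ?_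
  · have h1 := h0.2
    rw [show (fun t : ℝ => gF N P (y + t • v)) = fun t => _ from funext fun t => gF_eq N P (y + t • v)]
    refine h1.congr_deriv ?_
    simp only [zero_smul, add_zero]
    rw [gF_eq]
  · obtain ⟨B', k', _, h'⟩ := gF_bound N hN P (‖y‖) (by positivity)
    refine ((intble_exp_std k').const_mul B').mono' (gF_contx hN P _).aestronglyMeasurable
      (Filter.Eventually.of_forall fun x => ?_)
    rw [Real.norm_eq_abs]
    exact h' _ x (by simp)
  · refine Filter.Eventually.of_forall fun x t ht => ?_
    rw [Real.norm_eq_abs]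
    refine h _ x ((norm_add_le _ _).trans ?_)
    rw [norm_smul]
    rw [mem_ball_zero_iff] at ht
    have := mul_le_mul_of_nonneg_right ht.le (norm_nonneg v)
    linarith
  · refine Filter.Eventually.of_forall fun x t _ => ?_
    have e1 : HasDerivAt (fun t : ℝ => ev P (x - (y + t • v)))
        (- ∑ i, v i * ev (pd i P) (x - (y + t • v))) t := by
      have := ev_line P (x - y) (-v) t
      have hh : ∀ t : ℝ, x - y + t • (-v) = x - (y + t • v) := fun t => by simp; abel
      simp only [hh] at this
      refine this.congr_deriv ?_
      simp
    have e2 : HasDerivAt (fun t : ℝ => ⟪y + t • v, x⟫ - ‖y + t • v‖ ^ 2 / 2) (⟪v, x - (y + t • v)⟫) t := by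
      have hh : ∀ t : ℝ, ⟪y + t • v, x⟫ - ‖y + t • v‖ ^ 2 / 2 =
          (⟪y, x⟫ - ‖y‖ ^ 2 / 2) + t * (⟪v, x⟫ - ⟪v, y⟫) - t ^ 2 * (‖v‖ ^ 2 / 2) := fun t => by
        rw [norm_add_sq_real, inner_add_left, real_inner_smul_left, real_inner_smul_right, norm_smul,
          real_inner_comm y v, mul_pow, Real.norm_eq_abs, sq_abs]; ring
      simp_rw [hh]
      have a1 := (((hasDerivAt_id t).mul_const (⟪v, x⟫ - ⟪v, y⟫)).const_add (⟪y, x⟫ - ‖y‖ ^ 2 / 2)).sub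
        (((hasDerivAt_pow 2 t)).mul_const (‖v‖ ^ 2 / 2))
      refine a1.congr_deriv ?_
      rw [inner_sub_right, inner_add_right, real_inner_smul_right, real_inner_self_eq_norm_sq]
      simp; ring
    refine (e2.exp.mul (e1.const_mul (N x))).congr_deriv ?_
    rw [ev_DP]; ring
structure LC (N : EE n → ℝ) (b : ℝ) : Prop where
  lip : ∀ x y, |N x - N y| ≤ b * ‖x - y‖
  conv : ConvexOn ℝ univ N
lemma LC.cont {N : EE n → ℝ} {b : ℝ} (h : LC N b) : Continuous N := by
  have : LipschitzWith (Real.toNNReal b) N := LipschitzWith.of_dist_le_mul fun x y => by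
    rw [Real.dist_eq, dist_eq_norm]
    exact (h.lip x y).trans (mul_le_mul_of_nonneg_right (Real.le_coe_toNNReal b) (norm_nonneg _))
  exact this.continuous
lemma LC.pg {N : EE n → ℝ} {b : ℝ} (h : LC N b) : PG N := by
  refine ⟨h.cont, |N 0| + |b|, 1, by positivity, fun x => ?_⟩
  have h1 := h.lip x 0
  rw [sub_zero] at h1
  have h2 : |N x| ≤ |N x - N 0| + |N 0| := by simpa using abs_add_le (N x - N 0) (N 0)
  have h3 := mul_le_mul_of_nonneg_right (le_abs_self b) (norm_nonneg x)
  have := abs_nonneg (N 0); have := abs_nonneg b; have := norm_nonneg x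
  nlinarith [mul_nonneg (abs_nonneg (N 0)) (norm_nonneg x)]
def gh (N : EE n → ℝ) (y : EE n) : ℝ := ∫ z, N (y + z) ∂(stdGaussian (EE n))
lemma gh_eq (N : EE n → ℝ) : gh N = gF N 1 := by
  ext y; simp [gh, gF, ev]
variable {N : EE n → ℝ} {b : ℝ}
lemma LC.int (h : LC N b) (y : EE n) : Integrable (fun z => N (y + z)) (stdGaussian (EE n)) := by
  have : PG (fun z => N (y + z)) := by
    have : LC (fun z => N (y + z)) b := ⟨fun x z => by simpa using h.lip (y + x) (y + z),
      by
        have := h.conv.translate_right y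
        simpa [Function.comp_def] using this⟩
    exact this.pg
  exact this.intble
lemma gh_lip (h : LC N b) (x y : EE n) : |gh N x - gh N y| ≤ b * ‖x - y‖ := by
  unfold gh
  rw [← integral_sub (h.int x) (h.int y)]
  have := norm_integral_le_of_norm_le_const (μ := stdGaussian (EE n)) (f := fun z => N (x + z) - N (y + z))
    (C := b * ‖x - y‖) (Filter.Eventually.of_forall fun z => by simpa using h.lip (x + z) (y + z))
  simpa using this
lemma gh_conv (h : LC N b) : ConvexOn ℝ univ (gh N) := by
  refine ⟨convex_univ, fun x _ y _ s t hs ht hst => ?_⟩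
  unfold gh
  simp only [smul_eq_mul]
  rw [← integral_const_mul, ← integral_const_mul, ← integral_add ((h.int x).const_mul _) ((h.int y).const_mul _)]
  refine integral_mono (h.int _) (((h.int x).const_mul _).add ((h.int y).const_mul _)) fun z => ?_
  have := h.conv.2 (mem_univ (x + z)) (mem_univ (y + z)) hs ht hst
  simp only [smul_eq_mul] at this
  refine le_trans (le_of_eq ?_) this
  congr 1
  have : z = (s + t) • z := by rw [hst, one_smul]
  rw [smul_add, smul_add]
  nth_rewrite 1 [this]
  rw [add_smul]; abel
lemma gh_line (h : LC N b) (y v : EE n) (t : ℝ) :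
    HasDerivAt (fun t : ℝ => gh N (y + t • v)) (gF N (DP v 1) (y + t • v)) t := by
  rw [gh_eq]; exact gF_deriv h.pg 1 y v t
lemma gh_grad_le (h : LC N b) (y v : EE n) : |gF N (DP v 1) y| ≤ b * ‖v‖ := by
  have hb : 0 ≤ b * ‖v‖ := by simpa using (abs_nonneg _).trans (h.lip v 0)
  have h1 := gh_line h y v 0
  rw [zero_smul, add_zero] at h1
  have := h1.le_of_lip' (C := b * ‖v‖) hb (Filter.Eventually.of_forall fun t => by
    have := gh_lip h (y + t • v) (y + (0:ℝ) • v)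
    simp only [add_sub_add_left_eq_sub, zero_smul, sub_zero, norm_smul] at this ⊢
    rw [Real.norm_eq_abs]
    refine this.trans (le_of_eq (by ring)))
  simpa using this
lemma gh_hess_nonneg (h : LC N b) (y v : EE n) : 0 ≤ gF N (DP v (DP v 1)) y := by
  have hc : ConvexOn ℝ univ (fun t : ℝ => gh N (y + t • v)) := by
    have := (gh_conv h).comp_affineMap (AffineMap.lineMap y (y + v) : ℝ →ᵃ[ℝ] EE n)
    simpa [Function.comp_def, AffineMap.lineMap_apply, add_comm] using this
  have hm : Monotone (fun t : ℝ => gF N (DP v 1) (y + t • v)) := by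
    have h1 := hc.monotoneOn_deriv fun t _ => (gh_line h y v t).differentiableAt
    have h2 : deriv (fun t : ℝ => gh N (y + t • v)) = fun t => gF N (DP v 1) (y + t • v) :=
      funext fun t => (gh_line h y v t).deriv
    rw [h2] at h1
    exact monotoneOn_univ.1 h1
  have h3 := gF_deriv h.pg (DP v 1) y v 0
  rw [zero_smul, add_zero] at h3
  rw [← h3.deriv]
  exact hm.deriv_nonneg
end Moll
end

section
section Body
variable {n : ℕ} {N : EE n → ℝ} {b : ℝ}
lemma gF_int (hN : PG N) (P : PP n) (y : EE n) :
    Integrable (fun z => N (y + z) * ev P z) (stdGaussian (EE n)) := by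
  refine PG.intble (PG.mul ?_ (ev_pg P))
  obtain ⟨c, C, k, hC, h⟩ := hN
  refine ⟨by fun_prop, C * (1 + ‖y‖) ^ k, k, by positivity, fun z => (h _).trans ?_⟩
  rw [mul_assoc, ← mul_pow]
  have : ‖y + z‖ ≤ ‖y‖ + ‖z‖ := norm_add_le _ _
  have := mul_nonneg (norm_nonneg y) (norm_nonneg z)
  gcongr
  nlinarith
lemma gF_sum (hN : PG N) {ι : Type*} (s : Finset ι) (c : ι → ℝ) (P : ι → PP n) (y : EE n) :
    gF N (∑ i ∈ s, c i • P i) y = ∑ i ∈ s, c i * gF N (P i) y := by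
  unfold gF
  simp_rw [← integral_const_mul]
  rw [← integral_finset_sum _ fun i _ => (gF_int hN (P i) y).const_mul (c i)]
  congr 1; ext z
  rw [ev_sum, Finset.mul_sum]
  exact Finset.sum_congr rfl fun i _ => by rw [ev_smul]; ring
lemma DP_sum (v : EE n) (P : PP n) : DP v P = ∑ i, v i • DP (bs i) P := by
  have hl : Pot.lin (fun i => v i) = ∑ i, v i • Pot.lin (fun j => (bs i : EE n) j) := by
    simp [Pot.lin, Pi.single_apply]
  simp only [DP, smul_sub, Finset.sum_sub_distrib]
  rw [hl, Finset.sum_mul]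
  congr 1
  · exact Finset.sum_congr rfl fun i _ => by rw [smul_mul_assoc]
  · exact Finset.sum_congr rfl fun i _ => by simp [Pi.single_apply]
lemma DP_lin {ι : Type*} (s : Finset ι) (c : ι → ℝ) (P : ι → PP n) (v : EE n) :
    DP v (∑ i ∈ s, c i • P i) = ∑ i ∈ s, c i • DP v (P i) := by
  simp only [DP, smul_sub, Finset.sum_sub_distrib, Finset.mul_sum, mul_smul_comm]
  congr 1
  simp only [pd, map_sum, map_smul, Finset.smul_sum]
  rw [Finset.sum_comm]
  exact Finset.sum_congr rfl fun i _ => Finset.sum_congr rfl fun j _ => by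
    rw [Derivation.map_smul, smul_comm]
lemma hess_sum (hN : PG N) (v y : EE n) : gF N (DP v (DP v 1)) y =
    ∑ i, ∑ j, gF N (DP (bs j) (DP (bs i) 1)) y * v i * v j := by
  rw [DP_sum v 1, DP_lin, gF_sum hN]
  refine Finset.sum_congr rfl fun i _ => ?_
  rw [DP_sum, gF_sum hN, Finset.mul_sum]
  exact Finset.sum_congr rfl fun j _ => by ring
lemma grad_sum (hN : PG N) (v y : EE n) : gF N (DP v 1) y = ∑ i, v i * gF N (DP (bs i) 1) y := by
  rw [DP_sum v 1, gF_sum hN]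
lemma gF_lip (h : LC N b) (P : PP n) (x y : EE n) :
    |gF N P x - gF N P y| ≤ b * ‖x - y‖ * ∫ z, |ev P z| ∂(stdGaussian (EE n)) := by
  unfold gF
  rw [← integral_sub (gF_int h.pg P x) (gF_int h.pg P y), ← integral_const_mul, ← Real.norm_eq_abs]
  refine norm_integral_le_of_norm_le (((ev_pg P).intble.abs).const_mul _)
    (Filter.Eventually.of_forall fun z => ?_)
  rw [← sub_mul, norm_mul, Real.norm_eq_abs, Real.norm_eq_abs]
  exact mul_le_mul_of_nonneg_right (by simpa using h.lip (x + z) (y + z)) (abs_nonneg _)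
lemma hess_bd (h : LC N b) (P : PP n) (v y : EE n) :
    |gF N (DP v P) y| ≤ b * ‖v‖ * ∫ z, |ev P z| ∂(stdGaussian (EE n)) := by
  have hb : 0 ≤ b * ‖v‖ := by simpa using (abs_nonneg _).trans (h.lip v 0)
  have h0 : 0 ≤ ∫ z, |ev P z| ∂(stdGaussian (EE n)) := integral_nonneg fun z => abs_nonneg _
  have h1 := gF_deriv h.pg P y v 0
  rw [zero_smul, add_zero] at h1
  have := h1.le_of_lip' (C := b * ‖v‖ * ∫ z, |ev P z| ∂(stdGaussian (EE n))) (by positivity)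
    (Filter.Eventually.of_forall fun t => by
    have := gF_lip h P (y + t • v) (y + (0:ℝ) • v)
    simp only [add_sub_add_left_eq_sub, zero_smul, sub_zero, norm_smul] at this ⊢
    rw [Real.norm_eq_abs]
    refine this.trans (le_of_eq (by ring)))
  simpa using this
lemma gh_nonneg (h : ∀ x, 0 ≤ N x) (y : EE n) : 0 ≤ gh N y := integral_nonneg fun z => h _
lemma HL.scale {f : EE n → ℝ} {f' : ℝ} {s : ℝ} {x : EE n} {i : Fin n}
    (h : HasDerivAt (fun t : ℝ => f (s • x + t • bs i)) f' 0) : HL (fun x => f (s • x)) (s * f') x i := by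
  unfold HL
  have h1 : HasDerivAt (fun t : ℝ => s * t) s 0 := by simpa using (hasDerivAt_id (0:ℝ)).const_mul s
  have h2 := HasDerivAt.comp (h₂ := fun t : ℝ => f (s • x + t • bs i)) (h := fun t : ℝ => s * t) (0:ℝ)
    (by simpa using h) h1
  refine (h2.congr_deriv (mul_comm _ _)).congr_of_eventuallyEq (Filter.Eventually.of_forall fun t => ?_)
  simp [smul_smul]
lemma HL.inv {f : EE n → ℝ} {f' : ℝ} {x : EE n} {i : Fin n} (h : HL f f' x i) (h0 : f x ≠ 0) :
    HL (fun x => (f x)⁻¹) (- f' * (f x)⁻¹ ^ 2) x i := by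
  have := HasDerivAt.fun_inv h (by simpa using h0)
  unfold HL
  refine this.congr_deriv ?_
  simp; ring
structure SC (n : ℕ) where
  W : EE n → ℝ
  Wi : Fin n → EE n → ℝ
  Wij : Fin n → Fin n → EE n → ℝ
  j : ℝ
  B : ℝ
  hj : 0 ≤ j
  hB : 0 ≤ B
  W0 : ∀ x, 0 ≤ W x
  cW : Continuous W
  cWi : ∀ i, Continuous (Wi i)
  cWij : ∀ i k, Continuous (Wij i k)
  hW : ∀ i x, HL W (Wi i x) x i
  hWi : ∀ i k x, HL (Wi i) (Wij i k x) x k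
  bWij : ∀ i k x, |Wij i k x| ≤ B
  gr : ∀ x (v : Fin n → ℝ), (∑ i, v i * Wi i x) ^ 2 ≤ j ^ 2 * ∑ i, v i ^ 2
  hs : ∀ x (v : Fin n → ℝ), 0 ≤ ∑ i, ∑ k, Wij i k x * v i * v k
lemma SC.bWi (S : SC n) (i x) : |S.Wi i x| ≤ S.j := by
  have := S.gr x (Pi.single i 1)
  simp [Pi.single_apply] at this
  exact abs_le_of_sq_le_sq this S.hj
lemma SC.bWW (S : SC n) (i k x) : |S.Wi i x * S.Wi k x| ≤ S.j * S.j := by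
  rw [abs_mul]; exact mul_le_mul (S.bWi i x) (S.bWi k x) (abs_nonneg _) S.hj
def SC.pot (S : SC n) (ε : ℝ) (hε : 0 < ε) (hδ : 2 * ε * S.j ^ 2 < 1) : Pot n :=
  have hpos : ∀ x, 0 < 1 + ε * S.W x := fun x => by have := S.W0 x; positivity
  have hU0 : ∀ x, 0 < (1 + ε * S.W x)⁻¹ := fun x => inv_pos.2 (hpos x)
  have hU1 : ∀ x, (1 + ε * S.W x)⁻¹ ≤ 1 := fun x => inv_le_one_of_one_le₀ (by
    have := S.W0 x; have : 0 ≤ ε * S.W x := by positivity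
    linarith)
  have cU : Continuous fun x => (1 + ε * S.W x)⁻¹ := by
    have := S.cW
    exact (by fun_prop : Continuous fun x => 1 + ε * S.W x).inv₀ fun x => (hpos x).ne'
  have hU : ∀ i x, HL (fun x => (1 + ε * S.W x)⁻¹) (- (ε * S.Wi i x) * (1 + ε * S.W x)⁻¹ ^ 2) x i := fun i x => by
    have h1 := (HL.const (x := x) (i := i) 1).add ((S.hW i x).const_mul ε)
    have := h1.inv (hpos x).ne'
    simpa using this
  have hjB := S.hj
  have hBB := S.hB
  have hp2 : ∀ x, (1 + ε * S.W x)⁻¹ ^ 2 ≤ 1 := fun x => pow_le_one₀ (hU0 x).le (hU1 x)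
  have hp3 : ∀ x, (1 + ε * S.W x)⁻¹ ^ 3 ≤ 1 := fun x => pow_le_one₀ (hU0 x).le (hU1 x)
  { ψ := fun x => S.W x * (1 + ε * S.W x)⁻¹
    d := fun i x => S.Wi i x * (1 + ε * S.W x)⁻¹ ^ 2
    dd := fun i k x => S.Wij i k x * (1 + ε * S.W x)⁻¹ ^ 2 - 2 * ε * (S.Wi i x * S.Wi k x) * (1 + ε * S.W x)⁻¹ ^ 3
    M := ε⁻¹ + S.j + (S.B + 2 * ε * (S.j * S.j))
    δ := 2 * ε * S.j ^ 2
    cψ := S.cW.mul cU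
    cd := fun i => (S.cWi i).mul (cU.pow 2)
    cdd := fun i k => ((S.cWij i k).mul (cU.pow 2)).sub ((((S.cWi i).mul (S.cWi k)).const_mul (2 * ε)).mul (cU.pow 3))
    bψ := fun x => by
      have h1 : S.W x * (1 + ε * S.W x)⁻¹ ≤ ε⁻¹ := by
        rw [← div_eq_mul_inv, div_le_iff₀ (hpos x), mul_add, ← mul_assoc, inv_mul_cancel₀ hε.ne']
        have : 0 < ε⁻¹ := by positivity
        linarith
      rw [abs_of_nonneg (mul_nonneg (S.W0 x) (hU0 x).le)]
      have : 0 ≤ 2 * ε * (S.j * S.j) := by positivity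
      linarith
    bd := fun i x => by
      rw [abs_mul, abs_of_pos (pow_pos (hU0 x) 2)]
      have := mul_le_mul (S.bWi i x) (hp2 x) (pow_pos (hU0 x) 2).le hjB
      have : 0 ≤ 2 * ε * (S.j * S.j) := by positivity
      have : 0 < ε⁻¹ := by positivity
      linarith
    bdd := fun i k x => by
      refine (abs_sub _ _).trans ?_
      rw [abs_mul, abs_mul, abs_of_pos (pow_pos (hU0 x) 2), abs_of_pos (pow_pos (hU0 x) 3), abs_mul (2 * ε),
        abs_of_pos (by positivity : 0 < 2 * ε)]
      have h1 := mul_le_mul (S.bWij i k x) (hp2 x) (pow_pos (hU0 x) 2).le hBB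
      have h2 := mul_le_mul (mul_le_mul_of_nonneg_left (S.bWW i k x) (by positivity : 0 ≤ 2 * ε)) (hp3 x)
        (pow_pos (hU0 x) 3).le (by positivity)
      have : 0 < ε⁻¹ := by positivity
      linarith
    hd := fun i x => by
      refine ((S.hW i x).mul (hU i x)).congr ?_
      have : (1 + ε * S.W x)⁻¹ * (1 + ε * S.W x) = 1 := inv_mul_cancel₀ (hpos x).ne'
      linear_combination (- S.Wi i x * (1 + ε * S.W x)⁻¹) * this
    hdd := fun i k x => by
      have := ((S.hWi i k x).mul ((hU k x).mul (hU k x)))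
      simp only [← sq] at this
      refine this.congr ?_
      ring
    conv := fun x v => by
      have h1 := S.hs x v
      have h2 := S.gr x v
      have e : ∑ i, ∑ k, (S.Wij i k x * (1 + ε * S.W x)⁻¹ ^ 2 - 2 * ε * (S.Wi i x * S.Wi k x) * (1 + ε * S.W x)⁻¹ ^ 3)
          * v i * v k = (1 + ε * S.W x)⁻¹ ^ 2 * (∑ i, ∑ k, S.Wij i k x * v i * v k) -
          2 * ε * ((1 + ε * S.W x)⁻¹ ^ 3 * (∑ i, v i * S.Wi i x) ^ 2) := by
        rw [sq (∑ i, v i * S.Wi i x), Finset.sum_mul_sum]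
        simp only [Finset.mul_sum, ← Finset.sum_sub_distrib]
        exact Finset.sum_congr rfl fun i _ => Finset.sum_congr rfl fun k _ => by ring
      rw [e]
      have h3 : (1 + ε * S.W x)⁻¹ ^ 3 * (∑ i, v i * S.Wi i x) ^ 2 ≤ 1 * (S.j ^ 2 * ∑ i, v i ^ 2) :=
        mul_le_mul (hp3 x) h2 (sq_nonneg _) zero_le_one
      have h4 : 0 ≤ (1 + ε * S.W x)⁻¹ ^ 2 * (∑ i, ∑ k, S.Wij i k x * v i * v k) := by
        have := hU0 x; positivity
      nlinarith
    hδ := hδ }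
def LC.sc (h : LC N b) (h0 : ∀ x, 0 ≤ N x) (j s : ℝ) (hj : 0 < j) (hs : 0 < s) (hb : b * s ≤ 1) : SC n :=
  have hnn : ∀ i k, 0 ≤ j * (s * (s * (b * ‖(bs k : EE n)‖ * ∫ z, |ev (DP (bs i) 1) z| ∂(stdGaussian (EE n))))) :=
      fun i k => by
        have := (abs_nonneg _).trans (hess_bd h (DP (bs i) 1) (bs k) 0)
        positivity
  { W := fun x => j * gh N (s • x)
    Wi := fun i x => j * (s * gF N (DP (bs i) 1) (s • x))
    Wij := fun i k x => j * (s * (s * gF N (DP (bs k) (DP (bs i) 1)) (s • x)))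
    j := j
    B := ∑ i, ∑ k, j * (s * (s * (b * ‖(bs k : EE n)‖ * ∫ z, |ev (DP (bs i) 1) z| ∂(stdGaussian (EE n)))))
    hj := hj.le
    hB := Finset.sum_nonneg fun i _ => Finset.sum_nonneg fun k _ => hnn i k
    W0 := fun x => mul_nonneg hj.le (gh_nonneg h0 _)
    cW := by
      have := gF_cont h.pg 1
      rw [← gh_eq] at this
      fun_prop
    cWi := fun i => by
      have := gF_cont h.pg (DP (bs i) 1)
      fun_prop
    cWij := fun i k => by
      have := gF_cont h.pg (DP (bs k) (DP (bs i) 1))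
      fun_prop
    hW := fun i x => by
      have h1 := gh_line h (s • x) (bs i) 0
      rw [zero_smul, add_zero] at h1
      exact (HL.scale h1).const_mul j
    hWi := fun i k x => by
      have h1 := gF_deriv h.pg (DP (bs i) 1) (s • x) (bs k) 0
      rw [zero_smul, add_zero] at h1
      exact ((HL.scale h1).const_mul s).const_mul j
    bWij := fun i k x => by
      have h1 : |j * (s * (s * gF N (DP (bs k) (DP (bs i) 1)) (s • x)))| ≤
          j * (s * (s * (b * ‖(bs k : EE n)‖ * ∫ z, |ev (DP (bs i) 1) z| ∂(stdGaussian (EE n))))) := by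
        rw [abs_mul, abs_mul, abs_mul, abs_of_pos hj, abs_of_pos hs]
        have := hess_bd h (DP (bs i) 1) (bs k) (s • x)
        gcongr
      refine h1.trans ?_
      refine le_trans ?_ (Finset.single_le_sum (fun i _ => Finset.sum_nonneg fun k _ => hnn i k) (Finset.mem_univ i))
      exact Finset.single_le_sum (fun k _ => hnn i k) (Finset.mem_univ k)
    gr := fun x v => by
      have h1 := gh_grad_le h (s • x) (WithLp.toLp 2 v)
      rw [grad_sum h.pg] at h1
      have e : ∑ i, v i * (j * (s * gF N (DP (bs i) 1) (s • x))) =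
          j * (s * ∑ i, v i * gF N (DP (bs i) 1) (s • x)) := by
        simp only [Finset.mul_sum]; exact Finset.sum_congr rfl fun i _ => by ring
      rw [e, mul_pow]
      refine mul_le_mul_of_nonneg_left ?_ (sq_nonneg j)
      have e2 : ∑ i, v i ^ 2 = ‖(WithLp.toLp 2 v : EE n)‖ ^ 2 := by
        rw [EuclideanSpace.norm_sq_eq]; simp
      rw [e2]
      refine sq_le_sq' ?_ ?_
      · have := (abs_le.1 h1).1
        have h3 := norm_nonneg (WithLp.toLp 2 v : EE n)
        simp only at this
        nlinarith
      · have := (abs_le.1 h1).2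
        have h3 := norm_nonneg (WithLp.toLp 2 v : EE n)
        simp only at this
        nlinarith
    hs := fun x v => by
      have h1 := gh_hess_nonneg h (s • x) (WithLp.toLp 2 v)
      rw [hess_sum h.pg] at h1
      have e : ∑ i, ∑ k, j * (s * (s * gF N (DP (bs k) (DP (bs i) 1)) (s • x))) * v i * v k =
          j * (s * (s * ∑ i, ∑ k, gF N (DP (bs k) (DP (bs i) 1)) (s • x) * v i * v k)) := by
        simp only [Finset.mul_sum]
        exact Finset.sum_congr rfl fun i _ => Finset.sum_congr rfl fun k _ => by ring
      rw [e]
      simp only at h1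
      positivity }
end Body
end

section
open Filter Topology
section Body
variable {n : ℕ} {K : Set (EE n)}
lemma infDist_convex (hK : Convex ℝ K) (hne : K.Nonempty) : ConvexOn ℝ univ (fun x => infDist x K) := by
  refine ⟨convex_univ, fun x _ y _ a b ha hb hab => ?_⟩
  simp only [smul_eq_mul]
  refine le_of_forall_pos_le_add fun e he => ?_
  obtain ⟨p, hp, hp'⟩ := (infDist_lt_iff hne).1 (lt_add_of_pos_right (infDist x K) he)
  obtain ⟨q, hq, hq'⟩ := (infDist_lt_iff hne).1 (lt_add_of_pos_right (infDist y K) he)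
  refine (infDist_le_dist_of_mem (hK hp hq ha hb hab)).trans ?_
  rw [dist_eq_norm] at *
  have e1 : a • x + b • y - (a • p + b • q) = a • (x - p) + b • (y - q) := by
    rw [smul_sub, smul_sub]; abel
  rw [e1]
  refine (norm_add_le _ _).trans ?_
  rw [norm_smul, norm_smul, Real.norm_of_nonneg ha, Real.norm_of_nonneg hb]
  have h1 := mul_le_mul_of_nonneg_left hp'.le ha
  have h2 := mul_le_mul_of_nonneg_left hq'.le hb
  have h3 : a * e + b * e = e := by rw [← add_mul, hab, one_mul]
  linarith
lemma infDist_lc (hK : Convex ℝ K) (hne : K.Nonempty) (s : ℝ) (hs : 0 < s) :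
    LC (fun z : EE n => infDist (s • z) K) s := by
  refine ⟨fun x y => ?_, ?_⟩
  · have := (lipschitz_infDist_pt K).dist_le_mul (s • x) (s • y)
    rw [Real.dist_eq, dist_eq_norm, ← smul_sub, norm_smul, Real.norm_of_nonneg hs.le] at this
    simpa using this
  · have := (infDist_convex hK hne).comp_linearMap (s • LinearMap.id : EE n →ₗ[ℝ] EE n)
    simpa [Function.comp_def] using this
lemma gh_close (hK : Convex ℝ K) (hne : K.Nonempty) (s : ℝ) (hs : 0 < s) (x : EE n) :
    |gh (fun z : EE n => infDist (s • z) K) (s⁻¹ • x) - infDist x K| ≤ s * ∫ z, ‖z‖ ∂(stdGaussian (EE n)) := by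
  have h := infDist_lc hK hne s hs
  unfold gh
  have e1 : infDist x K = ∫ z, infDist x K ∂(stdGaussian (EE n)) := by simp
  rw [e1]
  rw [← integral_sub (h.int _) (integrable_const _), ← integral_const_mul, ← Real.norm_eq_abs]
  refine norm_integral_le_of_norm_le (PG.norm'.intble.const_mul s) (Eventually.of_forall fun z => ?_)
  have := h.lip (s⁻¹ • x + z) (s⁻¹ • x)
  simp only [smul_smul, mul_inv_cancel₀ hs.ne', one_smul, add_sub_cancel_left] at this
  simpa using this
lemma exists_approx (hK : Convex ℝ K) (hc : IsClosed K) (hne : K.Nonempty) :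
    ∃ Q : ℕ → Pot n, (∀ m, (Q m).δ = 2 / (m + 3)) ∧ (∀ m x, 0 ≤ (Q m).ψ x) ∧
      (∀ x ∈ K, Tendsto (fun m => rexp (- (Q m).ψ x)) atTop (𝓝 1)) ∧
      (∀ x ∉ K, Tendsto (fun m => rexp (- (Q m).ψ x)) atTop (𝓝 0)) := by
  have hJ : ∀ m : ℕ, (0:ℝ) < m + 3 := fun m => by positivity
  let s : ℕ → ℝ := fun m => ((m + 3 : ℝ) ^ 2)⁻¹
  have hs : ∀ m, 0 < s m := fun m => by have := hJ m; positivity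
  let ε : ℕ → ℝ := fun m => ((m + 3 : ℝ) ^ 3)⁻¹
  have hε : ∀ m, 0 < ε m := fun m => by have := hJ m; positivity
  let S : ℕ → SC n := fun m => (infDist_lc hK hne (s m) (hs m)).sc (fun x => infDist_nonneg) (m + 3) (s m)⁻¹
    (hJ m) (inv_pos.2 (hs m)) (by rw [mul_inv_cancel₀ (hs m).ne'])
  have hd : ∀ m, 2 * ε m * (S m).j ^ 2 = 2 / (m + 3) := fun m => by
    have := hJ m
    change 2 * ((m + 3 : ℝ) ^ 3)⁻¹ * (m + 3 : ℝ) ^ 2 = _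
    field_simp
  let Q : ℕ → Pot n := fun m => (S m).pot (ε m) (hε m) (by
    rw [hd, div_lt_one (hJ m)]; have : (0:ℝ) ≤ m := by positivity
    linarith)
  set I := ∫ z, ‖z‖ ∂(stdGaussian (EE n)) with hI
  have hI0 : 0 ≤ I := integral_nonneg fun z => norm_nonneg _
  have hψ : ∀ m x, (Q m).ψ x = (S m).W x * (1 + ε m * (S m).W x)⁻¹ := fun m x => rfl
  have hW : ∀ m x, (S m).W x = (m + 3) * gh (fun z : EE n => infDist (s m • z) K) ((s m)⁻¹ • x) := fun m x => rfl
  have hW0 := fun m x => (S m).W0 x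
  have hψ0 : ∀ m x, 0 ≤ (Q m).ψ x := fun m x => by
    rw [hψ]; have := hW0 m x; have := hε m; positivity
  refine ⟨Q, hd, hψ0, fun x hx => ?_, fun x hx => ?_⟩
  · have h1 : Tendsto (fun m => (Q m).ψ x) atTop (𝓝 0) := by
      refine squeeze_zero (fun m => hψ0 m x) (g := fun m : ℕ => I * (1 / ((m : ℝ) + 3))) (fun m => ?_) ?_
      · have h2 := gh_close hK hne (s m) (hs m) x
        rw [infDist_zero_of_mem hx, sub_zero] at h2
        have h3 := (le_abs_self _).trans h2
        have h4 : (Q m).ψ x ≤ (S m).W x := by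
          rw [hψ]
          refine mul_le_of_le_one_right (hW0 m x) (inv_le_one_of_one_le₀ ?_)
          have := mul_nonneg (hε m).le (hW0 m x); linarith
        refine h4.trans ?_
        rw [hW]
        refine (mul_le_mul_of_nonneg_left h3 (hJ m).le).trans (le_of_eq ?_)
        have := hJ m
        simp only [s]; rw [← hI]; field_simp
      · have := (tendsto_one_div_add_atTop_nhds_zero_nat (𝕜 := ℝ)).comp (tendsto_add_atTop_nat 2)
        have h5 : Tendsto (fun m : ℕ => 1 / ((m : ℝ) + 3)) atTop (𝓝 0) := by
          refine this.congr fun m => ?_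
          simp; ring
        simpa using h5.const_mul I
    have h9 := (Real.continuous_exp.tendsto _).comp h1.neg
    rw [neg_zero, Real.exp_zero] at h9
    exact h9
  · have hpos : 0 < infDist x K := (hc.notMem_iff_infDist_pos hne).1 hx
    set D := infDist x K with hD
    have h1 : Tendsto (fun m => (Q m).ψ x) atTop atTop := by
      have ht : Tendsto (fun m : ℕ => ((m : ℝ) + 3) * ((D / 2) / (1 + D))) atTop atTop :=
        (tendsto_atTop_add_const_right _ _ tendsto_natCast_atTop_atTop).atTop_mul_const (by positivity)
      refine tendsto_atTop_mono' _ ?_ ht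
      obtain ⟨m0, hm0⟩ := exists_nat_ge (2 * I / D)
      filter_upwards [eventually_ge_atTop m0] with m hm
      have hm' : 2 * I / D ≤ m := hm0.trans (by exact_mod_cast hm)
      rw [div_le_iff₀ hpos] at hm'
      have h2 := (abs_le.1 (gh_close hK hne (s m) (hs m) x)).1
      have h3 : s m * I ≤ D / 2 := by
        simp only [s]
        have h4 : I ≤ (m + 3 : ℝ) ^ 2 * (D / 2) := by
          have : (0:ℝ) ≤ m := by positivity
          nlinarith [mul_nonneg this hpos.le, mul_nonneg this (mul_nonneg this hpos.le)]
        rw [inv_mul_le_iff₀ (by have := hJ m; positivity)]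
        exact h4
      have h5 : (m + 3 : ℝ) * (D / 2) ≤ (S m).W x := by
        rw [hW]; exact mul_le_mul_of_nonneg_left (by linarith) (hJ m).le
      have hw := hW0 m x
      have he := hε m
      have hj := hJ m
      rw [hψ, ← div_eq_mul_inv, mul_div_assoc', div_le_div_iff₀ (by positivity) (by positivity)]
      have h6 : ε m * ((m + 3 : ℝ) * (D / 2)) ≤ D := by
        have : ε m * (m + 3) = ((m + 3 : ℝ) ^ 2)⁻¹ := by simp only [ε]; field_simp
        rw [← mul_assoc, this]
        have : ((m + 3 : ℝ) ^ 2)⁻¹ ≤ 1 := inv_le_one_of_one_le₀ (by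
          have : (0:ℝ) ≤ m := by positivity
          nlinarith)
        nlinarith
      nlinarith [mul_le_mul_of_nonneg_right h6 hw]
    exact Real.tendsto_exp_neg_atTop_nhds_zero.comp h1
def eK (K : Set (EE n)) (f : EE n → ℝ) : ℝ :=
  (∫ x in K, f x ∂(stdGaussian (EE n))) / (∫ x in K, 1 ∂(stdGaussian (EE n)))
lemma tendsto_num (Q : ℕ → Pot n) (hm : MeasurableSet K) (h0 : ∀ m x, 0 ≤ (Q m).ψ x)
    (h1 : ∀ x ∈ K, Tendsto (fun m => rexp (- (Q m).ψ x)) atTop (𝓝 1))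
    (h2 : ∀ x ∉ K, Tendsto (fun m => rexp (- (Q m).ψ x)) atTop (𝓝 0)) {f : EE n → ℝ} (hf : PG f) :
    Tendsto (fun m => ∫ x, rexp (- (Q m).ψ x) * f x ∂(stdGaussian (EE n))) atTop
      (𝓝 (∫ x in K, f x ∂(stdGaussian (EE n)))) := by
  rw [← integral_indicator hm]
  refine tendsto_integral_of_dominated_convergence (fun x => |f x|)
    (fun m => ((Q m).cexp.mul hf.cont).aestronglyMeasurable) hf.intble.abs
    (fun m => Eventually.of_forall fun x => ?_) (Eventually.of_forall fun x => ?_)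
  · rw [norm_mul, Real.norm_eq_abs, Real.norm_eq_abs, abs_of_pos (exp_pos _)]
    exact mul_le_of_le_one_left (abs_nonneg _) (Real.exp_le_one_iff.2 (by linarith [h0 m x]))
  · by_cases hx : x ∈ K
    · rw [indicator_of_mem hx]; simpa using (h1 x hx).mul_const (f x)
    · rw [indicator_of_notMem hx]; simpa using (h2 x hx).mul_const (f x)
lemma tendsto_eK (Q : ℕ → Pot n) (hm : MeasurableSet K) (hK : stdGaussian (EE n) K ≠ 0) (h0 : ∀ m x, 0 ≤ (Q m).ψ x)
    (h1 : ∀ x ∈ K, Tendsto (fun m => rexp (- (Q m).ψ x)) atTop (𝓝 1))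
    (h2 : ∀ x ∉ K, Tendsto (fun m => rexp (- (Q m).ψ x)) atTop (𝓝 0)) {f : EE n → ℝ} (hf : PG f) :
    Tendsto (fun m => ∫ x, f x ∂(Q m).m) atTop (𝓝 (eK K f)) := by
  have a1 := tendsto_num Q hm h0 h1 h2 hf
  have a2 := tendsto_num Q hm h0 h1 h2 (PG.const (E := EE n) 1)
  have hne : (∫ x in K, (1:ℝ) ∂(stdGaussian (EE n))) ≠ 0 := by
    simp [Measure.real, ENNReal.toReal_eq_zero_iff, hK]
  refine (a1.div a2 hne).congr fun m => ?_
  rw [Pot.integral_m']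
  simp only [Pi.div_apply, mul_one]
  rw [div_eq_inv_mul]
  rfl
def vK (K : Set (EE n)) (p : PP n) : ℝ := eK K (fun x => ev p x ^ 2) - eK K (ev p) ^ 2
def gK (K : Set (EE n)) (p : PP n) : ℝ := eK K (fun x => ∑ i, ev (pd i p) x ^ 2)
lemma Pot.V_lin (Q : Pot n) (θ : Fin n → ℝ) : Q.V (Pot.lin θ) = ∑ i, ∑ k, θ i * θ k *
    (∫ x, x i * x k ∂Q.m - (∫ x, x i ∂Q.m) * (∫ x, x k ∂Q.m)) := by
  unfold Pot.V
  simp_rw [Pot.ev_lin]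
  have e1 : ∀ x : EE n, (∑ i, θ i * x i) ^ 2 = ∑ i, ∑ k, θ i * θ k * (x i * x k) := fun x => by
    rw [sq, Finset.sum_mul_sum]
    exact Finset.sum_congr rfl fun i _ => Finset.sum_congr rfl fun k _ => by ring
  simp_rw [e1]
  have p1 : ∀ i k, PG (fun x : EE n => x i * x k) := fun i k => (PG.coord i).mul (PG.coord k)
  rw [integral_finset_sum _ fun i _ => Q.intble (PG.sum _ fun k _ => (p1 i k).const_mul _),
    integral_finset_sum _ fun i _ => Q.intble ((PG.coord i).const_mul _)]
  simp_rw [fun i => integral_finset_sum (μ := Q.m) Finset.univ fun k _ => Q.intble ((p1 i k).const_mul (θ i * θ k)),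
    integral_const_mul]
  rw [sq, Finset.sum_mul_sum, ← Finset.sum_sub_distrib]
  simp_rw [← Finset.sum_sub_distrib]
  exact Finset.sum_congr rfl fun i _ => Finset.sum_congr rfl fun k _ => by ring
lemma bodyPoincare (hK : Convex ℝ K) (hc : IsClosed K) (hne : K.Nonempty) (hK0 : stdGaussian (EE n) K ≠ 0)
    {a : ℝ} (ha0 : 0 ≤ a)
    (ha : ∀ θ : Fin n → ℝ, ∑ i, ∑ k, θ i * θ k * (eK K (fun x => x i * x k) - eK K (fun x => x i) * eK K (fun x => x k))
      ≤ a * ∑ i, θ i ^ 2) (p : PP n) : vK K p ≤ √a * gK K p := by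
  obtain ⟨Q, hδ, h0, h1, h2⟩ := exists_approx hK hc hne
  have T : ∀ {f : EE n → ℝ}, PG f → Tendsto (fun m => ∫ x, f x ∂(Q m).m) atTop (𝓝 (eK K f)) :=
    fun hf => tendsto_eK Q hc.measurableSet hK0 h0 h1 h2 hf
  let A : Fin n → Fin n → ℝ := fun i k => eK K (fun x => x i * x k) - eK K (fun x => x i) * eK K (fun x => x k)
  let Am : ℕ → Fin n → Fin n → ℝ := fun m i k => ∫ x, x i * x k ∂(Q m).m - (∫ x, x i ∂(Q m).m) * (∫ x, x k ∂(Q m).m)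
  have hA : ∀ i k, Tendsto (fun m => Am m i k) atTop (𝓝 (A i k)) := fun i k =>
    (T ((PG.coord i).mul (PG.coord k))).sub ((T (PG.coord i)).mul (T (PG.coord k)))
  let am : ℕ → ℝ := fun m => a + ∑ i, ∑ k, |Am m i k - A i k|
  have ham : Tendsto am atTop (𝓝 a) := by
    have : Tendsto am atTop (𝓝 (a + ∑ i : Fin n, ∑ k : Fin n, |A i k - A i k|)) :=
      tendsto_const_nhds.add (tendsto_finset_sum _ fun i _ => tendsto_finset_sum _ fun k _ =>
        ((hA i k).sub_const _).abs)
    simpa using this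
  have ham0 : ∀ m, 0 ≤ am m := fun m => add_nonneg ha0 (Finset.sum_nonneg fun i _ => Finset.sum_nonneg fun k _ => abs_nonneg _)
  have hV : ∀ m (θ : Fin n → ℝ), (Q m).V (Pot.lin θ) ≤ am m * ∑ i, θ i ^ 2 := fun m θ => by
    rw [Pot.V_lin]
    have hθ : ∀ i k, |θ i * θ k| ≤ ∑ i, θ i ^ 2 := fun i k => by
      have b1 : θ i ^ 2 ≤ ∑ i, θ i ^ 2 := Finset.single_le_sum (f := fun i => θ i ^ 2) (fun i _ => sq_nonneg _) (Finset.mem_univ i)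
      have b2 : θ k ^ 2 ≤ ∑ i, θ i ^ 2 := Finset.single_le_sum (f := fun i => θ i ^ 2) (fun i _ => sq_nonneg _) (Finset.mem_univ k)
      rw [abs_le]; constructor <;> nlinarith [sq_nonneg (θ i + θ k), sq_nonneg (θ i - θ k)]
    have : ∑ i, ∑ k, θ i * θ k * Am m i k = ∑ i, ∑ k, θ i * θ k * A i k + ∑ i, ∑ k, θ i * θ k * (Am m i k - A i k) := by
      simp only [← Finset.sum_add_distrib]
      exact Finset.sum_congr rfl fun i _ => Finset.sum_congr rfl fun k _ => by ring
    change ∑ i, ∑ k, θ i * θ k * Am m i k ≤ _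
    rw [this]
    have b3 : ∑ i, ∑ k, θ i * θ k * (Am m i k - A i k) ≤ (∑ i, ∑ k, |Am m i k - A i k|) * ∑ i, θ i ^ 2 := by
      rw [Finset.sum_mul]
      refine Finset.sum_le_sum fun i _ => ?_
      rw [Finset.sum_mul]
      refine Finset.sum_le_sum fun k _ => ?_
      refine (le_abs_self _).trans ?_
      rw [abs_mul, mul_comm]
      exact mul_le_mul_of_nonneg_left (hθ i k) (abs_nonneg _)
    have b4 := ha θ
    simp only [am]
    rw [add_mul]
    exact add_le_add b4 b3
  have main : ∀ m, (Q m).V p ≤ √(am m / (1 - (Q m).δ)) * (Q m).G p := fun m =>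
    (Q m).poincare (ham0 m) (hV m) p
  have hδt : Tendsto (fun m => 1 - (Q m).δ) atTop (𝓝 (1 - 0)) := by
    refine tendsto_const_nhds.sub ?_
    simp_rw [hδ]
    exact (tendsto_const_nhds (x := (2:ℝ))).div_atTop (tendsto_atTop_add_const_right _ _ tendsto_natCast_atTop_atTop)
  have L1 : Tendsto (fun m => (Q m).V p) atTop (𝓝 (vK K p)) :=
    (T ((ev_pg p).pow 2)).sub ((T (ev_pg p)).pow 2)
  have L2 : Tendsto (fun m => √(am m / (1 - (Q m).δ)) * (Q m).G p) atTop (𝓝 (√(a / (1 - 0)) * gK K p)) :=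
    ((ham.div hδt (by norm_num)).sqrt).mul (T (PG.sum _ fun i _ => (ev_pg _).pow 2))
  simpa using le_of_tendsto_of_tendsto' L1 L2 main
end Body
end

section
section Third
variable {n : ℕ}
lemma cs_gen {Ω : Type*} [MeasurableSpace Ω] (ν : Measure Ω) {f g : Ω → ℝ} (h1 : Integrable (fun x => f x ^ 2) ν)
    (h2 : Integrable (fun x => g x ^ 2) ν) (h3 : Integrable (fun x => f x * g x) ν) :
    (∫ x, f x * g x ∂ν) ^ 2 ≤ (∫ x, f x ^ 2 ∂ν) * ∫ x, g x ^ 2 ∂ν := by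
  refine quad_cs fun s => ?_
  have h : 0 ≤ ∫ x, (s * f x + g x) ^ 2 ∂ν := integral_nonneg fun x => sq_nonneg _
  have e : ∫ x, (s * f x + g x) ^ 2 ∂ν = ∫ x, (s ^ 2 * f x ^ 2 + (2 * s) * (f x * g x)) + g x ^ 2 ∂ν := by
    congr 1; ext x; ring
  rw [e, integral_add ((h1.const_mul _).fun_add (h3.const_mul _)) h2,
    integral_add (h1.const_mul _) (h3.const_mul _), integral_const_mul, integral_const_mul] at h
  linarith
lemma third_gen (ν : Measure (EE n)) [IsProbabilityMeasure ν] (hint : ∀ f : EE n → ℝ, PG f → Integrable f ν)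
    {a c : ℝ} (ha : 0 ≤ a) (hc : 0 ≤ c) (m : Fin n → ℝ) (hm : ∀ i, ∫ x, x i ∂ν = m i)
    (hP : ∀ p : PP n, ∫ x, ev p x ^ 2 ∂ν - (∫ x, ev p x ∂ν) ^ 2 ≤ c * ∫ x, ∑ i, ev (pd i p) x ^ 2 ∂ν)
    (hcov : ∀ θ : Fin n → ℝ, ∫ x, (∑ i, θ i * (x i - m i)) ^ 2 ∂ν ≤ a * ∑ i, θ i ^ 2) (θ : Fin n → ℝ) :
    ∑ b, ∑ d, (∫ x, (∑ i, θ i * (x i - m i)) * ((x b - m b) * (x d - m d)) ∂ν) ^ 2 ≤ 4 * a ^ 2 * c * ∑ i, θ i ^ 2 := by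
  set l : EE n → ℝ := fun x => ∑ i, θ i * (x i - m i) with hl
  have pz : ∀ b, PG (fun x : EE n => x b - m b) := fun b => (PG.coord b).sub (PG.const _)
  have pl' : ∀ θ : Fin n → ℝ, PG (fun x : EE n => ∑ i, θ i * (x i - m i)) := fun θ => PG.sum _ fun i _ => (pz i).const_mul _
  have pl : PG l := pl' θ
  have l0 : ∫ x, l x ∂ν = 0 := by
    rw [integral_finset_sum _ fun i _ => hint _ ((pz i).const_mul _)]
    refine Finset.sum_eq_zero fun i _ => ?_
    rw [integral_const_mul, integral_sub (hint _ (PG.coord i)) (integrable_const _), hm]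
    simp
  set M : Fin n → Fin n → ℝ := fun b d => ∫ x, l x * ((x b - m b) * (x d - m d)) ∂ν with hM
  have Msym : ∀ b d, M b d = M d b := fun b d => by simp only [hM]; congr 1; ext x; ring
  set S := ∑ b, ∑ d, M b d ^ 2 with hS
  have S0 : 0 ≤ S := Finset.sum_nonneg fun b _ => Finset.sum_nonneg fun d _ => sq_nonneg _
  let y : Fin n → PP n := fun b => MvPolynomial.X b - MvPolynomial.C (m b)
  have evy : ∀ b x, ev (y b) x = x b - m b := fun b x => by rw [ev_sub, ev_X, ev_C]
  let p : PP n := ∑ b, ∑ d, M b d • (y b * y d)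
  have evp : ∀ x, ev p x = ∑ b, ∑ d, M b d * ((x b - m b) * (x d - m d)) := fun x => by
    simp only [p, ev_sum, ev_smul, ev_mul, evy]
  have pdp : ∀ i x, ev (pd i p) x = 2 * ∑ d, M i d * (x d - m d) := fun i x => by
    have h : ∀ b, pd i (y b) = MvPolynomial.C (if b = i then 1 else 0) := fun b => by
      simp only [y, map_sub, MvPolynomial.pderiv_C, sub_zero, MvPolynomial.pderiv_X, Pi.single_apply]
      split_ifs <;> simp_all
    simp only [p, map_sum, Derivation.map_smul, Derivation.leibniz, h, ev_sum, ev_smul, smul_eq_mul, ev_add, ev_mul, ev_C, evy]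
    simp only [mul_add, Finset.sum_add_distrib, mul_ite, mul_one, mul_zero, Finset.sum_ite_eq', Finset.mem_univ, if_true]
    rw [Finset.sum_comm (f := fun b d => if b = i then M b d * (x d - m d) else 0)]
    simp only [Finset.sum_ite_eq', Finset.mem_univ, if_true]
    rw [two_mul]; congr 1
    exact Finset.sum_congr rfl fun d _ => by rw [Msym]
  have pp : PG (ev p) := ev_pg p
  have e1 : S = ∫ x, l x * (ev p x - ∫ x, ev p x ∂ν) ∂ν := by
    have : ∫ x, l x * (ev p x - ∫ x, ev p x ∂ν) ∂ν = ∫ x, l x * ev p x ∂ν := by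
      simp only [mul_sub]
      rw [integral_sub (hint _ (pl.mul pp)) ((hint _ pl).mul_const _), integral_mul_const, l0]; simp
    rw [this]
    have h2 : ∀ x, l x * ev p x = ∑ b, ∑ d, M b d * (l x * ((x b - m b) * (x d - m d))) := fun x => by
      rw [evp]; simp only [Finset.mul_sum]
      exact Finset.sum_congr rfl fun b _ => Finset.sum_congr rfl fun d _ => by ring
    simp only [h2]
    have q : ∀ b d, PG (fun x : EE n => M b d * (l x * ((x b - m b) * (x d - m d)))) := fun b d =>
      (pl.mul ((pz b).mul (pz d))).const_mul _
    rw [integral_finset_sum _ fun b _ => hint _ (PG.sum _ fun d _ => q b d)]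
    refine Finset.sum_congr rfl fun b _ => ?_
    rw [integral_finset_sum _ fun d _ => hint _ (q b d)]
    refine Finset.sum_congr rfl fun d _ => ?_
    rw [integral_const_mul, sq]
  have pc : PG (fun x => ev p x - ∫ x, ev p x ∂ν) := pp.sub (PG.const _)
  have e2 := cs_gen ν (hint _ (pl.pow 2)) (hint _ (pc.pow 2)) (hint _ (pl.mul pc))
  rw [← e1] at e2
  have e3 : ∫ x, (ev p x - ∫ x, ev p x ∂ν) ^ 2 ∂ν = ∫ x, ev p x ^ 2 ∂ν - (∫ x, ev p x ∂ν) ^ 2 := by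
    generalize hI : ∫ x, ev p x ∂ν = I
    have : ∀ x, (ev p x - I) ^ 2 = ev p x ^ 2 + (-(2 * I)) * ev p x + I ^ 2 := fun x => by ring
    simp only [this]
    rw [integral_add ((hint _ (pp.pow 2)).fun_add ((hint _ pp).const_mul _)) (integrable_const _),
      integral_add (hint _ (pp.pow 2)) ((hint _ pp).const_mul _), integral_const_mul, hI]
    simp; ring
  have e4 : ∫ x, ∑ i, ev (pd i p) x ^ 2 ∂ν ≤ 4 * a * S := by
    simp only [pdp, mul_pow]
    rw [integral_finset_sum _ fun i _ => hint _ (((pl' (M i)).pow 2).const_mul _), hS, Finset.mul_sum]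
    refine Finset.sum_le_sum fun i _ => ?_
    rw [integral_const_mul]
    have := hcov (M i)
    nlinarith
  have e5 := hP p
  rw [← e3] at e5
  have e6 := hcov θ
  have hθ : 0 ≤ ∑ i, θ i ^ 2 := Finset.sum_nonneg fun i _ => sq_nonneg _
  have e7 : S ^ 2 ≤ (a * ∑ i, θ i ^ 2) * (c * (4 * a * S)) := by
    refine e2.trans (mul_le_mul e6 (e5.trans (mul_le_mul_of_nonneg_left e4 hc)) (integral_nonneg fun x => sq_nonneg _) (by positivity))
  rcases S0.eq_or_lt with h | h
  · rw [← h]; positivity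
  · nlinarith
end Third
structure CM (n : ℕ) where
  mu : Measure (EE n)
  prob : IsProbabilityMeasure mu
  R : ℝ
  hR : 0 ≤ R
  supp : ∀ᵐ x ∂mu, ‖x‖ ≤ R
namespace CM
variable {n : ℕ} (X : CM n)
instance : IsProbabilityMeasure X.mu := X.prob
def wt (r : ℝ) (y x : EE n) : ℝ := rexp (r * ⟪y, x⟫ - r ^ 2 * ‖x‖ ^ 2 / 2)
def N (g : EE n → ℝ) (r : ℝ) (y : EE n) : ℝ := ∫ x, g x * wt r y x ∂X.mu
def Z (r : ℝ) (y : EE n) : ℝ := X.N (fun _ => 1) r y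
def U (g : EE n → ℝ) (r : ℝ) (y : EE n) : ℝ := X.N g r y / X.Z r y
lemma bdd {g : EE n → ℝ} (hg : Continuous g) : ∃ C, 0 ≤ C ∧ ∀ᵐ x ∂X.mu, |g x| ≤ C := by
  obtain ⟨C, hC⟩ := (isCompact_closedBall (0 : EE n) X.R).exists_bound_of_continuousOn hg.continuousOn
  refine ⟨max C 0, le_max_right _ _, X.supp.mono fun x hx => ?_⟩
  exact (hC x (by simpa using hx)).trans (le_max_left _ _)
lemma intble {g : EE n → ℝ} (hg : Continuous g) : Integrable g X.mu := by
  obtain ⟨C, h0, h⟩ := X.bdd hg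
  exact Integrable.of_bound hg.aestronglyMeasurable C h
lemma wt_cont (r : ℝ) (y : EE n) : Continuous (wt r y) := by unfold wt; fun_prop
lemma Z_pos (r : ℝ) (y : EE n) : 0 < X.Z r y := by
  unfold Z N wt
  simp only [one_mul]
  exact integral_exp_pos (X.intble (wt_cont r y))
def post (r : ℝ) (y : EE n) : Measure (EE n) := X.mu.tilted (fun x => r * ⟪y, x⟫ - r ^ 2 * ‖x‖ ^ 2 / 2)
instance (r : ℝ) (y : EE n) : IsProbabilityMeasure (X.post r y) :=
  isProbabilityMeasure_tilted (X.intble (wt_cont r y))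
lemma integral_post (g : EE n → ℝ) (r : ℝ) (y : EE n) : ∫ x, g x ∂(X.post r y) = X.U g r y := by
  unfold post U N Z N wt
  rw [integral_tilted]
  simp only [one_mul, smul_eq_mul]
  rw [div_eq_inv_mul, ← integral_const_mul]
  congr 1; ext x; ring
lemma post_supp (r : ℝ) (y : EE n) : ∀ᵐ x ∂(X.post r y), ‖x‖ ≤ X.R :=
  (tilted_absolutelyContinuous _ _).ae_le X.supp
lemma post_int {g : EE n → ℝ} (hg : Continuous g) (r : ℝ) (y : EE n) : Integrable g (X.post r y) := by
  obtain ⟨C, h0, h⟩ := X.bdd hg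
  exact Integrable.of_bound hg.aestronglyMeasurable C ((tilted_absolutelyContinuous _ _).ae_le h)
lemma Z_mul_U (g : EE n → ℝ) (r : ℝ) (y : EE n) : X.Z r y * X.U g r y = X.N g r y := by
  unfold U; field_simp [(X.Z_pos r y).ne']
end CM
end

section
structure Bd (n : ℕ) where
  K : Set (EE n)
  conv : Convex ℝ K
  comp : IsCompact K
  intr : (interior K).Nonempty
namespace Bd
variable {n : ℕ} (B : Bd n)
lemma ne : B.K.Nonempty := B.intr.mono interior_subset
lemma vpos : volume B.K ≠ 0 := (isOpen_interior.measure_pos volume B.intr |>.trans_le (measure_mono interior_subset)).ne'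
lemma vfin : volume B.K ≠ ⊤ := B.comp.measure_lt_top.ne
lemma rpos : 0 < volume.real B.K := ENNReal.toReal_pos B.vpos B.vfin
def cm : CM n where
  mu := (volume B.K)⁻¹ • volume.restrict B.K
  prob := ⟨by rw [Measure.smul_apply, Measure.restrict_apply_univ, smul_eq_mul, ENNReal.inv_mul_cancel B.vpos B.vfin]⟩
  R := Classical.choose (B.comp.isBounded.subset_closedBall_lt 0 0)
  hR := (Classical.choose_spec (B.comp.isBounded.subset_closedBall_lt 0 0)).1.le
  supp := by
    refine Measure.ae_smul_measure ?_ _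
    filter_upwards [ae_restrict_mem B.comp.measurableSet] with x hx
    simpa using (Classical.choose_spec (B.comp.isBounded.subset_closedBall_lt 0 0)).2 hx
lemma mem_ae : ∀ᵐ x ∂B.cm.mu, x ∈ B.K := Measure.ae_smul_measure (ae_restrict_mem B.comp.measurableSet) _
lemma integral_cm (f : EE n → ℝ) : ∫ x, f x ∂B.cm.mu = (volume.real B.K)⁻¹ * ∫ x in B.K, f x := by
  change ∫ x, f x ∂((volume B.K)⁻¹ • volume.restrict B.K) = _
  rw [integral_smul_measure, smul_eq_mul, ENNReal.toReal_inv]; rfl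
def tr (r : ℝ) (y : EE n) : Set (EE n) := (fun x => r • x - y) '' B.K
lemma tr_int (r : ℝ) (hr : 0 < r) (y : EE n) (f : EE n → ℝ) :
    ∫ z in B.tr r y, f z ∂(stdGaussian (EE n)) =
      (r ^ n * gc (EE n) * rexp (-‖y‖ ^ 2 / 2) * volume.real B.K) * B.cm.N (fun x => f (r • x - y)) r y := by
  have hm : MeasurableSet (B.tr r y) := (B.comp.image (by fun_prop)).isClosed.measurableSet
  rw [← integral_indicator hm, integral_std]
  have e1 : ∀ F : EE n → ℝ, ∫ z, F z = r ^ n * ∫ x, F (r • x - y) := fun F => by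
    have := Measure.integral_comp_smul_of_nonneg (volume : Measure (EE n)) (fun x => F (x - y)) r (hR := hr.le)
    rw [this, integral_sub_right_eq_self]
    simp only [finrank_euclideanSpace, Fintype.card_fin, smul_eq_mul]
    rw [mul_inv_cancel_left₀ (pow_pos hr n).ne']
  rw [e1]
  unfold CM.N
  rw [integral_cm, ← integral_indicator B.comp.measurableSet]
  have := B.rpos.ne'
  have e2 : ∀ I : ℝ, r ^ n * gc (EE n) * rexp (-‖y‖ ^ 2 / 2) * volume.real B.K * ((volume.real B.K)⁻¹ * I) =
    r ^ n * (gc (EE n) * rexp (-‖y‖ ^ 2 / 2) * I) := fun I => by field_simp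
  rw [e2]
  congr 1
  rw [← integral_const_mul]
  congr 1; ext x
  have hmem : r • x - y ∈ B.tr r y ↔ x ∈ B.K := by
    constructor
    · rintro ⟨x', hx', h⟩
      have : x' = x := smul_right_injective _ hr.ne' (sub_left_injective h)
      exact this ▸ hx'
    · exact fun h => ⟨x, h, rfl⟩
  by_cases hx : x ∈ B.K
  · rw [indicator_of_mem (hmem.2 hx), indicator_of_mem hx]
    unfold CM.wt
    have : -‖r • x - y‖ ^ 2 / 2 = -‖y‖ ^ 2 / 2 + (r * ⟪y, x⟫ - r ^ 2 * ‖x‖ ^ 2 / 2) := by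
      rw [norm_sub_sq_real, norm_smul, inner_smul_left, real_inner_comm x y, mul_pow, Real.norm_eq_abs, sq_abs]
      simp; ring
    rw [this, Real.exp_add]; simp only [smul_eq_mul]; ring
  · rw [indicator_of_notMem (fun h => hx (hmem.1 h)), indicator_of_notMem hx]; simp
lemma eK_tr (r : ℝ) (hr : 0 < r) (y : EE n) (f : EE n → ℝ) :
    eK (B.tr r y) f = ∫ x, f (r • x - y) ∂(B.cm.post r y) := by
  unfold eK
  rw [tr_int B r hr, tr_int B r hr, CM.integral_post]
  have h1 : r ^ n * gc (EE n) * rexp (-‖y‖ ^ 2 / 2) * volume.real B.K ≠ 0 := by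
    have := B.rpos; have := gc_pos (E := EE n); positivity
  rw [mul_div_mul_left _ _ h1]; rfl
lemma tr_ne (r : ℝ) (hr : 0 < r) (y : EE n) : stdGaussian (EE n) (B.tr r y) ≠ 0 := fun h => by
  have h1 := B.tr_int r hr y (fun _ => 1)
  rw [Measure.restrict_eq_zero.2 h, integral_zero_measure] at h1
  have := B.rpos; have := gc_pos (E := EE n); have h2 := B.cm.Z_pos r y
  have h3 : (0:ℝ) < r ^ n * gc (EE n) * rexp (-‖y‖ ^ 2 / 2) * volume.real B.K * B.cm.N (fun x => 1) r y :=
    mul_pos (by positivity) h2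
  linarith
theorem third (r : ℝ) (hr : 0 < r) (y : EE n) {a : ℝ} (ha : 0 ≤ a) (m : Fin n → ℝ)
    (hm : ∀ i, ∫ x, x i ∂(B.cm.post r y) = m i)
    (hcov : ∀ θ : Fin n → ℝ, ∫ x, (∑ i, θ i * (x i - m i)) ^ 2 ∂(B.cm.post r y) ≤ a * ∑ i, θ i ^ 2) (θ : Fin n → ℝ) :
    ∑ b, ∑ d, (∫ x, (∑ i, θ i * (x i - m i)) * ((x b - m b) * (x d - m d)) ∂(B.cm.post r y)) ^ 2
      ≤ 4 * a ^ 2 * (√a / r) * ∑ i, θ i ^ 2 := by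
  set T : EE n → EE n := fun x => r • x - y with hT
  have Tc : Continuous T := by fun_prop
  have Tm : AEMeasurable T (B.cm.post r y) := Tc.measurable.aemeasurable
  set ν := (B.cm.post r y).map T with hν
  haveI : IsProbabilityMeasure ν := Measure.isProbabilityMeasure_map Tm
  have im : ∀ f : EE n → ℝ, PG f → ∫ z, f z ∂ν = ∫ x, f (T x) ∂(B.cm.post r y) := fun f hf =>
    integral_map Tm hf.cont.aestronglyMeasurable
  have ie : ∀ f : EE n → ℝ, PG f → ∫ z, f z ∂ν = eK (B.tr r y) f := fun f hf => by
    rw [im f hf, eK_tr B r hr]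
  have hint : ∀ f : EE n → ℝ, PG f → Integrable f ν := fun f hf => by
    rw [hν, integrable_map_measure hf.cont.aestronglyMeasurable Tm]
    exact B.cm.post_int (hf.cont.comp Tc) r y
  have Ti : ∀ x i, T x i = r * x i - y i := fun x i => by simp [T]
  set m' : Fin n → ℝ := fun i => r * m i - y i with hm'
  have Td : ∀ x i, T x i - m' i = r * (x i - m i) := fun x i => by rw [Ti, hm']; ring
  have cc : ∀ i, Continuous fun x : EE n => x i := fun i => (PG.coord i).cont
  have hmm : ∀ i, ∫ x, x i ∂ν = m' i := fun i => by
    rw [im _ (PG.coord i)]; simp only [Ti]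
    rw [integral_sub ((B.cm.post_int (cc i) r y).const_mul _) (integrable_const _), integral_const_mul, hm]
    simp [hm']
  have pz : ∀ b, PG (fun x : EE n => x b - m' b) := fun b => (PG.coord b).sub (PG.const _)
  have pl : ∀ θ : Fin n → ℝ, PG (fun x : EE n => ∑ i, θ i * (x i - m' i)) := fun θ => PG.sum _ fun i _ => (pz i).const_mul _
  have ls : ∀ (θ : Fin n → ℝ) (x : EE n), ∑ i, θ i * (T x i - m' i) = r * ∑ i, θ i * (x i - m i) := fun θ x => by
    simp only [Td]; rw [Finset.mul_sum]; exact Finset.sum_congr rfl fun i _ => by ring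
  have hcov' : ∀ θ : Fin n → ℝ, ∫ x, (∑ i, θ i * (x i - m' i)) ^ 2 ∂ν ≤ (r ^ 2 * a) * ∑ i, θ i ^ 2 := fun θ => by
    rw [im _ ((pl θ).pow 2)]
    simp only [ls, mul_pow]
    rw [integral_const_mul, mul_assoc]
    exact mul_le_mul_of_nonneg_left (hcov θ) (sq_nonneg r)
  have hP : ∀ p : PP n, ∫ x, ev p x ^ 2 ∂ν - (∫ x, ev p x ∂ν) ^ 2 ≤ √(r ^ 2 * a) * ∫ x, ∑ i, ev (pd i p) x ^ 2 ∂ν := fun p => by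
    have hcomp : IsCompact (B.tr r y) := B.comp.image Tc
    have hconv : Convex ℝ (B.tr r y) := by
      rintro _ ⟨x, hx, rfl⟩ _ ⟨z, hz, rfl⟩ s t hs ht hst
      refine ⟨s • x + t • z, B.conv hx hz hs ht hst, ?_⟩
      simp only [smul_sub, smul_add, smul_comm r]
      have : y = s • y + t • y := by rw [← add_smul, hst, one_smul]
      nth_rewrite 1 [this]; abel
    have := bodyPoincare hconv hcomp.isClosed (B.ne.image _) (B.tr_ne r hr y) (a := r ^ 2 * a) (by positivity) (fun θ => ?_) p
    · unfold vK gK at this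
      rwa [← ie _ ((ev_pg p).pow 2), ← ie _ (ev_pg p), ← ie _ (PG.sum _ fun i _ => (ev_pg _).pow 2)] at this
    · refine le_of_eq_of_le ?_ (hcov' θ)
      have : ∀ x : EE n, (∑ i, θ i * (x i - m' i)) ^ 2 = ∑ i, ∑ k, θ i * θ k * (x i * x k - m' i * x k - m' k * x i + m' i * m' k) := fun x => by
        rw [sq, Finset.sum_mul_sum]
        exact Finset.sum_congr rfl fun i _ => Finset.sum_congr rfl fun k _ => by ring
      simp only [this]
      have p1 : ∀ i k, PG fun x : EE n => x i * x k - m' i * x k - m' k * x i + m' i * m' k := fun i k =>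
        ((((PG.coord i).mul (PG.coord k)).sub ((PG.coord k).const_mul _)).sub ((PG.coord i).const_mul _)).add (PG.const _)
      rw [integral_finset_sum _ fun i _ => hint _ (PG.sum _ fun k _ => (p1 i k).const_mul _)]
      refine Finset.sum_congr rfl fun i _ => ?_
      rw [integral_finset_sum _ fun k _ => hint _ ((p1 i k).const_mul _)]
      refine Finset.sum_congr rfl fun k _ => ?_
      rw [integral_const_mul, ← ie _ ((PG.coord i).mul (PG.coord k)), ← ie _ (PG.coord i), ← ie _ (PG.coord k),
        integral_add (hint _ ((((PG.coord i).mul (PG.coord k)).sub ((PG.coord k).const_mul _)).sub ((PG.coord i).const_mul _))) (integrable_const _),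
        integral_sub (hint _ (((PG.coord i).mul (PG.coord k)).sub ((PG.coord k).const_mul _))) (hint _ ((PG.coord i).const_mul _)),
        integral_sub (hint _ ((PG.coord i).mul (PG.coord k))) (hint _ ((PG.coord k).const_mul _)), integral_const_mul, integral_const_mul, hmm, hmm]
      simp; ring_nf; simp
  have key := third_gen ν hint (a := r ^ 2 * a) (c := √(r ^ 2 * a)) (by positivity) (by positivity) m' hmm hP hcov' θ
  have e : ∀ b d, ∫ x, (∑ i, θ i * (x i - m' i)) * ((x b - m' b) * (x d - m' d)) ∂ν =
      r ^ 3 * ∫ x, (∑ i, θ i * (x i - m i)) * ((x b - m b) * (x d - m d)) ∂(B.cm.post r y) := fun b d => by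
    rw [im _ ((pl θ).mul ((pz b).mul (pz d)))]
    simp only [ls]; simp only [Td]
    rw [← integral_const_mul]; congr 1; ext x; ring
  simp only [e, mul_pow, ← Finset.mul_sum] at key
  rw [Real.sqrt_mul (sq_nonneg r), Real.sqrt_sq hr.le] at key
  have h6 : 0 < r ^ 6 := by positivity
  refine le_of_mul_le_mul_left ?_ h6
  calc _ = (r ^ 3) ^ 2 * ∑ b, ∑ d, (∫ x, (∑ i, θ i * (x i - m i)) * ((x b - m b) * (x d - m d)) ∂(B.cm.post r y)) ^ 2 := by ring
    _ ≤ _ := key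
    _ = _ := by field_simp
end Bd
end

section
section GBs
variable {n : ℕ}
def GB (F : ℝ → EE n → ℝ) : Prop :=
  (∀ r, Continuous (F r)) ∧ ∃ C c : ℝ, 0 ≤ C ∧ ∀ r, |r| ≤ 2 → ∀ y, |F r y| ≤ C * rexp (c * ‖y‖)
variable {F G : ℝ → EE n → ℝ}
lemma GB.add (hF : GB F) (hG : GB G) : GB (fun r y => F r y + G r y) := by
  obtain ⟨h1, C, c, hC, h2⟩ := hF; obtain ⟨h3, D, d, hD, h4⟩ := hG
  refine ⟨fun r => (h1 r).add (h3 r), C + D, max c d, by positivity, fun r hr y => ?_⟩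
  have a1 := h2 r hr y; have a2 := h4 r hr y
  have b1 : rexp (c * ‖y‖) ≤ rexp (max c d * ‖y‖) := Real.exp_le_exp.2 (by gcongr; exact le_max_left _ _)
  have b2 : rexp (d * ‖y‖) ≤ rexp (max c d * ‖y‖) := Real.exp_le_exp.2 (by gcongr; exact le_max_right _ _)
  calc _ ≤ _ := abs_add_le _ _
    _ ≤ C * rexp (max c d * ‖y‖) + D * rexp (max c d * ‖y‖) := by
      have := mul_le_mul_of_nonneg_left b1 hC; have := mul_le_mul_of_nonneg_left b2 hD; linarith
    _ = _ := by ring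
lemma GB.mul (hF : GB F) (hG : GB G) : GB (fun r y => F r y * G r y) := by
  obtain ⟨h1, C, c, hC, h2⟩ := hF; obtain ⟨h3, D, d, hD, h4⟩ := hG
  refine ⟨fun r => (h1 r).mul (h3 r), C * D, c + d, by positivity, fun r hr y => ?_⟩
  rw [abs_mul, add_mul, Real.exp_add]
  calc _ ≤ _ := mul_le_mul (h2 r hr y) (h4 r hr y) (abs_nonneg _) (by positivity)
    _ = _ := by ring
lemma GB.const (c : ℝ) : GB (fun _ (_ : EE n) => c) :=
  ⟨fun r => continuous_const, |c|, 0, abs_nonneg _, fun r _ y => by simp⟩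
lemma GB.rr : GB (fun r (_ : EE n) => r) :=
  ⟨fun r => continuous_const, 2, 0, by norm_num, fun r hr y => by simpa using hr⟩
lemma GB.neg (hF : GB F) : GB (fun r y => - F r y) := by simpa using (GB.const (-1)).mul hF
lemma GB.sub (hF : GB F) (hG : GB G) : GB (fun r y => F r y - G r y) := by
  simpa [sub_eq_add_neg] using hF.add hG.neg
lemma GB.sum {ι : Type*} (s : Finset ι) {F : ι → ℝ → EE n → ℝ} (h : ∀ i ∈ s, GB (F i)) :
    GB (fun r y => ∑ i ∈ s, F i r y) := by
  classical
  induction s using Finset.induction_on with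
  | empty => simpa using GB.const 0
  | insert a s ha ih =>
    simp only [Finset.sum_insert ha]
    exact (h a (by simp)).add (ih fun i hi => h i (by simp [hi]))
lemma GB.coord (k : Fin n) : GB (fun _ y => y k) := by
  obtain ⟨C, c, hC, h⟩ := (PG.coord k).le_exp
  exact ⟨fun r => (PG.coord k).cont, C, c, hC, fun r _ y => h y⟩
lemma GB.int (hF : GB F) {r : ℝ} (hr : |r| ≤ 2) : Integrable (F r) (stdGaussian (EE n)) := by
  obtain ⟨h1, C, c, hC, h2⟩ := hF
  refine ((intble_exp_std c).const_mul C).mono' (h1 r).aestronglyMeasurable (Filter.Eventually.of_forall fun y => ?_)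
  exact h2 r hr y
lemma GB.deriv {F' : ℝ → EE n → ℝ} (hF : GB F) (hF' : GB F') (h : ∀ r y, HasDerivAt (fun r => F r y) (F' r y) r) {r : ℝ} (hr : |r| < 2) :
    HasDerivAt (fun r => ∫ y, F r y ∂(stdGaussian (EE n))) (∫ y, F' r y ∂(stdGaussian (EE n))) r := by
  have hi := hF.int hr.le
  obtain ⟨h1, C, c, hC, h2⟩ := hF'
  refine (hasDerivAt_integral_of_dominated_loc_of_deriv_le (F := F) (F' := F') (bound := fun y => C * rexp (c * ‖y‖)) (s := {r | |r| < 2}) ((isOpen_lt continuous_abs continuous_const).mem_nhds hr)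
    (Filter.Eventually.of_forall fun r => (hF.1 r).aestronglyMeasurable) hi (h1 r).aestronglyMeasurable
    (Filter.Eventually.of_forall fun y r' hr' => h2 r' (le_of_lt hr') y) ((intble_exp_std c).const_mul C)
    (Filter.Eventually.of_forall fun y r' _ => h r' y)).2
lemma GB.ibp {F' : ℝ → EE n → ℝ} (hF : GB F) (hF' : GB F') (k : Fin n) {r : ℝ} (hr : |r| ≤ 2) (h : ∀ y, HL (F r) (F' r y) y k) :
    ∫ y, (F' r y - y k * F r y) ∂(stdGaussian (EE n)) = 0 := by
  have hw : ∀ x : EE n, HL (fun x => rexp (-‖x‖ ^ 2 / 2)) (-(x k * rexp (-‖x‖ ^ 2 / 2))) x k := fun x => by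
    have h2 := (HL.normsq (x := x) (i := k)).neg.exp
    simp only [← neg_div] at h2
    exact h2.congr (by ring)
  have i1 : ∀ {f : EE n → ℝ}, Integrable f (stdGaussian (EE n)) → Integrable (fun x => f x * rexp (-‖x‖ ^ 2 / 2)) := fun hf => by
    refine ((intble_std _).1 hf).congr (Filter.Eventually.of_forall fun x => ?_)
    simp only [smul_eq_mul]; exact mul_comm _ _
  have := integral_bilinear_hasLineDerivAt_right_eq_neg_left_of_integrable
    (μ := (volume : Measure (EE n))) (f := F r) (f' := F' r)
    (g := fun x => rexp (-‖x‖ ^ 2 / 2)) (g' := fun x => -(x k * rexp (-‖x‖ ^ 2 / 2))) (v := bs k)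
    (B := ContinuousLinearMap.mul ℝ ℝ) (i1 (hF'.int hr)) ?_ (i1 (hF.int hr)) (fun x _ => h x) (fun x _ => hw x)
  · simp only [ContinuousLinearMap.mul_apply'] at this
    rw [integral_sub (hF'.int hr) (((GB.coord k).mul hF).int hr), sub_eq_zero, integral_std, integral_std]
    simp only [smul_eq_mul, mul_assoc]
    rw [integral_const_mul, integral_const_mul]
    congr 1
    rw [← neg_inj]
    rw [show ∫ x : EE n, rexp (-‖x‖ ^ 2 / 2) * F' r x = ∫ x, F' r x * rexp (-‖x‖ ^ 2 / 2) from by congr 1; ext x; ring,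
      ← this, ← integral_neg]
    congr 1; ext x; ring
  · refine (i1 (((GB.coord k).mul hF).int hr)).neg.congr (Filter.Eventually.of_forall fun x => ?_)
    simp only [ContinuousLinearMap.mul_apply', Pi.neg_apply]; ring
end GBs
namespace CM
variable {n : ℕ} (X : CM n)
lemma dexp {g α β δ : EE n → ℝ} (hg : Continuous g) (hα : Continuous α) (hβ : Continuous β) (hδ : Continuous δ) (t0 : ℝ) :
    HasDerivAt (fun t => ∫ x, g x * rexp (α x + t * β x + t ^ 2 * δ x) ∂X.mu)
      (∫ x, g x * (β x + 2 * t0 * δ x) * rexp (α x + t0 * β x + t0 ^ 2 * δ x) ∂X.mu) t0 := by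
  obtain ⟨Cg, g0, hg'⟩ := X.bdd hg
  obtain ⟨Ca, a0, ha'⟩ := X.bdd hα
  obtain ⟨Cb, b0, hb'⟩ := X.bdd hβ
  obtain ⟨Cd, d0, hd'⟩ := X.bdd hδ
  set τ := |t0| + 1
  have τ0 : 0 ≤ τ := by positivity
  refine (hasDerivAt_integral_of_dominated_loc_of_deriv_le (F := fun t x => g x * rexp (α x + t * β x + t ^ 2 * δ x))
    (F' := fun t x => g x * (β x + 2 * t * δ x) * rexp (α x + t * β x + t ^ 2 * δ x))
    (bound := fun _ => Cg * (Cb + 2 * τ * Cd) * rexp (Ca + τ * Cb + τ ^ 2 * Cd)) (s := {t | |t| < τ})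
    ((isOpen_lt continuous_abs continuous_const).mem_nhds (by simp [τ]))
    (Filter.Eventually.of_forall fun r => Continuous.aestronglyMeasurable (by fun_prop)) (X.intble (by fun_prop)) (Continuous.aestronglyMeasurable (by fun_prop))
    ?_ (integrable_const _) (Filter.Eventually.of_forall fun x t _ => ?_)).2
  · filter_upwards [hg', ha', hb', hd'] with x h1 h2 h3 h4 t ht
    have ht' : |t| ≤ τ := le_of_lt ht
    have k1 : |t * β x| ≤ τ * Cb := by rw [abs_mul]; exact mul_le_mul ht' h3 (abs_nonneg _) τ0
    have k2 : |t ^ 2 * δ x| ≤ τ ^ 2 * Cd := by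
      rw [abs_mul, abs_pow]; exact mul_le_mul (pow_le_pow_left₀ (abs_nonneg _) ht' 2) h4 (abs_nonneg _) (by positivity)
    have k3 : |2 * t * δ x| ≤ 2 * τ * Cd := by
      rw [abs_mul, abs_mul, abs_two]; exact mul_le_mul (by linarith) h4 (abs_nonneg _) (by positivity)
    rw [norm_mul, norm_mul, Real.norm_eq_abs, Real.norm_eq_abs, Real.norm_eq_abs, Real.abs_exp]
    refine mul_le_mul (mul_le_mul h1 ((abs_add_le _ _).trans (add_le_add h3 k3)) (abs_nonneg _) g0) (Real.exp_le_exp.2 ?_) (exp_pos _).le (by positivity)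
    have := le_abs_self (α x); have := le_abs_self (t * β x); have := le_abs_self (t ^ 2 * δ x); linarith
  · have e : HasDerivAt (fun t => α x + t * β x + t ^ 2 * δ x) (β x + 2 * t * δ x) t := by
      have h1 := ((hasDerivAt_id t).mul_const (β x)).const_add (α x)
      have h2 := ((hasDerivAt_pow 2 t).mul_const (δ x))
      refine (h1.add h2).congr_deriv (by simp)
    exact ((e.exp).const_mul (g x)).congr_deriv (by ring)
lemma N_cont {g : EE n → ℝ} (hg : Continuous g) (r : ℝ) : Continuous (X.N g r) := by
  rw [continuous_iff_continuousAt]; intro y0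
  obtain ⟨C, h0, h⟩ := X.bdd hg
  refine continuousAt_of_dominated (F := fun y x => g x * wt r y x) (bound := fun x => C * rexp (|r| * ((‖y0‖ + 1) * X.R))) (Filter.Eventually.of_forall fun y => (hg.mul (wt_cont r y)).aestronglyMeasurable) ?_ (integrable_const _)
    (Filter.Eventually.of_forall fun x => ?_)
  · filter_upwards [Metric.ball_mem_nhds y0 one_pos] with y hy
    filter_upwards [h, X.supp] with x hx hs
    have hy' : ‖y‖ ≤ ‖y0‖ + 1 := by
      have : ‖y - y0‖ < 1 := by simpa [dist_eq_norm] using hy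
      have := norm_le_norm_add_norm_sub' y y0; linarith
    unfold wt
    rw [norm_mul, Real.norm_eq_abs, Real.norm_eq_abs, Real.abs_exp]
    refine mul_le_mul hx (Real.exp_le_exp.2 ?_) (exp_pos _).le h0
    have h1 : r * ⟪y, x⟫ ≤ |r| * ((‖y0‖ + 1) * X.R) := by
      refine (le_abs_self _).trans ?_
      rw [abs_mul]
      refine mul_le_mul_of_nonneg_left ((abs_real_inner_le_norm y x).trans (mul_le_mul hy' hs (norm_nonneg _) (by positivity))) (abs_nonneg _)
    nlinarith [mul_nonneg (sq_nonneg r) (sq_nonneg ‖x‖)]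
  · unfold wt; fun_prop
lemma N_gb {g : EE n → ℝ} (hg : Continuous g) : GB (X.N g) := by
  obtain ⟨C, h0, h⟩ := X.bdd hg
  refine ⟨X.N_cont hg, C, 2 * X.R, h0, fun r hr y => ?_⟩
  have := norm_integral_le_of_norm_le (μ := X.mu) (integrable_const (C * rexp (2 * X.R * ‖y‖))) (f := fun x => g x * wt r y x) ?_
  · simpa [N] using this
  filter_upwards [h, X.supp] with x hx hs
  unfold wt
  rw [norm_mul, Real.norm_eq_abs, Real.norm_eq_abs, Real.abs_exp]
  refine mul_le_mul hx (Real.exp_le_exp.2 ?_) (exp_pos _).le h0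
  have h1 : r * ⟪y, x⟫ ≤ 2 * X.R * ‖y‖ := by
    refine (le_abs_self _).trans ?_
    rw [abs_mul]
    calc _ ≤ 2 * (‖y‖ * X.R) := mul_le_mul hr ((abs_real_inner_le_norm y x).trans (mul_le_mul_of_nonneg_left hs (norm_nonneg _))) (abs_nonneg _) (by norm_num)
      _ = _ := by ring
  nlinarith [mul_nonneg (sq_nonneg r) (sq_nonneg ‖x‖)]
lemma Z_gb : GB X.Z := X.N_gb continuous_const
lemma U_bd {g : EE n → ℝ} {C : ℝ} (h : ∀ᵐ x ∂X.mu, |g x| ≤ C) (r : ℝ) (y : EE n) : |X.U g r y| ≤ C := by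
  rw [← integral_post]
  have := norm_integral_le_of_norm_le (μ := X.post r y) (f := g) (integrable_const C) ((tilted_absolutelyContinuous _ _).ae_le h)
  simpa using this
lemma U_gb {g : EE n → ℝ} (hg : Continuous g) : GB (X.U g) := by
  obtain ⟨C, h0, h⟩ := X.bdd hg
  refine ⟨fun r => (X.N_cont hg r).div (X.N_cont continuous_const r) fun y => (X.Z_pos r y).ne', C, 0, h0, fun r hr y => ?_⟩
  simpa using X.U_bd h r y
lemma cco (k : Fin n) : Continuous fun x : EE n => x k := (PG.coord k).cont
lemma N_hl {g : EE n → ℝ} (hg : Continuous g) (r : ℝ) (y : EE n) (k : Fin n) :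
    HL (X.N g r) (r * X.N (fun x => g x * x k) r y) y k := by
  have h := X.dexp hg (α := fun x => r * ⟪y, x⟫ - r ^ 2 * ‖x‖ ^ 2 / 2) (β := fun x => r * x k) (δ := fun _ => 0) (by fun_prop)
    (by have := cco k; fun_prop) continuous_const 0
  unfold HL N wt
  convert h using 1
  · ext t; congr 1; ext x
    rw [inner_add_left, inner_smul_left, EuclideanSpace.inner_single_left]
    simp only [conj_trivial, one_mul, mul_zero, add_zero]
    congr 2; ring
  · rw [← integral_const_mul]; congr 1; ext x; simp; ring
lemma inner_sum (y x : EE n) : ⟪y, x⟫ = ∑ k, y k * x k := by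
  simp [PiLp.inner_apply, mul_comm]
lemma norm_sum (x : EE n) : ‖x‖ ^ 2 = ∑ k, x k * x k := by
  rw [EuclideanSpace.norm_sq_eq]; simp [sq]
lemma N_dr {g : EE n → ℝ} (hg : Continuous g) (r : ℝ) (y : EE n) :
    HasDerivAt (fun r => X.N g r y) (∑ k, (y k * X.N (fun x => g x * x k) r y - r * X.N (fun x => g x * x k * x k) r y)) r := by
  have h := X.dexp hg (α := fun _ => 0) (β := fun x => ⟪y, x⟫) (δ := fun x => - ‖x‖ ^ 2 / 2) continuous_const (by fun_prop)
    (by fun_prop) r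
  have e : ∀ (t : ℝ) (x : EE n), rexp (0 + t * ⟪y, x⟫ + t ^ 2 * (- ‖x‖ ^ 2 / 2)) = wt t y x := fun t x => by
    unfold wt; congr 1; ring
  simp only [e] at h
  refine h.congr_deriv ?_
  unfold N
  have i1 : ∀ k, Integrable (fun x => y k * (g x * x k * wt r y x)) X.mu := fun k =>
    X.intble (by have := cco k; have := wt_cont r y; fun_prop)
  have i2 : ∀ k, Integrable (fun x => r * (g x * x k * x k * wt r y x)) X.mu := fun k =>
    X.intble (by have := cco k; have := wt_cont r y; fun_prop)
  simp only [← integral_const_mul]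
  rw [← Finset.sum_congr rfl fun k _ => integral_sub (i1 k) (i2 k), ← integral_finset_sum (f := fun k x => y k * (g x * x k * wt r y x) - r * (g x * x k * x k * wt r y x)) _ fun k _ => (i1 k).sub (i2 k)]
  congr 1; ext x
  rw [inner_sum, show g x * ((∑ k, y k * x k) + 2 * r * (-‖x‖ ^ 2 / 2)) * wt r y x = (g x * wt r y x) * ((∑ k, y k * x k) - r * ‖x‖ ^ 2) by ring,
    norm_sum, Finset.mul_sum, ← Finset.sum_sub_distrib, Finset.mul_sum]
  exact Finset.sum_congr rfl fun k _ => by ring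
lemma one_mul_fun (k : Fin n) : (fun x : EE n => (1:ℝ) * x k) = fun x => x k := by ext; simp
lemma Z_hl (r : ℝ) (y : EE n) (k : Fin n) : HL (X.Z r) (X.Z r y * (r * X.U (fun x => x k) r y)) y k := by
  have := X.N_hl (g := fun _ => 1) continuous_const r y k
  rw [one_mul_fun, ← Z_mul_U] at this
  exact this.congr (by ring)
lemma Z_dr (r : ℝ) (y : EE n) : HasDerivAt (fun r => X.Z r y)
    (X.Z r y * ∑ k, (y k * X.U (fun x => x k) r y - r * X.U (fun x => x k * x k) r y)) r := by
  have := X.N_dr (g := fun _ => 1) continuous_const r y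
  refine HasDerivAt.congr_deriv this ?_
  simp only [one_mul, ← Z_mul_U]
  rw [Finset.mul_sum]; exact Finset.sum_congr rfl fun k _ => by ring
lemma U_hl {g : EE n → ℝ} (hg : Continuous g) (r : ℝ) (y : EE n) (k : Fin n) :
    HL (X.U g r) (r * (X.U (fun x => g x * x k) r y - X.U g r y * X.U (fun x => x k) r y)) y k := by
  have h1 := X.N_hl hg r y k
  have h2 := X.Z_hl r y k
  have hz := (X.Z_pos r y).ne'
  have h3 := HasDerivAt.fun_div h1 h2 (by simpa using hz)
  refine h3.congr_deriv ?_
  simp only [zero_smul, add_zero, ← Z_mul_U]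
  field_simp
lemma U_dr {g : EE n → ℝ} (hg : Continuous g) (r : ℝ) (y : EE n) :
    HasDerivAt (fun r => X.U g r y) (∑ k, (y k * (X.U (fun x => g x * x k) r y - X.U g r y * X.U (fun x => x k) r y)
      - r * (X.U (fun x => g x * x k * x k) r y - X.U g r y * X.U (fun x => x k * x k) r y))) r := by
  have h1 := X.N_dr hg r y
  have h2 := X.Z_dr r y
  have hz := (X.Z_pos r y).ne'
  have h3 := HasDerivAt.fun_div h1 h2 hz
  refine h3.congr_deriv ?_
  simp only [← Z_mul_U]
  rw [div_eq_iff (pow_ne_zero 2 hz)]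
  simp only [Finset.sum_mul, Finset.mul_sum, ← Finset.sum_sub_distrib]
  exact Finset.sum_congr rfl fun k _ => by ring
end CM
end

section
abbrev MM (n : ℕ) := Matrix (Fin n) (Fin n) ℝ
section MDs
variable {n : ℕ}
def MD (C : ℝ → MM n) (C' : MM n) (t : ℝ) : Prop := ∀ i j, HasDerivAt (fun t => C t i j) (C' i j) t
variable {C D : ℝ → MM n} {C' D' : MM n} {t : ℝ}
lemma MD.mul (hC : MD C C' t) (hD : MD D D' t) : MD (fun t => C t * D t) (C' * D t + C t * D') t := fun i j => by
  simp only [Matrix.mul_apply, Matrix.add_apply, ← Finset.sum_add_distrib]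
  exact HasDerivAt.fun_sum fun k _ => (hC i k).mul (hD k j)
lemma MD.pow (hC : MD C C' t) (p : ℕ) : MD (fun t => C t ^ p) (∑ j ∈ Finset.range p, C t ^ j * C' * C t ^ (p - 1 - j)) t := by
  induction p with
  | zero => intro i j; simpa using hasDerivAt_const t _
  | succ p ih =>
    have := ih.mul hC
    have e : (fun t => C t ^ (p + 1)) = fun t => C t ^ p * C t := by ext t; rw [pow_succ]
    rw [e, Finset.sum_range_succ]
    convert this using 2
    · rw [Finset.sum_mul]
      refine Finset.sum_congr rfl fun j hj => ?_
      rw [Finset.mem_range] at hj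
      rw [mul_assoc (C t ^ j * C'), ← pow_succ]
      congr 2; omega
    · simp
lemma MD.tr (hC : MD C C' t) : HasDerivAt (fun t => (C t).trace) C'.trace t := by
  simp only [Matrix.trace, Matrix.diag]
  exact HasDerivAt.fun_sum fun k _ => hC k k
lemma MD.trpow (hC : MD C C' t) (p : ℕ) : HasDerivAt (fun t => (C t ^ p).trace) (p * (C t ^ (p - 1) * C').trace) t := by
  refine (hC.pow p).tr.congr_deriv ?_
  rw [Matrix.trace_sum]
  rw [Finset.sum_congr rfl (g := fun _ => (C t ^ (p - 1) * C').trace)]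
  · simp
  intro j hj
  rw [Finset.mem_range] at hj
  rw [Matrix.trace_mul_comm, ← mul_assoc, ← pow_add]
  congr 3; omega
lemma MD.trpow2 (hC : MD C C' t) (hD : MD D D' t) (p : ℕ) : HasDerivAt (fun t => (C t ^ p * D t).trace)
    (∑ j ∈ Finset.range p, (C t ^ j * C' * C t ^ (p - 1 - j) * D t).trace + (C t ^ p * D').trace) t := by
  refine ((hC.pow p).mul hD).tr.congr_deriv ?_
  rw [Matrix.trace_add, Finset.sum_mul, Matrix.trace_sum]
end MDs
namespace CM
variable {n : ℕ} (X : CM n)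
def m1 (i : Fin n) (r : ℝ) (y : EE n) : ℝ := X.U (fun x => x i) r y
def m2 (i j : Fin n) (r : ℝ) (y : EE n) : ℝ := X.U (fun x => x i * x j) r y
def m3 (i j k : Fin n) (r : ℝ) (y : EE n) : ℝ := X.U (fun x => x i * x j * x k) r y
def m4 (i j k l : Fin n) (r : ℝ) (y : EE n) : ℝ := X.U (fun x => x i * x j * x k * x l) r y
lemma c2 (i j : Fin n) : Continuous fun x : EE n => x i * x j := (cco i).mul (cco j)
lemma c3 (i j k : Fin n) : Continuous fun x : EE n => x i * x j * x k := (c2 i j).mul (cco k)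
lemma m1_gb (i) : GB (X.m1 i) := X.U_gb (cco i)
lemma m2_gb (i j) : GB (X.m2 i j) := X.U_gb (c2 i j)
lemma m3_gb (i j k) : GB (X.m3 i j k) := X.U_gb (c3 i j k)
lemma m4_gb (i j k l) : GB (X.m4 i j k l) := X.U_gb ((c3 i j k).mul (cco l))
lemma m2s (i j r y) : X.m2 i j r y = X.m2 j i r y := by unfold m2; congr 1; ext x; ring
lemma m1_hl (i k r y) : HL (X.m1 i r) (r * (X.m2 i k r y - X.m1 i r y * X.m1 k r y)) y k := X.U_hl (cco i) r y k
lemma m2_hl (i j k r y) : HL (X.m2 i j r) (r * (X.m3 i j k r y - X.m2 i j r y * X.m1 k r y)) y k := X.U_hl (c2 i j) r y k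
lemma m3_hl (i j l k r y) : HL (X.m3 i j l r) (r * (X.m4 i j l k r y - X.m3 i j l r y * X.m1 k r y)) y k := X.U_hl (c3 i j l) r y k
lemma m1_dr (i r y) : HasDerivAt (fun r => X.m1 i r y) (∑ k, (y k * (X.m2 i k r y - X.m1 i r y * X.m1 k r y)
  - r * (X.m3 i k k r y - X.m1 i r y * X.m2 k k r y))) r := X.U_dr (cco i) r y
lemma m2_dr (i j r y) : HasDerivAt (fun r => X.m2 i j r y) (∑ k, (y k * (X.m3 i j k r y - X.m2 i j r y * X.m1 k r y)
  - r * (X.m4 i j k k r y - X.m2 i j r y * X.m2 k k r y))) r := X.U_dr (c2 i j) r y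
def A (r : ℝ) (y : EE n) : MM n := Matrix.of fun i j => X.m2 i j r y - X.m1 i r y * X.m1 j r y
def T (k : Fin n) (r : ℝ) (y : EE n) : MM n := Matrix.of fun i j =>
  X.m3 i j k r y - X.m1 i r y * X.m2 j k r y - X.m1 j r y * X.m2 i k r y - X.m1 k r y * X.m2 i j r y
    + 2 * X.m1 i r y * X.m1 j r y * X.m1 k r y
def S (k : Fin n) (r : ℝ) (y : EE n) : MM n := Matrix.of fun i j =>
  (X.m4 i j k k r y - X.m2 i j r y * X.m2 k k r y) - X.m1 i r y * (X.m3 j k k r y - X.m1 j r y * X.m2 k k r y)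
   - X.m1 j r y * (X.m3 i k k r y - X.m1 i r y * X.m2 k k r y)
def V (k : Fin n) (r : ℝ) (y : EE n) : MM n := X.S k r y - (2:ℝ) • Matrix.of (fun i j => X.A r y i k * X.A r y j k) - (2 * X.m1 k r y) • X.T k r y
lemma A_hl (i j k r y) : HL (fun y => X.A r y i j) (r * X.T k r y i j) y k :=
  ((X.m2_hl i j k r y).sub ((X.m1_hl i k r y).mul (X.m1_hl j k r y))).congr (by simp only [T, Matrix.of_apply]; ring)
lemma A_dr (i j r y) : HasDerivAt (fun r => X.A r y i j) (∑ k, (y k * X.T k r y i j - r * X.S k r y i j)) r := by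
  refine ((X.m2_dr i j r y).sub ((X.m1_dr i r y).mul (X.m1_dr j r y))).congr_deriv ?_
  simp only [Finset.sum_mul, Finset.mul_sum, ← Finset.sum_sub_distrib, ← Finset.sum_add_distrib]
  refine Finset.sum_congr rfl fun k _ => ?_
  simp only [T, S, Matrix.of_apply]; ring
lemma T_hl (i j k r y) : HL (fun y => X.T k r y i j) (r * X.V k r y i j) y k := by
  have h := (((((X.m3_hl i j k k r y).sub ((X.m1_hl i k r y).mul (X.m2_hl j k k r y))).sub
    ((X.m1_hl j k r y).mul (X.m2_hl i k k r y))).sub ((X.m1_hl k k r y).mul (X.m2_hl i j k r y))).add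
    ((((X.m1_hl i k r y).const_mul 2).mul (X.m1_hl j k r y)).mul (X.m1_hl k k r y)))
  refine h.congr ?_
  simp only [V, S, T, A, Matrix.of_apply, Matrix.sub_apply, Matrix.smul_apply, smul_eq_mul]
  ring
lemma A_gb (i j) : GB (fun r y => X.A r y i j) := (X.m2_gb i j).sub ((X.m1_gb i).mul (X.m1_gb j))
lemma T_gb (k i j) : GB (fun r y => X.T k r y i j) :=
  ((((X.m3_gb i j k).sub ((X.m1_gb i).mul (X.m2_gb j k))).sub ((X.m1_gb j).mul (X.m2_gb i k))).sub
    ((X.m1_gb k).mul (X.m2_gb i j))).add ((((GB.const 2).mul (X.m1_gb i)).mul (X.m1_gb j)).mul (X.m1_gb k))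
lemma S_gb (k i j) : GB (fun r y => X.S k r y i j) :=
  (((X.m4_gb i j k k).sub ((X.m2_gb i j).mul (X.m2_gb k k))).sub ((X.m1_gb i).mul ((X.m3_gb j k k).sub ((X.m1_gb j).mul (X.m2_gb k k))))).sub
   ((X.m1_gb j).mul ((X.m3_gb i k k).sub ((X.m1_gb i).mul (X.m2_gb k k))))
lemma V_gb (k i j) : GB (fun r y => X.V k r y i j) :=
  ((X.S_gb k i j).sub ((GB.const 2).mul ((X.A_gb i k).mul (X.A_gb j k)))).sub (((GB.const 2).mul (X.m1_gb k)).mul (X.T_gb k i j))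
end CM
section MG
variable {n : ℕ}
def MGB (C : ℝ → EE n → MM n) : Prop := ∀ i j, GB (fun r y => C r y i j)
variable {C D : ℝ → EE n → MM n}
lemma MGB.mul (hC : MGB C) (hD : MGB D) : MGB (fun r y => C r y * D r y) := fun i j => by
  simp only [Matrix.mul_apply]; exact GB.sum _ fun k _ => (hC i k).mul (hD k j)
lemma MGB.pow (hC : MGB C) (p : ℕ) : MGB (fun r y => C r y ^ p) := by
  induction p with
  | zero => intro i j; simpa using GB.const _
  | succ p ih => simpa only [pow_succ] using ih.mul hC
lemma MGB.smul {F : ℝ → EE n → ℝ} (hF : GB F) (hC : MGB C) : MGB (fun r y => F r y • C r y) := fun i j => hF.mul (hC i j)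
lemma MGB.sub (hC : MGB C) (hD : MGB D) : MGB (fun r y => C r y - D r y) := fun i j => (hC i j).sub (hD i j)
lemma MGB.sum {ι : Type*} (s : Finset ι) {F : ι → ℝ → EE n → MM n} (h : ∀ i ∈ s, MGB (F i)) : MGB (fun r y => ∑ i ∈ s, F i r y) := fun i j => by
  simp only [Matrix.sum_apply]; exact GB.sum _ fun k hk => h k hk i j
lemma MGB.tr (hC : MGB C) : GB (fun r y => (C r y).trace) := GB.sum _ fun k _ => hC k k
end MG
namespace CM
variable {n : ℕ} (X : CM n)
def Cm (r : ℝ) (y : EE n) : MM n := (2:ℝ) • (X.A r y - 1)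
def Ck (k : Fin n) (r : ℝ) (y : EE n) : MM n := (2 * r) • X.T k r y
def Ckk (k : Fin n) (r : ℝ) (y : EE n) : MM n := (2 * r ^ 2) • X.V k r y
def Cr (r : ℝ) (y : EE n) : MM n := (2:ℝ) • ∑ k, (y k • X.T k r y - r • X.S k r y)
lemma Cm_gb : MGB X.Cm := MGB.smul (GB.const 2) (MGB.sub X.A_gb fun i j => GB.const _)
lemma Ck_gb (k) : MGB (X.Ck k) := MGB.smul ((GB.const 2).mul GB.rr) (X.T_gb k)
lemma Ckk_gb (k) : MGB (X.Ckk k) := MGB.smul (by simpa only [sq] using (GB.const 2).mul (GB.rr.mul GB.rr)) (X.V_gb k)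
lemma Cr_gb : MGB X.Cr := MGB.smul (GB.const 2) (MGB.sum _ fun k _ => MGB.sub (MGB.smul (GB.coord k) (X.T_gb k)) (MGB.smul GB.rr (X.S_gb k)))
lemma Cm_hl (k r y) : MD (fun t => X.Cm r (y + t • bs k)) (X.Ck k r y) 0 := fun i j =>
  HL.congr ((X.A_hl i j k r y |>.sub (HL.const _)).const_mul 2) (by simp only [Ck, Matrix.smul_apply, smul_eq_mul]; ring)
lemma Ck_hl (k r y) : MD (fun t => X.Ck k r (y + t • bs k)) (X.Ckk k r y) 0 := fun i j =>
  HL.congr ((X.T_hl i j k r y).const_mul (2 * r)) (by simp only [Ckk, Matrix.smul_apply, smul_eq_mul]; ring)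
lemma Cm_dr (r y) : MD (fun r => X.Cm r y) (X.Cr r y) r := fun i j =>
  (((X.A_dr i j r y).sub_const _).const_mul 2).congr_deriv (by
    simp only [Cr, Matrix.smul_apply, Matrix.sum_apply, Matrix.sub_apply, smul_eq_mul])
lemma magic (r y) : r • X.Cr r y + ∑ k, (X.Ckk k r y - y k • X.Ck k r y + (2 * r * X.m1 k r y) • X.Ck k r y) =
    (-4 * r ^ 2) • (X.A r y * X.A r y) := by
  ext i j
  simp only [Cr, Ckk, Ck, V, Matrix.add_apply, Matrix.smul_apply, Matrix.sum_apply, Matrix.sub_apply, smul_eq_mul, Matrix.mul_apply, Finset.mul_sum, Matrix.of_apply]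
  rw [← Finset.sum_add_distrib]
  refine Finset.sum_congr rfl fun k _ => ?_
  have : X.A r y k j = X.A r y j k := by simp only [A, Matrix.of_apply]; rw [m2s]; ring
  rw [this]; ring
lemma Cm_symm (r y) : (X.Cm r y).IsHermitian := by
  ext i j; simp only [Cm, A, Matrix.conjTranspose_apply, star_trivial, Matrix.smul_apply, Matrix.sub_apply, Matrix.of_apply]
  rw [m2s, mul_comm (X.m1 j r y), Matrix.one_apply, Matrix.one_apply]; simp only [eq_comm]
variable (q : ℕ)
def u (r : ℝ) (y : EE n) : ℝ := (X.Cm r y ^ (2 * q)).trace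
def v (r : ℝ) (y : EE n) : ℝ := (1 + X.u q r y)⁻¹
lemma u_nonneg (r y) : 0 ≤ X.u q r y := by
  unfold u
  rw [two_mul, pow_add]
  have h : (X.Cm r y ^ q).IsHermitian := (X.Cm_symm r y).pow q
  simp only [Matrix.trace, Matrix.diag, Matrix.mul_apply]
  refine Finset.sum_nonneg fun i _ => Finset.sum_nonneg fun j _ => ?_
  have := h.apply i j
  simp only [star_trivial] at this
  rw [this]; exact mul_self_nonneg _
lemma u_gb : GB (X.u q) := (X.Cm_gb.pow _).tr
lemma v_pos (r y) : 0 < X.v q r y := inv_pos.2 (by have := X.u_nonneg q r y; linarith)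
lemma v_le (r y) : X.v q r y ≤ 1 := inv_le_one_of_one_le₀ (by have := X.u_nonneg q r y; linarith)
lemma v_gb : GB (X.v q) := by
  refine ⟨fun r => (continuous_const.add ((X.u_gb q).1 r)).inv₀ fun y => by have := X.u_nonneg q r y; show (1:ℝ) + X.u q r y ≠ 0; linarith, 1, 0, zero_le_one, fun r _ y => ?_⟩
  rw [abs_of_pos (X.v_pos q r y)]; simpa using X.v_le q r y
def wk (k : Fin n) (r : ℝ) (y : EE n) : ℝ := (2 * q : ℕ) * (X.Cm r y ^ (2 * q - 1) * X.Ck k r y).trace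
def Q2 (k : Fin n) (r : ℝ) (y : EE n) : ℝ :=
  ∑ j ∈ Finset.range (2 * q - 1), (X.Cm r y ^ j * X.Ck k r y * X.Cm r y ^ (2 * q - 1 - 1 - j) * X.Ck k r y).trace
def wkk (k : Fin n) (r : ℝ) (y : EE n) : ℝ := (2 * q : ℕ) * (X.Q2 q k r y + (X.Cm r y ^ (2 * q - 1) * X.Ckk k r y).trace)
def wr (r : ℝ) (y : EE n) : ℝ := (2 * q : ℕ) * (X.Cm r y ^ (2 * q - 1) * X.Cr r y).trace
lemma wk_gb (k) : GB (X.wk q k) := (GB.const _).mul ((X.Cm_gb.pow _).mul (X.Ck_gb k)).tr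
lemma wkk_gb (k) : GB (X.wkk q k) := (GB.const _).mul ((GB.sum _ fun j _ =>
  ((((X.Cm_gb.pow _).mul (X.Ck_gb k)).mul (X.Cm_gb.pow _)).mul (X.Ck_gb k)).tr).add ((X.Cm_gb.pow _).mul (X.Ckk_gb k)).tr)
lemma wr_gb : GB (X.wr q) := (GB.const _).mul ((X.Cm_gb.pow _).mul X.Cr_gb).tr
lemma u_hl (k r y) : HL (X.u q r) (X.wk q k r y) y k := by
  have := (X.Cm_hl k r y).trpow (2 * q)
  simp only [zero_smul, add_zero] at this; exact this
lemma wk_hl (k r y) : HL (X.wk q k r) (X.wkk q k r y) y k := by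
  have := ((X.Cm_hl k r y).trpow2 (X.Ck_hl k r y) (2 * q - 1)).const_mul (((2 * q : ℕ) : ℝ))
  simp only [zero_smul, add_zero] at this
  exact this
lemma u_dr (r y) : HasDerivAt (fun r => X.u q r y) (X.wr q r y) r := (X.Cm_dr r y).trpow (2 * q)
lemma v_hl (k r y) : HL (X.v q r) (-(X.v q r y ^ 2 * X.wk q k r y)) y k := by
  have h := HasDerivAt.fun_inv ((HL.const 1).add (X.u_hl q k r y)) (by have := X.u_nonneg q r (y + (0:ℝ) • bs k); linarith)
  refine HasDerivAt.congr_deriv h ?_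
  simp only [zero_smul, add_zero, v, inv_pow]
  have := X.u_nonneg q r y
  field_simp; ring
lemma v_dr (r y) : HasDerivAt (fun r => X.v q r y) (-(X.v q r y ^ 2 * X.wr q r y)) r := by
  have h := HasDerivAt.fun_inv ((X.u_dr q r y).const_add 1) (by have := X.u_nonneg q r y; linarith)
  refine HasDerivAt.congr_deriv h ?_
  simp only [v, inv_pow]
  have := X.u_nonneg q r y
  field_simp
def P (r : ℝ) (y : EE n) : ℝ := X.Z r y * (1 - X.v q r y)
def Pk (k : Fin n) (r : ℝ) (y : EE n) : ℝ := X.Z r y * (r * X.m1 k r y * (1 - X.v q r y) + X.v q r y * X.v q r y * X.wk q k r y)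
def Pkk (k : Fin n) (r : ℝ) (y : EE n) : ℝ := X.Z r y * (r * X.m1 k r y * (r * X.m1 k r y * (1 - X.v q r y) + X.v q r y * X.v q r y * X.wk q k r y)
  + r * (r * X.A r y k k) * (1 - X.v q r y) + r * X.m1 k r y * (X.v q r y * X.v q r y * X.wk q k r y)
  - 2 * (X.v q r y * X.v q r y * X.v q r y) * (X.wk q k r y * X.wk q k r y) + X.v q r y * X.v q r y * X.wkk q k r y)
def Pr (r : ℝ) (y : EE n) : ℝ := X.Z r y * ((∑ k, (y k * X.m1 k r y - r * X.m2 k k r y)) * (1 - X.v q r y) + X.v q r y * X.v q r y * X.wr q r y)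
lemma P_gb : GB (X.P q) := X.Z_gb.mul ((GB.const 1).sub (X.v_gb q))
lemma Pk_gb (k) : GB (X.Pk q k) := X.Z_gb.mul (((GB.rr.mul (X.m1_gb k)).mul ((GB.const 1).sub (X.v_gb q))).add
  (((X.v_gb q).mul (X.v_gb q)).mul (X.wk_gb q k)))
lemma Pkk_gb (k) : GB (X.Pkk q k) := by
  have a := GB.rr.mul (X.m1_gb k)
  have b := (GB.const 1).sub (X.v_gb q)
  have c := ((X.v_gb q).mul (X.v_gb q)).mul (X.wk_gb q k)
  exact X.Z_gb.mul (((((a.mul ((a.mul b).add c)).add ((GB.rr.mul (GB.rr.mul (X.A_gb k k))).mul b)).add (a.mul c)).sub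
    (((GB.const 2).mul (((X.v_gb q).mul (X.v_gb q)).mul (X.v_gb q))).mul ((X.wk_gb q k).mul (X.wk_gb q k)))).add
    (((X.v_gb q).mul (X.v_gb q)).mul (X.wkk_gb q k)))
lemma Pr_gb : GB (X.Pr q) := X.Z_gb.mul (((GB.sum _ fun k _ => ((GB.coord k).mul (X.m1_gb k)).sub (GB.rr.mul (X.m2_gb k k))).mul
  ((GB.const 1).sub (X.v_gb q))).add (((X.v_gb q).mul (X.v_gb q)).mul (X.wr_gb q)))
lemma P_hl (k r y) : HL (X.P q r) (X.Pk q k r y) y k :=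
  ((X.Z_hl r y k).mul ((HL.const 1).sub (X.v_hl q k r y))).congr (by simp only [Pk, m1]; ring)
lemma Pk_hl (k r y) : HL (X.Pk q k r) (X.Pkk q k r y) y k :=
  ((X.Z_hl r y k).mul ((((X.m1_hl k k r y).const_mul r).mul ((HL.const 1).sub (X.v_hl q k r y))).add
    (((X.v_hl q k r y).mul (X.v_hl q k r y)).mul (X.wk_hl q k r y)))).congr (by
      simp only [Pkk, A, Matrix.of_apply]
      change X.Z r y * (r * X.m1 k r y) * _ + _ = _
      ring)
lemma P_dr (r y) : HasDerivAt (fun r => X.P q r y) (X.Pr q r y) r :=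
  ((X.Z_dr r y).mul ((hasDerivAt_const r 1).sub (X.v_dr q r y))).congr_deriv (by
    simp only [Pr, m1, m2]; simp only [Pi.sub_apply]; ring)
def E0 (r : ℝ) (y : EE n) : ℝ := X.v q r y ^ 2 * ((2 * q : ℕ) * (∑ k, X.Q2 q k r y - 4 * r ^ 2 * (X.Cm r y ^ (2 * q - 1) * (X.A r y * X.A r y)).trace))
   - 2 * X.v q r y ^ 3 * ∑ k, X.wk q k r y ^ 2
lemma gen_id (r y) : r * X.Pr q r y + ∑ k, (X.Pkk q k r y - y k * X.Pk q k r y) = X.Z r y * X.E0 q r y := by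
  have h := congrArg (fun M => (X.Cm r y ^ (2 * q - 1) * M).trace) (X.magic r y)
  simp only [Matrix.mul_add, Matrix.mul_sub, Matrix.mul_sum, Matrix.mul_smul, Matrix.trace_add, Matrix.trace_sub, Matrix.trace_sum, Matrix.trace_smul, smul_eq_mul] at h
  have hA : ∀ k, X.A r y k k = X.m2 k k r y - X.m1 k r y * X.m1 k r y := fun k => rfl
  set τ : MM n → ℝ := fun M => (X.Cm r y ^ (2 * q - 1) * M).trace with hτ
  have e1 : ∀ k, X.Pkk q k r y - y k * X.Pk q k r y = X.Z r y * ((2 * q : ℕ) * X.v q r y ^ 2) * (τ (X.Ckk k r y) - y k * τ (X.Ck k r y) + 2 * r * X.m1 k r y * τ (X.Ck k r y))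
     + X.Z r y * ((2 * q : ℕ) * X.v q r y ^ 2) * X.Q2 q k r y - X.Z r y * 2 * X.v q r y ^ 3 * X.wk q k r y ^ 2
     - (r * X.Z r y * (1 - X.v q r y)) * (y k * X.m1 k r y - r * X.m2 k k r y) := fun k => by
    simp only [Pkk, Pk, wkk, hA]
    have : X.wk q k r y = (2 * q : ℕ) * τ (X.Ck k r y) := rfl
    rw [this]; ring
  rw [Finset.sum_congr rfl fun k _ => e1 k]
  simp only [Finset.sum_sub_distrib, Finset.sum_add_distrib, ← Finset.mul_sum] at h ⊢
  simp only [Pr, E0, wr]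
  change r * τ (X.Cr r y) + _ = _ at h
  change _ = X.Z r y * (X.v q r y ^ 2 * (((2 * q : ℕ) : ℝ) * (∑ k, X.Q2 q k r y - 4 * r ^ 2 * τ (X.A r y * X.A r y))) - _)
  change r * (X.Z r y * (_ + X.v q r y * X.v q r y * (((2 * q : ℕ) : ℝ) * τ (X.Cr r y)))) + _ = _
  simp only [Finset.sum_sub_distrib, ← Finset.mul_sum]
  linear_combination (X.Z r y * ((2 * q : ℕ) * X.v q r y ^ 2)) * h
theorem evol {r : ℝ} (hr : |r| < 2) : ∃ d, HasDerivAt (fun r => ∫ y, X.P q r y ∂(stdGaussian (EE n))) d r ∧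
    r * d = ∫ y, X.Z r y * X.E0 q r y ∂(stdGaussian (EE n)) := by
  refine ⟨_, (X.P_gb q).deriv (X.Pr_gb q) (X.P_dr q) hr, ?_⟩
  simp only [← gen_id]
  have g1 : ∀ k, GB (fun r y => X.Pkk q k r y - y k * X.Pk q k r y) := fun k => (X.Pkk_gb q k).sub ((GB.coord k).mul (X.Pk_gb q k))
  rw [integral_add ((GB.rr.mul (X.Pr_gb q)).int hr.le) ((GB.sum _ fun k _ => g1 k).int hr.le), integral_const_mul,
    integral_finset_sum _ fun k _ => (g1 k).int hr.le]
  rw [Finset.sum_eq_zero fun k _ => (X.Pk_gb q k).ibp (X.Pkk_gb q k) k hr.le (X.Pk_hl q k r), add_zero]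
end CM
end

section
section mat
variable {n : ℕ}
open Matrix
lemma diagz {C : MM n} (hC : C.IsHermitian) : ∃ (W : MM n) (l : Fin n → ℝ), Wᵀ * W = 1 ∧ W * Wᵀ = 1 ∧ C = W * diagonal l * Wᵀ := by
  have h := hC.spectral_theorem
  rw [Unitary.conjStarAlgAut_apply] at h
  refine ⟨hC.eigenvectorUnitary, hC.eigenvalues, ?_, ?_, ?_⟩
  · exact Unitary.coe_star_mul_self hC.eigenvectorUnitary
  · exact Unitary.coe_mul_star_self hC.eigenvectorUnitary
  · exact h
structure Dg (C W : MM n) (l : Fin n → ℝ) : Prop where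
  h1 : Wᵀ * W = 1
  h2 : W * Wᵀ = 1
  h3 : C = W * diagonal l * Wᵀ
variable {C W : MM n} {l : Fin n → ℝ}
lemma Dg.pow (h : Dg C W l) (p : ℕ) : C ^ p = W * diagonal (fun a => l a ^ p) * Wᵀ := by
  induction p with
  | zero => simp [h.h2]
  | succ p ih =>
    rw [pow_succ, ih]; conv_lhs => rw [h.h3]
    rw [show W * diagonal (fun a => l a ^ p) * Wᵀ * (W * diagonal l * Wᵀ) = W * (diagonal (fun a => l a ^ p) * (Wᵀ * W) * diagonal l) * Wᵀ by noncomm_ring,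
      h.h1, mul_one, diagonal_mul_diagonal]; rfl
lemma Dg.tr (h : Dg C W l) (p : ℕ) : (C ^ p).trace = ∑ a, l a ^ p := by
  rw [h.pow, trace_mul_comm, ← mul_assoc, h.h1, one_mul, trace_diagonal]
lemma Dg.tr2 (h : Dg C W l) (p s : ℕ) {T : MM n} (hT : Tᵀ = T) :
    (C ^ p * T * C ^ s * T).trace = ∑ a, ∑ b, l a ^ p * l b ^ s * (Wᵀ * T * W) a b ^ 2 := by
  rw [h.pow, h.pow]
  rw [show W * diagonal (fun a => l a ^ p) * Wᵀ * T * (W * diagonal (fun a => l a ^ s) * Wᵀ) * T =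
    W * (diagonal (fun a => l a ^ p) * (Wᵀ * T * W) * diagonal (fun a => l a ^ s) * (Wᵀ * T)) by noncomm_ring, trace_mul_comm,
    mul_assoc _ (Wᵀ * T) W]
  have hs : (Wᵀ * T * W)ᵀ = Wᵀ * T * W := by simp [transpose_mul, hT, mul_assoc]
  generalize Wᵀ * T * W = S at hs
  rw [trace]
  refine Finset.sum_congr rfl fun a _ => ?_
  rw [diag, mul_apply]
  refine Finset.sum_congr rfl fun b _ => ?_
  rw [mul_diagonal, diagonal_mul, show S b a = S a b from congrFun (congrFun hs a) b]; ring
lemma pw (x y : ℝ) (p s : ℕ) : x ^ p * y ^ s ≤ |x| ^ (p + s) + |y| ^ (p + s) := by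
  refine (le_abs_self _).trans ?_
  rw [abs_mul, abs_pow, abs_pow]
  have := abs_nonneg x
  have := abs_nonneg y
  rcases le_total |x| |y| with h | h
  · calc _ ≤ |y| ^ p * |y| ^ s := by gcongr
      _ ≤ _ := by rw [← pow_add]; linarith [pow_nonneg (abs_nonneg x) (p + s)]
  · calc _ ≤ |x| ^ p * |x| ^ s := by gcongr
      _ ≤ _ := by rw [← pow_add]; linarith [pow_nonneg (abs_nonneg y) (p + s)]
lemma Dg.col (h : Dg C W l) (a : Fin n) : ∑ i, W i a ^ 2 = 1 := by
  have := congrFun (congrFun h.h1 a) a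
  simpa [mul_apply, sq] using this
lemma Dg.ten (h : Dg C W l) {T : Fin n → MM n} (hT : ∀ k, (T k)ᵀ = T k) {κ : ℝ}
    (hk : ∀ θ : Fin n → ℝ, ∑ b, ∑ d, (∑ i, θ i * T b i d) ^ 2 ≤ κ * ∑ i, θ i ^ 2) (p s : ℕ) (he : Even (p + s)) :
    ∑ k, (C ^ p * T k * C ^ s * T k).trace ≤ 2 * κ * (C ^ (p + s)).trace := by
  set m := p + s
  set S : Fin n → MM n := fun k => Wᵀ * T k * W with hS
  have hs : ∀ k a b, S k a b = S k b a := fun k a b => by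
    have : (S k)ᵀ = S k := by simp [hS, transpose_mul, hT, mul_assoc]
    exact congrFun (congrFun this b) a
  have row : ∀ a, ∑ k, ∑ b, S k a b ^ 2 ≤ κ := fun a => by
    have := hk (fun i => W i a)
    rw [h.col, mul_one] at this
    refine le_trans (le_of_eq (Finset.sum_congr rfl fun k _ => ?_)) this
    have e : ∑ b, S k a b ^ 2 = (S k * S k) a a := by
      rw [mul_apply]; exact Finset.sum_congr rfl fun b _ => by rw [hs k b a, sq]
    have e2 : S k * S k = (Wᵀ * T k) * (Wᵀ * T k)ᵀ := by
      rw [hS]; simp only [transpose_mul, hT, transpose_transpose]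
      rw [show Wᵀ * T k * W * (Wᵀ * T k * W) = Wᵀ * T k * (W * Wᵀ) * (T k * W) by noncomm_ring, h.h2, mul_one]
    rw [e, e2, mul_apply]
    refine Finset.sum_congr rfl fun d _ => ?_
    rw [transpose_apply, ← sq, mul_apply]; rfl
  calc _ ≤ ∑ k, ∑ a, ∑ b, (l a ^ m * S k a b ^ 2 + l b ^ m * S k b a ^ 2) := Finset.sum_le_sum fun k _ => by
        rw [h.tr2 p s (hT k)]
        refine Finset.sum_le_sum fun a _ => Finset.sum_le_sum fun b _ => ?_
        rw [hs k b a, ← add_mul]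
        refine mul_le_mul_of_nonneg_right ?_ (sq_nonneg _)
        have := pw (l a) (l b) p s
        rwa [he.pow_abs, he.pow_abs] at this
    _ = 2 * ∑ a, l a ^ m * ∑ k, ∑ b, S k a b ^ 2 := by
        simp only [Finset.sum_add_distrib]
        have : ∑ k, ∑ a, ∑ b, l b ^ m * S k b a ^ 2 = ∑ k, ∑ a, ∑ b, l a ^ m * S k a b ^ 2 :=
          Finset.sum_congr rfl fun k _ => Finset.sum_comm
        rw [this, ← two_mul, Finset.sum_comm]; simp only [Finset.mul_sum]
    _ ≤ 2 * ∑ a, l a ^ m * κ := by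
        gcongr with a
        · exact he.pow_nonneg _
        · exact row a
    _ = _ := by rw [← Finset.sum_mul, h.tr]; ring
lemma Dg.quad (h : Dg C W l) (θ : Fin n → ℝ) : ∑ i, ∑ j, θ i * C i j * θ j = ∑ a, l a * (∑ i, W i a * θ i) ^ 2 := by
  have : ∀ i j, C i j = ∑ a, W i a * l a * W j a := fun i j => by
    rw [h.h3, mul_apply]; simp [mul_diagonal]
  simp only [this, sq, Finset.sum_mul, Finset.mul_sum]
  rw [Finset.sum_congr rfl fun j _ => Finset.sum_comm, Finset.sum_comm]
  refine Finset.sum_congr rfl fun a _ => Finset.sum_congr rfl fun i _ => Finset.sum_congr rfl fun j _ => by ring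
lemma Dg.nrm (h : Dg C W l) (θ : Fin n → ℝ) : ∑ a, (∑ i, W i a * θ i) ^ 2 = ∑ i, θ i ^ 2 := by
  have e := (Dg.mk h.h1 h.h2 (by simp [h.h2]) : Dg (1 : MM n) W (fun _ => 1)).quad θ
  simp only [one_mul] at e
  rw [← e]; simp [Matrix.one_apply, sq]
lemma Dg.eig (h : Dg C W l) (a : Fin n) : ∑ i, ∑ j, W i a * C i j * W j a = l a := by
  rw [h.quad]
  have : ∀ b, ∑ i, W i b * W i a = if b = a then 1 else 0 := fun b => by
    have := congrFun (congrFun h.h1 b) a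
    rw [mul_apply, one_apply] at this; exact this
  simp [this]
end mat
end

section
namespace CM
variable {n : ℕ} (X : CM n)
instance (r y) : IsProbabilityMeasure (X.post r y) := by
  haveI := X.prob
  exact isProbabilityMeasure_tilted (X.intble (wt_cont r y))
lemma A_post (r y i j) : X.A r y i j = ∫ x, (x i - X.m1 i r y) * (x j - X.m1 j r y) ∂(X.post r y) := by
  have I := fun {g : EE n → ℝ} (hg : Continuous g) => X.post_int hg r y
  have e : (fun x : EE n => (x i - X.m1 i r y) * (x j - X.m1 j r y)) = fun x => (x i * x j + (-X.m1 j r y) * x i) + ((-X.m1 i r y) * x j + X.m1 i r y * X.m1 j r y) := by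
    ext x; ring
  have := cco i
  have := cco j
  rw [e, integral_add (I (by fun_prop)) (I (by fun_prop)), integral_add (I (by fun_prop)) (I (by fun_prop)), integral_add (I (by fun_prop)) (I (by fun_prop)),
    integral_const_mul, integral_const_mul, integral_const, integral_post, integral_post, integral_post]
  simp only [A, Matrix.of_apply, m2, m1, probReal_univ, one_smul]; ring
lemma T_post (r y i j k) : X.T k r y i j = ∫ x, (x i - X.m1 i r y) * ((x j - X.m1 j r y) * (x k - X.m1 k r y)) ∂(X.post r y) := by
  have I := fun {g : EE n → ℝ} (hg : Continuous g) => X.post_int hg r y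
  have e : (fun x : EE n => (x i - X.m1 i r y) * ((x j - X.m1 j r y) * (x k - X.m1 k r y))) = fun x =>
    (x i * x j * x k + (-X.m1 i r y) * (x j * x k)) + (((-X.m1 j r y) * (x i * x k) + (- X.m1 k r y) * (x i * x j)) +
     (((X.m1 j r y * X.m1 k r y) * x i + (X.m1 i r y * X.m1 k r y) * x j) + ((X.m1 i r y * X.m1 j r y) * x k + (- (X.m1 i r y * X.m1 j r y * X.m1 k r y))))) := by
    ext x; ring
  have := cco i
  have := cco j
  have := cco k
  rw [e, integral_add (I (by fun_prop)) (I (by fun_prop)), integral_add (I (by fun_prop)) (I (by fun_prop)), integral_add (I (by fun_prop)) (I (by fun_prop)),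
    integral_add (I (by fun_prop)) (I (by fun_prop)), integral_add (I (by fun_prop)) (I (by fun_prop)), integral_add (I (by fun_prop)) (I (by fun_prop)),
    integral_add (I (by fun_prop)) (I (by fun_prop)), integral_const]
  simp only [integral_const_mul, integral_post, T, Matrix.of_apply, m3, m2, m1, probReal_univ, one_smul]; ring
lemma A_quad (r y) (θ : Fin n → ℝ) : ∫ x, (∑ i, θ i * (x i - X.m1 i r y)) ^ 2 ∂(X.post r y) = ∑ i, ∑ j, θ i * X.A r y i j * θ j := by
  have c := fun i : Fin n => cco i
  have e : (fun x : EE n => (∑ i, θ i * (x i - X.m1 i r y)) ^ 2) = fun x => ∑ i, ∑ j, (θ i * θ j) * ((x i - X.m1 i r y) * (x j - X.m1 j r y)) := by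
    ext x; rw [sq, Finset.sum_mul_sum]; exact Finset.sum_congr rfl fun i _ => Finset.sum_congr rfl fun j _ => by ring
  rw [e, integral_finset_sum _ fun i _ => X.post_int (by fun_prop) r y]
  refine Finset.sum_congr rfl fun i _ => ?_
  rw [integral_finset_sum _ fun i _ => X.post_int (by fun_prop) r y]
  refine Finset.sum_congr rfl fun j _ => ?_
  rw [integral_const_mul, ← A_post]; ring
lemma T_lin (r y) (θ : Fin n → ℝ) (b d) : ∫ x, (∑ i, θ i * (x i - X.m1 i r y)) * ((x b - X.m1 b r y) * (x d - X.m1 d r y)) ∂(X.post r y) =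
    ∑ i, θ i * X.T b r y i d := by
  have c := fun i : Fin n => cco i
  have e : (fun x : EE n => (∑ i, θ i * (x i - X.m1 i r y)) * ((x b - X.m1 b r y) * (x d - X.m1 d r y))) =
      fun x => ∑ i, θ i * ((x i - X.m1 i r y) * ((x d - X.m1 d r y) * (x b - X.m1 b r y))) := by
    ext x; rw [Finset.sum_mul]; exact Finset.sum_congr rfl fun i _ => by ring
  rw [e, integral_finset_sum _ fun i _ => X.post_int (by fun_prop) r y]
  refine Finset.sum_congr rfl fun i _ => ?_
  rw [integral_const_mul, ← T_post]
lemma T_symm (k r y) : (X.T k r y).transpose = X.T k r y := by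
  ext i j
  rw [Matrix.transpose_apply, T_post, T_post]; congr 1; ext x; ring
lemma N_fub {f g : EE n → ℝ} (hf : PG f) (hg : Continuous g) (r : ℝ) :
    ∫ y, f y * X.N g r y ∂(stdGaussian (EE n)) = ∫ x, g x * ∫ y, f (y + r • x) ∂(stdGaussian (EE n)) ∂X.mu := by
  haveI := X.prob
  have s : ∀ x, ∫ y, f (y + r • x) ∂(stdGaussian (EE n)) = ∫ y, f y * wt r y x ∂(stdGaussian (EE n)) := fun x => by
    rw [std_shift]; congr 1; ext y
    rw [smul_eq_mul, mul_comm]; unfold wt; rw [norm_smul, inner_smul_left, real_inner_comm, mul_pow, Real.norm_eq_abs, sq_abs]; rfl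
  simp only [s, N, ← integral_const_mul]
  rw [integral_integral_swap]
  · congr 1; ext x; congr 1; ext y; ring
  obtain ⟨C, k, hC, hb⟩ := hf.le_exp
  obtain ⟨D, hD, hgb⟩ := X.bdd hg
  refine Integrable.mono' (g := fun p : EE n × EE n => C * D * rexp ((k + |r| * X.R) * ‖p.1‖)) ?_ ?_ ?_
  · exact (((intble_exp_std (E := EE n) (k + |r| * X.R)).comp_fst X.mu).const_mul (C * D))
  · have := hf.cont
    refine Continuous.aestronglyMeasurable ?_
    unfold wt; fun_prop
  have := Measure.quasiMeasurePreserving_snd (μ := stdGaussian (EE n)) (ν := X.mu) |>.ae (hgb.and X.supp)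
  filter_upwards [this] with p hp
  obtain ⟨h1, h2⟩ := hp
  simp only [Function.uncurry]
  rw [norm_mul, norm_mul, Real.norm_eq_abs, Real.norm_eq_abs, Real.norm_eq_abs]
  unfold wt
  rw [Real.abs_exp, add_mul, Real.exp_add]
  have i1 : rexp (r * ⟪p.1, p.2⟫ - r ^ 2 * ‖p.2‖ ^ 2 / 2) ≤ rexp (|r| * X.R * ‖p.1‖) := by
    refine Real.exp_le_exp.2 ?_
    have h1 : r * ⟪p.1, p.2⟫ ≤ |r| * X.R * ‖p.1‖ := by
      refine (le_abs_self _).trans ?_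
      rw [abs_mul]
      calc _ ≤ |r| * (‖p.1‖ * X.R) := mul_le_mul_of_nonneg_left ((abs_real_inner_le_norm _ _).trans (mul_le_mul_of_nonneg_left h2 (norm_nonneg _))) (abs_nonneg _)
        _ = _ := by ring
    nlinarith [mul_nonneg (sq_nonneg r) (sq_nonneg ‖p.2‖)]
  calc _ ≤ (C * rexp (k * ‖p.1‖)) * (D * rexp (|r| * X.R * ‖p.1‖)) :=
        mul_le_mul (hb _) (mul_le_mul h1 i1 (exp_pos _).le hD) (by positivity) (by positivity)
    _ = _ := by ring
lemma Z_int (r : ℝ) : ∫ y, X.Z r y ∂(stdGaussian (EE n)) = 1 := by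
  haveI := X.prob
  have := X.N_fub (PG.const 1) (continuous_const (y := (1:ℝ))) r
  simpa [Z] using this
end CM
namespace Bd
variable {n : ℕ} (B : Bd n)
lemma drift (q : ℕ) (hq : 2 ≤ q) {r : ℝ} (hr : 0 < r) (hr1 : r ≤ 1) (y : EE n) :
    B.cm.E0 q r y ≤ r * (1040 * rexp 6 * q ^ 2) * ((1 - B.cm.v q r y) + n * rexp (-6 * q)) := by
  set X := B.cm
  obtain ⟨W, l, h1, h2, h3⟩ := diagz (X.Cm_symm r y)
  have hD : Dg (X.Cm r y) W l := ⟨h1, h2, h3⟩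
  have hA : X.A r y = W * Matrix.diagonal (fun a => 1 + l a / 2) * W.transpose := by
    have e : X.A r y = 1 + (1/2:ℝ) • X.Cm r y := by simp [CM.Cm, smul_smul]
    have e2 : Matrix.diagonal (fun a => 1 + l a / 2) = 1 + (1/2:ℝ) • Matrix.diagonal l := by
      rw [← Matrix.diagonal_smul, ← Matrix.diagonal_one, Matrix.diagonal_add]; congr 1; ext a; simp; ring
    rw [e, e2, Matrix.mul_add, Matrix.add_mul, mul_one, h2, Matrix.mul_smul, Matrix.smul_mul, ← h3]
  have hDA : Dg (X.A r y) W (fun a => 1 + l a / 2) := ⟨h1, h2, hA⟩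
  have lpos : ∀ a, 0 ≤ 1 + l a / 2 := fun a => by
    rw [← hDA.eig a, ← X.A_quad r y (fun i => W i a)]
    exact integral_nonneg fun x => sq_nonneg _
  have hu : X.u q r y = ∑ a, l a ^ (2 * q) := hD.tr _
  have lu : ∀ a, l a ^ (2 * q) ≤ X.u q r y := fun a => by
    rw [hu]; exact Finset.single_le_sum (f := fun a => l a ^ (2 * q)) (fun b _ => (even_two_mul q).pow_nonneg _) (Finset.mem_univ a)
  have u0 := X.u_nonneg q r y
  set u := X.u q r y with hudef
  obtain ⟨a, ha0, ha3⟩ : ∃ a : ℝ, 0 ≤ a ∧ a ^ 3 = 8 * (1 + u) :=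
    ⟨(8 * (1 + u)) ^ ((1:ℝ)/3), by positivity, by rw [← Real.rpow_natCast, ← Real.rpow_mul (by positivity)]; norm_num⟩
  have ha2 : 2 ≤ a := by
    by_contra h; push Not at h
    have : a ^ 3 < 2 ^ 3 := pow_lt_pow_left₀ h ha0 (by norm_num)
    linarith
  have la : ∀ b, 1 + l b / 2 ≤ a := fun b => by
    rcases le_or_gt (l b) 2 with h | h
    · linarith
    have h3 : l b ^ 3 ≤ u := (pow_le_pow_right₀ (by linarith) (by omega)).trans (lu b)
    have : (1 + l b / 2) ^ 3 ≤ a ^ 3 := by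
      calc _ ≤ (l b) ^ 3 := pow_le_pow_left₀ (lpos b) (by linarith) 3
        _ ≤ _ := by rw [ha3]; linarith
    exact le_of_pow_le_pow_left₀ (by norm_num) ha0 this
  have third := B.third r hr y ha0 (fun i => X.m1 i r y) (fun i => X.integral_post _ r y) (fun θ => by
    rw [X.A_quad, hDA.quad, ← hDA.nrm, Finset.mul_sum]
    exact Finset.sum_le_sum fun b _ => mul_le_mul_of_nonneg_right (la b) (sq_nonneg _))
  set κ := 32 * (1 + u) / r with hκ
  have hκ' : 4 * a ^ 2 * (√a / r) ≤ κ := by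
    have : √a ≤ a := by rw [Real.sqrt_le_left ha0]; nlinarith
    have : a ^ 2 * √a ≤ a ^ 3 := by rw [pow_succ a 2]; gcongr
    rw [hκ, mul_div_assoc', div_le_div_iff_of_pos_right hr]; nlinarith
  have hten : ∀ p s, p + s = 2 * q - 2 → ∑ k, (X.Cm r y ^ p * X.T k r y * X.Cm r y ^ s * X.T k r y).trace ≤ 2 * κ * (X.Cm r y ^ (2 * q - 2)).trace := fun p s h => by
    rw [← h]
    refine hD.ten (fun k => X.T_symm k r y) (fun θ => ?_) p s (by rw [h]; exact ⟨q - 1, by omega⟩)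
    have := third θ
    simp only [X, CM.T_lin] at this
    exact this.trans (mul_le_mul_of_nonneg_right hκ' (Finset.sum_nonneg fun i _ => sq_nonneg _))
  set τ := (X.Cm r y ^ (2 * q - 2)).trace with hτ
  have τe : τ = ∑ a, l a ^ (2 * q - 2) := hD.tr _
  have ev : Even (2 * q - 2) := ⟨q - 1, by omega⟩
  have τ0 : 0 ≤ τ := by rw [τe]; exact Finset.sum_nonneg fun a _ => ev.pow_nonneg _
  have Q : ∑ k, X.Q2 q k r y ≤ 512 * q * r * (1 + u) * τ := by
    simp only [CM.Q2]
    rw [Finset.sum_comm]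
    calc _ ≤ ∑ j ∈ Finset.range (2 * q - 1), 4 * r ^ 2 * (2 * κ * τ) := Finset.sum_le_sum fun j hj => by
          rw [Finset.mem_range] at hj
          refine le_trans (le_of_eq ?_) (mul_le_mul_of_nonneg_left (hten j (2 * q - 1 - 1 - j) (by omega)) (by positivity))
          rw [Finset.mul_sum]
          refine Finset.sum_congr rfl fun k _ => ?_
          simp only [CM.Ck, Matrix.mul_smul, Matrix.smul_mul, Matrix.trace_smul, smul_eq_mul]; ring
      _ = ((2 * q - 1 : ℕ) : ℝ) * (4 * r ^ 2 * (2 * κ * τ)) := by simp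
      _ ≤ (2 * q) * (4 * r ^ 2 * (2 * κ * τ)) := by
          refine mul_le_mul_of_nonneg_right ?_ (by positivity)
          exact_mod_cast Nat.sub_le _ _
      _ = _ := by rw [hκ]; field_simp; ring
  have Tr : - (X.Cm r y ^ (2 * q - 1) * (X.A r y * X.A r y)).trace ≤ 2 * τ := by
    have e : (X.Cm r y ^ (2 * q - 1) * (X.A r y * X.A r y)).trace = ∑ a, l a ^ (2 * q - 1) * (1 + l a / 2) ^ 2 := by
      rw [hD.pow, ← sq, hDA.pow,
        show W * Matrix.diagonal (fun a => l a ^ (2 * q - 1)) * W.transpose * (W * Matrix.diagonal (fun a => (1 + l a / 2) ^ 2) * W.transpose) =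
         W * (Matrix.diagonal (fun a => l a ^ (2 * q - 1)) * (W.transpose * W) * Matrix.diagonal (fun a => (1 + l a / 2) ^ 2) * W.transpose) by noncomm_ring, h1,
         Matrix.trace_mul_comm, mul_assoc _ W.transpose, h1, mul_one, mul_one, Matrix.diagonal_mul_diagonal, Matrix.trace_diagonal]
    rw [e, τe, ← Finset.sum_neg_distrib, Finset.mul_sum]
    refine Finset.sum_le_sum fun a _ => ?_
    have hp := ev.pow_nonneg (l a)
    rw [show 2 * q - 1 = (2 * q - 2) + 1 by omega, pow_succ]
    have hl := lpos a
    have : -(l a * (1 + l a / 2) ^ 2) ≤ 2 := by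
      rcases le_or_gt 0 (l a) with h | h
      · nlinarith [mul_nonneg h (sq_nonneg (1 + l a / 2))]
      · have : (1 + l a / 2) ^ 2 ≤ 1 := by nlinarith
        nlinarith [sq_nonneg (1 + l a / 2)]
    nlinarith
  have hqq : (2:ℝ) ≤ q := by exact_mod_cast hq
  have v0 := X.v_pos q r y
  have hv : X.v q r y * (1 + u) = 1 := inv_mul_cancel₀ (by positivity)
  set v := X.v q r y
  have τu : τ ≤ rexp 6 * (u + n * rexp (-6 * q)) := by
    have : ∀ a, l a ^ (2 * q - 2) ≤ rexp 6 * (l a ^ (2 * q) + rexp (-6 * q)) := fun a => by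
      have h0 := (even_two_mul q).pow_nonneg (l a)
      rw [← (even_two_mul q).pow_abs (l a)] at h0 ⊢
      rw [← ev.pow_abs (l a)]
      rcases le_total |l a| (rexp (-3)) with h | h
      · calc _ ≤ rexp (-3) ^ (2 * q - 2) := pow_le_pow_left₀ (abs_nonneg _) h _
          _ = rexp 6 * rexp (-6 * q) := by
            rw [← Real.exp_nat_mul, ← Real.exp_add]; congr 1
            rw [Nat.cast_sub (by omega)]; push_cast; ring
          _ ≤ _ := by gcongr; linarith
      · have e1 : 1 ≤ rexp 6 * |l a| ^ 2 := by
          calc (1:ℝ) = rexp 6 * rexp (-3) ^ 2 := by rw [← Real.exp_nat_mul, ← Real.exp_add]; norm_num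
            _ ≤ _ := by gcongr
        calc _ ≤ (rexp 6 * |l a| ^ 2) * |l a| ^ (2 * q - 2) := le_mul_of_one_le_left (by positivity) e1
          _ = rexp 6 * |l a| ^ (2 * q) := by rw [mul_assoc, ← pow_add]; congr 2; omega
          _ ≤ _ := by gcongr; linarith [exp_pos (-6 * (q:ℝ))]
    rw [τe]
    refine (Finset.sum_le_sum fun a _ => this a).trans (le_of_eq ?_)
    rw [← Finset.mul_sum, Finset.sum_add_distrib, hu]; simp
  have S3 : 0 ≤ 2 * v ^ 3 * ∑ k, X.wk q k r y ^ 2 := mul_nonneg (by positivity) (Finset.sum_nonneg fun k _ => sq_nonneg _)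
  have hr2 : r ^ 2 ≤ r := by nlinarith
  have vτ : v * τ ≤ rexp 6 * ((1 - v) + n * rexp (-6 * q)) := by
    have vl : v ≤ 1 := X.v_le q r y
    calc v * τ ≤ v * (rexp 6 * (u + n * rexp (-6 * q))) := by gcongr
      _ = rexp 6 * ((1 - v) + v * (n * rexp (-6 * q))) := by linear_combination rexp 6 * hv
      _ ≤ rexp 6 * ((1 - v) + 1 * (n * rexp (-6 * q))) := by gcongr
      _ = _ := by ring
  calc X.E0 q r y ≤ v ^ 2 * ((2 * q : ℕ) * (512 * q * r * (1 + u) * τ + 4 * r * (2 * τ * (1 + u)))) := by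
        have : -(4 * r ^ 2 * (X.Cm r y ^ (2 * q - 1) * (X.A r y * X.A r y)).trace) ≤ 4 * r * (2 * τ * (1 + u)) := by
          calc _ = 4 * r ^ 2 * -(X.Cm r y ^ (2 * q - 1) * (X.A r y * X.A r y)).trace := by ring
            _ ≤ 4 * r ^ 2 * (2 * τ) := by gcongr
            _ ≤ 4 * r * (2 * τ) := by gcongr
            _ ≤ _ := mul_le_mul_of_nonneg_left (le_mul_of_one_le_right (by positivity) (by linarith)) (by positivity)
        calc X.E0 q r y ≤ v ^ 2 * ((2 * q : ℕ) * (∑ k, X.Q2 q k r y - 4 * r ^ 2 * (X.Cm r y ^ (2 * q - 1) * (X.A r y * X.A r y)).trace)) := by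
              unfold CM.E0; linarith
          _ ≤ _ := by gcongr; linarith
    _ = (v * (1 + u)) * (r * (1024 * q ^ 2 + 16 * q) * (v * τ)) := by push_cast; ring
    _ ≤ r * (1040 * q ^ 2) * (v * τ) := by
        rw [hv, one_mul]; gcongr; nlinarith
    _ ≤ r * (1040 * q ^ 2) * (rexp 6 * ((1 - v) + n * rexp (-6 * q))) := by gcongr
    _ = _ := by ring
end Bd
end

section
namespace Bd
variable {n : ℕ} (B : Bd n)
structure Iso : Prop where
  mean : ∀ i, ∫ x, x i ∂B.cm.mu = 0
  cov : ∀ i j, ∫ x, x i * x j ∂B.cm.mu = if i = j then 1 else 0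
variable {B}
lemma Iso.y0 (h : B.Iso) {q : ℕ} (hq : 1 ≤ q) (y : EE n) : B.cm.P q 0 y = 0 := by
  haveI := B.cm.prob
  have hU : ∀ g : EE n → ℝ, B.cm.U g 0 y = ∫ x, g x ∂B.cm.mu := fun g => by simp [CM.U, CM.Z, CM.N, CM.wt]
  have hC : B.cm.Cm 0 y = 0 := by
    ext i j
    simp [CM.Cm, CM.A, CM.m2, CM.m1, hU, h.mean, h.cov, Matrix.one_apply]
  have : B.cm.u q 0 y = 0 := by rw [CM.u, hC, zero_pow (by omega)]; simp
  simp [CM.P, CM.v, this]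
theorem Iso.ybound (h : B.Iso) {q : ℕ} (hq : 2 ≤ q) {r : ℝ} (hr : 0 ≤ r) (hr1 : r * (1040 * rexp 6 * q) ≤ 1) :
    ∫ y, B.cm.P q r y ∂(stdGaussian (EE n)) ≤ n * rexp (-5 * q) := by
  set c := 1040 * rexp 6 * (q:ℝ) ^ 2 with hc
  set e := n * rexp (-6 * q) with he
  set Y : ℝ → ℝ := fun r => ∫ y, B.cm.P q r y ∂(stdGaussian (EE n)) with hY
  have hqq : (2:ℝ) ≤ q := by exact_mod_cast hq
  have r1 : r ≤ 1 := by
    have : (1:ℝ) ≤ 1040 * rexp 6 * q := by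
      have := Real.add_one_le_exp 6; nlinarith
    nlinarith
  have D : ∀ s ∈ Ioo 0 r, ∃ d, HasDerivAt Y d s ∧ d ≤ c * (Y s + e) := fun s hs => by
    have hs2 : |s| < 2 := by rw [abs_of_pos hs.1]; linarith [hs.2]
    obtain ⟨d, hd, hd2⟩ := B.cm.evol q hs2
    refine ⟨d, hd, ?_⟩
    have hs1 : s ≤ 1 := by linarith [hs.2]
    have i1 := (B.cm.Z_gb).int hs2.le
    have i2 := (B.cm.P_gb q).int hs2.le
    have : ∫ y, B.cm.Z s y * B.cm.E0 q s y ∂(stdGaussian (EE n)) ≤ ∫ y, ((s * c) * B.cm.P q s y + (s * c * e) * B.cm.Z s y) ∂(stdGaussian (EE n)) := by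
      by_cases hi : Integrable (fun y => B.cm.Z s y * B.cm.E0 q s y) (stdGaussian (EE n))
      · refine integral_mono hi ((i2.const_mul _).add (i1.const_mul _)) fun y => ?_
        have := mul_le_mul_of_nonneg_left (B.drift q hq hs.1 hs1 y) (B.cm.Z_pos s y).le
        refine this.trans (le_of_eq ?_)
        simp only [CM.P, Pi.add_apply]; ring
      · rw [integral_undef hi]
        refine integral_nonneg fun y => ?_
        have h1 := (B.cm.Z_pos s y).le
        have h2 := B.cm.v_le q s y
        have h3 := hs.1.le
        have : 0 ≤ B.cm.P q s y := mul_nonneg h1 (by linarith)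
        simp only [Pi.zero_apply]; positivity
    rw [← hd2, integral_add (i2.const_mul _) (i1.const_mul _), integral_const_mul, integral_const_mul, B.cm.Z_int] at this
    have h4 : s * d ≤ s * (c * (Y s + e)) := by rw [hY]; linarith
    exact le_of_mul_le_mul_left h4 hs.1
  have cont : ContinuousOn Y (Icc 0 r) := fun s hs => by
    have hs2 : |s| < 2 := by rw [abs_of_nonneg hs.1]; linarith [hs.2]
    obtain ⟨d, hd, hd2⟩ := B.cm.evol q hs2
    exact hd.continuousAt.continuousWithinAt
  have anti : AntitoneOn (fun s => (Y s + e) * rexp (-(c * s))) (Icc 0 r) := by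
    have dd : ∀ s ∈ Ioo 0 r, ∃ d, HasDerivAt (fun s => (Y s + e) * rexp (-(c * s))) d s ∧ d ≤ 0 := fun s hs => by
      obtain ⟨d, h1, h2⟩ := D s hs
      refine ⟨_, (h1.add_const e).mul (((hasDerivAt_id s).const_mul c).neg.exp), ?_⟩
      simp only [id, mul_one, Pi.neg_apply]
      nlinarith [exp_pos (-(c * s))]
    refine antitoneOn_of_deriv_nonpos (convex_Icc _ _) ((cont.add continuousOn_const).mul (by fun_prop)) ?_ ?_
    · rw [interior_Icc]; intro s hs
      obtain ⟨d, h1, h2⟩ := dd s hs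
      exact h1.differentiableAt.differentiableWithinAt
    · rw [interior_Icc]; intro s hs
      obtain ⟨d, h1, h2⟩ := dd s hs
      rwa [h1.deriv]
  have := anti ⟨le_rfl, hr⟩ ⟨hr, le_rfl⟩ hr
  have y0 : Y 0 = 0 := by simp only [hY]; simp [h.y0 (by omega : 1 ≤ q)]
  simp only [y0, mul_zero, neg_zero, Real.exp_zero, mul_one, zero_add] at this
  rw [Real.exp_neg, ← div_eq_mul_inv, div_le_iff₀ (exp_pos _)] at this
  have e0 : 0 ≤ e := by positivity
  have cr : c * r ≤ q := by rw [hc]; nlinarith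
  calc Y r ≤ e * rexp (c * r) := by linarith
    _ ≤ e * rexp q := by gcongr
    _ = _ := by rw [he, mul_assoc, ← Real.exp_add]; congr 2; ring
end Bd
lemma CM.hess_low {n : ℕ} (X : CM n) (q : ℕ) (hq : 1 ≤ q) (r : ℝ) (y : EE n) (H : Fin n → Fin n → ℝ) (hH : ∀ θ : Fin n → ℝ, 0 ≤ ∑ i, ∑ j, θ i * H i j * θ j) :
    1 / 2 * (∑ i, H i i) - (∑ i, H i i) * (1 - X.v q r y) ≤ ∑ i, ∑ j, H i j * X.m2 i j r y := by
  obtain ⟨W, l, h1, h2, h3⟩ := diagz (X.Cm_symm r y)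
  have hD : Dg (X.Cm r y) W l := ⟨h1, h2, h3⟩
  have Cij : ∀ i j, X.A r y i j = ∑ a, W i a * (1 + l a / 2) * W j a := fun i j => by
    have e : X.A r y = 1 + (1/2:ℝ) • X.Cm r y := by simp [CM.Cm, smul_smul]
    have e2 : (1 : MM n) i j = ∑ a, W i a * W j a := by rw [← h2, Matrix.mul_apply]; rfl
    have e3 : X.Cm r y i j = ∑ a, W i a * l a * W j a := by rw [h3, Matrix.mul_apply]; simp [Matrix.mul_diagonal]
    rw [e, Matrix.add_apply, Matrix.smul_apply, e2, e3, smul_eq_mul, Finset.mul_sum, ← Finset.sum_add_distrib]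
    exact Finset.sum_congr rfl fun a _ => by ring
  set η : Fin n → ℝ := fun a => ∑ i, ∑ j, W i a * H i j * W j a with hη
  have η0 : ∀ a, 0 ≤ η a := fun a => hH fun i => W i a
  have sw : ∀ s : Fin n → ℝ, ∑ i, ∑ j, H i j * ∑ a, W i a * s a * W j a = ∑ a, s a * η a := fun s => by
    simp only [hη, Finset.mul_sum]
    rw [Finset.sum_congr rfl fun j _ => Finset.sum_comm, Finset.sum_comm]
    refine Finset.sum_congr rfl fun a _ => Finset.sum_congr rfl fun i _ => Finset.sum_congr rfl fun j _ => by ring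
  have trH : ∑ i, H i i = ∑ a, η a := by
    have := sw fun _ => 1
    simp only [mul_one, one_mul] at this
    rw [← this]
    have e2 : ∀ i j, ∑ a, W i a * W j a = (1 : MM n) i j := fun i j => by rw [← h2, Matrix.mul_apply]; rfl
    simp [e2, Matrix.one_apply]
  have trA : ∑ i, ∑ j, H i j * X.A r y i j = ∑ a, (1 + l a / 2) * η a := by simp only [Cij]; exact sw _
  have lpos : ∀ a, 0 ≤ 1 + l a / 2 := fun a => by
    have hDA : Dg (X.A r y) W (fun a => 1 + l a / 2) := ⟨h1, h2, by ext i j; rw [Cij, Matrix.mul_apply]; simp [Matrix.mul_diagonal]⟩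
    rw [← hDA.eig a, ← X.A_quad r y (fun i => W i a)]
    exact integral_nonneg fun x => sq_nonneg _
  have low : ∑ i, ∑ j, H i j * X.A r y i j ≤ ∑ i, ∑ j, H i j * X.m2 i j r y := by
    have := hH fun i => X.m1 i r y
    have e : ∑ i, ∑ j, H i j * X.m2 i j r y = ∑ i, ∑ j, H i j * X.A r y i j + ∑ i, ∑ j, X.m1 i r y * H i j * X.m1 j r y := by
      simp only [← Finset.sum_add_distrib]
      exact Finset.sum_congr rfl fun i _ => Finset.sum_congr rfl fun j _ => by simp only [CM.A, Matrix.of_apply]; ring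
    linarith
  refine le_trans ?_ low
  rw [trA, trH]
  have S0 : 0 ≤ ∑ a, η a := Finset.sum_nonneg fun a _ => η0 a
  have vl := X.v_le q r y
  rcases le_or_gt (X.u q r y) 1 with hu | hu
  · have : ∀ a, 1 / 2 ≤ 1 + l a / 2 := fun a => by
      have h5 : l a ^ (2 * q) ≤ 1 := by
        refine le_trans ?_ hu
        rw [CM.u, hD.tr]; exact Finset.single_le_sum (f := fun a => l a ^ (2 * q)) (fun b _ => (even_two_mul q).pow_nonneg _) (Finset.mem_univ a)
      rw [← (even_two_mul q).pow_abs] at h5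
      have := (pow_le_one_iff_of_nonneg (abs_nonneg _) (by omega)).1 h5
      linarith [neg_abs_le (l a)]
    have : 1 / 2 * ∑ a, η a ≤ ∑ a, (1 + l a / 2) * η a := by
      rw [Finset.mul_sum]; exact Finset.sum_le_sum fun a _ => mul_le_mul_of_nonneg_right (this a) (η0 a)
    nlinarith
  · have : 0 ≤ ∑ a, (1 + l a / 2) * η a := Finset.sum_nonneg fun a _ => mul_nonneg (lpos a) (η0 a)
    have hv : X.v q r y ≤ 1 / 2 := by
      unfold CM.v; rw [inv_le_comm₀ (by linarith) (by norm_num)]; linarith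
    nlinarith
end

section
section gen
variable {E F : Type*} [NormedAddCommGroup E] [InnerProductSpace ℝ E] [FiniteDimensional ℝ E] [MeasurableSpace E] [BorelSpace E]
  [NormedAddCommGroup F] [InnerProductSpace ℝ F] [FiniteDimensional ℝ F] [MeasurableSpace F] [BorelSpace F]
lemma std_coiso (L : E →L[ℝ] F) (L' : F → E) (h1 : ∀ x y, ⟪L x, y⟫ = ⟪x, L' y⟫) (h2 : ∀ y, ‖L' y‖ = ‖y‖) :
    (stdGaussian E).map L = stdGaussian F := by
  haveI : IsProbabilityMeasure ((stdGaussian E).map L) := Measure.isProbabilityMeasure_map L.continuous.aemeasurable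
  refine Measure.ext_of_charFun ?_
  ext t
  rw [charFun_apply, integral_map L.continuous.aemeasurable (by fun_prop), charFun_stdGaussian, ← h2 t, ← charFun_stdGaussian, charFun_apply]
  simp only [h1]
lemma std_inner (u : E) (hu : ‖u‖ = 1) : (stdGaussian E).map (fun x => ⟪u, x⟫) = stdGaussian ℝ :=
  std_coiso (innerSL ℝ u) (fun t => t • u) (fun x y => by
    rw [innerSL_apply_apply, inner_smul_right, real_inner_comm x u]; rfl) (fun y => by rw [norm_smul, hu, mul_one])
lemma std_equiv (R : E ≃ₗᵢ[ℝ] E) (f : E → ℝ) : ∫ x, f (R x) ∂(stdGaussian E) = ∫ x, f x ∂(stdGaussian E) := by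
  conv_rhs => rw [← stdGaussian_map R]
  exact (R.toHomeomorph.toMeasurableEquiv.measurableEmbedding.integral_map f).symm
lemma std_neg (f : E → ℝ) : ∫ x, f (-x) ∂(stdGaussian E) = ∫ x, f x ∂(stdGaussian E) :=
  std_equiv (LinearIsometryEquiv.neg ℝ (E := E)) f
lemma std_rot (θ : ℝ) : ((stdGaussian E).prod (stdGaussian E)).map (ContinuousLinearMap.rotation θ) = (stdGaussian E).prod (stdGaussian E) :=
  IsGaussian.map_rotation_eq_self (by simpa using integral_id_stdGaussian (E := E)) θ
lemma std_rot1 (θ : ℝ) {f : E → ℝ} (hf : Continuous f) :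
    ∫ p : E × E, f (Real.cos θ • p.1 + Real.sin θ • p.2) ∂((stdGaussian E).prod (stdGaussian E)) = ∫ x, f x ∂(stdGaussian E) := by
  have e : ∫ p : E × E, f p.1 ∂((stdGaussian E).prod (stdGaussian E)) = ∫ x, f x ∂(stdGaussian E) := by
    rw [integral_fun_fst]; simp
  rw [← e]
  conv_rhs => rw [← std_rot θ]
  rw [integral_map (ContinuousLinearMap.continuous _).aemeasurable (by fun_prop)]
  rfl
end gen
def c0 : ℝ := ∫ t, max t 0 ∂(stdGaussian ℝ)
def c1 : ℝ := ∫ t, |t| ∂(stdGaussian ℝ)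
lemma abs_std_int : Integrable (fun t : ℝ => |t|) (stdGaussian ℝ) := by
  have := (PG.norm' (E := ℝ)).intble
  simpa using this
lemma max_std_int : Integrable (fun t : ℝ => max t 0) (stdGaussian ℝ) :=
  abs_std_int.mono' (by fun_prop) (Filter.Eventually.of_forall fun t => by
    rw [Real.norm_eq_abs, abs_of_nonneg (le_max_right _ _)]; exact max_le (le_abs_self _) (abs_nonneg _))
lemma c0_pos : 0 < c0 := by
  unfold c0
  rw [integral_pos_iff_support_of_nonneg (f := fun t : ℝ => max t 0) (fun t => le_max_right _ _) max_std_int]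
  have : Ioi (0:ℝ) ⊆ Function.support fun t : ℝ => max t 0 := fun t ht => by
    rw [Function.mem_support]; exact (lt_max_of_lt_left ht).ne'
  refine lt_of_lt_of_le (pos_iff_ne_zero.2 fun h => ?_) (measure_mono this)
  have := vol_ac_std (E := ℝ) h
  simp at this
lemma c1_nonneg : 0 ≤ c1 := integral_nonneg fun t => abs_nonneg t
structure GN {n : ℕ} (N : EE n → ℝ) : Prop where
  nn : ∀ x, 0 ≤ N x
  hom : ∀ (c : ℝ) x, 0 ≤ c → N (c • x) = c * N x
  sub : ∀ x y, N (x + y) ≤ N x + N y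
  cont : Continuous N
namespace GN
variable {n : ℕ} {N : EE n → ℝ}
lemma lc_of (h : GN N) {b : ℝ} (hb : ∀ x, ‖x‖ = 1 → N x ≤ b) (hb0 : 0 ≤ b) : LC N b := by
  have z : N 0 = 0 := by simpa using h.hom 0 0 le_rfl
  have hb' : ∀ x, N x ≤ b * ‖x‖ := fun x => by
    by_cases hx : x = 0
    · simp [hx, z]
    · have := hb ((‖x‖)⁻¹ • x) (by rw [norm_smul, norm_inv, norm_norm, inv_mul_cancel₀ (norm_ne_zero_iff.2 hx)])
      rw [h.hom _ _ (by positivity), inv_mul_le_iff₀ (norm_pos_iff.2 hx)] at this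
      linarith
  refine ⟨fun x y => ?_, convex_univ, fun x _ y _ a c ha hc _ => ?_⟩
  · rw [abs_le]
    have h1 := h.sub (x - y) y
    have h2 := h.sub (y - x) x
    have h3 := hb' (x - y)
    have h4 := hb' (y - x)
    rw [norm_sub_rev y x] at h4
    simp only [sub_add_cancel] at h1 h2
    constructor <;> linarith
  · have := h.sub (a • x) (c • y)
    rwa [h.hom _ _ ha, h.hom _ _ hc] at this
lemma lc' (h : GN N) : ∃ b, LC N b := by
  obtain ⟨C, hC⟩ := (isCompact_sphere (0 : EE n) 1).exists_bound_of_continuousOn h.cont.continuousOn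
  exact ⟨max C 0, h.lc_of (fun x hx => (le_abs_self _).trans ((hC x (by simpa using hx)).trans (le_max_left _ _))) (le_max_right _ _)⟩
def D (N : EE n → ℝ) : ℝ := ∫ x, N x ∂(stdGaussian (EE n))
lemma D_nonneg (h : GN N) : 0 ≤ D N := integral_nonneg h.nn
lemma int (h : GN N) : Integrable N (stdGaussian (EE n)) := h.lc'.choose_spec.pg.intble
lemma pt (h : GN N) (u : EE n) (hu : ‖u‖ = 1) : N u ≤ D N / c0 := by
  rw [le_div_iff₀ c0_pos]
  set R := Submodule.reflection (ℝ ∙ u)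
  have hR : ∀ x, R x = (2 * ⟪u, x⟫) • u - x := fun x => by
    rw [Submodule.reflection_apply, Submodule.starProjection_unit_singleton _ hu, two_smul, ← add_smul, two_mul]
  have e1 : ∫ x, N (R x) ∂(stdGaussian (EE n)) = D N := std_equiv R N
  have i1 : Integrable (fun x => N (R x)) (stdGaussian (EE n)) := by
    have := h.int
    rw [← stdGaussian_map R] at this
    exact (R.toHomeomorph.toMeasurableEquiv.measurableEmbedding.integrable_map_iff).1 this
  have i2 : Integrable (fun x : EE n => max ⟪u, x⟫ 0) (stdGaussian (EE n)) := by
    have := max_std_int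
    rw [← std_inner u hu] at this
    exact (integrable_map_measure (by fun_prop) (by fun_prop)).1 this
  have e2 : c0 = ∫ x : EE n, max ⟪u, x⟫ 0 ∂(stdGaussian (EE n)) := by
    unfold c0; rw [← std_inner u hu, integral_map (by fun_prop) (by fun_prop)]
  have : ∫ x : EE n, (2 * N u) * max ⟪u, x⟫ 0 ∂(stdGaussian (EE n)) ≤ ∫ x, (N x + N (R x)) ∂(stdGaussian (EE n)) := by
    refine integral_mono (i2.const_mul _) (h.int.fun_add i1) fun x => ?_
    have hs := h.sub x (R x)
    rw [hR, add_sub_cancel] at hs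
    show 2 * N u * max ⟪u, x⟫ 0 ≤ N x + N (R x)
    rw [hR]
    rcases le_total ⟪u, x⟫ 0 with h0 | h0
    · rw [max_eq_right h0, mul_zero]; linarith [h.nn x, h.nn ((2 * ⟪u, x⟫) • u - x)]
    · rw [max_eq_left h0]
      rw [h.hom _ _ (by positivity)] at hs
      linarith
  rw [integral_const_mul, ← e2, integral_add h.int i1, e1] at this
  unfold D at *; linarith
lemma lc (h : GN N) : LC N (D N / c0) := h.lc_of h.pt (div_nonneg h.D_nonneg c0_pos.le)
lemma D2 (h : GN N) : gh (gh N) 0 = √2 * D N := by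
  have hl := h.lc
  have e := std_rot1 (π / 4) (hl.cont)
  have i0 : Integrable (fun p : EE n × EE n => N (p.1 + p.2)) ((stdGaussian (EE n)).prod (stdGaussian (EE n))) := by
    have := hl.cont
    refine Integrable.mono' (((PG.norm' (E := EE n)).intble.comp_fst (stdGaussian (EE n))).fun_add ((PG.norm' (E := EE n)).intble.comp_snd (stdGaussian (EE n))) |>.const_mul (D N / c0))
      (by fun_prop) (Filter.Eventually.of_forall fun p => ?_)
    have h1 := hl.lip (p.1 + p.2) 0
    rw [show N 0 = 0 by simpa using h.hom 0 0 le_rfl, sub_zero, sub_zero] at h1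
    refine h1.trans (mul_le_mul_of_nonneg_left (norm_add_le _ _) (div_nonneg h.D_nonneg c0_pos.le))
  have : ∀ p : EE n × EE n, N (Real.cos (π / 4) • p.1 + Real.sin (π / 4) • p.2) = (√2 / 2) * N (p.1 + p.2) := fun p => by
    rw [Real.cos_pi_div_four, Real.sin_pi_div_four, ← smul_add, h.hom _ _ (by positivity)]
  simp only [this] at e
  rw [integral_const_mul, integral_prod _ i0] at e
  simp only [gh, zero_add]
  unfold D; rw [← e, ← mul_assoc, mul_div_assoc', Real.mul_self_sqrt (by norm_num)]; norm_num
end GN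
end

section
variable {n : ℕ} {N : EE n → ℝ} {b : ℝ}
lemma ev_DP1 (v x : EE n) : ev (DP v 1) x = ⟪v, x⟫ := by
  rw [ev_DP]; simp [ev, pd]
lemma gh_lc (h : LC N b) : LC (gh N) b := ⟨gh_lip h, gh_conv h⟩
lemma PG.gb {f : EE n → ℝ} (hf : PG f) : GB (fun _ => f) := by
  obtain ⟨C, k, hC, hk⟩ := hf.le_exp
  exact ⟨fun _ => hf.1, C, k, hC, fun _ _ y => hk y⟩
lemma PG.shift {f : EE n → ℝ} (h : LC f b) (z : EE n) : PG (fun w => f (z + w)) := by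
  have : LC (fun w => f (z + w)) b := ⟨fun x y => by simpa using h.lip (z + x) (z + y), by
    have := h.conv.comp_affineMap (AffineMap.const ℝ (EE n) z + AffineMap.id ℝ (EE n))
    exact this⟩
  exact this.pg
lemma gFD_pg (h : LC N b) (v : EE n) (P : PP n) : PG (gF N (DP v P)) := PG.of_bdd (gF_cont h.pg _) _ (hess_bd h P v)
lemma gFD_pg' (h : LC N b) (v : EE n) (P : PP n) (z : EE n) : PG (fun w => gF N (DP v P) (z + w)) :=
  PG.of_bdd ((gF_cont h.pg _).comp (by fun_prop)) _ (fun w => hess_bd h P v (z + w))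
lemma ibpD (h : LC N b) (i : Fin n) (P : PP n) (z : EE n) :
    gF (gh N) (DP (bs i) P) z = ∫ w, gF N (DP (bs i) 1) (z + w) * ev P w ∂(stdGaussian (EE n)) := by
  have p0 := PG.shift (gh_lc h) z
  have p1 := gFD_pg' h (bs i) 1 z
  have a1 := p1.mul (ev_pg P)
  have a2 := p0.mul (ev_pg (pd i P))
  have a3 := p0.mul (ev_pg P)
  have := GB.ibp a3.gb (a1.add a2).gb i (r := 0) (by norm_num) (fun y => HL.mul (by
    have := gh_line h (z + y) (bs i) 0
    rw [zero_smul, add_zero] at this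
    unfold HL; simpa only [add_assoc] using this) (ev_hl P i y))
  have e : gF (gh N) (DP (bs i) P) z = ∫ w, (w i * (gh N (z + w) * ev P w) - gh N (z + w) * ev (pd i P) w) ∂(stdGaussian (EE n)) := by
    unfold gF
    congr 1; ext w
    rw [ev_DP]
    have : ⟪(bs i : EE n), w⟫ = w i := by simp [bs, EuclideanSpace.inner_single_left]
    rw [this]
    have : ∑ j, (bs i : EE n) j * ev (pd j P) w = ev (pd i P) w := by simp [bs]
    rw [this]; ring
  have i3 := ((PG.coord i).mul a3).intble
  rw [integral_sub (a1.add a2).intble i3, integral_add a1.intble a2.intble] at this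
  rw [e, integral_sub i3 a2.intble]
  linarith
lemma tr_low (h : LC N b) (z : EE n) :
    gh (gh N) z - gh N z ≤ ∑ i, gF (gh N) (DP (bs i) (DP (bs i) 1)) z := by
  simp only [ibpD h]
  have hi : ∀ i ∈ Finset.univ, Integrable (fun w => gF N (DP (bs i) 1) (z + w) * ev (DP (bs i) 1) w) (stdGaussian (EE n)) :=
    fun i _ => ((gFD_pg' h (bs i) 1 z).mul (ev_pg _)).intble
  rw [← integral_finset_sum _ hi]
  have : gh (gh N) z - gh N z = ∫ w, (gh N (z + w) - gh N z) ∂(stdGaussian (EE n)) := by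
    rw [integral_sub (PG.shift (gh_lc h) z).intble (integrable_const _)]; simp [gh]
  rw [this]
  refine integral_mono ((PG.shift (gh_lc h) z).intble.sub (integrable_const _)) (integrable_finset_sum _ hi) fun w => ?_
  show gh N (z + w) - gh N z ≤ ∑ i, gF N (DP (bs i) 1) (z + w) * ev (DP (bs i) 1) w
  have e : ∑ i, gF N (DP (bs i) 1) (z + w) * ev (DP (bs i) 1) w = gF N (DP w 1) (z + w) := by
    rw [grad_sum h.pg w]
    refine Finset.sum_congr rfl fun i _ => ?_
    rw [ev_DP1, mul_comm]; congr 1; simp [bs, EuclideanSpace.inner_single_left]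
  rw [e]
  have hc : ConvexOn ℝ univ (fun t : ℝ => gh N (z + t • w)) := by
    have := (gh_conv h).comp_affineMap (AffineMap.lineMap z (z + w))
    refine ConvexOn.congr this fun t _ => ?_
    simp [AffineMap.lineMap_apply, add_comm]
  have hd := gh_line h z w 1
  have := hc.slope_le_of_hasDerivAt (mem_univ 0) (mem_univ 1) one_pos hd
  simpa [slope_def_field] using this
lemma gF_fub (h : LC N b) (Q : PP n) (z : EE n) : gF (gh N) Q z = ∫ y, gF N Q (y + z) ∂(stdGaussian (EE n)) := by
  unfold gF gh
  have : ∀ w, (∫ y, N (z + w + y) ∂(stdGaussian (EE n))) * ev Q w = ∫ y, N (z + w + y) * ev Q w ∂(stdGaussian (EE n)) :=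
    fun w => (integral_mul_const _ _).symm
  simp only [this]
  rw [integral_integral_swap]
  · congr 1; ext y; congr 1; ext w
    rw [show z + w + y = y + z + w by abel]
  · have hQ := (ev_pg Q)
    have hn := PG.norm' (E := EE n)
    have hNc := h.cont
    have hQc := hQ.cont
    have one : Integrable (fun _ : EE n => (1:ℝ)) (stdGaussian (EE n)) := integrable_const _
    have I1 := (((PG.const (|N z|)).add ((PG.const b).mul hn)).mul hQ).intble.mul_prod one
    have I2 := (((PG.const b)).mul hQ).intble.mul_prod hn.intble
    refine (I1.norm.fun_add I2.norm).mono' (by unfold Function.uncurry; fun_prop) (Filter.Eventually.of_forall fun p => ?_)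
    have h1 := h.lip (z + p.1 + p.2) z
    rw [show z + p.1 + p.2 - z = p.1 + p.2 by abel] at h1
    have hb : 0 ≤ b ∨ ∀ x : EE n, ‖x‖ = 0 := by
      by_cases hb : 0 ≤ b
      · exact Or.inl hb
      · right; intro x; by_contra hx
        have := (abs_nonneg _).trans (h.lip x 0)
        rw [sub_zero] at this
        have h2 : 0 < ‖x‖ := lt_of_le_of_ne (norm_nonneg _) (Ne.symm hx)
        nlinarith
    have h2 : |N (z + p.1 + p.2)| ≤ |N z| + b * ‖p.1‖ + b * ‖p.2‖ := by
      have h3 : b * ‖p.1 + p.2‖ ≤ b * ‖p.1‖ + b * ‖p.2‖ := by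
        rcases hb with hb | hb
        · rw [← mul_add]; exact mul_le_mul_of_nonneg_left (norm_add_le _ _) hb
        · simp [hb]
      have := abs_sub_abs_le_abs_sub (N (z + p.1 + p.2)) (N z)
      linarith
    have h4 : 0 ≤ |N z| + b * ‖p.1‖ ∧ 0 ≤ b * ‖p.2‖ := by
      rcases hb with hb | hb
      · constructor <;> positivity
      · simp [hb]
    simp only [Function.uncurry, Real.norm_eq_abs, abs_mul, abs_norm, mul_one, abs_one]
    rw [abs_of_nonneg h4.1]
    have h5 := abs_mul b ‖p.2‖
    rw [abs_of_nonneg h4.2, abs_norm] at h5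
    calc _ ≤ (|N z| + b * ‖p.1‖ + b * ‖p.2‖) * |ev Q p.1| := mul_le_mul_of_nonneg_right h2 (abs_nonneg _)
      _ = _ := by rw [h5]; ring
lemma CM.deriv (X : CM n) {F F' : ℝ → EE n → ℝ} (hF : ∀ r, Continuous (F r)) (hF' : ∀ r, Continuous (F' r))
    (C : ℝ) (hC : ∀ r x, |F' r x| ≤ C * (1 + ‖x‖) ^ 2) (hd : ∀ r x, HasDerivAt (fun r => F r x) (F' r x) r) (r : ℝ) :
    HasDerivAt (fun r => ∫ x, F r x ∂X.mu) (∫ x, F' r x ∂X.mu) r := by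
  exact (hasDerivAt_integral_of_dominated_loc_of_deriv_le (s := univ) Filter.univ_mem
    (Filter.Eventually.of_forall fun r => (hF r).aestronglyMeasurable) (X.intble (hF r)) (hF' r).aestronglyMeasurable
    (bound := fun x => C * (1 + ‖x‖) ^ 2) (Filter.Eventually.of_forall fun x r _ => hC r x) (X.intble (by fun_prop))
    (Filter.Eventually.of_forall fun x r _ => hd r x)).2
end

section
variable {n : ℕ} {N : EE n → ℝ} {b : ℝ}
lemma taylor2 {f f1 f2 : ℝ → ℝ} {κ r : ℝ} (hr : 0 ≤ r) (h1 : ∀ t, HasDerivAt f (f1 t) t) (h2 : ∀ t, HasDerivAt f1 (f2 t) t)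
    (h0 : f1 0 = 0) (hk : ∀ t, 0 ≤ t → t ≤ r → κ ≤ f2 t) : f 0 + κ * r ^ 2 / 2 ≤ f r := by
  have m1 : MonotoneOn (fun t => f1 t - κ * t) (Icc 0 r) := by
    have hd : ∀ t, HasDerivAt (fun t => f1 t - κ * t) (f2 t - κ * 1) t := fun t => (h2 t).sub ((hasDerivAt_id t).const_mul κ)
    refine monotoneOn_of_deriv_nonneg (convex_Icc _ _) (fun t _ => (hd t).continuousAt.continuousWithinAt) (fun t _ => (hd t).differentiableAt.differentiableWithinAt) fun t ht => ?_
    rw [interior_Icc] at ht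
    rw [(hd t).deriv]; linarith [hk t ht.1.le ht.2.le]
  have m2 : MonotoneOn (fun t => f t - κ * t ^ 2 / 2) (Icc 0 r) := by
    have hd : ∀ t, HasDerivAt (fun t => f t - κ * t ^ 2 / 2) (f1 t - κ * t) t := fun t => by
      refine ((h1 t).sub (((hasDerivAt_pow 2 t).const_mul κ).div_const 2)).congr_deriv ?_
      simp; ring
    refine monotoneOn_of_deriv_nonneg (convex_Icc _ _) (fun t _ => (hd t).continuousAt.continuousWithinAt) (fun t _ => (hd t).differentiableAt.differentiableWithinAt) fun t ht => ?_
    rw [interior_Icc] at ht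
    rw [(hd t).deriv]
    have := m1 (left_mem_Icc.2 hr) ⟨ht.1.le, ht.2.le⟩ ht.1.le
    simp only [h0, mul_zero, sub_zero] at this
    exact this
  have := m2 (left_mem_Icc.2 hr) (right_mem_Icc.2 hr) hr
  norm_num at this; linarith
lemma GN.gh_le (h : GN N) (z y : EE n) {f : EE n → ℝ} (hl : LC f b) (hf : ∀ x y, f (x + y) ≤ N x + f y) : gh f (z + y) ≤ N z + gh f y := by
  have : ∫ w, f (z + y + w) ∂(stdGaussian (EE n)) ≤ ∫ w, (N z + f (y + w)) ∂(stdGaussian (EE n)) := by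
    refine integral_mono (PG.shift hl _).intble ((integrable_const _).fun_add (PG.shift hl y).intble) fun w => ?_
    show f (z + y + w) ≤ _
    rw [add_assoc]; exact hf _ _
  rw [integral_add (integrable_const _) (PG.shift hl y).intble] at this
  simpa [gh] using this
lemma tr_bd (h : LC N b) (y : EE n) : ∑ i, gF N (DP (bs i) (DP (bs i) 1)) y ≤ n * (b * c1) := by
  have : ∀ i ∈ (Finset.univ : Finset (Fin n)), gF N (DP (bs i) (DP (bs i) 1)) y ≤ b * c1 := fun i _ => by
    refine (le_abs_self _).trans ((hess_bd h _ _ y).trans (le_of_eq ?_))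
    simp only [ev_DP1]
    have hu : ‖(bs i : EE n)‖ = 1 := by simp [bs]
    rw [hu, mul_one, c1, ← std_inner (bs i : EE n) hu, integral_map (by fun_prop) (by fun_prop)]
  refine (Finset.sum_le_sum this).trans ?_
  simp
lemma GN.key (h : GN N) {B : Bd n} (hB : B.Iso) (hK : ∀ x ∈ B.K, N x ≤ 1) {q : ℕ} (hq : 2 ≤ q) {r0 : ℝ} (hr0 : 0 ≤ r0) (hr02 : r0 ≤ 1)
    (hr : r0 * (1040 * rexp 6 * q) ≤ 1) :
    (1 / 2 * ((√2 - 1) * D N - r0) - n * (D N / c0 * c1) * (n * rexp (-5 * q))) * r0 ^ 2 / 2 ≤ r0 := by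
  have hl := h.lc
  have hl2 := gh_lc hl
  set b := D N / c0 with hb
  set X := B.cm
  set f : ℝ → ℝ := fun r => ∫ x, gh (gh N) (r • x) ∂X.mu
  set f1 : ℝ → ℝ := fun r => ∫ x, gF (gh N) (DP x 1) (r • x) ∂X.mu
  set f2 : ℝ → ℝ := fun r => ∫ x, gF (gh N) (DP x (DP x 1)) (r • x) ∂X.mu
  have hX := X.prob
  have gc : ∀ P, Continuous (gF (gh N) P) := gF_cont hl2.pg
  have c1' : ∀ r : ℝ, Continuous fun x : EE n => gF (gh N) (DP x 1) (r • x) := fun r => by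
    simp only [fun x : EE n => grad_sum hl2.pg x (r • x)]
    have := fun i => gc (DP (bs i) 1)
    fun_prop
  have c2' : ∀ r : ℝ, Continuous fun x : EE n => gF (gh N) (DP x (DP x 1)) (r • x) := fun r => by
    simp only [fun x : EE n => hess_sum hl2.pg x (r • x)]
    have := fun i j => gc (DP (bs j) (DP (bs i) 1))
    fun_prop
  have b0 : 0 ≤ b := div_nonneg h.D_nonneg c0_pos.le
  have d1 : ∀ t, HasDerivAt f (f1 t) t := by
    refine X.deriv (fun r => (gh_lc hl2).cont.comp (by fun_prop)) c1' b (fun r x => ?_) (fun r x => ?_)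
    · refine (gh_grad_le hl2 _ _).trans (mul_le_mul_of_nonneg_left ?_ b0)
      nlinarith [norm_nonneg x]
    · simpa using gh_line hl2 0 x r
  have d2 : ∀ t, HasDerivAt f1 (f2 t) t := by
    refine X.deriv c1' c2' (∑ i : Fin n, ∑ j : Fin n, b * ‖(bs j : EE n)‖ * ∫ z, |ev (DP (bs i) 1) z| ∂(stdGaussian (EE n))) (fun r x => ?_) (fun r x => ?_)
    · rw [hess_sum hl2.pg, Finset.sum_mul]
      refine (Finset.abs_sum_le_sum_abs _ _).trans (Finset.sum_le_sum fun i _ => ?_)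
      rw [Finset.sum_mul]
      refine (Finset.abs_sum_le_sum_abs _ _).trans (Finset.sum_le_sum fun j _ => ?_)
      rw [abs_mul, abs_mul, mul_assoc]
      have hx : ∀ i, |x i| ≤ 1 + ‖x‖ := fun i => (PiLp.norm_apply_le x i).trans (by linarith)
      refine mul_le_mul (hess_bd hl2 _ _ _) ?_ (by positivity) ((abs_nonneg _).trans (hess_bd hl2 (DP (bs i) 1) (bs j) (r • x)))
      rw [sq]; exact mul_le_mul (hx i) (hx j) (abs_nonneg _) (by positivity)
    · simpa using gF_deriv hl2.pg (DP x 1) 0 x r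
  have g0 : ∀ z, ∫ x, gF (gh N) (DP x 1) z ∂X.mu = 0 := fun z => by
    rw [show (fun x : EE n => gF (gh N) (DP x 1) z) = _ from funext fun x => grad_sum hl2.pg x z]
    rw [integral_finset_sum _ (fun i _ => X.intble (by fun_prop))]
    refine Finset.sum_eq_zero fun i _ => ?_
    rw [integral_mul_const, hB.mean, zero_mul]
  have h00 : f1 0 = 0 := by simpa [f1] using g0 0
  set H : Fin n → Fin n → EE n → ℝ := fun i j => gF N (DP (bs j) (DP (bs i) 1))
  have Hp : ∀ i j, PG (H i j) := fun i j => gFD_pg hl _ _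
  have fub : ∀ i j (g : EE n → ℝ), Continuous g → ∀ r, ∫ x, g x * gF (gh N) (DP (bs j) (DP (bs i) 1)) (r • x) ∂X.mu = ∫ y, H i j y * X.N g r y ∂(stdGaussian (EE n)) :=
    fun i j g hg r => by
      rw [X.N_fub (Hp i j) hg]
      simp only [gF_fub hl]; rfl
  have key : ∀ t, 0 ≤ t → t ≤ r0 → 1 / 2 * ((√2 - 1) * D N - r0) - n * (b * c1) * (n * rexp (-5 * q)) ≤ f2 t := fun t ht htr => by
    have ht2 : |t| ≤ 2 := by rw [abs_of_nonneg ht]; linarith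
    have e1 : f2 t = ∫ y, X.Z t y * ∑ i, ∑ j, H i j y * X.m2 i j t y ∂(stdGaussian (EE n)) := by
      show ∫ x, gF (gh N) (DP x (DP x 1)) (t • x) ∂X.mu = _
      simp only [fun x : EE n => hess_sum hl2.pg x (t • x), Finset.mul_sum]
      have := fun i j => gc (DP (bs j) (DP (bs i) 1))
      have hI : ∀ i j, Integrable (fun y => X.Z t y * (H i j y * X.m2 i j t y)) (stdGaussian (EE n)) := fun i j =>
        (X.Z_gb.mul ((Hp i j).gb.mul (X.m2_gb i j))).int ht2
      rw [integral_finset_sum _ (fun i _ => X.intble (by fun_prop)), integral_finset_sum _ (fun i _ => integrable_finset_sum _ fun j _ => hI i j)]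
      refine Finset.sum_congr rfl fun i _ => ?_
      rw [integral_finset_sum _ (fun i _ => X.intble (by fun_prop)), integral_finset_sum _ (fun j _ => hI i j)]
      refine Finset.sum_congr rfl fun j _ => ?_
      have e2 := fub i j (fun x => x i * x j) (by fun_prop) t
      rw [show ∫ x : EE n, gF (gh N) (DP (bs j) (DP (bs i) 1)) (t • x) * x i * x j ∂X.mu = ∫ x : EE n, (x i * x j) * gF (gh N) (DP (bs j) (DP (bs i) 1)) (t • x) ∂X.mu by
        congr 1; ext x; ring]
      rw [e2]; congr 1; ext y
      rw [← X.Z_mul_U, CM.m2]; ring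
    have hTI : Integrable (fun y => X.Z t y * ∑ i, H i i y) (stdGaussian (EE n)) :=
      (X.Z_gb.mul (GB.sum Finset.univ (fun i _ => (Hp i i).gb))).int ht2
    have hPI : Integrable (X.P q t) (stdGaussian (EE n)) := (X.P_gb q).int ht2
    have e2 : (√2 - 1) * D N - r0 ≤ ∫ y, X.Z t y * ∑ i, H i i y ∂(stdGaussian (EE n)) := by
      have e3 : ∫ y, X.Z t y * ∑ i, H i i y ∂(stdGaussian (EE n)) = ∫ x, ∑ i, gF (gh N) (DP (bs i) (DP (bs i) 1)) (t • x) ∂X.mu := by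
        have := fun i => gc (DP (bs i) (DP (bs i) 1))
        simp only [Finset.mul_sum]
        rw [integral_finset_sum _ (fun i _ => X.intble (by fun_prop)), integral_finset_sum _ (fun i _ => (X.Z_gb.mul (Hp i i).gb).int ht2)]
        refine Finset.sum_congr rfl fun i _ => ?_
        have := fub i i (fun _ => 1) (by fun_prop) t
        simp only [one_mul] at this
        rw [this]; congr 1; ext y; rw [mul_comm]; rfl
      rw [e3]
      have := fun i => gc (DP (bs i) (DP (bs i) 1))
      have cg := hl2.cont
      have cgg := (gh_lc hl2).cont
      have i1 : Integrable (fun x => gF (gh N) (DP x 1) 0) X.mu := X.intble (by simpa using c1' 0)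
      calc (√2 - 1) * D N - r0 ≤ ∫ x, (gh (gh N) 0 + t * gF (gh N) (DP x 1) 0 - (t + D N)) ∂X.mu := by
            rw [integral_sub ((integrable_const _).fun_add (i1.const_mul _)) (integrable_const _), integral_add (integrable_const _) (i1.const_mul _), integral_const_mul, g0]
            simp [h.D2]; linarith
        _ ≤ _ := by
            refine integral_mono_ae (((integrable_const _).fun_add (i1.const_mul _)).sub (integrable_const _)) (X.intble (by fun_prop)) ?_
            filter_upwards [B.mem_ae] with x hx
            refine le_trans ?_ (tr_low hl (t • x))
            have a1 : gh N (t • x) ≤ t + D N := by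
              have := h.gh_le (t • x) 0 hl (fun x y => h.sub x y)
              rw [add_zero, h.hom _ _ ht] at this
              have e : gh N 0 = D N := by simp [gh, D]
              have := mul_le_mul_of_nonneg_left (hK x hx) ht
              linarith
            have a2 : gh (gh N) 0 + t * gF (gh N) (DP x 1) 0 ≤ gh (gh N) (t • x) := by
              rcases ht.eq_or_lt with h0 | h0
              · simp [← h0]
              · have hc : ConvexOn ℝ univ (fun t : ℝ => gh (gh N) ((0:EE n) + t • x)) := by
                  have := (gh_conv hl2).comp_affineMap (AffineMap.lineMap 0 x)
                  refine ConvexOn.congr this fun t _ => ?_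
                  simp [AffineMap.lineMap_apply]
                have := hc.le_slope_of_hasDerivAt (mem_univ 0) (mem_univ t) h0 (gh_line hl2 0 x 0)
                rw [slope_def_field, le_div_iff₀ (by linarith)] at this
                simp at this; linarith
            linarith
    have e4 := hB.ybound hq ht ((mul_le_mul_of_nonneg_right htr (by positivity)).trans hr)
    rw [e1]
    calc _ ≤ ∫ y, (1 / 2 * (X.Z t y * ∑ i, H i i y) - n * (b * c1) * X.P q t y) ∂(stdGaussian (EE n)) := by
          rw [integral_sub (hTI.const_mul _) (hPI.const_mul _), integral_const_mul, integral_const_mul]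
          have : 0 ≤ n * (b * c1) := mul_nonneg (by positivity) (mul_nonneg b0 c1_nonneg)
          have := mul_le_mul_of_nonneg_left e4 this
          linarith
      _ ≤ _ := by
          have hI2 : Integrable (fun y => X.Z t y * ∑ i, ∑ j, H i j y * X.m2 i j t y) (stdGaussian (EE n)) :=
            (X.Z_gb.mul (GB.sum Finset.univ (fun i _ => GB.sum Finset.univ (fun j _ => ((Hp i j).gb.mul (X.m2_gb i j)))))).int ht2
          refine integral_mono ((hTI.const_mul _).sub (hPI.const_mul _)) hI2 fun y => ?_
          have hh := X.hess_low q (by omega) t y (fun i j => H i j y) (fun θ => by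
            have := gh_hess_nonneg hl y (WithLp.toLp 2 θ)
            rw [hess_sum hl.pg] at this
            refine this.trans (le_of_eq (Finset.sum_congr rfl fun i _ => Finset.sum_congr rfl fun j _ => ?_))
            show H i j y * θ i * θ j = _; ring)
          have hh := mul_le_mul_of_nonneg_left hh (X.Z_pos t y).le
          refine le_trans ?_ hh
          have := mul_le_mul_of_nonneg_right (tr_bd hl y) (mul_nonneg (X.Z_pos t y).le (sub_nonneg.2 (X.v_le q t y)))
          show 1 / 2 * (X.Z t y * ∑ i, H i i y) - n * (b * c1) * (X.Z t y * (1 - X.v q t y)) ≤ X.Z t y * (1 / 2 * ∑ i, H i i y - (∑ i, H i i y) * (1 - X.v q t y))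
          have : (∑ i, H i i y) * (X.Z t y * (1 - X.v q t y)) ≤ n * (b * c1) * (X.Z t y * (1 - X.v q t y)) := this
          linarith
  have T := taylor2 hr0 d1 d2 h00 key
  have up : f r0 ≤ f 0 + r0 := by
    have cgg := (gh_lc hl2).cont
    have : f r0 ≤ ∫ x, (gh (gh N) 0 + r0) ∂X.mu := by
      refine integral_mono_ae (X.intble (by fun_prop)) (integrable_const _) ?_
      filter_upwards [B.mem_ae] with x hx
      have := h.gh_le (r0 • x) 0 hl2 (fun x y => h.gh_le x y hl (fun x y => h.sub x y))
      rw [add_zero, h.hom _ _ hr0] at this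
      have := mul_le_mul_of_nonneg_left (hK x hx) hr0
      linarith
    simpa [f] using this
  linarith
theorem GN.main : ∃ C : ℝ, 0 < C ∧ ∀ n : ℕ, 2 ≤ n → ∀ (N : EE n → ℝ), GN N → ∀ B : Bd n, B.Iso → (∀ x ∈ B.K, N x ≤ 1) → D N ≤ C * Real.log n := by
  obtain ⟨q0, hq0⟩ := exists_nat_ge (Real.log (1 + 20 * (c1 / c0)))
  have cc : 0 ≤ c1 / c0 := div_nonneg c1_nonneg c0_pos.le
  have l2 : 0 < Real.log 2 := Real.log_pos one_lt_two
  refine ⟨20 * (2080 * rexp 6 * (1 + (3 + q0) / Real.log 2) + 1 / Real.log 2), by positivity, fun n hn N h B hB hK => ?_⟩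
  have hn' : (2:ℝ) ≤ n := by exact_mod_cast hn
  have ln : Real.log 2 ≤ Real.log n := Real.log_le_log (by norm_num) hn'
  set q : ℕ := ⌈Real.log n⌉₊ + q0 + 2 with hq
  have q1 : Real.log n + q0 ≤ q := by
    have := Nat.le_ceil (Real.log n); rw [hq]; push_cast; linarith
  have q2 : (q:ℝ) ≤ Real.log n + (3 + q0) := by
    have := Nat.ceil_lt_add_one (l2.le.trans ln); rw [hq]; push_cast; linarith
  have qp : (2:ℝ) ≤ q := by rw [hq]; push_cast; have : (0:ℝ) ≤ ⌈Real.log n⌉₊ := by positivity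
                            have : (0:ℝ) ≤ q0 := by positivity
                            linarith
  set r0 : ℝ := (1040 * rexp 6 * q)⁻¹ with hr0
  have A : 1 ≤ 1040 * rexp 6 * q := by
    have := Real.one_le_exp (x := 6) (by norm_num)
    nlinarith
  have r1 : r0 ≤ 1 := inv_le_one_of_one_le₀ A
  have r2 : 0 < r0 := by positivity
  have K := h.key hB hK (q := q) (by omega) r2.le r1 (by rw [hr0, inv_mul_cancel₀ (by positivity)])
  have E1 : (n:ℝ) * n * rexp (-5 * q) * (20 * (c1 / c0)) ≤ 1 := by
    have e1 : (n:ℝ) * n = rexp (2 * Real.log n) := by rw [two_mul, Real.exp_add, Real.exp_log (by linarith)]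
    have e2 : 20 * (c1 / c0) ≤ rexp q0 := by
      have := Real.exp_le_exp.2 hq0
      rw [Real.exp_log (by positivity)] at this; linarith
    rw [e1, ← Real.exp_add]
    refine (mul_le_mul_of_nonneg_left e2 (by positivity)).trans ?_
    rw [← Real.exp_add, Real.exp_le_one_iff]
    have : (0:ℝ) ≤ q0 := by positivity
    linarith [l2]
  have s2 : (1.4:ℝ) ≤ √2 := Real.le_sqrt_of_sq_le (by norm_num)
  have Dn := h.D_nonneg
  have E2 : (n:ℝ) * (D N / c0 * c1) * (n * rexp (-5 * q)) ≤ D N / 20 := by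
    calc _ = D N / 20 * ((n:ℝ) * n * rexp (-5 * q) * (20 * (c1 / c0))) := by ring
      _ ≤ _ := mul_le_of_le_one_right (by positivity) E1
  have E3 : (1 / 2 * ((√2 - 1) * D N - r0) - n * (D N / c0 * c1) * (n * rexp (-5 * q))) * r0 ≤ 2 := by
    by_contra hh; push Not at hh
    nlinarith
  have E4 : (D N / 20 * 3 - r0 / 2) * r0 ≤ 2 := by
    refine le_trans (mul_le_mul_of_nonneg_right ?_ r2.le) E3
    nlinarith
  have E5 : D N * 3 / 20 ≤ 2 * (1040 * rexp 6 * q) + 1 / 2 := by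
    have : D N / 20 * 3 - r0 / 2 ≤ 2 * (1040 * rexp 6 * q) := by
      rwa [← le_div_iff₀ r2, hr0, div_inv_eq_mul] at E4
    linarith
  have E6 : (q:ℝ) ≤ (1 + (3 + q0) / Real.log 2) * Real.log n := by
    refine q2.trans ?_
    rw [add_mul, one_mul]
    gcongr
    rw [div_mul_eq_mul_div, le_div_iff₀ l2]; gcongr
  have E7 : 1 ≤ 1 / Real.log 2 * Real.log n := by rw [div_mul_eq_mul_div, le_div_iff₀ l2]; linarith
  have E8 : 2080 * rexp 6 * q ≤ 2080 * rexp 6 * ((1 + (3 + q0) / Real.log 2) * Real.log n) := by gcongr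
  nlinarith
end

section
section conc
variable {E : Type*} [NormedAddCommGroup E] [InnerProductSpace ℝ E] [FiniteDimensional ℝ E] [MeasurableSpace E] [BorelSpace E]
structure SL (F : E → ℝ) (b : ℝ) : Prop where
  hom : ∀ c : ℝ, 0 < c → ∀ x, F (c • x) = c * F x
  sub : ∀ x y, F (x + y) ≤ F x + F y
  bd : ∀ x, F x ≤ b * ‖x‖
  cont : Continuous F
  b0 : 0 ≤ b
variable {F : E → ℝ} {b : ℝ}
lemma SL.zero (h : SL F b) : F 0 = 0 := by
  have := h.hom 2 two_pos 0
  rw [smul_zero] at this; linarith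
lemma SL.subg (h : SL F b) (y : E) : ∃ u : E, ‖u‖ ≤ b ∧ ⟪u, y⟫ = F y ∧ ∀ x, ⟪u, x⟫ ≤ F x := by
  have key : ∃ g : E →ₗ[ℝ] ℝ, g y = F y ∧ ∀ x, g x ≤ F x := by
    by_cases hy : y = 0
    · obtain ⟨g, _, h2⟩ := exists_extension_of_le_sublinear ((0 : E →ₗ[ℝ] ℝ).toPMap ⊥) F h.hom h.sub (fun x => by
        have : (x : E) = 0 := (Submodule.mem_bot ℝ).1 x.2
        rw [this, h.zero]; exact le_refl (0:ℝ))
      exact ⟨g, by rw [hy, map_zero, h.zero], h2⟩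
    · obtain ⟨g, h1, h2⟩ := exists_extension_of_le_sublinear (LinearPMap.mkSpanSingleton (K := ℝ) y (F y) hy : E →ₗ.[ℝ] ℝ) F h.hom h.sub (fun x => by
        obtain ⟨x, hx⟩ := x
        obtain ⟨c, rfl⟩ := Submodule.mem_span_singleton.1 hx
        have e : (LinearPMap.mkSpanSingleton (K := ℝ) y (F y) hy : E →ₗ.[ℝ] ℝ) ⟨c • y, hx⟩ = c * F y := by
          have := (LinearPMap.mkSpanSingleton (K := ℝ) y (F y) hy : E →ₗ.[ℝ] ℝ).map_smul c ⟨y, Submodule.mem_span_singleton_self y⟩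
          rw [LinearPMap.mkSpanSingleton_apply] at this
          exact this
        rw [e]
        show c * F y ≤ F (c • y)
        rcases lt_trichotomy c 0 with hc | hc | hc
        · have h3 := h.hom (-c) (by linarith) y
          have h4 := h.sub (c • y) (-c • y)
          rw [← add_smul, add_neg_cancel, zero_smul, h.zero, h3] at h4
          linarith
        · rw [hc, zero_smul, h.zero, zero_mul]
        · rw [h.hom _ hc])
      refine ⟨g, ?_, h2⟩
      have := h1 ⟨y, Submodule.mem_span_singleton_self y⟩
      rw [LinearPMap.mkSpanSingleton_apply] at this
      exact this
  obtain ⟨g, h1, h2⟩ := key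
  set u := (InnerProductSpace.toDual ℝ E).symm (LinearMap.toContinuousLinearMap g)
  have hu : ∀ x, ⟪u, x⟫ = g x := fun x => by
    rw [InnerProductSpace.toDual_symm_apply]; rfl
  refine ⟨u, ?_, by rw [hu, h1], fun x => by rw [hu]; exact h2 x⟩
  have h3 : ‖u‖ ^ 2 ≤ b * ‖u‖ := by
    rw [← real_inner_self_eq_norm_sq, hu]; exact (h2 u).trans (h.bd u)
  by_contra hh; push Not at hh
  nlinarith [norm_nonneg u, h.b0]
lemma SL.abs_le (h : SL F b) (x : E) : |F x| ≤ b * ‖x‖ := by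
  have h1 := h.bd x
  have h2 := h.bd (-x)
  have h3 := h.sub x (-x)
  rw [add_neg_cancel, h.zero] at h3
  rw [norm_neg] at h2
  rw [_root_.abs_le]; constructor <;> linarith
lemma SL.int (h : SL F b) : Integrable F (stdGaussian E) :=
  (((PG.norm' (E := E)).intble).const_mul b).mono' h.cont.aestronglyMeasurable (Filter.Eventually.of_forall h.abs_le)
lemma exp_std (a : E) : ∫ x, rexp ⟪a, x⟫ ∂(stdGaussian E) = rexp (‖a‖ ^ 2 / 2) := by
  have := std_shift (fun _ : E => (1:ℝ)) a
  simp only [smul_eq_mul, mul_one, Real.exp_sub] at this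
  rw [integral_div] at this
  simp only [integral_const, probReal_univ, smul_eq_mul, mul_one] at this
  rwa [eq_div_iff (Real.exp_pos _).ne', one_mul, eq_comm] at this
lemma exp_int2 (f : E × E → ℝ) (hf : Continuous f) (c : ℝ) (h : ∀ p, f p ≤ c * ‖p.1‖ + c * ‖p.2‖) :
    Integrable (fun p => rexp (f p)) ((stdGaussian E).prod (stdGaussian E)) := by
  refine ((intble_exp_std (E := E) c).mul_prod (intble_exp_std (E := E) c)).mono' (by fun_prop) (Filter.Eventually.of_forall fun p => ?_)
  rw [Real.norm_eq_abs, Real.abs_exp, ← Real.exp_add]; exact Real.exp_le_exp.2 (h p)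
lemma SL.diff_bd (h : SL F b) (x y : E) : F x - F y ≤ b * ‖x‖ + b * ‖y‖ := by
  have h1 := (_root_.abs_le.1 (h.abs_le y)).1
  have h2 := h.bd x
  linarith
lemma SL.step (h : SL F b) (lam θ M : ℝ) (hM : 0 ≤ lam * M) :
    ∫ p, rexp (lam * M * (F p.1 - F (cos θ • p.1 - sin θ • p.2))) ∂((stdGaussian E).prod (stdGaussian E)) ≤
      rexp ((lam * M * sin θ * b) ^ 2 / 2) * ∫ y, rexp (lam * M * (1 - cos θ) * b * ‖y‖) ∂(stdGaussian E) := by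
  have hc := h.cont
  have b0 := h.b0
  have nb : ∀ p : E × E, ‖cos θ • p.1 - sin θ • p.2‖ ≤ ‖p.1‖ + ‖p.2‖ := fun p => by
    refine (norm_sub_le _ _).trans (add_le_add ?_ ?_)
    · rw [norm_smul]; exact mul_le_of_le_one_left (norm_nonneg _) (abs_cos_le_one θ)
    · rw [norm_smul]; exact mul_le_of_le_one_left (norm_nonneg _) (abs_sin_le_one θ)
  have hI := exp_int2 (fun p : E × E => lam * M * (F p.1 - F (cos θ • p.1 - sin θ • p.2))) (by fun_prop) (lam * M * (2 * b)) (fun p => by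
    have h1 := h.diff_bd p.1 (cos θ • p.1 - sin θ • p.2)
    have h2 := mul_le_mul_of_nonneg_left (nb p) b0
    have h3 := mul_nonneg b0 (norm_nonneg p.2)
    calc _ ≤ lam * M * (b * ‖p.1‖ + (b * (‖p.1‖ + ‖p.2‖)) + b * ‖p.2‖) := mul_le_mul_of_nonneg_left (by linarith) hM
      _ = _ := by ring)
  rw [integral_prod _ hI, ← integral_const_mul]
  refine integral_mono hI.integral_prod_left ((intble_exp_std _).const_mul _) fun y => ?_
  obtain ⟨u, u1, u2, u3⟩ := h.subg y
  show ∫ z, rexp (lam * M * (F y - F (cos θ • y - sin θ • z))) ∂(stdGaussian E) ≤ _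
  have pt : ∀ z, rexp (lam * M * (F y - F (cos θ • y - sin θ • z))) ≤ rexp (lam * M * (1 - cos θ) * b * ‖y‖) * rexp ⟪(lam * M * sin θ) • u, z⟫ := fun z => by
    rw [← Real.exp_add, Real.exp_le_exp]
    have h1 := u3 (cos θ • y - sin θ • z)
    rw [inner_sub_right, inner_smul_right, inner_smul_right] at h1
    rw [real_inner_smul_left]
    have h2 : (1 - cos θ) * F y ≤ (1 - cos θ) * (b * ‖y‖) := mul_le_mul_of_nonneg_left (h.bd y) (by linarith [cos_le_one θ])
    calc _ ≤ lam * M * ((1 - cos θ) * (b * ‖y‖) + sin θ * ⟪u, z⟫) := mul_le_mul_of_nonneg_left (by rw [u2] at h1; linarith) hM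
      _ = _ := by ring
  have hexp : Integrable (fun z => rexp ⟪(lam * M * sin θ) • u, z⟫) (stdGaussian E) := by
    refine (intble_exp_std (‖(lam * M * sin θ) • u‖)).mono' (by fun_prop) (Filter.Eventually.of_forall fun z => ?_)
    rw [Real.norm_eq_abs, Real.abs_exp]; exact Real.exp_le_exp.2 (real_inner_le_norm _ _)
  refine (integral_mono_of_nonneg (Filter.Eventually.of_forall fun z => (Real.exp_pos _).le) (hexp.const_mul _) (Filter.Eventually.of_forall pt)).trans ?_
  rw [integral_const_mul, exp_std, mul_comm]
  refine mul_le_mul_of_nonneg_right (Real.exp_le_exp.2 ?_) (Real.exp_pos _).le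
  gcongr ?_ / 2
  rw [norm_smul, Real.norm_eq_abs, mul_pow, sq_abs, mul_pow _ b]
  gcongr
lemma SL.two (h : SL F b) {lam : ℝ} (hl : 0 ≤ lam) :
    ∫ p : E × E, rexp (lam * (F p.2 - F p.1)) ∂((stdGaussian E).prod (stdGaussian E)) ≤ 2 * rexp (lam ^ 2 * π ^ 2 * b ^ 2 / 8) := by
  have hc := h.cont
  have b0 := h.b0
  set A := ∫ y, rexp (lam * 2 * b * ‖y‖) ∂(stdGaussian E)
  obtain ⟨M, hM⟩ := exists_nat_ge (max 1 A)
  have M1 : (1:ℝ) ≤ M := (le_max_left _ _).trans hM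
  have MA : A ≤ M := (le_max_right _ _).trans hM
  set θ := π / 2 / M with hθ
  have Mθ : M * θ = π / 2 := by rw [hθ]; field_simp
  have θ0 : 0 ≤ θ := by positivity
  set X : ℕ → E × E → E := fun j p => cos (j * θ) • p.1 + sin (j * θ) • p.2
  have cX : ∀ j, Continuous (X j) := fun j => by fun_prop
  have nX : ∀ j p, ‖X j p‖ ≤ ‖p.1‖ + ‖p.2‖ := fun j p => by
    refine (norm_add_le _ _).trans (add_le_add ?_ ?_)
    · rw [norm_smul]; exact mul_le_of_le_one_left (norm_nonneg _) (abs_cos_le_one _)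
    · rw [norm_smul]; exact mul_le_of_le_one_left (norm_nonneg _) (abs_sin_le_one _)
  have lM : 0 ≤ lam * M := by positivity
  have hI : ∀ j, Integrable (fun p => rexp (lam * M * (F (X (j + 1) p) - F (X j p)))) ((stdGaussian E).prod (stdGaussian E)) := fun j => by
    refine exp_int2 _ (by fun_prop) (lam * M * (2 * b)) fun p => ?_
    have h1 := h.diff_bd (X (j + 1) p) (X j p)
    have h2 := mul_le_mul_of_nonneg_left (nX (j + 1) p) b0
    have h3 := mul_le_mul_of_nonneg_left (nX j p) b0
    calc _ ≤ lam * M * (b * (‖p.1‖ + ‖p.2‖) + b * (‖p.1‖ + ‖p.2‖)) := mul_le_mul_of_nonneg_left (by linarith) lM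
      _ = _ := by ring
  have S1 : ∀ p : E × E, rexp (lam * (F p.2 - F p.1)) ≤ ∑ j ∈ Finset.range M, (M:ℝ)⁻¹ * rexp (lam * M * (F (X (j + 1) p) - F (X j p))) := fun p => by
    have := convexOn_exp.map_sum_le (t := Finset.range M) (w := fun _ => (M:ℝ)⁻¹) (p := fun j => lam * M * (F (X (j + 1) p) - F (X j p)))
      (fun _ _ => by positivity) (by simp; field_simp) (fun _ _ => mem_univ _)
    simp only [smul_eq_mul] at this
    refine le_trans (le_of_eq ?_) this
    rw [← Finset.mul_sum, ← Finset.mul_sum, Finset.sum_range_sub (fun j => F (X j p))]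
    have e0 : X 0 p = p.1 := by simp [X]
    have e1 : X M p = p.2 := by simp [X, Mθ]
    rw [e0, e1]; congr 1; field_simp
  have S2 : ∀ j, ∫ p, rexp (lam * M * (F (X (j + 1) p) - F (X j p))) ∂((stdGaussian E).prod (stdGaussian E)) ≤ 2 * rexp (lam ^ 2 * π ^ 2 * b ^ 2 / 8) := fun j => by
    have e : ∫ p, rexp (lam * M * (F (X (j + 1) p) - F (X j p))) ∂((stdGaussian E).prod (stdGaussian E)) =
        ∫ p, rexp (lam * M * (F p.1 - F (cos θ • p.1 - sin θ • p.2))) ∂((stdGaussian E).prod (stdGaussian E)) := by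
      conv_rhs => rw [← std_rot ((j + 1 : ℕ) * θ)]
      rw [integral_map (ContinuousLinearMap.continuous _).aemeasurable (by fun_prop)]
      congr 1; ext p
      rw [ContinuousLinearMap.rotation_apply]
      have : X j p = cos θ • X (j + 1) p - sin θ • (-sin ((j + 1 : ℕ) * θ) • p.1 + cos ((j + 1 : ℕ) * θ) • p.2) := by
        have a : (j:ℝ) * θ = (j + 1 : ℕ) * θ - θ := by push_cast; ring
        simp only [X]
        rw [a, cos_sub, sin_sub]
        module
      rw [this]
    rw [e]
    refine (h.step lam θ M lM).trans ?_
    rw [mul_comm]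
    have sM : M * sin θ ≤ π / 2 := by rw [← Mθ]; gcongr; exact sin_le θ0
    have sM0 : 0 ≤ M * sin θ := mul_nonneg (by positivity) (sin_nonneg_of_nonneg_of_le_pi θ0 (by
      rw [hθ]; rw [div_div, div_le_iff₀ (by positivity)]; nlinarith [pi_pos]))
    have cM : M * (1 - cos θ) ≤ 2 / M := by
      have := one_sub_sq_div_two_le_cos (x := θ)
      calc M * (1 - cos θ) ≤ M * (θ ^ 2 / 2) := by gcongr; linarith
        _ = (M * θ) ^ 2 / 2 / M := by field_simp
        _ ≤ 2 / M := by rw [Mθ]; gcongr; nlinarith [pi_lt_four, pi_pos]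
    refine mul_le_mul ?_ (Real.exp_le_exp.2 ?_) (Real.exp_pos _).le (by norm_num)
    · have pt : ∀ y : E, rexp (lam * M * (1 - cos θ) * b * ‖y‖) ≤ (1 - (M:ℝ)⁻¹) + (M:ℝ)⁻¹ * rexp (lam * 2 * b * ‖y‖) := fun y => by
        have := convexOn_exp.2 (mem_univ 0) (mem_univ (lam * 2 * b * ‖y‖)) (show 0 ≤ 1 - (M:ℝ)⁻¹ by
          have := inv_le_one_of_one_le₀ M1; linarith) (show 0 ≤ (M:ℝ)⁻¹ by positivity) (by ring)
        simp only [smul_eq_mul, mul_zero, zero_add, Real.exp_zero, mul_one] at this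
        refine le_trans (Real.exp_le_exp.2 ?_) this
        calc _ = lam * b * ‖y‖ * (M * (1 - cos θ)) := by ring
          _ ≤ lam * b * ‖y‖ * (2 / M) := by gcongr
          _ = _ := by ring
      refine (integral_mono (intble_exp_std _) ((integrable_const _).fun_add ((intble_exp_std _).const_mul _)) pt).trans ?_
      rw [integral_add (integrable_const _) ((intble_exp_std _).const_mul _), integral_const_mul]
      simp only [integral_const, probReal_univ, smul_eq_mul, one_mul]
      have : (M:ℝ)⁻¹ * A ≤ 1 := by rw [inv_mul_le_iff₀ (by linarith)]; linarith
      have : 0 ≤ (M:ℝ)⁻¹ := by positivity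
      linarith
    · have : (M * sin θ) ^ 2 ≤ (π / 2) ^ 2 := by gcongr
      calc (lam * M * sin θ * b) ^ 2 / 2 = lam ^ 2 * b ^ 2 / 2 * (M * sin θ) ^ 2 := by ring
        _ ≤ lam ^ 2 * b ^ 2 / 2 * (π / 2) ^ 2 := by gcongr
        _ = _ := by ring
  refine (integral_mono_of_nonneg (Filter.Eventually.of_forall fun z => (Real.exp_pos _).le) (integrable_finset_sum _ fun j _ => (hI j).const_mul _) (Filter.Eventually.of_forall S1)).trans ?_
  rw [integral_finset_sum _ fun j _ => (hI j).const_mul _]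
  simp only [integral_const_mul]
  rw [← Finset.mul_sum, inv_mul_le_iff₀ (by linarith)]
  refine (Finset.sum_le_sum fun j _ => S2 j).trans ?_
  simp
lemma SL.mgf (h : SL F b) {lam : ℝ} (hl : 0 ≤ lam) :
    ∫ x, rexp (lam * F x) ∂(stdGaussian E) ≤ 2 * rexp (lam ^ 2 * π ^ 2 * b ^ 2 / 8) * rexp (lam * ∫ x, F x ∂(stdGaussian E)) := by
  have T := h.two hl
  have hc := h.cont
  have e : ∀ p : E × E, rexp (lam * (F p.2 - F p.1)) = rexp (-lam * F p.1) * rexp (lam * F p.2) := fun p => by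
    rw [← Real.exp_add]; congr 1; ring
  simp only [e] at T
  rw [integral_prod_mul (fun x => rexp (-lam * F x)) (fun x => rexp (lam * F x))] at T
  set m := ∫ x, F x ∂(stdGaussian E)
  have hI : Integrable (fun x => rexp (-lam * F x)) (stdGaussian E) := by
    refine (intble_exp_std (lam * b)).mono' (by fun_prop) (Filter.Eventually.of_forall fun x => ?_)
    rw [Real.norm_eq_abs, Real.abs_exp, Real.exp_le_exp]
    have := mul_le_mul_of_nonneg_left (_root_.abs_le.1 (h.abs_le x)).1 hl
    linarith
  have J : rexp (-lam * m) ≤ ∫ x, rexp (-lam * F x) ∂(stdGaussian E) := by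
    have pt : ∀ x, rexp (-lam * m) * (1 + lam * m) - rexp (-lam * m) * lam * F x ≤ rexp (-lam * F x) := fun x => by
      have h1 := Real.add_one_le_exp (-lam * F x + lam * m)
      have h2 : rexp (-lam * F x) = rexp (-lam * m) * rexp (-lam * F x + lam * m) := by rw [← Real.exp_add]; congr 1; ring
      rw [h2]
      have := mul_le_mul_of_nonneg_left h1 (Real.exp_pos (-lam * m)).le
      linarith
    have := integral_mono ((integrable_const _).sub (h.int.const_mul _)) hI pt
    simp only [Pi.sub_apply] at this
    rw [integral_sub (integrable_const _) (h.int.const_mul _)] at this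
    simp only [integral_const_mul, integral_const, probReal_univ, smul_eq_mul, one_mul] at this
    change rexp (-lam * m) * (1 + lam * m) - rexp (-lam * m) * lam * m ≤ _ at this
    linarith
  have P0 : 0 ≤ ∫ x, rexp (lam * F x) ∂(stdGaussian E) := integral_nonneg fun _ => (Real.exp_pos _).le
  have := (mul_le_mul_of_nonneg_right J P0).trans T
  rw [neg_mul, Real.exp_neg, inv_mul_le_iff₀ (Real.exp_pos _)] at this
  linarith
lemma SL.tail (h : SL F b) (hb : 0 < b) {k : ℕ} (hk : 1 ≤ k) (t : ℝ) (ht : ∫ x, F x ∂(stdGaussian E) ≤ t) :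
    stdGaussian E {x | t + 5 * √k * b ≤ F x} ≤ ENNReal.ofReal (rexp (-k) / 4) := by
  have hc := h.cont
  set lam := √k / b
  have hl : 0 ≤ lam := by positivity
  have hI : Integrable (fun x => rexp (lam * F x)) (stdGaussian E) := by
    refine (intble_exp_std (lam * b)).mono' (by fun_prop) (Filter.Eventually.of_forall fun x => ?_)
    rw [Real.norm_eq_abs, Real.abs_exp, Real.exp_le_exp]
    have := mul_le_mul_of_nonneg_left (h.bd x) hl
    linarith
  have M := mul_meas_ge_le_integral_of_nonneg (Filter.Eventually.of_forall fun x => (Real.exp_pos (lam * F x)).le) hI (rexp (lam * (t + 5 * √k * b)))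
  have S : {x | t + 5 * √k * b ≤ F x} ⊆ {x | rexp (lam * (t + 5 * √k * b)) ≤ rexp (lam * F x)} := fun x hx =>
    Real.exp_le_exp.2 (mul_le_mul_of_nonneg_left hx hl)
  refine (measure_mono S).trans ?_
  rw [← ofReal_measureReal]
  refine ENNReal.ofReal_le_ofReal ?_
  have M2 := M.trans (h.mgf hl)
  have kr : (1:ℝ) ≤ k := by exact_mod_cast hk
  have sk : √(k:ℝ) ^ 2 = k := Real.sq_sqrt (by linarith)
  have e1 : lam ^ 2 * π ^ 2 * b ^ 2 / 8 ≤ k * 1.25 := by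
    have : lam ^ 2 * π ^ 2 * b ^ 2 / 8 = k * (π ^ 2 / 8) := by
      rw [← sk]; simp only [lam]; field_simp
    rw [this]; gcongr; nlinarith [pi_lt_d2, pi_pos]
  have e2 : lam * (t + 5 * √k * b) = lam * t + 5 * k := by
    have : lam * (5 * √k * b) = 5 * k := by
      calc lam * (5 * √k * b) = 5 * √(k:ℝ) ^ 2 := by simp only [lam]; field_simp
        _ = _ := by rw [sk]
    rw [mul_add, this]
  have e3 : rexp (lam * ∫ x, F x ∂(stdGaussian E)) ≤ rexp (lam * t) := Real.exp_le_exp.2 (mul_le_mul_of_nonneg_left ht hl)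
  rw [e2] at M2 ⊢
  have M3 : rexp (lam * t + 5 * k) * (stdGaussian E).real {x | rexp (lam * t + 5 * k) ≤ rexp (lam * F x)} ≤ 2 * rexp (k * 1.25) * rexp (lam * t) :=
    M2.trans (by gcongr)
  generalize (stdGaussian E).real {x | rexp (lam * t + 5 * k) ≤ rexp (lam * F x)} = P at M3 ⊢
  rw [Real.exp_add] at M3
  have M4 : rexp (5 * k) * P ≤ 2 * rexp (k * 1.25) := by
    have := Real.exp_pos (lam * t)
    have : (rexp (5 * k) * P) * rexp (lam * t) ≤ (2 * rexp (k * 1.25)) * rexp (lam * t) := by linarith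
    exact le_of_mul_le_mul_right this (Real.exp_pos _)
  have e8 : (8:ℝ) ≤ rexp (2.75 * k) := by
    have h1 : rexp 2.75 ≤ rexp (2.75 * k) := Real.exp_le_exp.2 (by linarith)
    have h2 : rexp 2.75 = rexp 1 * rexp 1 * rexp 0.75 := by rw [← Real.exp_add, ← Real.exp_add]; norm_num
    have h3 := Real.exp_one_gt_d9
    have h4 := Real.add_one_le_exp (0.75:ℝ)
    nlinarith [mul_self_nonneg (rexp 1 - 2.7)]
  have e5 : rexp (5 * k) = rexp (2.75 * k) * rexp (k * 1.25) * rexp k := by rw [← Real.exp_add, ← Real.exp_add]; congr 1; ring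
  rw [e5] at M4
  rw [Real.exp_neg, le_div_iff₀ (by norm_num), ← one_div, le_div_iff₀ (Real.exp_pos _)]
  have p1 := Real.exp_pos (k * 1.25 : ℝ)
  have p2 := Real.exp_pos (k : ℝ)
  have M5 : rexp (2.75 * k) * rexp k * P ≤ 2 := by
    have : (rexp (2.75 * k) * rexp k * P) * rexp (k * 1.25) ≤ 2 * rexp (k * 1.25) := by linarith
    exact le_of_mul_le_mul_right this p1
  by_contra hh; push Not at hh
  nlinarith
end conc
end

section
variable {n k : ℕ}
abbrev GG (n k : ℕ) := PiLp 2 (fun _ : Fin k => EE n)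
def ap (Γ : GG n k) (v : EE k) : EE n := ∑ j, v j • Γ j
lemma ap_cont : Continuous fun p : GG n k × EE k => ap p.1 p.2 := by unfold ap; fun_prop
lemma ap_cont1 (v : EE k) : Continuous fun Γ : GG n k => ap Γ v := by unfold ap; fun_prop
lemma ap_cont2 (Γ : GG n k) : Continuous fun v : EE k => ap Γ v := by unfold ap; fun_prop
lemma ap_smul (Γ : GG n k) (c : ℝ) (v : EE k) : ap Γ (c • v) = c • ap Γ v := by
  simp [ap, Finset.smul_sum, mul_smul]
lemma ap_smul' (Γ : GG n k) (c : ℝ) (v : EE k) : ap (c • Γ) v = c • ap Γ v := by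
  simp [ap, Finset.smul_sum, smul_comm c]
lemma ap_add' (Γ Γ' : GG n k) (v : EE k) : ap (Γ + Γ') v = ap Γ v + ap Γ' v := by
  simp [ap, Finset.sum_add_distrib]
lemma ap_norm (Γ : GG n k) (v : EE k) : ‖ap Γ v‖ ≤ ‖Γ‖ * ‖v‖ := by
  refine (norm_sum_le _ _).trans ?_
  have := Real.sum_mul_le_sqrt_mul_sqrt Finset.univ (fun j => ‖v j‖) (fun j => ‖Γ j‖)
  rw [PiLp.norm_eq_of_L2, EuclideanSpace.norm_eq, mul_comm]
  simpa only [norm_smul] using this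
lemma ap_law1 (v : EE k) (hv : ‖v‖ = 1) : (stdGaussian (GG n k)).map (fun Γ => ap Γ v) = stdGaussian (EE n) := by
  have := std_coiso (E := GG n k) (F := EE n) (∑ j, v j • PiLp.proj 2 (fun _ : Fin k => EE n) j) (fun w => WithLp.toLp 2 fun j => v j • w)
    (fun x y => by
      have e1 : (∑ j, v j • PiLp.proj (𝕜 := ℝ) 2 (fun _ : Fin k => EE n) j) x = ∑ j, v j • x j := by
        rw [ContinuousLinearMap.sum_apply]; rfl
      have e2 : ⟪x, (WithLp.toLp 2 fun j => v j • y : GG n k)⟫ = ∑ j, ⟪x j, v j • y⟫ := PiLp.inner_apply _ _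
      rw [e1, e2, sum_inner]
      simp only [real_inner_smul_left, real_inner_smul_right])
    (fun y => by
      rw [PiLp.norm_eq_of_L2]
      simp only [norm_smul, mul_pow]
      rw [← Finset.sum_mul, ← EuclideanSpace.norm_sq_eq, hv, one_pow, one_mul, Real.sqrt_sq (norm_nonneg _)])
  rw [← this]; congr 1; ext Γ; simp [ap, ContinuousLinearMap.sum_apply]
lemma ap_law (v : EE k) : (stdGaussian (GG n k)).map (fun Γ => ap Γ v) = (stdGaussian (EE n)).map (fun x => ‖v‖ • x) := by
  by_cases hv : v = 0
  · have e1 : (fun Γ : GG n k => ap Γ v) = fun _ => 0 := by ext Γ; simp [hv, ap]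
    have e2 : (fun x : EE n => ‖v‖ • x) = fun _ => 0 := by ext x; simp [hv]
    rw [e1, e2, Measure.map_const, Measure.map_const]; simp
  · have hn : ‖v‖ ≠ 0 := norm_ne_zero_iff.2 hv
    have h1 : ‖‖v‖⁻¹ • v‖ = 1 := by rw [norm_smul, norm_inv, norm_norm, inv_mul_cancel₀ hn]
    rw [← ap_law1 (‖v‖⁻¹ • v) h1, Measure.map_map (by fun_prop) (ap_cont1 _).measurable]
    congr 1; ext1 Γ
    show _ = ‖v‖ • ap Γ (‖v‖⁻¹ • v)
    rw [ap_smul, smul_inv_smul₀ hn]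
lemma std_cov (i j : Fin k) : ∫ y : EE k, y i * y j ∂(stdGaussian (EE k)) = if j = i then 1 else 0 := by
  have := GB.ibp (n := k) (F := fun _ y => y j) (F' := fun _ y => if j = i then 1 else 0) (GB.coord j) (GB.const _) i (r := 0) (by norm_num) (fun y => HL.coord j)
  rw [integral_sub (integrable_const _) (((PG.coord i).mul (PG.coord j)).intble)] at this
  simp only [integral_const, probReal_univ, smul_eq_mul, one_mul] at this
  linarith
lemma ap_sq (Γ : GG n k) : ∫ v, ‖ap Γ v‖ ∂(stdGaussian (EE k)) ≤ ‖Γ‖ := by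
  have hc := ap_cont2 Γ
  have e : ∀ v : EE k, ‖ap Γ v‖ ^ 2 = ∑ i, ∑ j, ⟪Γ i, Γ j⟫ * (v i * v j) := fun v => by
    rw [← real_inner_self_eq_norm_sq, ap, sum_inner]
    simp only [inner_sum, real_inner_smul_left, real_inner_smul_right]
    refine Finset.sum_congr rfl fun i _ => Finset.sum_congr rfl fun j _ => by ring
  have hi : ∀ i j, Integrable (fun v : EE k => ⟪Γ i, Γ j⟫ * (v i * v j)) (stdGaussian (EE k)) := fun i j => ((PG.coord i).mul (PG.coord j)).intble.const_mul _
  have hI : Integrable (fun v => ‖ap Γ v‖ ^ 2) (stdGaussian (EE k)) := by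
    simp only [e]; exact integrable_finset_sum _ fun i _ => integrable_finset_sum _ fun j _ => hi i j
  have e2 : ∫ v, ‖ap Γ v‖ ^ 2 ∂(stdGaussian (EE k)) = ‖Γ‖ ^ 2 := by
    simp only [e]
    rw [integral_finset_sum _ (fun i _ => integrable_finset_sum _ fun j _ => hi i j), PiLp.norm_sq_eq_of_L2]
    refine Finset.sum_congr rfl fun i _ => ?_
    rw [integral_finset_sum _ (fun j _ => hi i j)]
    simp [integral_const_mul, std_cov]
  have h1 : ∀ v, ‖Γ‖ * ‖ap Γ v‖ ≤ (‖Γ‖ ^ 2 + ‖ap Γ v‖ ^ 2) / 2 := fun v => by nlinarith [sq_nonneg (‖Γ‖ - ‖ap Γ v‖)]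
  have hI1 : Integrable (fun v => ‖ap Γ v‖) (stdGaussian (EE k)) :=
    ((PG.norm' (E := EE k)).intble.const_mul ‖Γ‖).mono' (by fun_prop) (Filter.Eventually.of_forall fun v => by rw [norm_norm]; exact ap_norm Γ v)
  have := integral_mono (hI1.const_mul _) (((integrable_const (‖Γ‖ ^ 2)).fun_add hI).div_const 2) h1
  rw [integral_const_mul, integral_div, integral_add (integrable_const _) hI, e2] at this
  simp only [integral_const, probReal_univ, smul_eq_mul, one_mul, add_self_div_two] at this
  rcases (norm_nonneg Γ).eq_or_lt with h0 | h0
  · have : ∀ v, ‖ap Γ v‖ = 0 := fun v => le_antisymm (by simpa [← h0] using ap_norm Γ v) (norm_nonneg _)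
    simp [this]
  · rw [sq] at this; exact le_of_mul_le_mul_left this h0
lemma norm_mean : ∫ v : EE k, ‖v‖ ∂(stdGaussian (EE k)) ≤ √k := by
  have hs := fun i : Fin k => ((PG.coord i).mul (PG.coord i)).intble
  have e : ∀ v : EE k, ‖v‖ ^ 2 = ∑ i, v i * v i := fun v => by
    rw [EuclideanSpace.norm_sq_eq]; refine Finset.sum_congr rfl fun i _ => by rw [Real.norm_eq_abs, sq_abs, sq]
  have hI : Integrable (fun v : EE k => ‖v‖ ^ 2) (stdGaussian (EE k)) := by simp only [e]; exact integrable_finset_sum _ fun i _ => hs i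
  have e2 : ∫ v : EE k, ‖v‖ ^ 2 ∂(stdGaussian (EE k)) = k := by
    simp only [e]; rw [integral_finset_sum _ fun i _ => hs i]; simp [std_cov]
  have sk : √(k:ℝ) ^ 2 = k := Real.sq_sqrt (by positivity)
  have h1 : ∀ v : EE k, √k * ‖v‖ ≤ (k + ‖v‖ ^ 2) / 2 := fun v => by nlinarith [sq_nonneg (√k - ‖v‖)]
  have := integral_mono ((PG.norm' (E := EE k)).intble.const_mul (√k)) (((integrable_const (k:ℝ)).fun_add hI).div_const 2) h1
  rw [integral_const_mul, integral_div, integral_add (integrable_const _) hI, e2] at this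
  simp only [integral_const, probReal_univ, smul_eq_mul, one_mul, add_self_div_two] at this
  rcases (Real.sqrt_nonneg k).eq_or_lt with h0 | h0
  · have hk : k = 0 := by
      have := (Real.sqrt_eq_zero (by positivity)).1 h0.symm
      exact_mod_cast this
    subst hk
    have : ∀ v : EE 0, ‖v‖ = 0 := fun v => by rw [Subsingleton.elim v 0, norm_zero]
    simp [this]
  · have h2 : √k * ∫ v : EE k, ‖v‖ ∂(stdGaussian (EE k)) ≤ √k * √k := by rw [← sq, sk]; exact this
    exact le_of_mul_le_mul_left h2 h0
def FF (k : ℕ) (S : EE n → ℝ) (Γ : GG n k) : ℝ := ∫ v, S (ap Γ v) ∂(stdGaussian (EE k))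
variable {S : EE n → ℝ} {β : ℝ}
lemma SL.ap_int (h : SL S β) (Γ : GG n k) : Integrable (fun v => S (ap Γ v)) (stdGaussian (EE k)) := by
  have hc := ap_cont2 Γ
  have := h.cont
  refine ((PG.norm' (E := EE k)).intble.const_mul (β * ‖Γ‖)).mono' (by fun_prop) (Filter.Eventually.of_forall fun v => (h.abs_le _).trans ?_)
  rw [mul_assoc]; exact mul_le_mul_of_nonneg_left (ap_norm Γ v) h.b0
lemma SL.ff (h : SL S β) : SL (FF k S) β := by
  have hom : ∀ c : ℝ, 0 < c → ∀ Γ : GG n k, FF k S (c • Γ) = c * FF k S Γ := fun c hc Γ => by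
    unfold FF; simp only [ap_smul', h.hom c hc]; rw [integral_const_mul]
  have sub : ∀ Γ Γ' : GG n k, FF k S (Γ + Γ') ≤ FF k S Γ + FF k S Γ' := fun Γ Γ' => by
    unfold FF; rw [← integral_add (h.ap_int Γ) (h.ap_int Γ')]
    exact integral_mono (h.ap_int _) ((h.ap_int Γ).fun_add (h.ap_int Γ')) fun v => by
      show S (ap (Γ + Γ') v) ≤ _
      rw [ap_add']; exact h.sub _ _
  have bd : ∀ Γ : GG n k, FF k S Γ ≤ β * ‖Γ‖ := fun Γ => by
    have hc := ap_cont2 Γ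
    have hI1 : Integrable (fun v => ‖ap Γ v‖) (stdGaussian (EE k)) :=
      ((PG.norm' (E := EE k)).intble.const_mul ‖Γ‖).mono' (by fun_prop) (Filter.Eventually.of_forall fun v => by rw [norm_norm]; exact ap_norm Γ v)
    refine (integral_mono (h.ap_int Γ) (hI1.const_mul β) fun v => h.bd _).trans ?_
    rw [integral_const_mul]; exact mul_le_mul_of_nonneg_left (ap_sq Γ) h.b0
  refine ⟨hom, sub, bd, ?_, h.b0⟩
  have : LipschitzWith ⟨β, h.b0⟩ (FF k S) := LipschitzWith.of_le_add_mul _ fun x y => by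
    have h1 := sub (x - y) y
    rw [sub_add_cancel] at h1
    have h2 := bd (x - y)
    rw [dist_eq_norm]; show _ ≤ _ + β * ‖x - y‖; linarith
  exact this.continuous
lemma SL.ff_mean (h : SL S β) (h0 : ∀ x, 0 ≤ S x) : ∫ Γ, FF k S Γ ∂(stdGaussian (GG n k)) ≤ √k * ∫ x, S x ∂(stdGaussian (EE n)) := by
  have hc := ap_cont (n := n) (k := k)
  have hS := h.cont
  have I : Integrable (Function.uncurry fun (Γ : GG n k) (v : EE k) => S (ap Γ v)) ((stdGaussian (GG n k)).prod (stdGaussian (EE k))) := by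
    refine ((((PG.norm' (E := GG n k)).intble).mul_prod (PG.norm' (E := EE k)).intble).const_mul β).mono' (hS.comp hc).aestronglyMeasurable (Filter.Eventually.of_forall fun p => (h.abs_le _).trans ?_)
    exact mul_le_mul_of_nonneg_left (ap_norm _ _) h.b0
  unfold FF
  rw [integral_integral_swap I]
  have e : ∀ v : EE k, ∫ Γ : GG n k, S (ap Γ v) ∂(stdGaussian (GG n k)) = ‖v‖ * ∫ x, S x ∂(stdGaussian (EE n)) := fun v => by
    have h1 := integral_map (μ := stdGaussian (GG n k)) (f := S) (ap_cont1 v).aemeasurable hS.aestronglyMeasurable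
    rw [← h1, ap_law, integral_map (by fun_prop) hS.aestronglyMeasurable, ← integral_const_mul]
    congr 1; ext x
    rcases (norm_nonneg v).eq_or_lt with h0 | h0
    · rw [← h0, zero_smul, h.zero, zero_mul]
    · rw [h.hom _ h0]
  simp only [e]
  rw [integral_mul_const]
  exact mul_le_mul_of_nonneg_right norm_mean (integral_nonneg h0)
end

section
variable {n k : ℕ}
lemma std_le {s : Set (EE n)} (hs : MeasurableSet s) : stdGaussian (EE n) s ≤ ENNReal.ofReal (gc (EE n)) * volume s := by
  rw [std_eq, withDensity_apply _ hs, ← setLIntegral_const]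
  refine lintegral_mono fun x => ENNReal.ofReal_le_ofReal ?_
  have h1 : rexp (-‖x‖^2/2) ≤ 1 := Real.exp_le_one_iff.2 (by nlinarith [sq_nonneg ‖x‖])
  nlinarith [gc_pos (E := EE n)]
lemma vol_scale {r : ℝ} (hr : 0 < r) (s : Set (EE n)) : volume {x | r • x ∈ s} = ENNReal.ofReal ((r ^ n)⁻¹) * volume s := by
  have := Measure.addHaar_preimage_smul (volume : Measure (EE n)) hr.ne' s
  rw [finrank_euclideanSpace_fin, abs_of_pos (by positivity)] at this
  exact this
lemma om_le (hk : 1 ≤ k) : volume (ball (0 : EE k) 1) ≤ ENNReal.ofReal ((gc (EE k))⁻¹ * rexp (k/2) * (√k ^ k)⁻¹) := by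
  have hk' : (0:ℝ) < √k := Real.sqrt_pos.2 (by exact_mod_cast hk)
  have sk : √(k:ℝ) ^ 2 = k := Real.sq_sqrt (by positivity)
  have hg := gc_pos (E := EE k)
  have h1 : ENNReal.ofReal (gc (EE k) * rexp (-k/2)) * volume (ball (0 : EE k) (√k)) ≤ 1 := by
    refine le_trans ?_ (prob_le_one (μ := stdGaussian (EE k)) (s := ball (0 : EE k) (√k)))
    rw [std_eq, withDensity_apply _ measurableSet_ball, ← setLIntegral_const]
    refine setLIntegral_mono' measurableSet_ball fun x hx => ENNReal.ofReal_le_ofReal ?_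
    rw [mem_ball_zero_iff] at hx
    refine mul_le_mul_of_nonneg_left (Real.exp_le_exp.2 ?_) hg.le
    nlinarith [norm_nonneg x]
  rw [Measure.addHaar_ball_of_pos _ _ hk', finrank_euclideanSpace_fin, ← mul_assoc, ← ENNReal.ofReal_mul (by positivity)] at h1
  have hp : 0 < gc (EE k) * rexp (-k/2) * √k ^ k := by positivity
  rw [mul_comm, ← ENNReal.le_div_iff_mul_le (Or.inl (ENNReal.ofReal_pos.2 hp).ne') (Or.inl ENNReal.ofReal_ne_top), ← ENNReal.ofReal_one, ← ENNReal.ofReal_div_of_pos hp] at h1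
  refine h1.trans (ENNReal.ofReal_le_ofReal (le_of_eq ?_))
  have : rexp (k/2) = (rexp (-k/2))⁻¹ := by rw [← Real.exp_neg]; congr 1; ring
  rw [this, one_div, mul_inv, mul_inv]
variable {A : Set (EE n)} {ρ : ℝ}
lemma out_pt (hA : IsClosed A) (hρ : 0 < ρ) (hv : ENNReal.ofReal (gc (EE n)) * volume A ≤ ENNReal.ofReal (ρ ^ n)) (v : EE k) (hv0 : 0 < ‖v‖) :
    stdGaussian (GG n k) {Γ | ap Γ v ∈ A} ≤ ENNReal.ofReal ((ρ / ‖v‖) ^ n) := by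
  have e : stdGaussian (GG n k) {Γ | ap Γ v ∈ A} = stdGaussian (EE n) {x | ‖v‖ • x ∈ A} := by
    have := congrArg (fun μ => μ A) (ap_law (n := n) v)
    simp only at this
    rwa [Measure.map_apply (ap_cont1 v).measurable hA.measurableSet, Measure.map_apply (by fun_prop) hA.measurableSet] at this
  have hm : MeasurableSet {x : EE n | ‖v‖ • x ∈ A} := hA.measurableSet.preimage (by fun_prop)
  rw [e]
  refine (std_le hm).trans ?_
  rw [vol_scale hv0, mul_left_comm]
  refine (mul_le_mul_right hv _).trans ?_
  rw [← ENNReal.ofReal_mul (by positivity), div_pow, div_eq_inv_mul]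
lemma out_dy (hA : IsClosed A) (hρ : 0 < ρ) (hv : ENNReal.ofReal (gc (EE n)) * volume A ≤ ENNReal.ofReal (ρ ^ n)) (hkn : k + 1 ≤ n) (v : EE k) :
    stdGaussian (GG n k) {Γ | ap Γ v ∈ A} ≤ ∑' j : ℕ, (closedBall (0 : EE k) (2 ^ j * ρ)).indicator (fun _ => ENNReal.ofReal (2 ^ (k+1) * ((2 ^ j) ^ (k+1))⁻¹)) v := by
  by_cases h : ‖v‖ ≤ ρ
  · refine le_trans ?_ (ENNReal.le_tsum 0)
    rw [indicator_of_mem (by simpa using h)]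
    refine prob_le_one.trans ?_
    rw [← ENNReal.ofReal_one]
    refine ENNReal.ofReal_le_ofReal ?_
    simpa using one_le_pow₀ (M₀ := ℝ) (by norm_num : (1:ℝ) ≤ 2)
  · push Not at h
    have h0 : 0 < ‖v‖ := hρ.trans h
    obtain ⟨m, h1, h2⟩ := exists_nat_pow_near (x := ‖v‖ / ρ) (y := 2) (by rw [one_le_div hρ]; exact h.le) (by norm_num)
    refine le_trans ?_ (ENNReal.le_tsum (m+1))
    rw [div_lt_iff₀ hρ] at h2
    rw [indicator_of_mem (by simpa using h2.le)]
    refine (out_pt hA hρ hv v h0).trans (ENNReal.ofReal_le_ofReal ?_)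
    have h3 : ρ / ‖v‖ ≤ (2 ^ m)⁻¹ := by
      rw [← inv_div]; exact inv_anti₀ (by positivity) h1
    have h4 : ρ / ‖v‖ ≤ 1 := by rw [div_le_one h0]; exact h.le
    calc (ρ / ‖v‖) ^ n ≤ (ρ / ‖v‖) ^ (k+1) := pow_le_pow_of_le_one (by positivity) h4 hkn
      _ ≤ ((2 ^ m)⁻¹) ^ (k+1) := pow_le_pow_left₀ (by positivity) h3 _
      _ = _ := by
        rw [pow_succ (2:ℝ) m, mul_pow _ (2:ℝ) (k+1), inv_pow, mul_inv]; field_simp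
lemma out_int (hA : IsClosed A) (hρ : 0 < ρ) (hv : ENNReal.ofReal (gc (EE n)) * volume A ≤ ENNReal.ofReal (ρ ^ n)) (hkn : k + 1 ≤ n) :
    ∫⁻ Γ, volume {v : EE k | ap Γ v ∈ A} ∂(stdGaussian (GG n k)) ≤ ENNReal.ofReal (2 ^ (k+2) * ρ ^ k) * volume (ball (0 : EE k) 1) := by
  have hm : MeasurableSet {p : GG n k × EE k | ap p.1 p.2 ∈ A} := (hA.preimage ap_cont).measurableSet
  have e1 := Measure.prod_apply (μ := stdGaussian (GG n k)) (ν := (volume : Measure (EE k))) hm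
  have e2 := Measure.prod_apply_symm (μ := stdGaussian (GG n k)) (ν := (volume : Measure (EE k))) hm
  rw [e1] at e2
  refine (le_of_eq e2).trans ?_
  refine (lintegral_mono fun v => out_dy hA hρ hv hkn v).trans ?_
  rw [lintegral_tsum (fun j => (measurable_const.indicator measurableSet_closedBall).aemeasurable)]
  simp only [lintegral_indicator_const measurableSet_closedBall]
  have e3 : ∀ j : ℕ, ENNReal.ofReal (2 ^ (k+1) * ((2 ^ j) ^ (k+1))⁻¹) * volume (closedBall (0 : EE k) (2 ^ j * ρ)) = ENNReal.ofReal (2 ^ (k+1) * ρ ^ k * (1/2) ^ j) * volume (ball (0 : EE k) 1) := fun j => by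
    rw [Measure.addHaar_closedBall _ _ (by positivity), finrank_euclideanSpace_fin, ← mul_assoc, ← ENNReal.ofReal_mul (by positivity)]
    congr 2
    rw [mul_pow, pow_succ ((2:ℝ)^j) k, one_div, inv_pow]; field_simp
  simp only [e3]
  rw [ENNReal.tsum_mul_right, ← ENNReal.ofReal_tsum_of_nonneg (fun j => by positivity) (summable_geometric_two.mul_left _), tsum_mul_left, tsum_geometric_two]
  refine le_of_eq ?_
  congr 2; ring
lemma out_tail (hA : IsClosed A) (hρ : 0 < ρ) (hv : ENNReal.ofReal (gc (EE n)) * volume A ≤ ENNReal.ofReal (ρ ^ n)) (hkn : k + 1 ≤ n) :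
    stdGaussian (GG n k) {Γ | ENNReal.ofReal (4 * rexp k * (2 ^ (k+2) * ρ ^ k)) * volume (ball (0 : EE k) 1) ≤ volume {v : EE k | ap Γ v ∈ A}} ≤ ENNReal.ofReal (rexp (-k) / 4) := by
  have hm : MeasurableSet {p : GG n k × EE k | ap p.1 p.2 ∈ A} := (hA.preimage ap_cont).measurableSet
  have hmf : Measurable fun Γ : GG n k => volume {v : EE k | ap Γ v ∈ A} := measurable_measure_prodMk_left hm
  have h1 := (mul_meas_ge_le_lintegral hmf (μ := stdGaussian (GG n k)) (ENNReal.ofReal (4 * rexp k * (2 ^ (k+2) * ρ ^ k)) * volume (ball (0 : EE k) 1))).trans (out_int hA hρ hv hkn)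
  generalize stdGaussian (GG n k) {Γ | ENNReal.ofReal (4 * rexp k * (2 ^ (k+2) * ρ ^ k)) * volume (ball (0 : EE k) 1) ≤ volume {v : EE k | ap Γ v ∈ A}} = P at *
  have hw0 : volume (ball (0 : EE k) 1) ≠ 0 := (measure_ball_pos _ _ one_pos).ne'
  have hwt : volume (ball (0 : EE k) 1) ≠ ⊤ := measure_ball_lt_top.ne
  generalize volume (ball (0 : EE k) 1) = w at *
  rw [ENNReal.ofReal_mul (by positivity)] at h1
  have hp : 0 < (2:ℝ) ^ (k+2) * ρ ^ k := by positivity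
  have h2 : (ENNReal.ofReal (4 * rexp k) * P) * (ENNReal.ofReal (2 ^ (k+2) * ρ ^ k) * w) ≤ 1 * (ENNReal.ofReal (2 ^ (k+2) * ρ ^ k) * w) := by
    rw [one_mul]; refine le_trans (le_of_eq ?_) h1; ring
  rw [ENNReal.mul_le_mul_iff_left (mul_ne_zero (ENNReal.ofReal_pos.2 hp).ne' hw0) (ENNReal.mul_ne_top ENNReal.ofReal_ne_top hwt)] at h2
  rw [mul_comm, ← ENNReal.le_div_iff_mul_le (by simp [Real.exp_pos]) (by simp), ← ENNReal.ofReal_one, ← ENNReal.ofReal_div_of_pos (by positivity)] at h2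
  refine h2.trans (le_of_eq ?_)
  congr 1; rw [Real.exp_neg]; field_simp
variable {S : EE n → ℝ} {β : ℝ}
lemma in_bd (h : SL S β) (h0 : ∀ x, 0 ≤ S x) {m : ℝ} (hm : 0 < m) (Γ : GG n k) (hΓ : FF k S Γ ≤ m) :
    ENNReal.ofReal ((2 * gc (EE k) * (2 * m) ^ k)⁻¹) ≤ volume {v : EE k | S (ap Γ v) ≤ 1} := by
  have hc : Continuous fun v : EE k => S (ap Γ v) := h.cont.comp (ap_cont2 Γ)
  have hmeas : MeasurableSet {v : EE k | S (ap Γ v) ≤ 2 * m} := (isClosed_le hc continuous_const).measurableSet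
  have h1 := mul_meas_ge_le_integral_of_nonneg (μ := stdGaussian (EE k)) (Filter.Eventually.of_forall fun v => h0 (ap Γ v)) (h.ap_int Γ) (2 * m)
  have h2 : (stdGaussian (EE k)).real {v : EE k | 2 * m ≤ S (ap Γ v)} ≤ 1/2 := by
    have := h1.trans hΓ
    nlinarith
  have h3 : (1:ℝ)/2 ≤ (stdGaussian (EE k)).real {v : EE k | S (ap Γ v) ≤ 2 * m} := by
    have := probReal_compl_eq_one_sub (μ := stdGaussian (EE k)) hmeas
    have h4 : (stdGaussian (EE k)).real {v : EE k | S (ap Γ v) ≤ 2 * m}ᶜ ≤ (stdGaussian (EE k)).real {v : EE k | 2 * m ≤ S (ap Γ v)} :=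
      measureReal_mono fun v hv => by
        simp only [mem_compl_iff, mem_setOf_eq, not_le] at hv
        exact hv.le
    linarith
  have h4 : ENNReal.ofReal (1/2) ≤ stdGaussian (EE k) {v : EE k | S (ap Γ v) ≤ 2 * m} := by
    rw [← ofReal_measureReal]; exact ENNReal.ofReal_le_ofReal h3
  have h5 := h4.trans (std_le hmeas)
  have e : {v : EE k | S (ap Γ v) ≤ 2 * m} = {v | (2 * m)⁻¹ • v ∈ {v : EE k | S (ap Γ v) ≤ 1}} := by
    ext v
    simp only [mem_setOf_eq, ap_smul]
    rw [h.hom _ (by positivity), inv_mul_le_iff₀ (by positivity), mul_one]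
  rw [e, vol_scale (by positivity), ← mul_assoc, ← ENNReal.ofReal_mul gc_pos.le] at h5
  have hp : 0 < gc (EE k) * (((2 * m)⁻¹) ^ k)⁻¹ := by have := gc_pos (E := EE k); positivity
  rw [mul_comm, ← ENNReal.div_le_iff_le_mul (Or.inl (ENNReal.ofReal_pos.2 hp).ne') (Or.inl ENNReal.ofReal_ne_top), ← ENNReal.ofReal_div_of_pos hp] at h5
  refine le_trans (le_of_eq ?_) h5
  congr 1
  have := gc_pos (E := EE k)
  rw [inv_pow, inv_inv]; field_simp
theorem bad_event (hk : 1 ≤ k) (hkn : k + 1 ≤ n) (hA : IsClosed A) (hρ : 0 < ρ) (hv : ENNReal.ofReal (gc (EE n)) * volume A ≤ ENNReal.ofReal (ρ ^ n))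
    (h : SL S β) (hβ : 0 < β) (h0 : ∀ x, 0 ≤ S x) {s0 : ℝ} (hs : ∫ x, S x ∂(stdGaussian (EE n)) ≤ s0) :
    stdGaussian (GG n k) {Γ | ENNReal.ofReal ((128 * rexp (3/2) * ρ * (s0 + 5 * β)) ^ k) * volume {v : EE k | S (ap Γ v) ≤ 1} < volume {v : EE k | ap Γ v ∈ A}} ≤ ENNReal.ofReal (rexp (-k) / 2) := by
  have hs0 : 0 ≤ s0 := (integral_nonneg h0).trans hs
  have hk' : (0:ℝ) < √k := Real.sqrt_pos.2 (by exact_mod_cast hk)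
  set m0 := s0 + 5 * β with hm0
  have hm0p : 0 < m0 := by positivity
  have t1 := out_tail (k := k) hA hρ hv hkn
  have t2 := (h.ff (k := k)).tail hβ (k := k) (by exact_mod_cast hk) (√k * s0) ((h.ff_mean h0).trans (mul_le_mul_of_nonneg_left hs hk'.le))
  refine (measure_mono (t := _ ∪ _) ?_).trans ((measure_union_le _ _).trans ((add_le_add t1 t2).trans (le_of_eq ?_)))
  swap
  · rw [← ENNReal.ofReal_add (by positivity) (by positivity)]; congr 1; ring
  intro Γ hΓ
  by_contra hc
  simp only [mem_union, mem_setOf_eq, not_or, not_le] at hc hΓ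
  obtain ⟨c1, c2⟩ := hc
  have i1 := in_bd h h0 (m := √k * m0) (by positivity) Γ (by rw [hm0]; linarith)
  have hg := gc_pos (E := EE k)
  refine absurd (c1.trans_le ((mul_le_mul_right (om_le hk) _).trans (?_ : _ ≤ _))) (lt_irrefl _)
  refine le_trans ?_ hΓ.le
  refine le_trans ?_ (mul_le_mul_right i1 _)
  rw [← ENNReal.ofReal_mul (by positivity), ← ENNReal.ofReal_mul (by positivity)]
  refine ENNReal.ofReal_le_ofReal ?_
  have e1 : rexp k * rexp (k/2) = rexp (3/2) ^ k := by
    rw [← Real.exp_add, ← Real.exp_nat_mul]; congr 1; ring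
  have h32 : (32:ℝ) ≤ 32 ^ k := by simpa using pow_le_pow_right₀ (by norm_num : (1:ℝ) ≤ 32) hk
  have e2 : 4 * rexp k * (2 ^ (k + 2) * ρ ^ k) * ((gc (EE k))⁻¹ * rexp (k / 2) * (√k ^ k)⁻¹) = 16 * (2 ^ k * rexp (3/2) ^ k * ρ ^ k * (gc (EE k))⁻¹ * (√k ^ k)⁻¹) := by
    rw [← e1]; ring
  have e3 : (128 * rexp (3 / 2) * ρ * m0) ^ k * (2 * gc (EE k) * (2 * (√k * m0)) ^ k)⁻¹ = 32 ^ k / 2 * (2 ^ k * rexp (3/2) ^ k * ρ ^ k * (gc (EE k))⁻¹ * (√k ^ k)⁻¹) := by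
    rw [show (128:ℝ) = 32 * 2 * 2 by norm_num]
    simp only [mul_pow]
    have : m0 ^ k ≠ 0 := by positivity
    have : √(k:ℝ) ^ k ≠ 0 := by positivity
    field_simp
  rw [e2, e3]
  refine mul_le_mul_of_nonneg_right (by linarith) (by positivity)
end

section
variable {n k : ℕ}
abbrev OG (n : ℕ) := Matrix.orthogonalGroup (Fin n) ℝ
instance og_top : IsTopologicalGroup (OG n) where
  continuous_mul := by
    refine Continuous.subtype_mk ?_ _
    exact (continuous_subtype_val.comp continuous_fst).matrix_mul (continuous_subtype_val.comp continuous_snd)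
  continuous_inv := by
    refine Continuous.subtype_mk (f := fun g : OG n => g.1.transpose) ?_ _
    exact continuous_subtype_val.matrix_transpose
instance mat_borel : BorelSpace (Matrix (Fin n) (Fin n) ℝ) := inferInstanceAs (BorelSpace (Fin n → Fin n → ℝ))
instance mat_sc : SecondCountableTopology (Matrix (Fin n) (Fin n) ℝ) := inferInstanceAs (SecondCountableTopology (Fin n → Fin n → ℝ))
instance mat_lc : LocallyCompactSpace (Matrix (Fin n) (Fin n) ℝ) := inferInstanceAs (LocallyCompactSpace (Fin n → Fin n → ℝ))
instance og_borel : BorelSpace (OG n) := Subtype.borelSpace _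
instance og_sc : SecondCountableTopology (OG n) := TopologicalSpace.Subtype.secondCountableTopology _
instance og_lc : LocallyCompactSpace (OG n) := by
  have : IsClosed {g : Matrix (Fin n) (Fin n) ℝ | g ∈ Matrix.orthogonalGroup (Fin n) ℝ} := by
    simp only [Matrix.mem_orthogonalGroup_iff]
    exact isClosed_eq (continuous_id.matrix_mul continuous_id.matrix_transpose) continuous_const
  exact this.isClosedEmbedding_subtypeVal.locallyCompactSpace
lemma og_right (μ : Measure (OG n)) (h1 : μ.IsHaarMeasure) (h2 : IsProbabilityMeasure μ) (h : OG n) {s : Set (OG n)} (hs : MeasurableSet s) :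
    μ {g | g * h ∈ s} = μ s := by
  have hm : Measurable fun g : OG n => g * h := (continuous_id.mul continuous_const).measurable
  haveI : IsProbabilityMeasure (μ.map (fun g => g * h)) := Measure.isProbabilityMeasure_map hm.aemeasurable
  have := Measure.isHaarMeasure_eq_of_isProbabilityMeasure (μ.map (fun g => g * h)) μ
  conv_rhs => rw [← this, Measure.map_apply hm hs]
  rfl
def act (g : OG n) (x : EE n) : EE n := Matrix.toEuclideanLin (g : Matrix (Fin n) (Fin n) ℝ) x
lemma act_cont : Continuous fun p : OG n × EE n => act p.1 p.2 := by
  unfold act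
  simp only [Matrix.toEuclideanLin_apply]
  refine (PiLp.continuous_toLp 2 _).comp ?_
  exact (continuous_subtype_val.comp continuous_fst).matrix_mulVec ((PiLp.continuous_ofLp 2 _).comp continuous_snd)
lemma act_mul (g h : OG n) (x : EE n) : act (g * h) x = act g (act h x) := by
  unfold act
  simp [Matrix.toEuclideanLin_apply, Matrix.mulVec_mulVec]
lemma act_iso (g : OG n) : ∃ R : EE n ≃ₗᵢ[ℝ] EE n, ∀ x, R x = act g x := by
  have h1 : (g : Matrix (Fin n) (Fin n) ℝ) ∈ unitary (Matrix (Fin n) (Fin n) ℝ) := by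
    have h2 := (Matrix.mem_orthogonalGroup_iff _ _).1 g.2
    have h3 := (Matrix.mem_orthogonalGroup_iff' _ _).1 g.2
    rw [Unitary.mem_iff, Matrix.star_eq_conjTranspose, Matrix.conjTranspose_eq_transpose_of_trivial]
    exact ⟨h3, h2⟩
  exact ⟨Unitary.linearIsometryEquiv ⟨_, Unitary.map_mem (Matrix.toEuclideanCLM (𝕜 := ℝ)) h1⟩, fun x => rfl⟩
lemma iso_act (R : EE n ≃ₗᵢ[ℝ] EE n) : ∃ g : OG n, ∀ x, act g x = R x := by
  let u := Unitary.linearIsometryEquiv.symm R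
  obtain ⟨M, hM⟩ : ∃ M, Matrix.toEuclideanCLM (n := Fin n) (𝕜 := ℝ) M = u.1 := (Matrix.toEuclideanCLM (n := Fin n) (𝕜 := ℝ)).surjective u.1
  have h1 : M * star M = 1 := by
    apply (Matrix.toEuclideanCLM (n := Fin n) (𝕜 := ℝ)).injective
    show Matrix.toEuclideanCLM (n := Fin n) (𝕜 := ℝ) (M * star M) = Matrix.toEuclideanCLM (n := Fin n) (𝕜 := ℝ) 1
    rw [map_mul, map_star, map_one, hM]
    exact Unitary.mul_star_self_of_mem u.2
  rw [Matrix.star_eq_conjTranspose, Matrix.conjTranspose_eq_transpose_of_trivial] at h1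
  refine ⟨⟨M, (Matrix.mem_orthogonalGroup_iff _ _).2 h1⟩, fun x => ?_⟩
  show Matrix.toEuclideanCLM (n := Fin n) (𝕜 := ℝ) M x = _
  rw [hM]; rfl
def actG (g : OG n) (Γ : GG n k) : GG n k := WithLp.toLp 2 fun j => act g (Γ j)
lemma act_ap (g : OG n) (Γ : GG n k) (v : EE k) : ap (actG g Γ) v = act g (ap Γ v) := by
  simp [ap, actG, act]
lemma actG_cont : Continuous fun p : OG n × GG n k => actG p.1 p.2 := by
  refine (PiLp.continuous_toLp 2 _).comp (continuous_pi fun j => ?_)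
  exact act_cont.comp (continuous_fst.prodMk ((continuous_apply j).comp ((PiLp.continuous_ofLp 2 _).comp continuous_snd)))
lemma actG_law (g : OG n) : (stdGaussian (GG n k)).map (actG g) = stdGaussian (GG n k) := by
  obtain ⟨R, hR⟩ := act_iso g
  have := stdGaussian_map (LinearIsometryEquiv.piLpCongrRight 2 (fun _ : Fin k => R))
  rw [← this]
  conv_lhs => rw [this]
  congr 1; ext1 Γ
  unfold actG
  rw [LinearIsometryEquiv.piLpCongrRight_apply]
  simp only [hR]
lemma inj_ae (hkn : k ≤ n) : ∀ᵐ Γ ∂(stdGaussian (GG n k)), Function.Injective (ap Γ) := by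
  let M : GG n k → Matrix (Fin k) (Fin k) ℝ := fun Γ => Matrix.of fun i j => Γ j (Fin.castLE hkn i)
  have hMc : Continuous fun Γ => (M Γ).det := by
    refine Continuous.matrix_det (continuous_matrix fun i j => ?_)
    show Continuous fun Γ : GG n k => Γ j (Fin.castLE hkn i)
    fun_prop
  have h1 : ∀ Γ, (M Γ).det ≠ 0 → Function.Injective (ap Γ) := fun Γ hd v w hvw => by
    have e : ∀ v : EE k, ∀ i, (M Γ).mulVec v.ofLp i = ap Γ v (Fin.castLE hkn i) := fun v i => by
      simp [ap, M, Matrix.mulVec, dotProduct, mul_comm]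
    have : (M Γ).mulVec v.ofLp = (M Γ).mulVec w.ofLp := by ext i; rw [e, e, hvw]
    have := Matrix.mulVec_injective_of_isUnit ((Matrix.isUnit_iff_isUnit_det _).2 (Ne.isUnit hd)) this
    exact WithLp.ofLp_injective 2 this
  let Γ0 : GG n k := WithLp.toLp 2 fun j => EuclideanSpace.single (Fin.castLE hkn j) 1
  have hM : ∀ Γ (t : ℝ), M (Γ + t • Γ0) = Matrix.scalar _ t - (- M Γ) := fun Γ t => by
    ext i j
    simp [M, Γ0, Matrix.scalar_apply, Matrix.diagonal_apply, add_comm, Fin.castLE_inj, Pi.single_apply]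
  have hfin : ∀ Γ, {t : ℝ | (M (Γ + t • Γ0)).det = 0}.Finite := fun Γ => by
    refine (Polynomial.finite_setOfPred_isRoot (Matrix.charpoly_monic (- M Γ)).ne_zero).subset fun t ht => ?_
    simp only [mem_setOf_eq, Polynomial.IsRoot.def, Matrix.eval_charpoly] at ht ⊢
    rw [← hM, ht]
  have hD : volume {Γ : GG n k | (M Γ).det = 0} = 0 := by
    have hc : IsClosed {p : GG n k × ℝ | (M (p.1 + p.2 • Γ0)).det = 0} :=
      isClosed_eq (hMc.comp (by fun_prop)) continuous_const
    have hm := hc.measurableSet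
    have e1 := Measure.prod_apply (μ := (volume : Measure (GG n k))) (ν := (volume : Measure ℝ).restrict (Icc 0 1)) hm
    have e2 := Measure.prod_apply_symm (μ := (volume : Measure (GG n k))) (ν := (volume : Measure ℝ).restrict (Icc 0 1)) hm
    rw [e1] at e2
    have z : ∀ Γ : GG n k, ((volume : Measure ℝ).restrict (Icc 0 1)) (Prod.mk Γ ⁻¹' {p : GG n k × ℝ | (M (p.1 + p.2 • Γ0)).det = 0}) = 0 := fun Γ => by
      refine le_antisymm ((Measure.restrict_apply_le _ _).trans (le_of_eq ?_)) bot_le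
      exact (hfin Γ).measure_zero _
    have z2 : ∀ t : ℝ, (volume : Measure (GG n k)) ((fun Γ => (Γ, t)) ⁻¹' {p : GG n k × ℝ | (M (p.1 + p.2 • Γ0)).det = 0}) = volume {Γ : GG n k | (M Γ).det = 0} := fun t =>
      measure_preimage_add_right volume (t • Γ0) {Γ : GG n k | (M Γ).det = 0}
    simp only [z, z2, lintegral_zero, lintegral_const] at e2
    simpa using e2.symm
  have : ∀ᵐ Γ ∂(stdGaussian (GG n k)), (M Γ).det ≠ 0 := by
    rw [ae_iff]; simp only [not_not]; exact std_ac_vol hD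
  exact this.mono h1
def bad (c : ℝ≥0∞) (A B : Set (EE n)) (f : EE k → EE n) : Prop := c * volume {v | f v ∈ B} < volume {v | f v ∈ A}
lemma factor (ι : EE k →ₗᵢ[ℝ] EE n) (Γ : GG n k) (hΓ : Function.Injective (ap Γ)) :
    ∃ (h : OG n) (τ : EE k →ₗ[ℝ] EE k), LinearMap.det τ ≠ 0 ∧ ∀ v, ap Γ v = act h (ι (τ v)) := by
  let L : EE k →ₗ[ℝ] EE n := { toFun := ap Γ, map_add' := fun x y => by simp [ap, add_smul, Finset.sum_add_distrib], map_smul' := fun c x => ap_smul Γ c x }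
  have hL : Function.Injective L := hΓ
  have hr : Module.finrank ℝ (LinearMap.range L) = k := by
    rw [LinearMap.finrank_range_of_inj hL, finrank_euclideanSpace_fin]
  let σ : EE k ≃ₗᵢ[ℝ] LinearMap.range L := ((stdOrthonormalBasis ℝ (LinearMap.range L)).reindex (finCongr hr)).repr.symm
  let e := LinearEquiv.ofInjective L hL
  let τ : EE k ≃ₗ[ℝ] EE k := e.trans σ.symm.toLinearEquiv
  let ι' : EE k →ₗᵢ[ℝ] EE n := (LinearMap.range L).subtypeₗᵢ.comp σ.toLinearIsometry
  let j : LinearMap.range ι.toLinearMap →ₗᵢ[ℝ] EE n := ι'.comp ι.equivRange.symm.toLinearIsometry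
  let R := j.extend.toLinearIsometryEquiv rfl
  obtain ⟨h, hh⟩ := iso_act R
  refine ⟨h, τ.toLinearMap, ?_, fun v => ?_⟩
  · exact (LinearEquiv.isUnit_det' τ).ne_zero
  · rw [hh]
    have e1 : R (ι (τ v)) = j ⟨ι (τ v), ⟨_, rfl⟩⟩ := LinearIsometry.extend_apply j ⟨ι (τ v), ⟨_, rfl⟩⟩
    show _ = R (ι (τ v))
    rw [e1]
    have e2 : (⟨ι (τ v), ⟨_, rfl⟩⟩ : LinearMap.range ι.toLinearMap) = ι.equivRange (τ v) := rfl
    show _ = ι' (ι.equivRange.symm _)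
    rw [e2, LinearIsometryEquiv.symm_apply_apply]
    show _ = ((σ (σ.symm (e v)) : LinearMap.range L) : EE n)
    rw [LinearIsometryEquiv.apply_symm_apply]
    rfl
lemma bad_lin (c : ℝ≥0∞) (A B : Set (EE n)) (f : EE k → EE n) (τ : EE k →ₗ[ℝ] EE k) (hτ : LinearMap.det τ ≠ 0) :
    bad c A B (fun v => f (τ v)) ↔ bad c A B f := by
  unfold bad
  have e : ∀ A : Set (EE n), volume {v : EE k | f (τ v) ∈ A} = ENNReal.ofReal |(LinearMap.det τ)⁻¹| * volume {v | f v ∈ A} := fun A =>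
    Measure.addHaar_preimage_linearMap volume hτ {v | f v ∈ A}
  have hp : 0 < |(LinearMap.det τ)⁻¹| := abs_pos.2 (inv_ne_zero hτ)
  rw [e, e, mul_left_comm, ENNReal.mul_lt_mul_iff_right (ENNReal.ofReal_pos.2 hp).ne' ENNReal.ofReal_ne_top]
theorem transfer (hkn : k ≤ n) (c : ℝ≥0∞) {A B : Set (EE n)} (hA : IsClosed A) (hB : IsClosed B) (ι : EE k →ₗᵢ[ℝ] EE n)
    (μ : Measure (OG n)) (h1 : μ.IsHaarMeasure) (h2 : IsProbabilityMeasure μ) :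
    μ {g | bad c A B (fun v => act g (ι v))} = stdGaussian (GG n k) {Γ | bad c A B (ap Γ)} := by
  have m1 : ∀ {A : Set (EE n)}, IsClosed A → Measurable fun p : OG n × GG n k => volume {v : EE k | act p.1 (ap p.2 v) ∈ A} := fun {A} hA => by
    have : IsClosed {q : (OG n × GG n k) × EE k | act q.1.1 (ap q.1.2 q.2) ∈ A} :=
      hA.preimage (act_cont.comp ((continuous_fst.comp continuous_fst).prodMk (ap_cont.comp ((continuous_snd.comp continuous_fst).prodMk continuous_snd))))
    exact measurable_measure_prodMk_left this.measurableSet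
  have m2 : ∀ {A : Set (EE n)}, IsClosed A → Measurable fun g : OG n => volume {v : EE k | act g (ι v) ∈ A} := fun {A} hA => by
    have : IsClosed {q : OG n × EE k | act q.1 (ι q.2) ∈ A} :=
      hA.preimage (act_cont.comp (continuous_fst.prodMk (ι.continuous.comp continuous_snd)))
    exact measurable_measure_prodMk_left this.measurableSet
  have m3 : ∀ {A : Set (EE n)}, IsClosed A → Measurable fun Γ : GG n k => volume {v : EE k | ap Γ v ∈ A} := fun {A} hA =>
    measurable_measure_prodMk_left (hA.preimage ap_cont).measurableSet
  have hS : MeasurableSet {p : OG n × GG n k | bad c A B (fun v => act p.1 (ap p.2 v))} :=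
    measurableSet_lt ((m1 hB).const_mul c) (m1 hA)
  have hS2 : MeasurableSet {g : OG n | bad c A B (fun v => act g (ι v))} :=
    measurableSet_lt ((m2 hB).const_mul c) (m2 hA)
  have hS3 : MeasurableSet {Γ : GG n k | bad c A B (ap Γ)} :=
    measurableSet_lt ((m3 hB).const_mul c) (m3 hA)
  have e1 := Measure.prod_apply (μ := μ) (ν := stdGaussian (GG n k)) hS
  have e2 := Measure.prod_apply_symm (μ := μ) (ν := stdGaussian (GG n k)) hS
  rw [e1] at e2
  have z1 : ∀ g : OG n, stdGaussian (GG n k) (Prod.mk g ⁻¹' {p : OG n × GG n k | bad c A B (fun v => act p.1 (ap p.2 v))}) = stdGaussian (GG n k) {Γ | bad c A B (ap Γ)} := fun g => by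
    have hm : Measurable (actG (k := k) g) := (actG_cont.comp (Continuous.prodMk_right g)).measurable
    conv_rhs => rw [← actG_law g, Measure.map_apply hm hS3]
    congr 1; ext Γ
    show bad c A B (fun v => act g (ap Γ v)) ↔ bad c A B (fun v => ap (actG g Γ) v)
    simp only [act_ap]
  have z2 : ∀ᵐ Γ ∂(stdGaussian (GG n k)), μ ((fun g => (g, Γ)) ⁻¹' {p : OG n × GG n k | bad c A B (fun v => act p.1 (ap p.2 v))}) = μ {g | bad c A B (fun v => act g (ι v))} := by
    filter_upwards [inj_ae hkn] with Γ hΓ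
    obtain ⟨h, τ, hτ, hf⟩ := factor ι Γ hΓ
    rw [← og_right μ h1 h2 h hS2]
    congr 1; ext g
    show bad c A B (fun v => act g (ap Γ v)) ↔ bad c A B (fun v => act (g * h) (ι v))
    rw [← bad_lin c A B (fun v => act (g * h) (ι v)) τ hτ]
    simp only [hf, act_mul]
  simp only [z1] at e2
  rw [lintegral_congr_ae z2] at e2
  simpa using e2.symm
end

section
variable {n k : ℕ}
lemma haus_eq : ∃ c : ℝ≥0∞, c ≠ ∞ ∧ ∀ s : Set (EE k), μH[(k:ℝ)] s = c * volume s := by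
  have h := isAddHaarMeasure_hausdorffMeasure (E := EE k)
  rw [finrank_euclideanSpace_fin] at h
  have := Measure.isAddLeftInvariant_eq_smul (μH[(k:ℝ)] : Measure (EE k)) volume
  refine ⟨(Measure.addHaarScalarFactor (μH[(k:ℝ)] : Measure (EE k)) volume : ℝ≥0∞), ENNReal.coe_ne_top, fun s => ?_⟩
  conv_lhs => rw [this]
  rfl
lemma good_vrad (hk : 1 ≤ k) {M : ℝ} (hM : 0 ≤ M) {A B B' : Set (EE n)} (hBB : B ⊆ B') (H₀ : Submodule ℝ (EE n)) (ι : EE k →ₗᵢ[ℝ] EE n) (hι : LinearMap.range ι.toLinearMap = H₀) (g : OG n)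
    (h : ¬ bad (ENNReal.ofReal (M ^ k)) A B (fun v => act g (ι v))) :
    vrad k (rotate (g : Matrix (Fin n) (Fin n) ℝ) H₀) (A ∩ (rotate (g : Matrix (Fin n) (Fin n) ℝ) H₀ : Set _)) ≤
      ENNReal.ofReal M * vrad k (rotate (g : Matrix (Fin n) (Fin n) ℝ) H₀) (B' ∩ (rotate (g : Matrix (Fin n) (Fin n) ℝ) H₀ : Set _)) := by
  obtain ⟨c, hc, hcs⟩ := haus_eq (k := k)
  obtain ⟨R, hR⟩ := act_iso g
  let f : EE k → EE n := fun v => act g (ι v)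
  have hf : Isometry f := by
    have : f = fun v => R (ι v) := funext fun v => (hR _).symm
    rw [this]; exact R.isometry.comp ι.isometry
  have hr : (rotate (g : Matrix (Fin n) (Fin n) ℝ) H₀ : Set (EE n)) = range f := by
    ext x
    simp only [rotate, Submodule.map_coe, ← hι, mem_image, SetLike.mem_coe, LinearMap.mem_range, mem_range]
    constructor
    · rintro ⟨y, ⟨v, rfl⟩, rfl⟩; exact ⟨v, rfl⟩
    · rintro ⟨v, rfl⟩; exact ⟨_, ⟨v, rfl⟩, rfl⟩
  have e : ∀ X : Set (EE n), μH[(k:ℝ)] (X ∩ range f) = c * volume {v | f v ∈ X} := fun X => by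
    rw [← hcs, ← hf.hausdorffMeasure_image (Or.inl (Nat.cast_nonneg k)) {v | f v ∈ X}]
    congr 1
    exact (image_preimage_eq_inter_range).symm
  have hk0 : (k:ℝ) ≠ 0 := by positivity
  unfold vrad
  rw [hr, e, e, e]
  have hM' : ENNReal.ofReal M = (ENNReal.ofReal (M ^ k)) ^ ((k:ℝ)⁻¹) := by
    rw [ENNReal.ofReal_rpow_of_nonneg (by positivity) (by positivity), ← Real.rpow_natCast, ← Real.rpow_mul hM, mul_inv_cancel₀ hk0, Real.rpow_one]
  rw [hM', ← ENNReal.mul_rpow_of_nonneg _ _ (by positivity)]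
  refine ENNReal.rpow_le_rpow ?_ (by positivity)
  rw [← mul_div_assoc]
  refine ENNReal.div_le_div_right ?_ _
  rw [mul_left_comm]
  refine mul_le_mul_right ?_ _
  have h' : volume {v | f v ∈ A} ≤ ENNReal.ofReal (M ^ k) * volume {v | f v ∈ B} := not_lt.1 h
  have h'' : volume {v | f v ∈ B} ≤ volume {v | f v ∈ B'} := measure_mono fun v (hv : f v ∈ B) => hBB hv
  exact h'.trans (mul_le_mul_right h'' _)
theorem haar_main (hk : 1 ≤ k) (hkn : k + 1 ≤ n) {A B' : Set (EE n)} {ρ β s0 : ℝ} {S : EE n → ℝ} (hA : IsClosed A) (hρ : 0 < ρ) (hv : ENNReal.ofReal (gc (EE n)) * volume A ≤ ENNReal.ofReal (ρ ^ n))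
    (h : SL S β) (hβ : 0 < β) (h0 : ∀ x, 0 ≤ S x) (hs : ∫ x, S x ∂(stdGaussian (EE n)) ≤ s0) (hB : {x | S x ≤ 1} ⊆ B')
    (H₀ : Submodule ℝ (EE n)) (hH : Module.finrank ℝ H₀ = k) (μ : Measure (OG n)) (h1 : μ.IsHaarMeasure) (h2 : IsProbabilityMeasure μ) :
    1 - ENNReal.ofReal (Real.exp (-(k : ℝ))) < μ {g | vrad k (rotate (g : Matrix (Fin n) (Fin n) ℝ) H₀) (A ∩ (rotate (g : Matrix (Fin n) (Fin n) ℝ) H₀ : Set _)) ≤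
      ENNReal.ofReal (128 * rexp (3/2) * ρ * (s0 + 5 * β)) * vrad k (rotate (g : Matrix (Fin n) (Fin n) ℝ) H₀) (B' ∩ (rotate (g : Matrix (Fin n) (Fin n) ℝ) H₀ : Set _))} := by
  have hs0 : 0 ≤ s0 := (integral_nonneg h0).trans hs
  let σ : EE k ≃ₗᵢ[ℝ] H₀ := ((stdOrthonormalBasis ℝ H₀).reindex (finCongr hH)).repr.symm
  let ι : EE k →ₗᵢ[ℝ] EE n := H₀.subtypeₗᵢ.comp σ.toLinearIsometry
  have hι : LinearMap.range ι.toLinearMap = H₀ := by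
    ext x
    constructor
    · rintro ⟨v, rfl⟩; exact (σ v).2
    · intro hx; exact ⟨σ.symm ⟨x, hx⟩, by show ((σ (σ.symm ⟨x, hx⟩) : H₀) : EE n) = x; rw [LinearIsometryEquiv.apply_symm_apply]⟩
  have hBc : IsClosed {x | S x ≤ 1} := isClosed_le h.cont continuous_const
  have t := bad_event hk hkn hA hρ hv h hβ h0 hs
  have t2 := transfer (by omega : k ≤ n) (ENNReal.ofReal ((128 * rexp (3/2) * ρ * (s0 + 5 * β)) ^ k)) hA hBc ι μ h1 h2
  have t3 : μ {g | bad (ENNReal.ofReal ((128 * rexp (3/2) * ρ * (s0 + 5 * β)) ^ k)) A {x | S x ≤ 1} (fun v => act g (ι v))} ≤ ENNReal.ofReal (rexp (-k) / 2) := t2.le.trans t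
  generalize hG : {g : OG n | vrad k (rotate (g : Matrix (Fin n) (Fin n) ℝ) H₀) (A ∩ (rotate (g : Matrix (Fin n) (Fin n) ℝ) H₀ : Set _)) ≤
      ENNReal.ofReal (128 * rexp (3/2) * ρ * (s0 + 5 * β)) * vrad k (rotate (g : Matrix (Fin n) (Fin n) ℝ) H₀) (B' ∩ (rotate (g : Matrix (Fin n) (Fin n) ℝ) H₀ : Set _))} = G
  have hu : (1:ℝ≥0∞) ≤ ENNReal.ofReal (rexp (-k) / 2) + μ G := by
    rw [← measure_univ (μ := μ)]
    refine (measure_mono (t := _ ∪ G) ?_).trans ((measure_union_le _ _).trans (add_le_add_left t3 _))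
    intro g _
    by_cases hb : bad (ENNReal.ofReal ((128 * rexp (3/2) * ρ * (s0 + 5 * β)) ^ k)) A {x | S x ≤ 1} (fun v => act g (ι v))
    · exact Or.inl hb
    · right; rw [← hG]; exact good_vrad hk (by positivity) hB H₀ ι hι g hb
  refine lt_of_lt_of_le ?_ (tsub_le_iff_left.2 hu)
  have he : rexp (-k) ≤ 1 := Real.exp_le_one_iff.2 (by simp)
  have hp := Real.exp_pos (-k)
  rw [← ENNReal.ofReal_one, ← ENNReal.ofReal_sub _ (by positivity), ← ENNReal.ofReal_sub _ (by positivity), ENNReal.ofReal_lt_ofReal_iff (by linarith)]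
  linarith
end

section
variable {n k : ℕ}
lemma sym_pt {K : Set (EE n)} (hK : IsCompact K) (hc : Convex ℝ K) (h0 : volume K ≠ 0) :
    ∃ x, ENNReal.ofReal ((2 ^ n)⁻¹) * volume K ≤ volume {y | y ∈ K ∧ (2:ℝ) • x - y ∈ K} := by
  have ht : volume K ≠ ⊤ := hK.measure_lt_top.ne
  have hcl := hK.isClosed
  have hm : MeasurableSet {p : EE n × EE n | p.2 ∈ K ∧ (2:ℝ) • p.1 - p.2 ∈ K} :=
    ((hcl.preimage continuous_snd).inter (hcl.preimage (by fun_prop : Continuous fun p : EE n × EE n => (2:ℝ) • p.1 - p.2))).measurableSet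
  have e1 := Measure.prod_apply (μ := (volume : Measure (EE n))) (ν := (volume : Measure (EE n))) hm
  have e2 := Measure.prod_apply_symm (μ := (volume : Measure (EE n))) (ν := (volume : Measure (EE n))) hm
  rw [e1] at e2
  have z1 : ∀ y : EE n, volume ((fun x => (x, y)) ⁻¹' {p : EE n × EE n | p.2 ∈ K ∧ (2:ℝ) • p.1 - p.2 ∈ K}) = K.indicator (fun _ => ENNReal.ofReal ((2 ^ n)⁻¹) * volume K) y := fun y => by
    by_cases hy : y ∈ K
    · rw [indicator_of_mem hy]
      have : (fun x => (x, y)) ⁻¹' {p : EE n × EE n | p.2 ∈ K ∧ (2:ℝ) • p.1 - p.2 ∈ K} = {x : EE n | (2:ℝ) • x ∈ (fun z => z + -y) ⁻¹' K} := by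
        ext x; simp [hy, sub_eq_add_neg]
      rw [this, vol_scale two_pos, measure_preimage_add_right]
    · rw [indicator_of_notMem hy]
      have : (fun x => (x, y)) ⁻¹' {p : EE n × EE n | p.2 ∈ K ∧ (2:ℝ) • p.1 - p.2 ∈ K} = ∅ := by
        ext x; simp [hy]
      rw [this, measure_empty]
  simp only [z1] at e2
  rw [lintegral_indicator_const hK.measurableSet] at e2
  let f : EE n → ℝ≥0∞ := fun x => volume {y | y ∈ K ∧ (2:ℝ) • x - y ∈ K}
  have z2 : ∫⁻ x, f x = ∫⁻ x in K, f x := by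
    rw [← lintegral_indicator hK.measurableSet]
    congr 1; ext x
    by_cases hx : x ∈ K
    · rw [indicator_of_mem hx]
    · rw [indicator_of_notMem hx]
      have : {y | y ∈ K ∧ (2:ℝ) • x - y ∈ K} = ∅ := by
        ext y
        simp only [mem_setOf_eq, mem_empty_iff_false, iff_false, not_and]
        intro h1 h2
        apply hx
        have := hc h1 h2 (by norm_num : (0:ℝ) ≤ 1/2) (by norm_num : (0:ℝ) ≤ 1/2) (by norm_num)
        rw [smul_sub, smul_smul, add_sub_cancel] at this
        simpa using this
      show volume _ = 0
      rw [this, measure_empty]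
  have e3 : ∫⁻ x in K, f x = ENNReal.ofReal ((2 ^ n)⁻¹) * volume K * volume K := z2.symm.trans e2
  obtain ⟨x, -, hx⟩ := exists_setLAverage_le (f := f) h0 hK.measurableSet.nullMeasurableSet
    (by rw [e3]; exact ENNReal.mul_ne_top (ENNReal.mul_ne_top ENNReal.ofReal_ne_top ht) ht)
  refine ⟨x, le_trans (le_of_eq ?_) hx⟩
  rw [setLAverage_eq, e3, ENNReal.mul_div_cancel_right h0 ht]
lemma conv_vol {P Q : Set (EE n)} (hP : IsClosed P) (hQ : IsClosed Q) {D : Set (EE n)} (hD : MeasurableSet D) {b : ℝ≥0∞}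
    (h : ∀ z ∈ D, b ≤ volume {w | w ∈ P ∧ z - w ∈ Q}) : b * volume D ≤ volume P * volume Q := by
  have hm : MeasurableSet {p : EE n × EE n | p.2 ∈ P ∧ p.1 - p.2 ∈ Q} :=
    ((hP.preimage continuous_snd).inter (hQ.preimage (by fun_prop : Continuous fun p : EE n × EE n => p.1 - p.2))).measurableSet
  have e1 := Measure.prod_apply (μ := (volume : Measure (EE n))) (ν := (volume : Measure (EE n))) hm
  have e2 := Measure.prod_apply_symm (μ := (volume : Measure (EE n))) (ν := (volume : Measure (EE n))) hm
  rw [e1] at e2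
  have z1 : ∀ y : EE n, volume ((fun x => (x, y)) ⁻¹' {p : EE n × EE n | p.2 ∈ P ∧ p.1 - p.2 ∈ Q}) = P.indicator (fun _ => volume Q) y := fun y => by
    by_cases hy : y ∈ P
    · rw [indicator_of_mem hy]
      have : (fun x => (x, y)) ⁻¹' {p : EE n × EE n | p.2 ∈ P ∧ p.1 - p.2 ∈ Q} = (fun z => z + -y) ⁻¹' Q := by
        ext x; simp [hy, sub_eq_add_neg]
      rw [this, measure_preimage_add_right]
    · rw [indicator_of_notMem hy]
      have : (fun x => (x, y)) ⁻¹' {p : EE n × EE n | p.2 ∈ P ∧ p.1 - p.2 ∈ Q} = ∅ := by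
        ext x; simp [hy]
      rw [this, measure_empty]
  simp only [z1] at e2
  rw [lintegral_indicator_const hP.measurableSet] at e2
  rw [mul_comm (volume P), ← e2, ← setLIntegral_const]
  exact (setLIntegral_mono' hD h).trans (setLIntegral_le_lintegral _ _)
lemma csub {s t : Set (EE n)} (hs : IsCompact s) (ht : IsCompact t) : IsCompact (s - t) := by
  rw [sub_eq_add_neg]; exact hs.add ht.neg
lemma diff_vol {K : Set (EE n)} (hK : IsCompact K) (hc : Convex ℝ K) (h0 : volume K ≠ 0) :
    volume (K - K) ≤ ENNReal.ofReal (8 ^ n) * volume K := by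
  have ht : volume K ≠ ⊤ := hK.measure_lt_top.ne
  obtain ⟨x, hx⟩ := sym_pt hK hc h0
  set B : Set (EE n) := {y | y ∈ K ∧ (2:ℝ) • x - y ∈ K} with hB
  have hcl := hK.isClosed
  have hBc : IsCompact B := hK.inter_right (hcl.preimage (by fun_prop : Continuous fun y : EE n => (2:ℝ) • x - y))
  have hP : volume (K - B) ≤ ENNReal.ofReal (2 ^ n) * volume K := by
    have h1 : K - B ⊆ {z | (1/2:ℝ) • z ∈ (fun w => w + x) ⁻¹' K} := by
      rintro _ ⟨a, ha, b, hb, rfl⟩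
      have := hc ha hb.2 (by norm_num : (0:ℝ) ≤ 1/2) (by norm_num : (0:ℝ) ≤ 1/2) (by norm_num)
      simp only [mem_preimage, mem_setOf_eq]
      convert this using 1
      module
    refine (measure_mono h1).trans ?_
    rw [vol_scale (by norm_num), measure_preimage_add_right]
    refine le_of_eq ?_
    congr 2
    rw [one_div, inv_pow, inv_inv]
  have hQ : volume (B - K) = volume (K - B) := by
    rw [← neg_sub, Measure.measure_neg]
  have h1 := conv_vol (csub hK hBc).isClosed (csub hBc hK).isClosed (csub hK hK).isClosed.measurableSet (b := volume B) (fun z hz => by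
    obtain ⟨a, ha, c, hc', rfl⟩ := hz
    have e : volume B = volume ((fun w => a - w) ⁻¹' B) := ((Measure.measurePreserving_sub_left volume a).measure_preimage hBc.isClosed.measurableSet.nullMeasurableSet).symm
    rw [e]
    refine measure_mono fun w (hw : a - w ∈ B) => ⟨⟨a, ha, a - w, hw, sub_sub_cancel a w⟩, ⟨a - w, hw, c, hc', sub_right_comm a w c⟩⟩)
  rw [hQ] at h1
  have h2 := (mul_le_mul_left hx _).trans (h1.trans (mul_le_mul' hP hP))
  have hp : 0 < ((2:ℝ) ^ n)⁻¹ := by positivity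
  have hne : ENNReal.ofReal ((2 ^ n)⁻¹) * volume K ≠ 0 := mul_ne_zero (ENNReal.ofReal_pos.2 hp).ne' h0
  have hnt : ENNReal.ofReal ((2 ^ n)⁻¹) * volume K ≠ ⊤ := ENNReal.mul_ne_top ENNReal.ofReal_ne_top ht
  rw [← ENNReal.mul_le_mul_iff_right hne hnt]
  refine h2.trans (le_of_eq ?_)
  have e : ENNReal.ofReal (2 ^ n) * ENNReal.ofReal (2 ^ n) = ENNReal.ofReal ((2 ^ n)⁻¹) * ENNReal.ofReal (8 ^ n) := by
    rw [← ENNReal.ofReal_mul (by positivity), ← ENNReal.ofReal_mul (by positivity)]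
    congr 1
    rw [show (8:ℝ) = 2 * 2 * 2 by norm_num, mul_pow, mul_pow]; field_simp
  calc _ = ENNReal.ofReal (2 ^ n) * ENNReal.ofReal (2 ^ n) * (volume K * volume K) := by ring
    _ = _ := by rw [e]; ring
lemma hull_sub {K : Set (EE n)} (hc : Convex ℝ K) (h0 : (0 : EE n) ∈ K) : convexHull ℝ (K ∪ -K) ⊆ K - K := by
  refine convexHull_min ?_ (hc.sub hc)
  rintro x (hx | hx)
  · exact ⟨x, hx, 0, h0, sub_zero x⟩
  · exact ⟨0, h0, -x, hx, by simp⟩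
lemma zero_int {K : Set (EE n)} (hK : IsCompact K) (hc : Convex ℝ K) (hi : (interior K).Nonempty) (hv : volume K = 1) (hm : ∫ x in K, x = 0) :
    (0 : EE n) ∈ interior K := by
  haveI : IsProbabilityMeasure ((volume : Measure (EE n)).restrict K) := ⟨by rw [Measure.restrict_apply_univ, hv]⟩
  obtain ⟨p, hp⟩ := hi
  obtain ⟨r, hr, hb⟩ := Metric.nhds_basis_closedBall.mem_iff.1 (isOpen_interior.mem_nhds hp)
  have hbK : closedBall p r ⊆ K := hb.trans interior_subset
  have e : (volume : Measure (EE n)).restrict K (closedBall p r) = volume (closedBall p r) := Measure.restrict_eq_self _ hbK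
  have hpos : volume (closedBall p r) ≠ 0 := (measure_closedBall_pos _ _ hr).ne'
  have hint : Integrable (fun x : EE n => x) ((volume : Measure (EE n)).restrict K) := continuous_id.continuousOn.integrableOn_compact hK
  have := Convex.average_mem_interior_of_set (f := fun x : EE n => x) (t := closedBall p r) hc (by rw [e]; exact hpos) ((ae_restrict_mem hK.measurableSet)) hint
    (hb ((convex_closedBall p r).set_average_mem isClosed_closedBall (by rw [e]; exact hpos) (by rw [e]; exact measure_closedBall_lt_top.ne)
      (ae_restrict_mem measurableSet_closedBall) hint.integrableOn))
  rwa [average_eq_integral, hm] at this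
lemma quad {K : Set (EE n)} (hK : IsCompact K) {L : ℝ} (hL : ∀ ξ : EE n, ‖ξ‖ = 1 → (∫ x in K, (⟪x, ξ⟫) ^ 2) = L ^ 2) (ξ : EE n) :
    ∫ x in K, ⟪x, ξ⟫ ^ 2 = L ^ 2 * ‖ξ‖ ^ 2 := by
  by_cases h : ξ = 0
  · simp [h]
  have hn : ‖ξ‖ ≠ 0 := norm_ne_zero_iff.2 h
  have := hL (‖ξ‖⁻¹ • ξ) (by rw [norm_smul, norm_inv, norm_norm, inv_mul_cancel₀ hn])
  simp only [real_inner_smul_right, mul_pow] at this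
  rw [integral_const_mul] at this
  rw [← this]; field_simp
lemma ci {K : Set (EE n)} (hK : IsCompact K) {f : EE n → ℝ} (hf : Continuous f) : Integrable f ((volume : Measure (EE n)).restrict K) := hf.continuousOn.integrableOn_compact hK
lemma cov_K {K : Set (EE n)} (hK : IsCompact K) {L : ℝ} (hL : ∀ ξ : EE n, ‖ξ‖ = 1 → (∫ x in K, (⟪x, ξ⟫) ^ 2) = L ^ 2) (i j : Fin n) :
    ∫ x in K, x i * x j = if i = j then L ^ 2 else 0 := by
  have h1 : ∀ i : Fin n, ∫ x in K, x i * x i = L ^ 2 := fun i => by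
    have := hL (EuclideanSpace.single i 1) (by simp)
    simpa [EuclideanSpace.inner_single_right, sq] using this
  by_cases hij : i = j
  · subst hij; simp [h1]
  have h2 := quad hK hL (EuclideanSpace.single i 1 + EuclideanSpace.single j 1)
  have h3 : ‖(EuclideanSpace.single i 1 + EuclideanSpace.single j 1 : EE n)‖ ^ 2 = 2 := by
    rw [← real_inner_self_eq_norm_sq, inner_add_left, inner_add_right, inner_add_right]
    simp [EuclideanSpace.inner_single_right, hij, Ne.symm hij]
    norm_num
  rw [h3] at h2
  have e : ∀ x : EE n, ⟪x, (EuclideanSpace.single i 1 + EuclideanSpace.single j 1 : EE n)⟫ ^ 2 = x i * x i + x j * x j + 2 * (x i * x j) := fun x => by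
    rw [inner_add_right]; simp [EuclideanSpace.inner_single_right]; ring
  simp only [e] at h2
  rw [integral_add ((ci hK (by fun_prop)).fun_add (ci hK (by fun_prop))) (ci hK (by fun_prop)), integral_add (ci hK (by fun_prop)) (ci hK (by fun_prop)), h1, h1, integral_const_mul] at h2
  rw [if_neg hij]; linarith
lemma L_low (hn : 1 ≤ n) {K : Set (EE n)} (hK : IsCompact K) (hv : volume K = 1) {L : ℝ} (hLp : 0 < L) (hL : ∀ ξ : EE n, ‖ξ‖ = 1 → (∫ x in K, (⟪x, ξ⟫) ^ 2) = L ^ 2) :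
    gc (EE n) ≤ (√(8 * rexp 1) * L) ^ n := by
  have hg := gc_pos (E := EE n)
  have hn0 : (n:ℝ) ≠ 0 := by positivity
  have hnp : (0:ℝ) < n := by positivity
  obtain ⟨q, hq, hqn⟩ : ∃ q : ℝ, 0 < q ∧ q ^ n = gc (EE n) := ⟨gc (EE n) ^ ((n:ℝ)⁻¹), by positivity, by
    rw [← Real.rpow_natCast, ← Real.rpow_mul hg.le, inv_mul_cancel₀ hn0, Real.rpow_one]⟩
  rw [← hqn]
  refine pow_le_pow_left₀ hq.le ?_ _
  have hsn : 0 < √(n:ℝ) := Real.sqrt_pos.2 hnp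
  set r := √n * q / (2 * rexp (1/2)) with hr
  have hrp : 0 < r := by positivity
  have hball : volume (ball (0 : EE n) r) ≤ ENNReal.ofReal (1/2) := by
    rw [Measure.addHaar_ball_of_pos _ _ hrp, finrank_euclideanSpace_fin]
    refine (mul_le_mul_right (om_le hn) _).trans ?_
    rw [← ENNReal.ofReal_mul (by positivity)]
    refine ENNReal.ofReal_le_ofReal ?_
    have : rexp (n/2) = rexp (1/2) ^ n := by rw [← Real.exp_nat_mul]; congr 1; ring
    rw [hr, this, ← hqn, div_pow, mul_pow, mul_pow]
    have e : √(n:ℝ) ^ n * q ^ n / (2 ^ n * rexp (1 / 2) ^ n) * ((q ^ n)⁻¹ * rexp (1 / 2) ^ n * (√(n:ℝ) ^ n)⁻¹) = (2 ^ n)⁻¹ := by field_simp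
    rw [e, one_div]
    refine inv_anti₀ two_pos ?_
    simpa using pow_le_pow_right₀ (by norm_num : (1:ℝ) ≤ 2) hn
  have hI : ∫ x in K, ‖x‖ ^ 2 = n * L ^ 2 := by
    have e : ∀ x : EE n, ‖x‖ ^ 2 = ∑ i, x i * x i := fun v => by
      rw [EuclideanSpace.norm_sq_eq]; refine Finset.sum_congr rfl fun i _ => by rw [Real.norm_eq_abs, sq_abs, sq]
    simp only [e]
    rw [integral_finset_sum _ fun i _ => ci hK (by fun_prop)]
    simp [cov_K hK hL]
  have hlow : (1:ℝ)/2 ≤ volume.real (K \ ball 0 r) := by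
    have h1 : volume K ≤ volume (ball (0:EE n) r) + volume (K \ ball 0 r) := by
      refine (measure_mono ?_).trans (measure_union_le _ _)
      intro x hx; by_cases h : x ∈ ball (0:EE n) r
      · exact Or.inl h
      · exact Or.inr ⟨hx, h⟩
    have hft : volume (K \ ball (0:EE n) r) ≠ ⊤ := ((measure_mono diff_subset).trans_lt hK.measure_lt_top).ne
    have h2 := h1.trans (add_le_add_left hball _)
    rw [hv, ← ofReal_measureReal hft, ← ENNReal.ofReal_add (by norm_num) measureReal_nonneg, ← ENNReal.ofReal_one, ENNReal.ofReal_le_ofReal_iff (by positivity)] at h2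
    linarith
  have h3 : r ^ 2 * (1/2) ≤ n * L ^ 2 := by
    rw [← hI]
    have hm : MeasurableSet (K \ ball (0:EE n) r) := hK.measurableSet.diff measurableSet_ball
    have h4 : ∫ x in K \ ball (0:EE n) r, r ^ 2 ≤ ∫ x in K \ ball (0:EE n) r, ‖x‖ ^ 2 := by
      refine setIntegral_mono_on (integrableOn_const ((measure_mono diff_subset).trans_lt hK.measure_lt_top).ne) (IntegrableOn.mono_set (ci hK (by fun_prop)) diff_subset) hm fun x hx => ?_
      have : r ≤ ‖x‖ := by simpa using hx.2
      exact pow_le_pow_left₀ hrp.le this 2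
    have h5 : ∫ x in K \ ball (0:EE n) r, ‖x‖ ^ 2 ≤ ∫ x in K, ‖x‖ ^ 2 :=
      setIntegral_mono_set (ci hK (by fun_prop)) (Filter.Eventually.of_forall fun x => by positivity) (Filter.Eventually.of_forall fun x hx => diff_subset hx)
    rw [setIntegral_const, smul_eq_mul, mul_comm] at h4
    refine le_trans (mul_le_mul_of_nonneg_left hlow (by positivity)) (h4.trans h5)
  have e2 : rexp (1/2) ^ 2 = rexp 1 := by rw [← Real.exp_nat_mul]; norm_num
  have e3 : r ^ 2 = n * q ^ 2 / (4 * rexp 1) := by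
    rw [hr, div_pow, mul_pow, mul_pow, e2, Real.sq_sqrt hnp.le]; norm_num
  rw [e3] at h3
  have h6 : q ^ 2 ≤ 8 * rexp 1 * L ^ 2 := by
    have : n * q ^ 2 / (4 * rexp 1) * (1/2) = n * (q ^ 2 / (8 * rexp 1)) := by field_simp; norm_num
    rw [this] at h3
    have := le_of_mul_le_mul_left h3 hnp
    rw [div_le_iff₀ (by positivity)] at this; linarith
  refine le_of_sq_le_sq ?_ (by positivity)
  rw [mul_pow, Real.sq_sqrt (by positivity)]; exact h6
end

section
variable {n k : ℕ}
def sb {K : Set (EE n)} (hK : IsCompact K) (hc : Convex ℝ K) (hi : (0 : EE n) ∈ interior K) {L : ℝ} (hL : 0 < L) : Bd n where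
  K := L⁻¹ • K
  conv := hc.smul _
  comp := hK.smul _
  intr := by
    rw [interior_smul₀ (inv_pos.2 hL).ne']
    exact ⟨_, smul_mem_smul_set hi⟩
lemma sb_int {K : Set (EE n)} (hK : IsCompact K) (hc : Convex ℝ K) (hi : (0 : EE n) ∈ interior K) {L : ℝ} (hL : 0 < L)
    (hv : volume K = 1) (f : EE n → ℝ) : ∫ x, f x ∂(sb hK hc hi hL).cm.mu = ∫ x in K, f (L⁻¹ • x) := by
  have hp := inv_pos.2 hL
  rw [Bd.integral_cm, Measure.setIntegral_comp_smul_of_pos volume f K hp]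
  have : volume.real (L⁻¹ • K) = L⁻¹ ^ n := by
    rw [Measure.real, Measure.addHaar_smul, hv, mul_one, ENNReal.toReal_ofReal (abs_nonneg _), finrank_euclideanSpace_fin, abs_of_pos (by positivity)]
  show (volume.real (L⁻¹ • K))⁻¹ * _ = _
  rw [this, finrank_euclideanSpace_fin, smul_eq_mul]
  rfl
lemma sb_iso {K : Set (EE n)} (hK : IsCompact K) (hc : Convex ℝ K) (hi : (0 : EE n) ∈ interior K) {L : ℝ} (hL : 0 < L)
    (hv : volume K = 1) (hm : ∫ x in K, x = 0) (hq : ∀ ξ : EE n, ‖ξ‖ = 1 → (∫ x in K, (⟪x, ξ⟫) ^ 2) = L ^ 2) :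
    (sb hK hc hi hL).Iso where
  mean i := by
    rw [sb_int hK hc hi hL hv (fun x => x i)]
    have hint : Integrable (fun x : EE n => x) ((volume : Measure (EE n)).restrict K) := continuous_id.continuousOn.integrableOn_compact hK
    have h := ContinuousLinearMap.integral_comp_comm (EuclideanSpace.proj i : EE n →L[ℝ] ℝ) hint
    rw [hm, map_zero] at h
    have h' : ∫ x in K, x i = 0 := h
    simp only [PiLp.smul_apply, smul_eq_mul]
    rw [integral_const_mul, h', mul_zero]
  cov i j := by
    rw [sb_int hK hc hi hL hv (fun x => x i * x j)]
    simp only [PiLp.smul_apply, smul_eq_mul]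
    have : ∀ x : EE n, L⁻¹ * x i * (L⁻¹ * x j) = L⁻¹ ^ 2 * (x i * x j) := fun x => by ring
    simp only [this]
    rw [integral_const_mul, cov_K hK hq]
    split_ifs
    · field_simp
    · simp
lemma gau {K : Set (EE n)} (hc : Convex ℝ K) (hi : (0 : EE n) ∈ interior K) : GN (gauge K) where
  nn := gauge_nonneg
  hom c x h := by rw [gauge_smul_of_nonneg h, smul_eq_mul]
  sub := gauge_add_le hc (absorbent_nhds_zero (mem_interior_iff_mem_nhds.1 hi))
  cont := continuous_gauge hc (mem_interior_iff_mem_nhds.1 hi)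
lemma GN.smul' {N : EE n → ℝ} (h : GN N) {L : ℝ} (hL : 0 ≤ L) : GN (fun x => L * N x) where
  nn x := mul_nonneg hL (h.nn x)
  hom c x h' := by rw [h.hom c x h']; ring
  sub x y := by have := mul_le_mul_of_nonneg_left (h.sub x y) hL; linarith
  cont := h.cont.const_mul L
lemma vrad_mono {H : Submodule ℝ (EE n)} {A B : Set (EE n)} (h : A ⊆ B) : vrad k H A ≤ vrad k H B := by
  unfold vrad
  exact ENNReal.rpow_le_rpow (ENNReal.div_le_div_right (measure_mono h) _) (by positivity)
theorem fin_main : ∃ C : ℝ, 0 < C ∧ ∀ (n : ℕ), 2 ≤ n →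
      ∀ K : Set (EuclideanSpace ℝ (Fin n)),
        IsCompact K → Convex ℝ K → (interior K).Nonempty →
        volume K = 1 → (∫ x in K, x) = (0 : EuclideanSpace ℝ (Fin n)) →
    ∀ L : ℝ, 0 < L → (∀ ξ : EuclideanSpace ℝ (Fin n), ‖ξ‖ = 1 →
      (∫ x in K, (⟪x, ξ⟫) ^ 2) = L ^ 2) →
        ∀ k : ℕ, 1 ≤ k → k ≤ n - 1 →
          ∀ H₀ : Submodule ℝ (EuclideanSpace ℝ (Fin n)), Module.finrank ℝ H₀ = k →
            ∀ μ : Measure (Matrix.orthogonalGroup (Fin n) ℝ),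
              μ.IsHaarMeasure → IsProbabilityMeasure μ →
              1 - ENNReal.ofReal (Real.exp (-(k : ℝ))) <
                μ {g | vrad k (rotate (g : Matrix (Fin n) (Fin n) ℝ) H₀)
                        (convexHull ℝ (K ∪ -K) ∩
                          (rotate (g : Matrix (Fin n) (Fin n) ℝ) H₀ : Set _)) ≤
                      ENNReal.ofReal (C * Real.log n) *
                        vrad k (rotate (g : Matrix (Fin n) (Fin n) ℝ) H₀)
                          ((K ∩ -K) ∩ (rotate (g : Matrix (Fin n) (Fin n) ℝ) H₀ : Set _))} := by
  obtain ⟨C, hC, hmain⟩ := GN.main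
  have hc0 := c0_pos
  refine ⟨128 * rexp (3/2) * (8 * √(8 * rexp 1)) * (2 + 10 / c0) * C, by positivity, ?_⟩
  intro n hn K hK hc hi0 hv hm L hL hq k hk hkn H₀ hH μ h1 h2
  have hi := zero_int hK hc hi0 hv hm
  have hlog : 0 < Real.log n := Real.log_pos (by exact_mod_cast hn)
  have hG := gau hc hi
  have hD' := hmain n hn _ (hG.smul' hL.le) (sb hK hc hi hL) (sb_iso hK hc hi hL hv hm hq) (by
    rintro _ ⟨y, hy, rfl⟩
    have : gauge K (L⁻¹ • y) = L⁻¹ * gauge K y := hG.hom _ _ (inv_pos.2 hL).le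
    show L * gauge K (L⁻¹ • y) ≤ 1
    rw [this, mul_inv_cancel_left₀ hL.ne']
    exact gauge_le_one_of_mem hy)
  set D0 : ℝ := C * Real.log n with hD0
  have hD0p : 0 < D0 := by positivity
  have hD : GN.D (gauge K) ≤ D0 / L := by
    have e : GN.D (fun x => L * gauge K x) = L * GN.D (gauge K) := integral_const_mul _ _
    rw [e] at hD'
    rw [le_div_iff₀ hL]; linarith
  set S : EE n → ℝ := fun x => gauge K x + gauge K (-x) with hS
  set β : ℝ := 2 * D0 / (c0 * L) with hβ
  have hβp : 0 < β := by positivity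
  have hpt : ∀ x : EE n, gauge K x ≤ D0 / (c0 * L) * ‖x‖ := fun x => by
    by_cases hx : x = 0
    · subst hx; simp
    have hx' : 0 < ‖x‖ := norm_pos_iff.2 hx
    have h := hG.pt (‖x‖⁻¹ • x) (by rw [norm_smul, norm_inv, norm_norm, inv_mul_cancel₀ hx'.ne'])
    have h3 : GN.D (gauge K) / c0 ≤ D0 / (c0 * L) := by
      rw [mul_comm, ← div_div]
      exact div_le_div_of_nonneg_right hD hc0.le
    rw [hG.hom _ _ (by positivity)] at h
    have := h.trans h3
    rw [inv_mul_le_iff₀ hx'] at this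
    linarith
  have hSL : SL S β :=
    { hom := fun c h x => by
        simp only [hS]
        rw [← smul_neg, hG.hom _ _ h.le, hG.hom _ _ h.le]; ring
      sub := fun x y => by
        simp only [hS]
        have a := hG.sub x y
        have b := hG.sub (-x) (-y)
        rw [neg_add]; linarith
      bd := fun x => by
        simp only [hS]
        have a := hpt x
        have b := hpt (-x)
        rw [norm_neg] at b
        have : β = D0 / (c0 * L) + D0 / (c0 * L) := by rw [hβ]; ring
        rw [this, add_mul]; linarith
      cont := hG.cont.add (hG.cont.comp continuous_neg)
      b0 := hβp.le }
  have hint2 : Integrable (fun x : EE n => gauge K (-x)) (stdGaussian (EE n)) := by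
    have g2 : GN (fun x : EE n => gauge K (-x)) :=
      { nn := fun x => gauge_nonneg _
        hom := fun c x h => by rw [← smul_neg]; exact hG.hom _ _ h
        sub := fun x y => by rw [neg_add]; exact hG.sub _ _
        cont := hG.cont.comp continuous_neg }
    exact g2.int
  have hs : ∫ x, S x ∂stdGaussian (EE n) ≤ 2 * D0 / L := by
    simp only [hS]
    rw [integral_add hG.int hint2, std_neg]
    have : ∫ x, gauge K x ∂stdGaussian (EE n) ≤ D0 / L := hD
    have e : 2 * D0 / L = D0 / L + D0 / L := by ring
    rw [e]; linarith
  have hmem : ∀ x : EE n, gauge K x ≤ 1 → x ∈ K := fun x hx => by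
    rw [gauge_le_one_iff_mem_closure hc (mem_interior_iff_mem_nhds.1 hi), hK.isClosed.closure_eq] at hx
    exact hx
  have hB : {x | S x ≤ 1} ⊆ K ∩ -K := fun x (hx : gauge K x + gauge K (-x) ≤ 1) => by
    have a := hG.nn x
    have b := hG.nn (-x)
    exact ⟨hmem x (by linarith), hmem (-x) (by linarith)⟩
  have hLl := L_low (by omega) hK hv hL hq
  have hvol : ENNReal.ofReal (gc (EE n)) * volume (K - K) ≤ ENNReal.ofReal ((8 * √(8 * rexp 1) * L) ^ n) := by
    have h3 := diff_vol hK hc (by rw [hv]; exact one_ne_zero)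
    rw [hv, mul_one] at h3
    refine (mul_le_mul' (ENNReal.ofReal_le_ofReal hLl) h3).trans ?_
    rw [← ENNReal.ofReal_mul (by positivity), ← mul_pow]
    exact le_of_eq (by congr 2; ring)
  have hfin := haar_main hk (by omega : k + 1 ≤ n) (csub hK hK).isClosed (by positivity) hvol hSL hβp
    (fun x => add_nonneg (hG.nn _) (hG.nn _)) hs hB H₀ hH μ h1 h2
  refine hfin.trans_le (measure_mono fun g hg => ?_)
  have hg' := (vrad_mono (inter_subset_inter_left _ (hull_sub hc (interior_subset hi)))).trans hg
  refine hg'.trans (le_of_eq ?_)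
  congr 2
  rw [hβ, hD0]
  field_simp
  ring
end

end ISO

/-- Theorem (random sections of an isotropic convex body): with respect to the
rotation-invariant Haar probability measure on `G_{n,k}` — realized as the pushforward of the
Haar probability measure on the orthogonal group `O(n)` acting on a fixed `k`-dimensional
subspace `H₀` — a random subspace `H` satisfies
`vrad(K_out ∩ H) ≤ C·(log n) · vrad(K_in ∩ H)` with probability greater than `1 − e^{−k}`. -/
theorem stmt3 :
    ∃ C : ℝ, 0 < C ∧ ∀ (n : ℕ), 2 ≤ n →
      ∀ K : Set (EuclideanSpace ℝ (Fin n)),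
        IsCompact K → Convex ℝ K → (interior K).Nonempty → IsIsotropic K →
        ∀ k : ℕ, 1 ≤ k → k ≤ n - 1 →
          ∀ H₀ : Submodule ℝ (EuclideanSpace ℝ (Fin n)), Module.finrank ℝ H₀ = k →
            ∀ μ : Measure (Matrix.orthogonalGroup (Fin n) ℝ),
              μ.IsHaarMeasure → IsProbabilityMeasure μ →
              1 - ENNReal.ofReal (Real.exp (-(k : ℝ))) <
                μ {g | vrad k (rotate (g : Matrix (Fin n) (Fin n) ℝ) H₀)
                        (convexHull ℝ (K ∪ -K) ∩
                          (rotate (g : Matrix (Fin n) (Fin n) ℝ) H₀ : Set _)) ≤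
                      ENNReal.ofReal (C * Real.log n) *
                        vrad k (rotate (g : Matrix (Fin n) (Fin n) ℝ) H₀)
                          ((K ∩ -K) ∩ (rotate (g : Matrix (Fin n) (Fin n) ℝ) H₀ : Set _))} := by
  obtain ⟨C, hC, h⟩ := ISO.fin_main
  refine ⟨C, hC, ?_⟩
  rintro n hn K hK hc hi ⟨hv, hm, L, hL, hq⟩
  exact h n hn K hK hc hi hv hm L hL hq
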